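/- Let n > 1, let 𝒜 be a first-order homogeneous constant-coefficient differential operator (k = 1) and let 1 < q < ∞. Then 𝒜 is elliptic and canceling if and only if every map u ∈ BV^𝒜_loc(ℝ^n) is L^{n/(n−1),q}-differentiable at ℒ^n-almost every x ∈ ℝ^n. -/

import Mathlib

open MeasureTheory Metric Filter
open scoped ENNReal RealInnerProductSpace Topology

noncomputable section

/-- Euclidean space `ℝ^n`. -/
abbrev Euc (n : ℕ) : Type := EuclideanSpace ℝ (Fin n)

/-- The `i`-th standard basis vector of `ℝ^n`. -/
def stdVec (n : ℕ) (i : Fin n) : Euc n := EuclideanSpace.single i (1 : ℝ)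

/-- Coefficients `A_I : V →ₗ W` (indexed by `I : Fin k → Fin n`) of a homogeneous linear
constant-coefficient differential operator `𝒜 u = ∑_I A_I ∂_I u` of order `k` on `ℝ^n`. -/
abbrev CoeffOp (n k : ℕ) (V W : Type*) [NormedAddCommGroup V] [InnerProductSpace ℝ V]
    [NormedAddCommGroup W] [InnerProductSpace ℝ W] : Type _ :=
  (Fin k → Fin n) → (V →ₗ[ℝ] W)

variable {V W F : Type*}
  [NormedAddCommGroup V] [InnerProductSpace ℝ V] [FiniteDimensional ℝ V]
  [NormedAddCommGroup W] [InnerProductSpace ℝ W] [FiniteDimensional ℝ W]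

/-- The coefficients represent a linear map on symmetric tensors `V ⊙^k ℝ^n`. -/
def IsSymmetricOp (n k : ℕ) (A : CoeffOp n k V W) : Prop :=
  ∀ (I : Fin k → Fin n) (σ : Equiv.Perm (Fin k)), A (I ∘ σ) = A I

/-- The symbol `𝒜[ξ] v = A (v ⊗^k ξ) = ∑_I (∏ i, ξ_{I i}) A_I v`. -/
def symbolMap (n k : ℕ) (A : CoeffOp n k V W) (ξ : Euc n) : V →ₗ[ℝ] W :=
  ∑ I : Fin k → Fin n, (∏ i, ξ (I i)) • A I

/-- Ellipticity: the symbol is injective for all `ξ ≠ 0`. -/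
def IsElliptic (n k : ℕ) (A : CoeffOp n k V W) : Prop :=
  ∀ ξ : Euc n, ξ ≠ 0 → Function.Injective (symbolMap n k A ξ)

/-- Van Schaftingen's cancellation condition: `⋂_{ξ ∈ 𝕊^{n-1}} im 𝒜[ξ] = {0}`. -/
def IsCanceling (n k : ℕ) (A : CoeffOp n k V W) : Prop :=
  (⋂ ξ ∈ sphere (0 : Euc n) 1, (LinearMap.range (symbolMap n k A ξ) : Set W)) = {0}

/-- Inverse of an endomorphism (junk value when not invertible), via matrix inversion. -/
def linInv (f : V →ₗ[ℝ] V) : V →ₗ[ℝ] V :=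
  letI b := Module.finBasis ℝ V
  Matrix.toLin b b ((LinearMap.toMatrix b b f)⁻¹)

/-- `𝒜†[ξ] = (𝒜*[ξ] 𝒜[ξ])⁻¹ 𝒜*[ξ]`. -/
def Adagger (n k : ℕ) (A : CoeffOp n k V W) (ξ : Euc n) : W →ₗ[ℝ] V :=
  linInv (LinearMap.adjoint (symbolMap n k A ξ) ∘ₗ symbolMap n k A ξ) ∘ₗ
    LinearMap.adjoint (symbolMap n k A ξ)

/-- Condition (WC): for every `w ∈ ⋂_{ξ ∈ 𝕊^{n-1}} im 𝒜[ξ]`,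
`∫_{𝕊^{n-1}} 𝒜†[ξ] w ⊗^{k-n} ξ dℋ^{n-1}(ξ) = 0`, written componentwise in the
tensor coordinates indexed by `J : Fin (k-n) → Fin n`. -/
def IsWeaklyCanceling (n k : ℕ) (A : CoeffOp n k V W) : Prop :=
  ∀ w : W, (∀ ξ ∈ sphere (0 : Euc n) 1, w ∈ LinearMap.range (symbolMap n k A ξ)) →
    ∀ J : Fin (k - n) → Fin n,
      (∫ ξ in sphere (0 : Euc n) 1,
        (∏ i, ξ (J i)) • (Adagger n k A ξ w) ∂(μH[(n : ℝ) - 1])) = 0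

section TestFun

variable [NormedAddCommGroup F] [NormedSpace ℝ F]

/-- Compactly supported smooth test function. -/
def IsTestFun (n : ℕ) (φ : Euc n → F) : Prop :=
  ContDiff ℝ (⊤ : ℕ∞) φ ∧ HasCompactSupport φ

/-- Iterated directional derivative `∂_{I 0} ⋯ ∂_{I (m-1)} φ (x)`. -/
def dirDeriv (n m : ℕ) (I : Fin m → Fin n) (φ : Euc n → F) (x : Euc n) : F :=
  iteratedFDeriv ℝ m φ x (fun i => stdVec n (I i))

/-- Smooth functions of degree-`≤ j` polynomial type. -/
def IsPolyDeg (n : ℕ) (j : ℕ) (P : Euc n → F) : Prop :=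
  ContDiff ℝ (⊤ : ℕ∞) P ∧ ∀ x, iteratedFDeriv ℝ (j + 1) P x = 0

end TestFun

/-- Pointwise application of the operator `𝒜` to a smooth map. -/
def Aapply (n k : ℕ) (A : CoeffOp n k V W) (u : Euc n → V) (x : Euc n) : W :=
  ∑ I : Fin k → Fin n, A I (dirDeriv n k I u x)

/-- `𝒜 u = f σ` (a `W`-valued measure with total-variation measure `σ` and polar density `f`)
in the sense of distributions. -/
def HasDistribA (n k : ℕ) (A : CoeffOp n k V W) (u : Euc n → V) (σ : Measure (Euc n))
    (f : Euc n → W) : Prop :=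
  ∀ φ : Euc n → W, IsTestFun n φ →
    ((-1 : ℝ) ^ k) * (∑ I : Fin k → Fin n,
        ∫ x, ⟪u x, LinearMap.adjoint (A I) (dirDeriv n k I φ x)⟫) =
      ∫ x, ⟪f x, φ x⟫ ∂σ

/-- `u ∈ BV^𝒜_loc(ℝ^n)`: `u` is locally integrable and `𝒜 u` is a `W`-valued Radon measure,
given by its polar decomposition `f σ` with `σ` locally finite and `‖f‖ = 1` σ-a.e. -/
def MemBVAloc (n k : ℕ) (A : CoeffOp n k V W) (u : Euc n → V) : Prop :=
  LocallyIntegrable u volume ∧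
    ∃ (σ : Measure (Euc n)) (f : Euc n → W), IsLocallyFiniteMeasure σ ∧
      LocallyIntegrable f σ ∧ (∀ᵐ x ∂σ, ‖f x‖ = 1) ∧ HasDistribA n k A u σ f

/-- `v` is the family of weak derivatives of order `m` of `u` (componentwise, indexed by
`I : Fin m → Fin n`). -/
def IsWeakDerivFamily (n m : ℕ) (u : Euc n → V) (v : (Fin m → Fin n) → Euc n → V) : Prop :=
  (∀ I, LocallyIntegrable (v I) volume) ∧
    ∀ (I : Fin m → Fin n) (φ : Euc n → ℝ), IsTestFun n φ →
      ∫ x, (dirDeriv n m I φ x) • u x = ((-1 : ℝ) ^ m) • ∫ x, φ x • v I x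

/-- `Q r = o(r^a)` as `r ↓ 0`. -/
def SmallO (Q : ℝ → ℝ≥0∞) (a : ℝ) : Prop :=
  Tendsto (fun r => Q r / ENNReal.ofReal (r ^ a)) (𝓝[>] (0 : ℝ)) (𝓝 0)

section Spaces

variable [NormedAddCommGroup F] [NormedSpace ℝ F]

/-- `f ∈ t^{j,p}(x)`: there is a polynomial `P` of degree at most `j` with
`(⨍_{B_r(x)} |f - P|^p)^{1/p} = o(r^j)` as `r ↓ 0`. -/
def MemT (n : ℕ) (j : ℕ) (p : ℝ) (f : Euc n → F) (x : Euc n) : Prop :=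
  ∃ P : Euc n → F, IsPolyDeg n j P ∧
    SmallO (fun r => ((volume (ball x r))⁻¹ *
      ∫⁻ y in ball x r, (‖f y - P y‖₊ : ℝ≥0∞) ^ p) ^ (1 / p)) (j : ℝ)

/-- `f ∈ t^{j,∞}(x)`: there is a polynomial `P` of degree at most `j` with
`‖f - P‖_{L^∞(B_r(x))} = o(r^j)` as `r ↓ 0`. -/
def MemTInf (n : ℕ) (j : ℕ) (f : Euc n → F) (x : Euc n) : Prop :=
  ∃ P : Euc n → F, IsPolyDeg n j P ∧
    SmallO (fun r => essSup (fun y => (‖f y - P y‖₊ : ℝ≥0∞))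
      (volume.restrict (ball x r))) (j : ℝ)

/-- The Lorentz `L^{p,q}` quasi-norm (for `p, q < ∞`). -/
def lorentzNorm {α : Type*} [MeasurableSpace α] (p q : ℝ) (μ : Measure α) (f : α → F) : ℝ≥0∞ :=
  ENNReal.ofReal p ^ (1 / q) *
    (∫⁻ t in Set.Ioi (0 : ℝ),
      (ENNReal.ofReal t * (μ {x | t < ‖f x‖}) ^ (1 / p)) ^ q * (ENNReal.ofReal t)⁻¹) ^ (1 / q)

/-- `f` is `L^{p,q}`-differentiable of order `j` at `x`:
`‖f - P‖_{L^{p,q}(B_r(x))} = o(r^{j + n/p})` for a polynomial `P` of degree at most `j`. -/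
def MemTLorentz (n : ℕ) (j : ℕ) (p q : ℝ) (f : Euc n → F) (x : Euc n) : Prop :=
  ∃ P : Euc n → F, IsPolyDeg n j P ∧
    SmallO (fun r => lorentzNorm p q (volume.restrict (ball x r)) (fun y => f y - P y))
      ((j : ℝ) + n / p)

/-- `f ∈ L^p_loc`. -/
def LocLp (n : ℕ) (p : ℝ) (f : Euc n → F) : Prop :=
  ∀ K : Set (Euc n), IsCompact K → ∫⁻ x in K, (‖f x‖₊ : ℝ≥0∞) ^ p < ⊤

end Spaces

end

set_option linter.unusedSectionVars false

/-- The polynomial weight `(1 + ‖x‖²)^{-n}` on `ℝ^n`. -/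
noncomputable def wt (n : ℕ) (x : Euc n) : ℝ := ((1 + ‖x‖ ^ 2) ^ n)⁻¹

theorem wt_pos {n : ℕ} (x : Euc n) : 0 < wt n x := by unfold wt; positivity

theorem continuous_wt {n : ℕ} : Continuous (wt n) := by
  unfold wt
  exact Continuous.inv₀ (by fun_prop) fun x => by positivity

theorem wt_le_one {n : ℕ} (x : Euc n) : wt n x ≤ 1 := by
  unfold wt
  exact inv_le_one_of_one_le₀ (one_le_pow₀ (by nlinarith [sq_nonneg ‖x‖]))

theorem wt_le_inner {n : ℕ} (hn : 1 ≤ n) {ξ : Euc n} (hξ : ‖ξ‖ = 1) (x : Euc n) :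
    wt n x ≤ (1 + ⟪x, ξ⟫ ^ 2)⁻¹ := by
  unfold wt
  have h1 : ⟪x, ξ⟫ ^ 2 ≤ ‖x‖ ^ 2 := by
    have := abs_real_inner_le_norm x ξ
    rw [hξ, mul_one] at this
    rw [← sq_abs]
    gcongr
  gcongr
  calc 1 + ⟪x, ξ⟫ ^ 2 ≤ 1 + ‖x‖ ^ 2 := by linarith
    _ ≤ (1 + ‖x‖ ^ 2) ^ n := le_self_pow₀ (by nlinarith [sq_nonneg ‖x‖]) (by omega)

theorem lintegral_slab_le {n : ℕ} (hn : 1 ≤ n) : ∃ C : ℝ≥0∞, C ≠ ⊤ ∧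
    ∀ ξ : Euc n, ‖ξ‖ = 1 → ∀ φ : ℝ → ℝ≥0∞, Measurable φ →
      ∫⁻ y : Euc n, φ ⟪y, ξ⟫ * ENNReal.ofReal (wt n y) ≤
        C * ∫⁻ t : ℝ, φ t * ENNReal.ofReal ((1 + t ^ 2)⁻¹) := by
  obtain ⟨m, rfl⟩ : ∃ m, n = m + 1 := ⟨n - 1, by omega⟩
  set g : ℝ → ℝ≥0∞ := fun t => ENNReal.ofReal ((1 + t ^ 2)⁻¹) with hg
  have hgm : Measurable g := by fun_prop
  refine ⟨∫⁻ y : Fin m → ℝ, ∏ i, g (y i), ?_, ?_⟩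
  · have h : Integrable (fun y : Fin m → ℝ => ∏ i, (1 + (y i) ^ 2)⁻¹) volume :=
      Integrable.fintype_prod_dep (f := fun _ t => (1 + t ^ 2)⁻¹)
        (fun _ => integrable_inv_one_add_sq)
    have h2 := h.lintegral_lt_top
    simp only [hg]
    convert h2.ne using 3 with y
    rw [ENNReal.ofReal_prod_of_nonneg]
    intro i _
    positivity
  · intro ξ hξ φ hφ
    obtain ⟨b, hb⟩ := Orthonormal.exists_orthonormalBasis_extension_of_card_eq (𝕜 := ℝ)
      (E := Euc (m + 1)) (ι := Fin (m + 1)) (by simp) (v := fun _ => ξ) (s := {0})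
      ⟨fun _ => by simpa using hξ, fun i j hij => (hij (Subsingleton.elim _ _)).elim⟩
    have hb0 : b 0 = ξ := hb 0 rfl
    have hwt : ∀ y : Euc (m + 1), ENNReal.ofReal (wt (m + 1) y) ≤ ∏ i, g (b.repr y i) := by
      intro y
      simp only [hg]
      rw [← ENNReal.ofReal_prod_of_nonneg (fun i _ => by positivity)]
      apply ENNReal.ofReal_le_ofReal
      rw [Finset.prod_inv_distrib]
      unfold wt
      gcongr ?_⁻¹
      calc ∏ i, (1 + (b.repr y i) ^ 2) ≤ ∏ i : Fin (m + 1), (1 + ‖y‖ ^ 2) := by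
            apply Finset.prod_le_prod (fun i _ => by positivity)
            intro i _
            have : ‖b.repr y i‖ ≤ ‖b.repr y‖ := PiLp.norm_apply_le _ _
            rw [b.repr.norm_map] at this
            rw [← sq_abs]
            have h2 : |b.repr y i| ≤ ‖y‖ := this
            gcongr
        _ = _ := by simp
    have hmp := (EuclideanSpace.volume_preserving_symm_measurableEquiv_toLp (Fin (m + 1))).comp
      b.measurePreserving_repr
    have hmp2 := (volume_preserving_piFinSuccAbove (fun _ : Fin (m + 1) => ℝ) 0).comp hmp
    calc ∫⁻ y, φ ⟪y, ξ⟫ * ENNReal.ofReal (wt (m + 1) y)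
        ≤ ∫⁻ y : Euc (m + 1), φ (b.repr y 0) * ∏ i, g (b.repr y i) := by
          apply lintegral_mono
          intro y
          have : b.repr y 0 = ⟪y, ξ⟫ := by
            rw [b.repr_apply_apply, hb0, real_inner_comm]
          simp only [this]
          gcongr
          exact hwt y
      _ = ∫⁻ y : Euc (m + 1), (fun z : ℝ × (Fin m → ℝ) => (φ z.1 * g z.1) * ∏ i, g (z.2 i))
            ((MeasurableEquiv.piFinSuccAbove (fun _ : Fin (m + 1) => ℝ) 0)
              ((MeasurableEquiv.toLp 2 (Fin (m + 1) → ℝ)).symm (b.repr y))) := by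
          apply lintegral_congr
          intro y
          rw [Fin.prod_univ_succ, ← mul_assoc]
          rfl
      _ = ∫⁻ z : ℝ × (Fin m → ℝ), (φ z.1 * g z.1) * ∏ i, g (z.2 i) := by
          refine hmp2.lintegral_comp (f := fun z : ℝ × (Fin m → ℝ) =>
            (φ z.1 * g z.1) * ∏ i, g (z.2 i)) ?_
          fun_prop
      _ = _ := by
          rw [Measure.volume_eq_prod, lintegral_prod_mul (f := fun t => φ t * g t)
            (g := fun y : Fin m → ℝ => ∏ i, g (y i)) (by fun_prop)
            (Finset.measurable_fun_prod _ fun i _ => hgm.comp (measurable_pi_apply i)).aemeasurable,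
            mul_comm]

theorem lintegral_wt_ne_top {n : ℕ} (hn : 1 ≤ n) :
    ∫⁻ y : Euc n, ENNReal.ofReal (wt n y) ≠ ⊤ := by
  obtain ⟨C, hC, h⟩ := lintegral_slab_le hn
  have h1 := h (EuclideanSpace.single ⟨0, hn⟩ 1) (by simp) (fun _ => 1) measurable_const
  simp only [one_mul] at h1
  refine ne_top_of_le_ne_top (ENNReal.mul_ne_top hC ?_) h1
  exact integrable_inv_one_add_sq.lintegral_lt_top.ne

theorem integrable_wt {n : ℕ} (hn : 1 ≤ n) : Integrable (wt n) volume := by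
  refine ⟨continuous_wt.aestronglyMeasurable, ?_⟩
  rw [hasFiniteIntegral_iff_ofReal (ae_of_all _ fun x => (wt_pos x).le)]
  exact (lintegral_wt_ne_top hn).lt_top

theorem lorentzNorm_eq_top {α F : Type*} [MeasurableSpace α] [NormedAddCommGroup F]
    [NormedSpace ℝ F] {p q : ℝ} (hp : 0 < p) (hq : 0 < q) (μ : Measure α) (f : α → F)
    {c : ℝ≥0∞} (hc : c ≠ 0) {t₀ : ℝ} (ht₀ : 0 < t₀)
    (h : ∀ t, t₀ < t → c ≤ ENNReal.ofReal t * (μ {x | t < ‖f x‖}) ^ (1 / p)) :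
    lorentzNorm p q μ f = ⊤ := by
  have h1 : ∫⁻ t in Set.Ioi (0 : ℝ),
      (ENNReal.ofReal t * (μ {x | t < ‖f x‖}) ^ (1 / p)) ^ q * (ENNReal.ofReal t)⁻¹ = ⊤ := by
    rw [eq_top_iff]
    calc (⊤ : ℝ≥0∞) = c ^ q * ∫⁻ t in Set.Ioi t₀, (ENNReal.ofReal t)⁻¹ := by
          have : ∫⁻ t in Set.Ioi t₀, (ENNReal.ofReal t)⁻¹ = ⊤ := by
            by_contra hne
            apply not_integrableOn_Ioi_inv (a := t₀)
            refine ⟨(measurable_inv).aestronglyMeasurable, ?_⟩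
            rw [hasFiniteIntegral_iff_norm]
            refine lt_of_le_of_lt (le_of_eq ?_) (lt_top_iff_ne_top.2 hne)
            apply setLIntegral_congr_fun measurableSet_Ioi
            intro t ht
            have : 0 < t := ht₀.trans ht
            simp only [Real.norm_eq_abs]
            rw [abs_of_pos (by positivity), ENNReal.ofReal_inv_of_pos this]
          rw [this, ENNReal.mul_top]
          simp [hc, hq.le]
      _ = ∫⁻ t in Set.Ioi t₀, c ^ q * (ENNReal.ofReal t)⁻¹ := by
          rw [lintegral_const_mul]
          fun_prop
      _ ≤ ∫⁻ t in Set.Ioi t₀, (ENNReal.ofReal t * (μ {x | t < ‖f x‖}) ^ (1 / p)) ^ q *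
            (ENNReal.ofReal t)⁻¹ := by
          apply setLIntegral_mono' measurableSet_Ioi
          intro t ht
          gcongr
          exact h t ht
      _ ≤ _ := lintegral_mono_set (Set.Ioi_subset_Ioi ht₀.le)
  unfold lorentzNorm
  rw [h1, ENNReal.top_rpow_of_pos (by positivity), ENNReal.mul_top]
  have : 0 < ENNReal.ofReal p := by simpa using hp
  exact (ENNReal.rpow_pos this (by simp)).ne'

theorem not_smallO_top {Q : ℝ → ℝ≥0∞} {a : ℝ} (h : ∀ r, 0 < r → Q r = ⊤) : ¬ SmallO Q a := by
  intro hs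
  unfold SmallO at hs
  have h2 : Tendsto (fun _ : ℝ => (⊤ : ℝ≥0∞)) (𝓝[>] (0 : ℝ)) (𝓝 0) := by
    refine hs.congr' ?_
    filter_upwards [self_mem_nhdsWithin] with r hr
    rw [h r hr, ENNReal.top_div_of_ne_top (by simp)]
  exact ENNReal.top_ne_zero (tendsto_nhds_unique tendsto_const_nhds h2)

theorem not_memTLorentz {n : ℕ} {F : Type*} [NormedAddCommGroup F] [NormedSpace ℝ F] {j : ℕ}
    {p q : ℝ} (hp : 0 < p) (hq : 0 < q) {f : Euc n → F} {x : Euc n}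
    (h : ∀ r, 0 < r → ∀ M : ℝ, ∃ c : ℝ≥0∞, c ≠ 0 ∧ ∃ t₀ : ℝ, 0 < t₀ ∧ ∀ t, t₀ < t →
      c ≤ ENNReal.ofReal t * (volume (ball x r ∩ {y | t + M < ‖f y‖})) ^ (1 / p)) :
    ¬ MemTLorentz n j p q f x := by
  rintro ⟨P, ⟨hP, -⟩, hs⟩
  refine not_smallO_top (fun r hr => ?_) hs
  obtain ⟨M, hM⟩ := (isCompact_closedBall x r).exists_bound_of_continuousOn
    hP.continuous.continuousOn
  obtain ⟨c, hc, t₀, ht₀, h1⟩ := h r hr M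
  refine lorentzNorm_eq_top hp hq _ _ hc ht₀ fun t ht => (h1 t ht).trans ?_
  refine mul_le_mul_right (ENNReal.rpow_le_rpow (le_trans (measure_mono ?_)
    (Measure.le_restrict_apply _ _)) (by positivity)) _
  rintro y ⟨hyr, hy⟩
  refine ⟨?_, hyr⟩
  have h3 := hM y (ball_subset_closedBall hyr)
  have h4 := norm_sub_norm_le (f y) (P y)
  simp only [Set.mem_ofPred_eq] at hy ⊢
  linarith

theorem slab_volume_ge {n : ℕ} (hn : 1 ≤ n) {r : ℝ} (hr : 0 < r) : ∃ c : ℝ≥0∞, c ≠ 0 ∧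
    ∃ ρ₀ : ℝ, 0 < ρ₀ ∧ ∀ ξ : Euc n, ‖ξ‖ = 1 → ∀ x : Euc n, ∀ ρ : ℝ, 0 < ρ → ρ ≤ ρ₀ →
      c * ENNReal.ofReal ρ ≤ volume (ball x r ∩ {y | |⟪y, ξ⟫ - ⟪x, ξ⟫| < ρ}) := by
  obtain ⟨m, rfl⟩ : ∃ m, n = m + 1 := ⟨n - 1, by omega⟩
  set δ : ℝ := r / (m + 1) with hδ
  have hδ0 : 0 < δ := by positivity
  refine ⟨ENNReal.ofReal ((2 * δ) ^ m), by simp [hδ0], δ, hδ0, ?_⟩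
  intro ξ hξ x ρ hρ hρδ
  obtain ⟨b, hb⟩ := Orthonormal.exists_orthonormalBasis_extension_of_card_eq (𝕜 := ℝ)
    (E := Euc (m + 1)) (ι := Fin (m + 1)) (by simp) (v := fun _ => ξ) (s := {0})
    ⟨fun _ => by simpa using hξ, fun i j hij => (hij (Subsingleton.elim _ _)).elim⟩
  have hb0 : b 0 = ξ := hb 0 rfl
  have hmp := (EuclideanSpace.volume_preserving_symm_measurableEquiv_toLp (Fin (m + 1))).comp
    b.measurePreserving_repr
  set w : Fin (m + 1) → ℝ := Fin.cons ρ (fun _ => δ) with hw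
  have hw1 : ∀ i, w i ≤ δ := fun i => by
    refine Fin.cases ?_ (fun j => ?_) i <;> simp [hw, hρδ]
  set S : Set (Fin (m + 1) → ℝ) := Set.pi Set.univ fun i =>
    Set.Ioo (b.repr x i - w i) (b.repr x i + w i) with hS
  have hSv : volume S = ENNReal.ofReal ((2 * δ) ^ m) * ENNReal.ofReal (2 * ρ) := by
    rw [hS, Real.volume_pi_Ioo, Fin.prod_univ_succ, mul_comm]
    congr 1
    · rw [ENNReal.ofReal_pow (by positivity)]
      simp [hw]
      rw [← two_mul, ENNReal.ofReal_mul zero_le_two, ENNReal.ofReal_ofNat]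
    · congr 1; simp [hw]; ring
  have hpre := hmp.measure_preimage (s := S)
    (MeasurableSet.univ_pi fun i => measurableSet_Ioo).nullMeasurableSet
  calc _ ≤ volume S := by
        rw [hSv]; gcongr; linarith
    _ = _ := hpre.symm
    _ ≤ _ := by
        apply measure_mono
        intro y hy
        have hy2 : ∀ i, |b.repr y i - b.repr x i| < w i := by
          intro i
          have := hy i (Set.mem_univ i)
          simp only [Set.mem_Ioo, Function.comp] at this
          rw [abs_lt]
          have h2 : ((MeasurableEquiv.toLp 2 (Fin (m + 1) → ℝ)).symm (b.repr y)) i = b.repr y i :=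
            rfl
          rw [h2] at this
          constructor <;> linarith
        constructor
        · rw [mem_ball, dist_eq_norm, ← b.repr.norm_map, map_sub]
          refine lt_of_pow_lt_pow_left₀ 2 hr.le ?_
          rw [EuclideanSpace.real_norm_sq_eq]
          calc ∑ i, ((b.repr y - b.repr x) i) ^ 2 < ∑ i : Fin (m + 1), δ ^ 2 := by
                apply Finset.sum_lt_sum_of_nonempty Finset.univ_nonempty
                intro i _
                rw [← sq_abs]
                have h3 := (hy2 i).trans_le (hw1 i)
                have : |(b.repr y - b.repr x) i| < δ := by simpa using h3
                gcongr
            _ = (m + 1) * δ ^ 2 := by simp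
            _ ≤ r ^ 2 := by
                rw [hδ, div_pow]
                have : (m + 1 : ℝ) * (r ^ 2 / (m + 1) ^ 2) = r ^ 2 / (m + 1) := by field_simp
                rw [this]
                apply div_le_self (by positivity)
                have : (0 : ℝ) ≤ m := by positivity
                linarith
        · have := hy2 0
          rw [b.repr_apply_apply, b.repr_apply_apply, hb0, real_inner_comm y ξ,
            real_inner_comm x ξ] at this
          simpa [hw] using this

theorem locallyIntegrable_of_wt {n : ℕ} {F : Type*} [NormedAddCommGroup F] {g : Euc n → F}
    (hg : AEStronglyMeasurable g volume)
    (h : ∫⁻ y, ‖g y‖ₑ * ENNReal.ofReal (wt n y) ≠ ⊤) : LocallyIntegrable g volume := by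
  rw [locallyIntegrable_iff]
  intro K hK
  rcases K.eq_empty_or_nonempty with rfl | hne
  · simp
  obtain ⟨x₀, hx₀, hmin⟩ := hK.exists_isMinOn hne continuous_wt.continuousOn
  refine ⟨hg.restrict, ?_⟩
  have hc : ENNReal.ofReal (wt n x₀) ≠ 0 := by simpa using wt_pos x₀
  have h1 : (∫⁻ y in K, ‖g y‖ₑ) * ENNReal.ofReal (wt n x₀) ≤
      ∫⁻ y, ‖g y‖ₑ * ENNReal.ofReal (wt n y) := by
    rw [← lintegral_mul_const' _ _ (by simp)]
    refine (setLIntegral_mono' hK.measurableSet fun y hy => ?_).trans (setLIntegral_le_lintegral _ _)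
    gcongr
    exact hmin hy
  rw [HasFiniteIntegral]
  by_contra hcon
  rw [not_lt_top_iff.1 hcon, ENNReal.top_mul hc] at h1
  exact h (top_le_iff.1 h1)

section OrderOne

variable {n : ℕ} {V W : Type*} [NormedAddCommGroup V] [InnerProductSpace ℝ V]
  [FiniteDimensional ℝ V] [NormedAddCommGroup W] [InnerProductSpace ℝ W] [FiniteDimensional ℝ W]

/-- The coefficient of `∂_i` in a first order operator. -/
def coef (A : CoeffOp n 1 V W) (i : Fin n) : V →ₗ[ℝ] W := A fun _ => i

theorem sum_fin_one {M : Type*} [AddCommMonoid M] (g : (Fin 1 → Fin n) → M) :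
    ∑ I, g I = ∑ i, g fun _ => i :=
  Fintype.sum_equiv (Equiv.funUnique (Fin 1) (Fin n)) _ _ fun I => by
    congr 1; ext j; simp [Subsingleton.elim j 0]

theorem symbolMap_one (A : CoeffOp n 1 V W) (ξ : Euc n) :
    symbolMap n 1 A ξ = ∑ i, ξ i • coef A i := by
  unfold symbolMap
  rw [sum_fin_one]
  simp [coef]

theorem dirDeriv_one {F : Type*} [NormedAddCommGroup F] [NormedSpace ℝ F] (i : Fin n)
    (φ : Euc n → F) (x : Euc n) :
    dirDeriv n 1 (fun _ => i) φ x = fderiv ℝ φ x (stdVec n i) := by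
  unfold dirDeriv
  rw [iteratedFDeriv_one_apply]

theorem hasDistribA_iff {A : CoeffOp n 1 V W} {u : Euc n → V} {σ : Measure (Euc n)}
    {f : Euc n → W} : HasDistribA n 1 A u σ f ↔ ∀ φ : Euc n → W, IsTestFun n φ →
      -(∑ i, ∫ x, ⟪coef A i (u x), fderiv ℝ φ x (stdVec n i)⟫) = ∫ x, ⟪f x, φ x⟫ ∂σ := by
  unfold HasDistribA
  simp only [sum_fin_one, dirDeriv_one, LinearMap.adjoint_inner_right, pow_one, neg_mul, one_mul]
  rfl

end OrderOne

/-- A truncated power singularity. -/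
noncomputable def sing (α s : ℝ) : ℝ≥0∞ :=
  (Set.Ioo (-1 : ℝ) 1).indicator (fun s => ‖s‖ₑ ^ (-α)) s

theorem measurable_sing (α : ℝ) : Measurable (sing α) := by
  unfold sing
  refine Measurable.indicator ?_ measurableSet_Ioo
  fun_prop

theorem lintegral_sing_ne_top {α : ℝ} (hα : α < 1) : ∫⁻ s, sing α s ≠ ⊤ := by
  have h0 : IntegrableOn (fun s : ℝ => ‖s‖ ^ (-α)) (ball 0 1) :=
    integrableOn_ball_of_norm_le_rpow (C := 1) (α := α) (by simp) (by simpa using hα)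
      (ae_of_all _ fun s => by simp [abs_of_nonneg (Real.rpow_nonneg (abs_nonneg s) _)])
      (measurable_norm.pow_const _).aestronglyMeasurable
  have h1 := h0.lintegral_lt_top.ne
  unfold sing
  rw [lintegral_indicator measurableSet_Ioo]
  rw [Real.ball_eq_Ioo, zero_sub, zero_add] at h1
  convert h1 using 1
  apply lintegral_congr_ae
  filter_upwards [ae_restrict_of_ae (compl_mem_ae_iff.2 (measure_singleton (0 : ℝ)))] with s hs
  rw [← ENNReal.ofReal_rpow_of_pos (norm_pos_iff.2 hs), ofReal_norm]

/-- Superposition of the singularities at all rational points. -/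
noncomputable def denseSing (α s : ℝ) : ℝ≥0∞ :=
  ∑' k : ℕ, ENNReal.ofReal ((1 / 2) ^ k) * sing α (s - ((Encodable.decode (α := ℚ) k).getD 0 : ℚ))

theorem measurable_sing_sub (α a : ℝ) : Measurable fun s => sing α (s - a) :=
  (measurable_sing α).comp (measurable_id.sub_const _)

theorem measurable_denseSing (α : ℝ) : Measurable (denseSing α) := by
  unfold denseSing
  exact Measurable.tsum fun k => (measurable_sing_sub α _).const_mul _

theorem lintegral_denseSing_ne_top {α : ℝ} (hα : α < 1) : ∫⁻ s, denseSing α s ≠ ⊤ := by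
  unfold denseSing
  rw [lintegral_tsum fun k => ((measurable_sing_sub α _).const_mul _).aemeasurable]
  have : ∀ k : ℕ, ∫⁻ s, ENNReal.ofReal ((1 / 2) ^ k) *
      sing α (s - ((Encodable.decode (α := ℚ) k).getD 0 : ℚ)) =
      ENNReal.ofReal ((1 / 2) ^ k) * ∫⁻ s, sing α s := by
    intro k
    rw [lintegral_const_mul _ (measurable_sing_sub α _), lintegral_sub_right_eq_self]
  simp_rw [this]
  rw [ENNReal.tsum_mul_right]
  refine ENNReal.mul_ne_top ?_ (lintegral_sing_ne_top hα)
  exact summable_geometric_two.tsum_ofReal_ne_top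

section

variable {n : ℕ} {V W : Type*} [NormedAddCommGroup V] [InnerProductSpace ℝ V]
  [FiniteDimensional ℝ V] [NormedAddCommGroup W] [InnerProductSpace ℝ W] [FiniteDimensional ℝ W]

theorem IsTestFun.fderiv_apply_eq {F : Type*} [NormedAddCommGroup F] [NormedSpace ℝ F]
    {φ : Euc n → F} (hφ : IsTestFun n φ) (e : Euc n) :
    IsTestFun n (fun x => fderiv ℝ φ x e) := by
  refine ⟨?_, hφ.2.fderiv_apply ℝ e⟩
  exact (hφ.1.fderiv_right (m := (⊤ : ℕ∞)) (by simp)).clm_apply contDiff_const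

theorem integrable_bilin_of_hasCompactSupport {F G H : Type*} [NormedAddCommGroup F]
    [NormedSpace ℝ F] [NormedAddCommGroup G] [NormedSpace ℝ G] [NormedAddCommGroup H]
    [NormedSpace ℝ H] (B : F →L[ℝ] G →L[ℝ] H) {μ : Measure (Euc n)} {u : Euc n → F}
    {φ : Euc n → G} (hu : LocallyIntegrable u μ) (hφ : Continuous φ) (hc : HasCompactSupport φ) :
    Integrable (fun x => B (u x) (φ x)) μ := by
  have hs : Function.support (fun x => B (u x) (φ x)) ⊆ tsupport φ := by
    intro x hx
    apply subset_tsupport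
    intro h0
    apply hx
    simp [h0]
  rw [← integrableOn_iff_integrable_of_support_subset hs]
  have hK := hu.integrableOn_isCompact hc
  obtain ⟨M, hM⟩ := hφ.bounded_above_of_compact_support hc
  refine Integrable.mono' (hK.norm.const_mul (‖B‖ * M)) ?_ ?_
  · exact B.aestronglyMeasurable_comp₂ hK.1 hφ.aestronglyMeasurable
  · refine ae_of_all _ fun x => (B.le_opNorm₂ _ _).trans ?_
    have := hM x
    have h2 : 0 ≤ ‖B‖ * ‖u x‖ := by positivity
    nlinarith

theorem locallyIntegrable_inner_test {μ : Measure (Euc n)} {u φ : Euc n → W}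
    (hu : LocallyIntegrable u μ) (hφ : Continuous φ) (hc : HasCompactSupport φ) :
    Integrable (fun x => ⟪u x, φ x⟫) μ :=
  integrable_bilin_of_hasCompactSupport (innerSL ℝ) hu hφ hc

/-- A profile constant along `c` is weakly `c`-differentiable with zero derivative. -/
theorem integral_inner_fderiv_eq_zero {u φ : Euc n → W} {c : Euc n}
    (hu : LocallyIntegrable u volume) (hφ : IsTestFun n φ)
    (hc : ∀ x, ∀ t : ℝ, u (x + t • c) = u x) :
    ∫ x, ⟪u x, fderiv ℝ φ x c⟫ = 0 := by
  have h := integral_bilinear_hasLineDerivAt_right_eq_neg_left_of_integrable (μ := volume)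
    (f := u) (f' := fun _ => 0) (g := φ) (g' := fun x => fderiv ℝ φ x c) (v := c)
    (B := innerSL ℝ) (by simp)
    (locallyIntegrable_inner_test hu (hφ.fderiv_apply_eq c).1.continuous (hφ.fderiv_apply_eq c).2)
    (locallyIntegrable_inner_test hu hφ.1.continuous hφ.2)
    (fun x _ => by
      unfold HasLineDerivAt
      simp only [hc]
      exact hasDerivAt_const _ _)
    (fun x _ => ((hφ.1.differentiable (by simp)) x).hasFDerivAt.hasLineDerivAt c)
  refine Eq.trans h ?_
  simp

theorem sum_inner_coef_eq {u : V} (A : CoeffOp n 1 V W) (b : OrthonormalBasis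
    (Fin (Module.finrank ℝ W)) ℝ W) (L : Euc n →L[ℝ] W) :
    ∑ i, ⟪coef A i u, L (stdVec n i)⟫ =
      ∑ j, ⟪b j, L (∑ i, ⟪coef A i u, b j⟫ • stdVec n i)⟫ := by
  simp only [map_sum, map_smul, inner_sum, inner_smul_right]
  rw [Finset.sum_comm]
  exact Finset.sum_congr rfl fun i _ => (b.sum_inner_mul_inner _ _).symm

theorem inner_sum_coef (A : CoeffOp n 1 V W) (v : V) (w : W) (ξ : Euc n) :
    ⟪∑ i, ⟪coef A i v, w⟫ • stdVec n i, ξ⟫ = ⟪symbolMap n 1 A ξ v, w⟫ := by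
  rw [symbolMap_one, sum_inner]
  simp only [LinearMap.sum_apply, LinearMap.smul_apply, sum_inner, real_inner_smul_left, stdVec,
    EuclideanSpace.inner_single_left]
  exact Finset.sum_congr rfl fun i _ => by simp [mul_comm]

theorem exists_not_differentiable_of_not_elliptic (hn : 1 < n) (A : CoeffOp n 1 V W) {q : ℝ}
    (hq : 0 < q) (hA : ¬ IsElliptic n 1 A) : ∃ u : Euc n → V, MemBVAloc n 1 A u ∧
      ∀ x, ¬ MemTLorentz n 1 ((n : ℝ) / ((n : ℝ) - 1)) q u x := by
  obtain ⟨ξ, hξ, v, hv, hAv⟩ : ∃ ξ : Euc n, ‖ξ‖ = 1 ∧ ∃ v : V, v ≠ 0 ∧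
      symbolMap n 1 A ξ v = 0 := by
    unfold IsElliptic at hA
    push Not at hA
    obtain ⟨ξ, hξ, hinj⟩ := hA
    rw [injective_iff_map_eq_zero] at hinj
    push Not at hinj
    obtain ⟨v, hv, hv0⟩ := hinj
    refine ⟨‖ξ‖⁻¹ • ξ, by simp [norm_smul, hξ], v, hv0, ?_⟩
    have : symbolMap n 1 A (‖ξ‖⁻¹ • ξ) = ‖ξ‖⁻¹ • symbolMap n 1 A ξ := by
      simp [symbolMap_one, Finset.smul_sum, mul_smul]
    rw [this, LinearMap.smul_apply, hv, smul_zero]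
  have hn1 : (0 : ℝ) < (n : ℝ) - 1 := by
    have : (1 : ℝ) < n := by exact_mod_cast hn
    linarith
  set p : ℝ := (n : ℝ) / ((n : ℝ) - 1) with hp
  have hp1 : 1 < p := by rw [hp, one_lt_div hn1]; linarith
  have hp0 : 0 < p := by linarith
  set α : ℝ := 1 / p with hα
  have hα1 : α < 1 := by rw [hα, div_lt_one hp0]; exact hp1
  have hα0 : 0 < α := by positivity
  obtain ⟨C, hC, hslab⟩ := lintegral_slab_le (n := n) hn.le
  have hfin : ∫⁻ y : Euc n, denseSing α ⟪y, ξ⟫ * ENNReal.ofReal (wt n y) ≠ ⊤ := by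
    refine ne_top_of_le_ne_top (ENNReal.mul_ne_top hC ?_) (hslab ξ hξ _ (measurable_denseSing α))
    refine ne_top_of_le_ne_top (lintegral_denseSing_ne_top hα1) (lintegral_mono fun t => ?_)
    calc _ ≤ denseSing α t * 1 := by
          gcongr
          rw [ENNReal.ofReal_le_one]
          exact inv_le_one_of_one_le₀ (by nlinarith [sq_nonneg t])
      _ = _ := mul_one _
  have hmξ : Measurable fun y : Euc n => denseSing α ⟪y, ξ⟫ :=
    (measurable_denseSing α).comp (by fun_prop)
  have hae : ∀ᵐ y : Euc n, denseSing α ⟪y, ξ⟫ < ⊤ := by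
    filter_upwards [ae_lt_top (hmξ.mul continuous_wt.measurable.ennreal_ofReal) hfin] with y hy
    by_contra hcon
    rw [Pi.mul_apply, not_lt_top_iff.1 hcon, ENNReal.top_mul (by simpa using wt_pos y)] at hy
    exact lt_irrefl _ hy
  set u : Euc n → V := fun y => (denseSing α ⟪y, ξ⟫).toReal • v with hu
  have hlocR : LocallyIntegrable (fun y : Euc n => (denseSing α ⟪y, ξ⟫).toReal) volume := by
    apply locallyIntegrable_of_wt hmξ.ennreal_toReal.aestronglyMeasurable
    refine ne_top_of_le_ne_top hfin (lintegral_mono fun y => ?_)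
    dsimp only
    gcongr
    rw [Real.enorm_of_nonneg ENNReal.toReal_nonneg]
    exact ENNReal.ofReal_toReal_le
  have hlocV : LocallyIntegrable u volume := fun y => by
    obtain ⟨s, hs, hi⟩ := hlocR y
    exact ⟨s, hs, hi.smul_const v⟩
  have hloc : ∀ w : W, LocallyIntegrable (fun y : Euc n => (denseSing α ⟪y, ξ⟫).toReal • w)
      volume := fun w y => by
    obtain ⟨s, hs, hi⟩ := hlocR y
    exact ⟨s, hs, hi.smul_const w⟩
  refine ⟨u, ⟨hlocV, 0, fun _ => 0, inferInstance, locallyIntegrable_zero, by simp, ?_⟩, ?_⟩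
  · rw [hasDistribA_iff]
    intro φ hφ
    simp only [integral_zero_measure, neg_eq_zero]
    have hint : ∀ w : W, ∀ e, Integrable (fun x : Euc n =>
        ⟪(denseSing α ⟪x, ξ⟫).toReal • w, fderiv ℝ φ x e⟫) volume := fun w e =>
      locallyIntegrable_inner_test (hloc w) (hφ.fderiv_apply_eq e).1.continuous
        (hφ.fderiv_apply_eq e).2
    have h1 : ∀ i, (fun x => ⟪coef A i (u x), fderiv ℝ φ x (stdVec n i)⟫) = fun x =>
        ⟪(denseSing α ⟪x, ξ⟫).toReal • coef A i v, fderiv ℝ φ x (stdVec n i)⟫ := by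
      intro i; ext x; simp [hu]
    simp_rw [h1]
    rw [← integral_finsetSum _ fun i _ => hint _ _]
    set b := stdOrthonormalBasis ℝ W
    have h2 : ∀ x : Euc n, ∑ i, ⟪(denseSing α ⟪x, ξ⟫).toReal • coef A i v,
        fderiv ℝ φ x (stdVec n i)⟫ = ∑ j, ⟪(denseSing α ⟪x, ξ⟫).toReal • b j,
          fderiv ℝ φ x (∑ i, ⟪coef A i v, b j⟫ • stdVec n i)⟫ := by
      intro x
      simp only [real_inner_smul_left]
      rw [← Finset.mul_sum, sum_inner_coef_eq A b, Finset.mul_sum]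
    simp_rw [h2]
    rw [integral_finsetSum _ fun i _ => hint _ _]
    refine Finset.sum_eq_zero fun j _ => integral_inner_fderiv_eq_zero (hloc _) hφ ?_
    intro x t
    rw [inner_add_left, real_inner_smul_left, inner_sum_coef, hAv]
    simp
  · intro x
    refine not_memTLorentz hp0 hq fun r hr M => ?_
    obtain ⟨s₀, hs1, hs2⟩ := exists_rat_btwn (show ⟪x, ξ⟫ - r / 2 < ⟪x, ξ⟫ + r / 2 by linarith)
    obtain ⟨c, hc, ρ₀, hρ₀, hvol⟩ := slab_volume_ge hn.le (half_pos hr)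
    set x₀ : Euc n := x + ((s₀ : ℝ) - ⟪x, ξ⟫) • ξ with hx₀
    have hx₀s : ⟪x₀, ξ⟫ = s₀ := by
      rw [hx₀, inner_add_left, real_inner_smul_left, real_inner_self_eq_norm_sq, hξ]; ring
    have hball : ball x₀ (r / 2) ⊆ ball x r := by
      apply ball_subset_ball'
      rw [dist_eq_norm, hx₀, add_sub_cancel_left, norm_smul, hξ, mul_one, Real.norm_eq_abs]
      have : |(s₀ : ℝ) - ⟪x, ξ⟫| ≤ r / 2 := abs_le.2 ⟨by linarith, by linarith⟩
      linarith
    set a : ℝ := (1 / 2) ^ (Encodable.encode s₀) * ‖v‖ with ha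
    have ha0 : 0 < a := by positivity
    have key : ∀ ρ : ℝ, 0 < ρ → ρ ≤ min ρ₀ 1 → c * ENNReal.ofReal ρ ≤
        volume (ball x r ∩ {y | a * ρ ^ (-α) < ‖u y‖}) := by
      intro ρ hρ hρ1
      refine (hvol ξ hξ x₀ ρ hρ (hρ1.trans (min_le_left _ _))).trans ?_
      apply measure_mono_ae
      filter_upwards [hae] with y hy hmem
      obtain ⟨hyb, hys⟩ := hmem
      refine ⟨hball hyb, ?_⟩
      have hys' : |⟪y, ξ⟫ - s₀| < ρ := by rw [← hx₀s]; exact hys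
      have hle : ENNReal.ofReal ((1 / 2) ^ (Encodable.encode s₀)) * sing α (⟪y, ξ⟫ - s₀) ≤
          denseSing α ⟪y, ξ⟫ := by
        unfold denseSing
        refine le_trans (le_of_eq ?_) (ENNReal.le_tsum (Encodable.encode s₀))
        simp
      have hs : sing α (⟪y, ξ⟫ - s₀) = ‖⟪y, ξ⟫ - s₀‖ₑ ^ (-α) := by
        unfold sing
        rw [Set.indicator_of_mem]
        exact abs_lt.1 (hys'.trans_le (hρ1.trans (min_le_right _ _)))
      have hlt : ENNReal.ofReal (ρ ^ (-α)) < sing α (⟪y, ξ⟫ - s₀) := by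
        rw [hs, ← ENNReal.ofReal_rpow_of_pos hρ, ENNReal.rpow_neg, ENNReal.rpow_neg,
          ENNReal.inv_lt_inv]
        apply ENNReal.rpow_lt_rpow _ hα0
        rw [Real.enorm_eq_ofReal_abs]
        exact (ENNReal.ofReal_lt_ofReal_iff hρ).2 hys'
      have h3 : ENNReal.ofReal ((1 / 2) ^ (Encodable.encode s₀) * ρ ^ (-α)) <
          denseSing α ⟪y, ξ⟫ := by
        refine lt_of_lt_of_le ?_ hle
        rw [ENNReal.ofReal_mul (by positivity)]
        rw [ENNReal.mul_lt_mul_iff_right (by simp) (by simp)]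
        exact hlt
      have h4 := (ENNReal.ofReal_lt_iff_lt_toReal (by positivity) hy.ne).1 h3
      change a * ρ ^ (-α) < ‖u y‖
      rw [hu, norm_smul, Real.norm_of_nonneg ENNReal.toReal_nonneg, ha]
      calc _ = ((1 / 2) ^ (Encodable.encode s₀) * ρ ^ (-α)) * ‖v‖ := by ring
        _ < _ := by gcongr
    refine ⟨c ^ (1 / p) * ENNReal.ofReal (a / 2), ?_, ?_⟩
    · refine mul_ne_zero ?_ (by simpa using ha0)
      simp [hc, hp0.le]
    set B := max 1 (a * (min ρ₀ 1) ^ (-α))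
    refine ⟨B + |M|, by positivity, fun t ht => ?_⟩
    have hM1 := neg_abs_le M
    have hM2 := le_abs_self M
    have hB1 : 1 ≤ B := le_max_left _ _
    have hB2 : a * (min ρ₀ 1) ^ (-α) ≤ B := le_max_right _ _
    have htM : 0 < t + M := by linarith
    have ht0 : 0 < t := by linarith [abs_nonneg M]
    set ρ : ℝ := ((t + M) / a) ^ (-p) with hρ
    have hρ0 : 0 < ρ := by positivity
    have hαp : -p * -α = 1 := by rw [hα]; field_simp
    have hρα : a * ρ ^ (-α) = t + M := by
      rw [hρ, ← Real.rpow_mul (by positivity), hαp, Real.rpow_one]; field_simp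
    have hρ1 : ρ ≤ min ρ₀ 1 := by
      by_contra hcon
      push Not at hcon
      have : a * ρ ^ (-α) < a * (min ρ₀ 1) ^ (-α) := by
        gcongr ?_ * ?_
        exact Real.rpow_lt_rpow_of_neg (by positivity) hcon (by linarith)
      linarith
    have hk := key ρ hρ0 hρ1
    rw [hρα] at hk
    calc c ^ (1 / p) * ENNReal.ofReal (a / 2)
        ≤ c ^ (1 / p) * (ENNReal.ofReal t * ENNReal.ofReal (ρ ^ (1 / p))) := by
          rw [← ENNReal.ofReal_mul ht0.le]
          gcongr
          have : ρ ^ (1 / p) = a / (t + M) := by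
            rw [hρ, ← Real.rpow_mul (by positivity)]
            have : -p * (1 / p) = -1 := by field_simp
            rw [this, Real.rpow_neg_one, inv_div]
          rw [this, mul_div_assoc', div_le_div_iff₀ two_pos htM]
          nlinarith
      _ = ENNReal.ofReal t * (c * ENNReal.ofReal ρ) ^ (1 / p) := by
          rw [ENNReal.mul_rpow_of_nonneg _ _ (by positivity),
            ENNReal.ofReal_rpow_of_pos hρ0]
          ring
      _ ≤ _ := by gcongr

end

section FourierMultiplier

open scoped SchwartzMap FourierTransform

theorem eLpNorm_fourier_eq {n : ℕ} (f : 𝓢(Euc n, ℂ)) :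
    eLpNorm (𝓕 f : 𝓢(Euc n, ℂ)) 2 volume = eLpNorm f 2 volume := by
  have h := SchwartzMap.norm_fourier_toL2_eq f
  rw [SchwartzMap.norm_toLp, SchwartzMap.norm_toLp] at h
  exact (ENNReal.toReal_eq_toReal_iff' ((𝓕 f).memLp 2 volume).eLpNorm_ne_top
    (f.memLp 2 volume).eLpNorm_ne_top).1 h

theorem fourier_sub' {n : ℕ} (f g : 𝓢(Euc n, ℂ)) : 𝓕 (f - g) = 𝓕 f - 𝓕 g :=
  map_sub (FourierTransform.fourierCLE ℂ 𝓢(Euc n, ℂ)) f g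

/-- Scalar convolution, written with the kernel evaluated at `x - y`. -/
noncomputable def sconv {n : ℕ} (H g : Euc n → ℂ) (x : Euc n) : ℂ := ∫ y, H (x - y) * g y

theorem eLpNorm_sconv_eq {n : ℕ} (H g : 𝓢(Euc n, ℂ)) :
    eLpNorm (sconv H g) 2 volume = eLpNorm (fun ξ => 𝓕 H ξ * 𝓕 g ξ) 2 volume := by
  have h1 : sconv H g = SchwartzMap.convolution (ContinuousLinearMap.mul ℂ ℂ) H g := by
    ext x
    rw [SchwartzMap.convolution_apply, sconv, convolution_eq_swap]
    rfl
  have h2 : (fun ξ => 𝓕 H ξ * 𝓕 g ξ)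
      = (𝓕 (SchwartzMap.convolution (ContinuousLinearMap.mul ℂ ℂ) H g) : 𝓢(Euc n, ℂ)) := by
    ext ξ
    rw [SchwartzMap.fourier_convolution_apply, SchwartzMap.fourier_coe, SchwartzMap.fourier_coe,
      Real.fourier_mul_convolution_eq H.integrable g.integrable]
  rw [h1, h2, eLpNorm_fourier_eq]

theorem memLp_translate_neg {n : ℕ} (H : 𝓢(Euc n, ℂ)) (x : Euc n) :
    MemLp (fun y => H (x - y)) 2 volume :=
  (H.memLp 2 volume).comp_measurePreserving (Measure.measurePreserving_sub_left volume x)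

theorem integrable_sconv {n : ℕ} (H : 𝓢(Euc n, ℂ)) {g : Euc n → ℂ} (hg : MemLp g 2 volume)
    (x : Euc n) : Integrable (fun y => H (x - y) * g y) := by
  have := MemLp.integrable_mul (memLp_translate_neg H x) hg
  exact this

theorem sconv_sub_left {n : ℕ} (H H' : 𝓢(Euc n, ℂ)) {g : Euc n → ℂ} (hg : MemLp g 2 volume) :
    sconv (H - H' : 𝓢(Euc n, ℂ)) g = sconv H g - sconv H' g := by
  ext x
  simp only [sconv, sub_apply, sub_mul, Pi.sub_apply]
  exact integral_sub (integrable_sconv H hg x) (integrable_sconv H' hg x)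

theorem sconv_sub_right {n : ℕ} (H : 𝓢(Euc n, ℂ)) {g g' : Euc n → ℂ} (hg : MemLp g 2 volume)
    (hg' : MemLp g' 2 volume) : sconv H (g - g') = sconv H g - sconv H g' := by
  ext x
  simp only [sconv, mul_sub, Pi.sub_apply]
  exact integral_sub (integrable_sconv H hg x) (integrable_sconv H hg' x)

theorem enorm_sconv_le {n : ℕ} (H : 𝓢(Euc n, ℂ)) {g : Euc n → ℂ} (hg : MemLp g 2 volume)
    (x : Euc n) : ‖sconv H g x‖ₑ ≤ eLpNorm H 2 volume * eLpNorm g 2 volume := by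
  calc ‖sconv H g x‖ₑ ≤ ∫⁻ y, ‖H (x - y) * g y‖ₑ := enorm_integral_le_lintegral_enorm _
    _ = eLpNorm (fun y => H (x - y) * g y) 1 volume := by rw [eLpNorm_one_eq_lintegral_enorm]
    _ ≤ eLpNorm (fun y => H (x - y)) 2 volume * eLpNorm g 2 volume := by
        have := eLpNorm_smul_le_mul_eLpNorm (p := 2) (q := 2) (r := 1) hg.1
          (memLp_translate_neg H x).1
        exact this
    _ = _ := by
        have h := eLpNorm_comp_measurePreserving (p := 2) (g := H) (f := fun y => x - y)
          H.continuous.aestronglyMeasurable (Measure.measurePreserving_sub_left volume x)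
        rw [← h]
        rfl

theorem continuous_sconv {n : ℕ} (H : 𝓢(Euc n, ℂ)) {g : Euc n → ℂ} (hg : MemLp g 2 volume) :
    AEStronglyMeasurable (sconv H g) volume := by
  have : AEStronglyMeasurable (fun p : Euc n × Euc n => H (p.1 - p.2) * g p.2)
      (volume.prod volume) := by
    refine (H.continuous.comp (by fun_prop)).aestronglyMeasurable.mul ?_
    exact hg.1.comp_quasiMeasurePreserving Measure.quasiMeasurePreserving_snd
  exact this.integral_prod_right'

theorem eLpNorm_sconv_le {n : ℕ} (H : 𝓢(Euc n, ℂ)) {C : ℝ} (hC : ∀ ξ, ‖𝓕 H ξ‖ ≤ C)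
    {g : Euc n → ℂ} (hg : MemLp g 2 volume) :
    eLpNorm (sconv H g) 2 volume ≤ ENNReal.ofReal C * eLpNorm g 2 volume := by
  have hS : ∀ g : 𝓢(Euc n, ℂ),
      eLpNorm (sconv H g) 2 volume ≤ ENNReal.ofReal C * eLpNorm g 2 volume := by
    intro g
    rw [eLpNorm_sconv_eq, ← eLpNorm_fourier_eq g]
    refine eLpNorm_le_mul_eLpNorm_of_ae_le_mul (Eventually.of_forall fun ξ => ?_) 2
    rw [norm_mul]
    exact mul_le_mul_of_nonneg_right (hC ξ) (norm_nonneg _)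
  have hex : ∀ k : ℕ, ∃ f : 𝓢(Euc n, ℂ), eLpNorm (g - (f : Euc n → ℂ)) 2 volume
      ≤ ENNReal.ofReal (1 / ((k : ℝ) + 1)) := by
    intro k
    obtain ⟨f, h1, h2, h3⟩ := MemLp.exist_eLpNorm_sub_le (p := 2) (by simp) (by simp) hg
      (ε := 1 / ((k : ℝ) + 1)) (by positivity)
    exact ⟨h1.toSchwartzMap h2, h3⟩
  choose f hf using hex
  have hz : Tendsto (fun k : ℕ => ENNReal.ofReal (1 / ((k : ℝ) + 1))) atTop (𝓝 0) := by
    rw [← ENNReal.ofReal_zero]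
    exact (ENNReal.continuous_ofReal.tendsto _).comp tendsto_one_div_add_atTop_nhds_zero_nat
  have hlim : ∀ x, Tendsto (fun k => sconv H (f k) x) atTop (𝓝 (sconv H g x)) := by
    intro x
    rw [tendsto_iff_edist_tendsto_0]
    refine tendsto_of_tendsto_of_tendsto_of_le_of_le tendsto_const_nhds
      (h := fun k : ℕ => eLpNorm H 2 volume * ENNReal.ofReal (1 / ((k : ℝ) + 1))) ?_
      (fun _ => zero_le) ?_
    · have := ENNReal.Tendsto.const_mul (a := eLpNorm H 2 volume) hz
        (Or.inr (H.memLp 2 volume).eLpNorm_ne_top)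
      simpa using this
    · intro k
      dsimp only
      rw [edist_comm, edist_eq_enorm_sub]
      have := enorm_sconv_le H (hg.sub ((f k).memLp 2 volume)) x
      rw [sconv_sub_right H hg ((f k).memLp 2 volume)] at this
      exact this.trans (mul_le_mul_right (hf k) _)
  have hfat := Lp.eLpNorm_lim_le_liminf_eLpNorm (p := 2) (μ := (volume : Measure (Euc n)))
    (f := fun k => sconv H (f k)) (fun k => continuous_sconv H ((f k).memLp 2 volume))
    (sconv H g) (Eventually.of_forall hlim)
  refine hfat.trans ?_
  have hb : ∀ k, eLpNorm (sconv H (f k)) 2 volume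
      ≤ ENNReal.ofReal C * (eLpNorm g 2 volume + ENNReal.ofReal (1 / ((k : ℝ) + 1))) := by
    intro k
    refine (hS (f k)).trans (mul_le_mul_right ?_ _)
    have h1 : (f k : Euc n → ℂ) = g - (g - f k) := by simp
    rw [h1]
    refine (eLpNorm_sub_le hg.1 (hg.sub ((f k).memLp 2 volume)).1 (by norm_num)).trans ?_
    exact add_le_add le_rfl (hf k)
  have hl : Tendsto (fun k : ℕ => ENNReal.ofReal C *
      (eLpNorm g 2 volume + ENNReal.ofReal (1 / ((k : ℝ) + 1)))) atTop
      (𝓝 (ENNReal.ofReal C * eLpNorm g 2 volume)) := by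
    have := ENNReal.Tendsto.const_mul (a := ENNReal.ofReal C)
      (hz.const_add (eLpNorm g 2 volume)) (Or.inr ENNReal.ofReal_ne_top)
    simpa using this
  rw [← hl.liminf_eq]
  exact liminf_le_liminf (Eventually.of_forall hb)

/-- Convolutions with kernels whose Fourier transforms are uniformly bounded and eventually
constant at almost every frequency form a Cauchy sequence in `L²`. -/
theorem sconv_cauchy {n : ℕ} (H : ℕ → 𝓢(Euc n, ℂ)) {C : ℝ} (hC : ∀ J ξ, ‖𝓕 (H J) ξ‖ ≤ C)
    {a : Euc n → ℂ} (ha : ∀ᵐ ξ, Tendsto (fun J => 𝓕 (H J) ξ) atTop (𝓝 (a ξ)))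
    {g : Euc n → ℂ} (hg : MemLp g 2 volume) {ε : ℝ≥0∞} (hε : ε ≠ 0) :
    ∃ J₀, ∀ J ≥ J₀, ∀ J' ≥ J₀, eLpNorm (sconv (H J) g - sconv (H J') g) 2 volume ≤ ε := by
  have hC0 : 0 ≤ C := (norm_nonneg _).trans (hC 0 0)
  have ham : AEStronglyMeasurable a volume :=
    aestronglyMeasurable_of_tendsto_ae atTop
      (fun J => (𝓕 (H J) : 𝓢(Euc n, ℂ)).continuous.aestronglyMeasurable) ha
  have hS : ∀ f : 𝓢(Euc n, ℂ), Tendsto (fun J => eLpNorm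
      (fun ξ => (𝓕 (H J) ξ - a ξ) * 𝓕 f ξ) 2 volume) atTop (𝓝 0) := by
    intro f
    have haC : ∀ᵐ ξ, ‖a ξ‖ ≤ C := by
      filter_upwards [ha] with ξ h
      exact le_of_tendsto h.norm (Eventually.of_forall fun J => hC J ξ)
    have hf2 := (𝓕 f : 𝓢(Euc n, ℂ)).memLp 2 (volume : Measure (Euc n))
    have hCt : ENNReal.ofReal (2 * C) ^ (2 : ℝ) ≠ ⊤ :=
      ENNReal.rpow_ne_top_of_nonneg (by norm_num) ENNReal.ofReal_ne_top
    have hd : Tendsto (fun J => ∫⁻ ξ, ‖(𝓕 (H J) ξ - a ξ) * 𝓕 f ξ‖ₑ ^ (2 : ℝ)) atTop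
        (𝓝 (∫⁻ _ : Euc n, 0)) := by
      refine tendsto_lintegral_of_dominated_convergence'
        (fun ξ => ENNReal.ofReal (2 * C) ^ (2 : ℝ) * ‖𝓕 f ξ‖ₑ ^ (2 : ℝ)) ?_ ?_ ?_ ?_
      · intro J
        exact ((((𝓕 (H J) : 𝓢(Euc n, ℂ)).continuous.aestronglyMeasurable.sub ham).mul
          (𝓕 f : 𝓢(Euc n, ℂ)).continuous.aestronglyMeasurable).enorm).pow_const _
      · intro J
        filter_upwards [haC] with ξ h
        rw [enorm_mul, ENNReal.mul_rpow_of_nonneg _ _ (by norm_num)]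
        gcongr
        rw [← ofReal_norm]
        refine ENNReal.ofReal_le_ofReal ?_
        have := norm_sub_le (𝓕 (H J) ξ) (a ξ)
        linarith [hC J ξ]
      · rw [lintegral_const_mul' _ _ hCt]
        refine ENNReal.mul_ne_top hCt ?_
        have := lintegral_rpow_enorm_lt_top_of_eLpNorm_lt_top (p := 2) (by simp) (by simp) hf2.2
        simpa using this.ne
      · filter_upwards [ha] with ξ h
        have h1 : Tendsto (fun J => ‖(𝓕 (H J) ξ - a ξ) * 𝓕 f ξ‖ₑ) atTop (𝓝 0) := by
          have h2 : Tendsto (fun J => (𝓕 (H J) ξ - a ξ) * 𝓕 f ξ) atTop (𝓝 0) := by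
            have := (h.sub_const (a ξ)).mul_const (𝓕 f ξ)
            simpa using this
          have := (continuous_enorm.tendsto _).comp h2
          rwa [enorm_zero] at this
        have := (ENNReal.continuous_rpow_const (y := 2)).tendsto 0 |>.comp h1
        rwa [ENNReal.zero_rpow_of_pos (by norm_num)] at this
    simp only [lintegral_zero] at hd
    have h3 := (ENNReal.continuous_rpow_const (y := 1 / 2)).tendsto 0 |>.comp hd
    rw [ENNReal.zero_rpow_of_pos (by norm_num)] at h3
    refine h3.congr fun J => ?_
    rw [eLpNorm_eq_lintegral_rpow_enorm_toReal (by simp) (by simp)]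
    simp
  set K : ℝ≥0∞ := ENNReal.ofReal (2 * C) + 1 with hK
  have hK0 : K ≠ ⊤ := ENNReal.add_ne_top.2 ⟨ENNReal.ofReal_ne_top, ENNReal.one_ne_top⟩
  obtain ⟨δ, hδ0, hδ⟩ : ∃ δ : ℝ, 0 < δ ∧ K * ENNReal.ofReal δ ≤ ε / 2 := by
    by_cases he : ε = ⊤
    · exact ⟨1, one_pos, by simp [he, ENNReal.top_div]⟩
    · refine ⟨(ε / 2 / K).toReal, ENNReal.toReal_pos ?_ ?_, ?_⟩
      · simp [hε, hK0]
      · exact ENNReal.div_ne_top (ENNReal.div_ne_top he (by simp)) (by simp [hK])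
      · rw [ENNReal.ofReal_toReal (ENNReal.div_ne_top (ENNReal.div_ne_top he (by simp))
          (by simp [hK]))]
        exact ENNReal.mul_div_le
  obtain ⟨f₀, h1, h2, hf⟩ := MemLp.exist_eLpNorm_sub_le (p := 2) (by simp) (by simp) hg hδ0
  set f := h1.toSchwartzMap h2 with hfd
  have hfm := f.memLp 2 (volume : Measure (Euc n))
  have hff : (f : Euc n → ℂ) = f₀ := rfl
  have h4 : ε / 4 ≠ 0 := by simp [hε]
  obtain ⟨J₀, hJ₀⟩ := eventually_atTop.1 ((hS f).eventually (gt_mem_nhds (pos_iff_ne_zero.2 h4)))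
  refine ⟨J₀, fun J hJ J' hJ' => ?_⟩
  rw [← sconv_sub_left _ _ hg]
  have hCC : ∀ ξ, ‖𝓕 (H J - H J') ξ‖ ≤ 2 * C := by
    intro ξ
    rw [fourier_sub', sub_apply]
    refine (norm_sub_le _ _).trans ?_
    linarith [hC J ξ, hC J' ξ]
  have e1 : sconv (H J - H J' : 𝓢(Euc n, ℂ)) g = sconv (H J - H J' : 𝓢(Euc n, ℂ)) (g - f)
      + sconv (H J - H J' : 𝓢(Euc n, ℂ)) f := by
    rw [sconv_sub_right _ hg hfm]; abel
  rw [e1]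
  refine (eLpNorm_add_le (continuous_sconv _ (hg.sub hfm)) (continuous_sconv _ hfm)
    (by norm_num)).trans ?_
  have e2 := eLpNorm_sconv_le _ hCC (hg.sub hfm)
  have e3 : eLpNorm (sconv (H J - H J' : 𝓢(Euc n, ℂ)) f) 2 volume ≤ ε / 4 + ε / 4 := by
    rw [eLpNorm_sconv_eq]
    have : (fun ξ => 𝓕 (H J - H J') ξ * 𝓕 f ξ) = (fun ξ => (𝓕 (H J) ξ - a ξ) * 𝓕 f ξ)
        - (fun ξ => (𝓕 (H J') ξ - a ξ) * 𝓕 f ξ) := by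
      ext ξ
      rw [fourier_sub', sub_apply]
      simp only [Pi.sub_apply]; ring
    rw [this]
    refine (eLpNorm_sub_le ?_ ?_ (by norm_num)).trans (add_le_add (hJ₀ J hJ).le (hJ₀ J' hJ').le)
    · exact ((𝓕 (H J) : 𝓢(Euc n, ℂ)).continuous.aestronglyMeasurable.sub ham).mul
          (𝓕 f : 𝓢(Euc n, ℂ)).continuous.aestronglyMeasurable
    · exact ((𝓕 (H J') : 𝓢(Euc n, ℂ)).continuous.aestronglyMeasurable.sub ham).mul
          (𝓕 f : 𝓢(Euc n, ℂ)).continuous.aestronglyMeasurable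
  have e4 : ε / 4 + ε / 4 = ε / 2 := by
    rw [← two_mul, ← mul_div_assoc, show (4 : ℝ≥0∞) = 2 * 2 by norm_num]
    rw [ENNReal.mul_div_mul_left _ _ (by simp) (by simp)]
  calc _ ≤ K * ENNReal.ofReal δ + (ε / 4 + ε / 4) := by
        refine add_le_add (e2.trans (mul_le_mul' (by simp [hK]) ?_)) e3
        rw [hff]; exact hf
    _ ≤ ε / 2 + ε / 2 := by rw [e4]; gcongr
    _ = ε := ENNReal.add_halves ε

end FourierMultiplier

section Dagger

variable {n : ℕ} {V W : Type*}
  [NormedAddCommGroup V] [InnerProductSpace ℝ V] [FiniteDimensional ℝ V]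
  [NormedAddCommGroup W] [InnerProductSpace ℝ W] [FiniteDimensional ℝ W]

/-- The coefficients as continuous linear maps. -/
noncomputable def coefL (A : CoeffOp n 1 V W) (i : Fin n) : V →L[ℝ] W :=
  LinearMap.toContinuousLinearMap (coef A i)

/-- The symbol as a continuous linear map. -/
noncomputable def symL (A : CoeffOp n 1 V W) (ξ : Euc n) : V →L[ℝ] W := ∑ i, ξ i • coefL A i

theorem symL_apply (A : CoeffOp n 1 V W) (ξ : Euc n) (v : V) :
    symL A ξ v = symbolMap n 1 A ξ v := by
  simp [symL, symbolMap_one, coefL, LinearMap.sum_apply]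

theorem symL_apply' (A : CoeffOp n 1 V W) (ξ : Euc n) (v : V) :
    symL A ξ v = ∑ i, ξ i • coefL A i v := by
  simp [symL]

theorem symL_smul (A : CoeffOp n 1 V W) (t : ℝ) (ξ : Euc n) : symL A (t • ξ) = t • symL A ξ := by
  simp [symL, Finset.smul_sum, smul_smul]

theorem contDiff_symL (A : CoeffOp n 1 V W) : ContDiff ℝ (⊤ : ℕ∞) (symL A) := by
  unfold symL
  fun_prop

/-- The left inverse `(A*A)⁻¹A*` of the symbol. -/
noncomputable def dag (A : CoeffOp n 1 V W) (ξ : Euc n) : W →L[ℝ] V :=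
  (ContinuousLinearMap.adjoint (symL A ξ) ∘L symL A ξ).inverse ∘L
    ContinuousLinearMap.adjoint (symL A ξ)

theorem isInvertible_adjoint_comp {T : V →L[ℝ] W} (hT : Function.Injective T) :
    (ContinuousLinearMap.adjoint T ∘L T).IsInvertible := by
  have hinj : Function.Injective (ContinuousLinearMap.adjoint T ∘L T) := by
    rw [injective_iff_map_eq_zero]
    intro v hv
    have h : ⟪(ContinuousLinearMap.adjoint T ∘L T) v, v⟫ = 0 := by rw [hv]; simp
    rw [ContinuousLinearMap.comp_apply, ContinuousLinearMap.adjoint_inner_left,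
      inner_self_eq_zero] at h
    exact hT (by simpa using h)
  exact ⟨(LinearEquiv.ofInjectiveEndo (ContinuousLinearMap.adjoint T ∘L T : V →ₗ[ℝ] V)
    hinj).toContinuousLinearEquiv, rfl⟩

variable {A : CoeffOp n 1 V W}

theorem symL_injective (hA : IsElliptic n 1 A) {ξ : Euc n} (hξ : ξ ≠ 0) :
    Function.Injective (symL A ξ) := by
  intro a b h
  rw [symL_apply, symL_apply] at h
  exact hA ξ hξ h

theorem dag_symL (hA : IsElliptic n 1 A) {ξ : Euc n} (hξ : ξ ≠ 0) (v : V) :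
    dag A ξ (symL A ξ v) = v := by
  have h := isInvertible_adjoint_comp (symL_injective hA hξ)
  exact DFunLike.congr_fun h.inverse_comp_self v

theorem symL_dag (hA : IsElliptic n 1 A) {ξ : Euc n} (hξ : ξ ≠ 0) {w : W}
    (hw : w ∈ LinearMap.range (symbolMap n 1 A ξ)) : symL A ξ (dag A ξ w) = w := by
  obtain ⟨v, rfl⟩ := hw
  rw [← symL_apply, dag_symL hA hξ]

theorem contDiffAt_dag (hA : IsElliptic n 1 A) {ξ : Euc n} (hξ : ξ ≠ 0) :
    ContDiffAt ℝ (⊤ : ℕ∞) (dag A) ξ := by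
  have h := isInvertible_adjoint_comp (symL_injective hA hξ)
  have h1 : ContDiffAt ℝ (⊤ : ℕ∞) (fun ξ => ContinuousLinearMap.adjoint (symL A ξ)) ξ :=
    ((ContinuousLinearMap.adjoint (𝕜 := ℝ) (E := V) (F := W)).toContinuousLinearEquiv.contDiff.comp
      (contDiff_symL A)).contDiffAt
  have h2 := h1.clm_comp (contDiff_symL A).contDiffAt
  exact (h.contDiffAt_map_inverse.comp ξ h2).clm_comp h1

theorem dag_smul (hA : IsElliptic n 1 A) {ξ : Euc n} (hξ : ξ ≠ 0) {t : ℝ} (ht : t ≠ 0) :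
    dag A (t • ξ) = t⁻¹ • dag A ξ := by
  have h := isInvertible_adjoint_comp (symL_injective hA hξ)
  have e1 : ContinuousLinearMap.adjoint (symL A (t • ξ)) = t • ContinuousLinearMap.adjoint (symL A ξ) := by
    rw [symL_smul, map_smulₛₗ]; simp
  have h' := isInvertible_adjoint_comp (symL_injective hA (smul_ne_zero ht hξ))
  have e2 : (ContinuousLinearMap.adjoint (symL A (t • ξ)) ∘L symL A (t • ξ)).inverse
      = (t⁻¹ * t⁻¹) • (ContinuousLinearMap.adjoint (symL A ξ) ∘L symL A ξ).inverse := by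
    have e3 : ContinuousLinearMap.adjoint (symL A (t • ξ)) ∘L symL A (t • ξ)
        = (t * t) • (ContinuousLinearMap.adjoint (symL A ξ) ∘L symL A ξ) := by
      rw [e1, symL_smul, ContinuousLinearMap.smul_comp, ContinuousLinearMap.comp_smul, smul_smul]
    ext v
    have k1 := DFunLike.congr_fun h'.self_comp_inverse v
    have k2 := DFunLike.congr_fun h.inverse_comp_self
      ((ContinuousLinearMap.adjoint (symL A (t • ξ)) ∘L symL A (t • ξ)).inverse v)
    rw [ContinuousLinearMap.comp_apply] at k1 k2
    simp only [ContinuousLinearMap.id_apply] at k1 k2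
    rw [_root_.smul_apply, ← k2]
    have k3 : (ContinuousLinearMap.adjoint (symL A ξ) ∘L symL A ξ)
        ((ContinuousLinearMap.adjoint (symL A (t • ξ)) ∘L symL A (t • ξ)).inverse v)
        = (t⁻¹ * t⁻¹) • v := by
      conv_rhs => rw [← k1]
      conv_rhs => rw [e3]
      rw [_root_.smul_apply, smul_smul]
      rw [show t⁻¹ * t⁻¹ * (t * t) = 1 by field_simp, one_smul, ← e3]
    rw [k3, map_smul]
  unfold dag
  rw [e2, e1, ContinuousLinearMap.smul_comp, ContinuousLinearMap.comp_smul, smul_smul]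
  congr 1
  field_simp

theorem exists_norm_dag_le (hA : IsElliptic n 1 A) : ∃ C : ℝ, 0 ≤ C ∧ ∀ ξ : Euc n, ξ ≠ 0 →
    ‖ξ‖ * ‖dag A ξ‖ ≤ C := by
  have hc : ContinuousOn (dag A) (sphere 0 1) := fun ξ hξ =>
    (contDiffAt_dag hA (by rintro rfl; simp at hξ)).continuousAt.continuousWithinAt
  obtain ⟨C, hC⟩ := (isCompact_sphere (0 : Euc n) 1).exists_bound_of_continuousOn hc
  refine ⟨max C 0, le_max_right _ _, fun ξ hξ => ?_⟩
  have hn : ‖ξ‖ ≠ 0 := norm_ne_zero_iff.2 hξ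
  have h1 : ξ = ‖ξ‖ • (‖ξ‖⁻¹ • ξ) := by rw [smul_smul, mul_inv_cancel₀ hn, one_smul]
  have h2 : ‖ξ‖⁻¹ • ξ ≠ 0 := smul_ne_zero (inv_ne_zero hn) hξ
  have h3 : ‖dag A (‖ξ‖⁻¹ • ξ)‖ ≤ C := hC _ (by simp [norm_smul, hn])
  have h4 : dag A ξ = ‖ξ‖⁻¹ • dag A (‖ξ‖⁻¹ • ξ) := by
    conv_lhs => rw [h1]
    exact dag_smul hA h2 hn
  rw [h4, norm_smul, norm_inv, norm_norm, ← mul_assoc, mul_inv_cancel₀ hn, one_mul]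
  exact h3.trans (le_max_left _ _)

end Dagger

section Cutoff

open scoped SchwartzMap FourierTransform ContDiff

variable {n : ℕ}

/-- A smooth cutoff equal to `1` on the unit ball and supported in the ball of radius `2`. -/
noncomputable def chiBump (n : ℕ) : ContDiffBump (0 : Euc n) := ⟨1, 2, one_pos, one_lt_two⟩

theorem chiBump_one {x : Euc n} (hx : ‖x‖ ≤ 1) : chiBump n x = 1 :=
  (chiBump n).one_of_mem_closedBall (by simpa [chiBump] using hx)

theorem chiBump_zero {x : Euc n} (hx : 2 ≤ ‖x‖) : chiBump n x = 0 :=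
  (chiBump n).zero_of_le_dist (by simpa [chiBump] using hx)

/-- The annular cutoff `χ(ξ/2) - χ(ξ)`. -/
noncomputable def psiCut (n : ℕ) (ξ : Euc n) : ℝ := chiBump n ((2 : ℝ)⁻¹ • ξ) - chiBump n ξ

theorem contDiff_psiCut : ContDiff ℝ ∞ (psiCut n) := by
  unfold psiCut
  exact ((chiBump n).contDiff.comp (contDiff_const_smul _)).sub (chiBump n).contDiff

theorem psiCut_zero {x : Euc n} (hx : ‖x‖ ≤ 1) : psiCut n x = 0 := by
  rw [psiCut, chiBump_one hx, chiBump_one, sub_self]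
  rw [norm_smul]; norm_num; linarith [norm_nonneg x]

theorem psiCut_zero' {x : Euc n} (hx : 4 ≤ ‖x‖) : psiCut n x = 0 := by
  rw [psiCut, chiBump_zero, chiBump_zero, sub_self]
  · linarith
  · rw [norm_smul]; norm_num; linarith

theorem hasCompactSupport_of_psiCut {F : Type*} [NormedAddCommGroup F] {f : Euc n → F}
    (h : ∀ x, 4 ≤ ‖x‖ → f x = 0) : HasCompactSupport f :=
  HasCompactSupport.of_support_subset_isCompact (isCompact_closedBall (0 : Euc n) 4) fun x hx => by
    simp only [mem_closedBall, dist_zero_right]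
    by_contra! hc
    exact hx (h x hc.le)

/-- `ψ a` is smooth if `a` is smooth away from the origin. -/
theorem contDiff_psiCut_mul {a : Euc n → ℝ} (ha : ∀ ξ, ξ ≠ 0 → ContDiffAt ℝ ∞ a ξ) :
    ContDiff ℝ ∞ (fun ξ => ((psiCut n ξ * a ξ : ℝ) : ℂ)) := by
  refine Complex.ofRealCLM.contDiff.comp (contDiff_iff_contDiffAt.2 fun ξ => ?_)
  by_cases hξ : ξ = 0
  · have : (fun ξ => psiCut n ξ * a ξ) =ᶠ[𝓝 ξ] fun _ => 0 := by
      rw [hξ]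
      filter_upwards [ball_mem_nhds (0 : Euc n) one_pos] with y hy
      rw [psiCut_zero, zero_mul]
      simpa using (mem_ball_zero_iff.1 hy).le
    exact contDiffAt_const.congr_of_eventuallyEq this
  · exact contDiff_psiCut.contDiffAt.mul (ha ξ hξ)

/-- The Schwartz function `ψ a`, for `a` smooth away from the origin. -/
noncomputable def psiMul {a : Euc n → ℝ} (ha : ∀ ξ, ξ ≠ 0 → ContDiffAt ℝ ∞ a ξ) : 𝓢(Euc n, ℂ) :=
  HasCompactSupport.toSchwartzMap (f := fun ξ => ((psiCut n ξ * a ξ : ℝ) : ℂ))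
    (hasCompactSupport_of_psiCut fun x hx => by simp [psiCut_zero' hx]) (contDiff_psiCut_mul ha)

theorem psiMul_apply {a : Euc n → ℝ} (ha : ∀ ξ, ξ ≠ 0 → ContDiffAt ℝ ∞ a ξ) (ξ : Euc n) :
    psiMul ha ξ = ((psiCut n ξ * a ξ : ℝ) : ℂ) := rfl

/-- The cutoff as a complex Schwartz function. -/
noncomputable def chiS (n : ℕ) : 𝓢(Euc n, ℂ) :=
  HasCompactSupport.toSchwartzMap (f := fun ξ => ((chiBump n ξ : ℝ) : ℂ))
    ((chiBump n).hasCompactSupport.comp_left (g := fun t : ℝ => (t : ℂ)) (by simp))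
    (Complex.ofRealCLM.contDiff.comp (chiBump n).contDiff)

theorem chiS_apply (ξ : Euc n) : chiS n ξ = (chiBump n ξ : ℂ) := rfl

/-- Dilation `ξ ↦ f (c⁻¹ ξ)` of a Schwartz function. -/
noncomputable def dil (c : ℝˣ) (f : 𝓢(Euc n, ℂ)) : 𝓢(Euc n, ℂ) :=
  SchwartzMap.compCLMOfContinuousLinearEquiv ℂ
    (ContinuousLinearEquiv.smulLeft (M₁ := Euc n) (R₁ := ℝ) c⁻¹) f

theorem dil_apply (c : ℝˣ) (f : 𝓢(Euc n, ℂ)) (ξ : Euc n) : dil c f ξ = f ((c : ℝ)⁻¹ • ξ) := by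
  have : c⁻¹ • ξ = (c : ℝ)⁻¹ • ξ := by rw [Units.smul_def, Units.val_inv_eq_inv_val]
  rw [← this]
  rfl

theorem fourierInv_dil {c : ℝˣ} (hc : 0 < (c : ℝ)) (f : 𝓢(Euc n, ℂ)) (x : Euc n) :
    𝓕⁻ (dil c f) x = ((c : ℝ) ^ n : ℝ) * 𝓕⁻ f ((c : ℝ) • x) := by
  rw [SchwartzMap.fourierInv_coe, SchwartzMap.fourierInv_coe, Real.fourierInv_eq',
    Real.fourierInv_eq']
  have h := Measure.integral_comp_inv_smul (volume : Measure (Euc n))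
    (fun ξ : Euc n => Complex.exp (↑(2 * Real.pi * ⟪ξ, (c : ℝ) • x⟫) * Complex.I) • f ξ) (c : ℝ)
  simp only [finrank_euclideanSpace, Fintype.card_fin] at h
  rw [abs_of_nonneg (by positivity)] at h
  rw [← Complex.real_smul, ← h]
  refine integral_congr_ae (Eventually.of_forall fun ξ => ?_)
  dsimp only
  rw [dil_apply, real_inner_smul_left, real_inner_smul_right, inv_mul_cancel_left₀ hc.ne']

/-- The real part of the inverse Fourier transform at `x`. -/
noncomputable def reF (x : Euc n) : 𝓢(Euc n, ℂ) →ₗ[ℝ] ℝ where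
  toFun f := (𝓕⁻ f x).re
  map_add' f g := by
    rw [show 𝓕⁻ (f + g) = 𝓕⁻ f + 𝓕⁻ g from FourierTransform.fourierInv_add f g]
    simp
  map_smul' c f := by
    rw [show 𝓕⁻ (c • f) = c • 𝓕⁻ f from FourierTransform.fourierInv_smul c f]
    simp

theorem reF_apply (x : Euc n) (f : 𝓢(Euc n, ℂ)) : reF x f = (𝓕⁻ f x).re := rfl

/-- The mollifier: real part of the inverse Fourier transform of the cutoff. -/
noncomputable def etaS (n : ℕ) : 𝓢(Euc n, ℝ) := (𝓕⁻ (chiS n)).postcompCLM Complex.reCLM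

theorem etaS_apply (x : Euc n) : etaS n x = reF x (chiS n) := rfl

theorem integral_etaS : ∫ x, etaS n x = 1 := by
  have h1 : ∀ x, etaS n x = Complex.reCLM (𝓕⁻ (chiS n) x) := fun x => rfl
  simp_rw [h1]
  rw [ContinuousLinearMap.integral_comp_comm _ (𝓕⁻ (chiS n)).integrable]
  have h2 : ∫ x, 𝓕⁻ (chiS n) x = 𝓕 (𝓕⁻ (chiS n)) 0 := by
    rw [SchwartzMap.fourier_coe, Real.fourier_eq']
    simp
  rw [h2, FourierTransform.fourier_fourierInv_eq, chiS_apply, chiBump_one (by simp)]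
  simp

/-- The Schwartz function `ψ`. -/
noncomputable def psiS (n : ℕ) : 𝓢(Euc n, ℂ) :=
  psiMul (a := fun _ => 1) fun _ _ => contDiffAt_const

theorem reF_psiS (x : Euc n) :
    reF x (psiS n) = 2 ^ n * etaS n ((2 : ℝ) • x) - etaS n x := by
  have h : psiS n = dil (Units.mk0 2 two_ne_zero) (chiS n) - chiS n := by
    ext ξ
    rw [sub_apply, dil_apply, chiS_apply, chiS_apply, psiS, psiMul_apply, psiCut]
    simp
  rw [h, map_sub, etaS_apply, etaS_apply, reF_apply, fourierInv_dil (by simp), reF_apply, reF_apply,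
    Complex.re_ofReal_mul]
  simp

end Cutoff

section Kernel

open scoped SchwartzMap FourierTransform ContDiff LineDeriv

variable {n : ℕ} {V W : Type*}
  [NormedAddCommGroup V] [InnerProductSpace ℝ V] [FiniteDimensional ℝ V]
  [NormedAddCommGroup W] [InnerProductSpace ℝ W] [FiniteDimensional ℝ W]
  {A : CoeffOp n 1 V W}

theorem contDiffAt_dag_inner (hA : IsElliptic n 1 A) (w : W) (v : V) (ξ : Euc n) (hξ : ξ ≠ 0) :
    ContDiffAt ℝ ∞ (fun ξ => ⟪dag A ξ w, v⟫) ξ :=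
  ((contDiffAt_dag hA hξ).clm_apply contDiffAt_const).inner ℝ contDiffAt_const

theorem contDiffAt_coord_dag (hA : IsElliptic n 1 A) (i : Fin n) (w : W) (v : V) (ξ : Euc n)
    (hξ : ξ ≠ 0) : ContDiffAt ℝ ∞ (fun ξ : Euc n => ξ i * ⟪dag A ξ w, v⟫) ξ :=
  ContDiffAt.mul (by fun_prop) (contDiffAt_dag_inner hA w v ξ hξ)

/-- Entries of the Fourier transform of the dyadic kernel. -/
noncomputable def kerS (hA : IsElliptic n 1 A) (w : W) (v : V) : 𝓢(Euc n, ℂ) :=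
  (2 * Real.pi * Complex.I : ℂ)⁻¹ • psiMul (contDiffAt_dag_inner hA w v)

/-- Entries of the Fourier transform of the gradient of the dyadic kernel. -/
noncomputable def dkerS (hA : IsElliptic n 1 A) (i : Fin n) (w : W) (v : V) : 𝓢(Euc n, ℂ) :=
  psiMul (contDiffAt_coord_dag hA i w v)

theorem dkerS_apply (hA : IsElliptic n 1 A) (i : Fin n) (w : W) (v : V) (ξ : Euc n) :
    dkerS hA i w v ξ = ((psiCut n ξ * (ξ i * ⟪dag A ξ w, v⟫) : ℝ) : ℂ) := rfl

theorem inner_stdVec (x : Euc n) (i : Fin n) : ⟪x, stdVec n i⟫ = x i := by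
  simp [stdVec, EuclideanSpace.inner_single_right]

theorem lineDeriv_kerS (hA : IsElliptic n 1 A) (i : Fin n) (w : W) (v : V) :
    ∂_{stdVec n i} (𝓕⁻ (kerS hA w v)) = 𝓕⁻ (dkerS hA i w v) := by
  rw [SchwartzMap.lineDerivOp_fourierInv_eq]
  congr 1
  ext ξ
  rw [_root_.smul_apply, SchwartzMap.smulLeftCLM_apply_apply (by fun_prop), dkerS_apply, kerS,
    _root_.smul_apply, psiMul_apply, inner_stdVec]
  have : (2 * Real.pi * Complex.I : ℂ) ≠ 0 := by
    simp [Real.pi_ne_zero]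
  rw [Complex.real_smul, smul_eq_mul, smul_eq_mul]
  push_cast
  field_simp

/-- The rank-one map `z ↦ (w' ↦ Re z ⟪w, w'⟫ v)`. -/
noncomputable def rankOneRe (w : W) (v : V) : ℂ →L[ℝ] W →L[ℝ] V :=
  Complex.reCLM.smulRight ((innerSL ℝ w).smulRight v)

theorem rankOneRe_apply (w w' : W) (v : V) (z : ℂ) :
    rankOneRe w v z w' = (z.re * ⟪w, w'⟫) • v := by
  simp [rankOneRe, smul_smul]

/-- The dyadic kernel. -/
noncomputable def kap (hA : IsElliptic n 1 A) : 𝓢(Euc n, W →L[ℝ] V) :=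
  ∑ a, ∑ b, (𝓕⁻ (kerS hA (stdOrthonormalBasis ℝ W a) (stdOrthonormalBasis ℝ V b))).postcompCLM
    (rankOneRe (stdOrthonormalBasis ℝ W a) (stdOrthonormalBasis ℝ V b))

theorem fderiv_kap_apply (hA : IsElliptic n 1 A) (x : Euc n) (i : Fin n) (w : W) :
    fderiv ℝ (kap hA) x (stdVec n i) w = ∑ a, ∑ b,
      (reF x (dkerS hA i (stdOrthonormalBasis ℝ W a) (stdOrthonormalBasis ℝ V b)) *
        ⟪stdOrthonormalBasis ℝ W a, w⟫) • stdOrthonormalBasis ℝ V b := by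
  rw [← SchwartzMap.lineDerivOp_apply_eq_fderiv, kap, LineDeriv.lineDerivOp_sum]
  simp only [LineDeriv.lineDerivOp_sum, _root_.sum_apply]
  refine Finset.sum_congr rfl fun a _ => Finset.sum_congr rfl fun b _ => ?_
  rw [SchwartzMap.lineDerivOp_apply_eq_fderiv]
  have : (((𝓕⁻ (kerS hA (stdOrthonormalBasis ℝ W a) (stdOrthonormalBasis ℝ V b))).postcompCLM
    (rankOneRe (stdOrthonormalBasis ℝ W a) (stdOrthonormalBasis ℝ V b)) : 𝓢(Euc n, W →L[ℝ] V)) :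
      Euc n → W →L[ℝ] V) = (rankOneRe (stdOrthonormalBasis ℝ W a) (stdOrthonormalBasis ℝ V b)) ∘
      (𝓕⁻ (kerS hA (stdOrthonormalBasis ℝ W a) (stdOrthonormalBasis ℝ V b)) : 𝓢(Euc n, ℂ)) := rfl
  rw [this, fderiv_comp x (ContinuousLinearMap.differentiableAt _)
    (SchwartzMap.differentiableAt _), ContinuousLinearMap.fderiv,
    ContinuousLinearMap.comp_apply, ← SchwartzMap.lineDerivOp_apply_eq_fderiv, lineDeriv_kerS,
    rankOneRe_apply, reF_apply]

theorem sum_fderiv_kap_coef (hA : IsElliptic n 1 A) (x : Euc n) (v : V) :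
    ∑ i, fderiv ℝ (kap hA) x (stdVec n i) (coefL A i v)
      = (2 ^ n * etaS n ((2 : ℝ) • x) - etaS n x) • v := by
  rw [← reF_psiS]
  simp_rw [fderiv_kap_apply]
  rw [Finset.sum_comm]
  conv_lhs => enter [2, a]; rw [Finset.sum_comm]
  rw [Finset.sum_comm]
  have key : ∀ b, ∑ a, ∑ i, reF x (dkerS hA i (stdOrthonormalBasis ℝ W a) (stdOrthonormalBasis ℝ V b)) *
      ⟪stdOrthonormalBasis ℝ W a, coefL A i v⟫ = reF x (psiS n) * ⟪stdOrthonormalBasis ℝ V b, v⟫ := by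
    intro b
    have h1 : ⟪stdOrthonormalBasis ℝ V b, v⟫ • psiS n = ∑ a, ∑ i,
        ⟪stdOrthonormalBasis ℝ W a, coefL A i v⟫ •
          dkerS hA i (stdOrthonormalBasis ℝ W a) (stdOrthonormalBasis ℝ V b) := by
      ext ξ
      simp only [_root_.sum_apply, _root_.smul_apply, dkerS_apply, psiS, psiMul_apply]
      by_cases hξ : ξ = 0
      · simp [hξ, psiCut_zero]
      simp_rw [Complex.real_smul]
      norm_cast
      have h2 : ∑ a, ∑ i, ⟪stdOrthonormalBasis ℝ W a, coefL A i v⟫ *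
          (psiCut n ξ * (ξ i * ⟪dag A ξ (stdOrthonormalBasis ℝ W a), stdOrthonormalBasis ℝ V b⟫))
          = psiCut n ξ * ⟪dag A ξ (∑ a, ⟪stdOrthonormalBasis ℝ W a, symL A ξ v⟫ •
            stdOrthonormalBasis ℝ W a), stdOrthonormalBasis ℝ V b⟫ := by
        rw [map_sum, sum_inner, Finset.mul_sum]
        refine Finset.sum_congr rfl fun a _ => ?_
        rw [map_smul, real_inner_smul_left, symL_apply', inner_sum, Finset.sum_mul, Finset.mul_sum]
        refine Finset.sum_congr rfl fun i _ => ?_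
        rw [real_inner_smul_right]; ring
      rw [h2, OrthonormalBasis.sum_repr', dag_symL hA hξ, real_inner_comm]
      ring
    rw [mul_comm, ← smul_eq_mul, ← map_smul, h1, map_sum]
    refine Finset.sum_congr rfl fun a _ => ?_
    rw [map_sum]
    refine Finset.sum_congr rfl fun i _ => ?_
    rw [map_smul, smul_eq_mul, mul_comm]
  calc _ = ∑ b, (∑ a, ∑ i, reF x (dkerS hA i (stdOrthonormalBasis ℝ W a)
        (stdOrthonormalBasis ℝ V b)) * ⟪stdOrthonormalBasis ℝ W a, coefL A i v⟫) •
          stdOrthonormalBasis ℝ V b := by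
        simp_rw [Finset.sum_smul]
    _ = _ := by
        simp_rw [key, mul_smul]
        rw [← Finset.smul_sum, OrthonormalBasis.sum_repr']

theorem sum_coef_fderiv_kap (hA : IsElliptic n 1 A) (x : Euc n) {w : W}
    (hw : ∀ ξ : Euc n, ξ ≠ 0 → w ∈ LinearMap.range (symbolMap n 1 A ξ)) :
    ∑ i, coefL A i (fderiv ℝ (kap hA) x (stdVec n i) w)
      = (2 ^ n * etaS n ((2 : ℝ) • x) - etaS n x) • w := by
  rw [← reF_psiS]
  refine ext_inner_right ℝ fun w' => ?_
  have h1 : ⟪w, w'⟫ • psiS n = ∑ i, ∑ a, ∑ b,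
      (⟪stdOrthonormalBasis ℝ W a, w⟫ * ⟪coefL A i (stdOrthonormalBasis ℝ V b), w'⟫) •
        dkerS hA i (stdOrthonormalBasis ℝ W a) (stdOrthonormalBasis ℝ V b) := by
    ext ξ
    simp only [_root_.sum_apply, _root_.smul_apply, dkerS_apply, psiS, psiMul_apply]
    by_cases hξ : ξ = 0
    · simp [hξ, psiCut_zero]
    simp_rw [Complex.real_smul]
    norm_cast
    have h2 : ∀ i, ∑ a, ∑ b, (⟪stdOrthonormalBasis ℝ W a, w⟫ *
        ⟪coefL A i (stdOrthonormalBasis ℝ V b), w'⟫) * (psiCut n ξ *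
          (ξ i * ⟪dag A ξ (stdOrthonormalBasis ℝ W a), stdOrthonormalBasis ℝ V b⟫))
        = psiCut n ξ * ⟪ξ i • coefL A i (∑ b, ⟪stdOrthonormalBasis ℝ V b, dag A ξ
          (∑ a, ⟪stdOrthonormalBasis ℝ W a, w⟫ • stdOrthonormalBasis ℝ W a)⟫ •
            stdOrthonormalBasis ℝ V b), w'⟫ := by
      intro i
      rw [Finset.sum_comm, real_inner_smul_left, map_sum, sum_inner, Finset.mul_sum,
        Finset.mul_sum]
      refine Finset.sum_congr rfl fun b _ => ?_
      rw [map_smul, real_inner_smul_left, map_sum, inner_sum, Finset.sum_mul, Finset.mul_sum,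
        Finset.mul_sum]
      refine Finset.sum_congr rfl fun a _ => ?_
      rw [map_smul, real_inner_smul_right, real_inner_comm (stdOrthonormalBasis ℝ V b)]
      ring
    simp_rw [h2, OrthonormalBasis.sum_repr']
    rw [← Finset.mul_sum, ← sum_inner, ← symL_apply', symL_dag hA hξ (hw ξ hξ)]
    ring
  rw [real_inner_smul_left, mul_comm, ← smul_eq_mul, ← map_smul, h1, map_sum, sum_inner]
  refine Finset.sum_congr rfl fun i _ => ?_
  rw [fderiv_kap_apply]
  simp only [map_sum, sum_inner, map_smul, real_inner_smul_left, smul_eq_mul]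
  refine Finset.sum_congr rfl fun a _ => Finset.sum_congr rfl fun b _ => ?_
  ring

end Kernel

/-- The rescaled function `x ↦ 2 ^ (jm) h (2 ^ j x)`. -/
noncomputable def dy {n : ℕ} {E : Type*} [NormedAddCommGroup E] [NormedSpace ℝ E] (m : ℕ)
    (h : Euc n → E) (j : ℤ) (x : Euc n) : E :=
  ((2 : ℝ) ^ j) ^ m • h ((2 : ℝ) ^ j • x)

section KernelL2

open scoped SchwartzMap FourierTransform ContDiff LineDeriv

variable {n : ℕ} {V W : Type*}
  [NormedAddCommGroup V] [InnerProductSpace ℝ V] [FiniteDimensional ℝ V]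
  [NormedAddCommGroup W] [InnerProductSpace ℝ W] [FiniteDimensional ℝ W]
  {A : CoeffOp n 1 V W}

/-- `2 ^ j` as a unit. -/
noncomputable def twoPow (j : ℤ) : ℝˣ := Units.mk0 ((2 : ℝ) ^ j) (by positivity)

/-- Entries of the truncated gradient kernels. -/
noncomputable def truncS (hA : IsElliptic n 1 A) (i : Fin n) (w : W) (v : V) (J : ℕ) :
    𝓢(Euc n, ℂ) :=
  ∑ j ∈ Finset.Ico (-(J : ℤ)) J, 𝓕⁻ (dil (twoPow j) (dkerS hA i w v))

theorem sum_Ico_telescope {M : Type*} [AddCommGroup M] (f : ℤ → M) (J : ℕ) :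
    ∑ j ∈ Finset.Ico (-(J : ℤ)) J, (f (j + 1) - f j) = f J - f (-J) := by
  induction J with
  | zero => simp
  | succ J ih =>
    have h1 : Finset.Ico (-((J + 1 : ℕ) : ℤ)) ((J + 1 : ℕ) : ℤ)
        = insert (-((J : ℤ) + 1)) (insert (J : ℤ) (Finset.Ico (-(J : ℤ)) J)) := by
      ext k
      simp only [Finset.mem_Ico, Finset.mem_insert]
      push_cast
      omega
    rw [h1, Finset.sum_insert, Finset.sum_insert, ih]
    · push_cast
      rw [show -((J : ℤ) + 1) + 1 = -J by ring]
      abel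
    · simp
    · simp only [Finset.mem_insert, Finset.mem_Ico]
      omega

theorem fourier_truncS (hA : IsElliptic n 1 A) (i : Fin n) (w : W) (v : V) (J : ℕ) {ξ : Euc n}
    (hξ : ξ ≠ 0) : 𝓕 (truncS hA i w v J) ξ =
      (((chiBump n (((2 : ℝ) ^ (-(J : ℤ))) • ξ) - chiBump n (((2 : ℝ) ^ (J : ℤ)) • ξ)) *
        (ξ i * ⟪dag A ξ w, v⟫) : ℝ) : ℂ) := by
  have h1 : 𝓕 (truncS hA i w v J)
      = ∑ j ∈ Finset.Ico (-(J : ℤ)) J, dil (twoPow j) (dkerS hA i w v) := by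
    rw [truncS, FourierTransform.fourier_sum]
    simp
  rw [h1, _root_.sum_apply]
  have h2 : ∀ j : ℤ, dil (twoPow j) (dkerS hA i w v) ξ =
      (((chiBump n (((2 : ℝ) ^ (-(j + 1))) • ξ) - chiBump n (((2 : ℝ) ^ (-j)) • ξ)) *
        (ξ i * ⟪dag A ξ w, v⟫) : ℝ) : ℂ) := by
    intro j
    have hp : ((2 : ℝ) ^ j)⁻¹ ≠ 0 := by positivity
    rw [dil_apply, dkerS_apply, psiCut]
    simp only [twoPow, Units.val_mk0]
    rw [dag_smul hA hξ hp, smul_smul, _root_.smul_apply, real_inner_smul_left,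
      show (2 : ℝ)⁻¹ * ((2 : ℝ) ^ j)⁻¹ = 2 ^ (-(j + 1)) by
        rw [neg_add, zpow_add₀ two_ne_zero, zpow_neg, zpow_neg, zpow_one, mul_comm],
      ← zpow_neg]
    congr 2
    simp only [PiLp.smul_apply, smul_eq_mul]
    rw [show (2 : ℝ) ^ (-j) * ξ i * (((2 : ℝ) ^ (-j))⁻¹ * ⟪dag A ξ w, v⟫)
      = ((2 : ℝ) ^ (-j) * ((2 : ℝ) ^ (-j))⁻¹) * (ξ i * ⟪dag A ξ w, v⟫) by ring,
      mul_inv_cancel₀ (by positivity), one_mul]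
  simp_rw [h2]
  rw [← Complex.ofReal_sum, ← Finset.sum_mul,
    sum_Ico_telescope (fun j : ℤ => chiBump n (((2 : ℝ) ^ (-j)) • ξ)) J, neg_neg]

theorem abs_coord_dag_le {C : ℝ} {i : Fin n} {w : W} {v : V} {ξ : Euc n}
    (hC : ‖ξ‖ * ‖dag A ξ‖ ≤ C) : |ξ i * ⟪dag A ξ w, v⟫| ≤ C * ‖w‖ * ‖v‖ := by
  rw [abs_mul]
  have h1 : |ξ i| ≤ ‖ξ‖ := by simpa using PiLp.norm_apply_le ξ i
  have h2 : |⟪dag A ξ w, v⟫| ≤ ‖dag A ξ‖ * ‖w‖ * ‖v‖ :=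
    (abs_real_inner_le_norm _ _).trans (by gcongr; exact (dag A ξ).le_opNorm w)
  calc _ ≤ ‖ξ‖ * (‖dag A ξ‖ * ‖w‖ * ‖v‖) := by gcongr
    _ = (‖ξ‖ * ‖dag A ξ‖) * ‖w‖ * ‖v‖ := by ring
    _ ≤ _ := by gcongr

theorem exists_norm_fourier_truncS_le (hn : 1 ≤ n) (hA : IsElliptic n 1 A) (i : Fin n) (w : W)
    (v : V) : ∃ C : ℝ, ∀ J ξ, ‖𝓕 (truncS hA i w v J) ξ‖ ≤ C := by
  obtain ⟨C, hC0, hC⟩ := exists_norm_dag_le hA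
  refine ⟨C * ‖w‖ * ‖v‖, fun J => ?_⟩
  have h0 : ∀ ξ ∈ ({0}ᶜ : Set (Euc n)), ‖𝓕 (truncS hA i w v J) ξ‖ ≤ C * ‖w‖ * ‖v‖ := by
    intro ξ hξ
    rw [fourier_truncS hA i w v J hξ, Complex.norm_real, Real.norm_eq_abs, abs_mul]
    have h1 : |chiBump n (((2 : ℝ) ^ (-(J : ℤ))) • ξ) - chiBump n (((2 : ℝ) ^ (J : ℤ)) • ξ)| ≤ 1 :=
      abs_sub_le_of_nonneg_of_le (chiBump n).nonneg (chiBump n).le_one (chiBump n).nonneg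
        (chiBump n).le_one
    calc _ ≤ 1 * (C * ‖w‖ * ‖v‖) := by
          gcongr
          exact abs_coord_dag_le (hC ξ hξ)
      _ = _ := one_mul _
  have : Nontrivial (Euc n) := by
    have : Nonempty (Fin n) := ⟨⟨0, hn⟩⟩
    infer_instance
  have hd : Dense ({0}ᶜ : Set (Euc n)) := dense_compl_singleton 0
  intro ξ
  have hcl : IsClosed {ξ | ‖𝓕 (truncS hA i w v J) ξ‖ ≤ C * ‖w‖ * ‖v‖} :=
    isClosed_le (𝓕 (truncS hA i w v J)).continuous.norm continuous_const
  exact hcl.closure_subset_iff.2 h0 (hd ξ)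

theorem tendsto_fourier_truncS (hA : IsElliptic n 1 A) (i : Fin n) (w : W) (v : V) {ξ : Euc n}
    (hξ : ξ ≠ 0) : Tendsto (fun J => 𝓕 (truncS hA i w v J) ξ) atTop
      (𝓝 ((ξ i * ⟪dag A ξ w, v⟫ : ℝ) : ℂ)) := by
  have hp : 0 < ‖ξ‖ := norm_pos_iff.2 hξ
  obtain ⟨N₁, hN₁⟩ := pow_unbounded_of_one_lt ‖ξ‖ (one_lt_two : (1 : ℝ) < 2)
  obtain ⟨N₂, hN₂⟩ := pow_unbounded_of_one_lt (2 / ‖ξ‖) (one_lt_two : (1 : ℝ) < 2)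
  refine tendsto_const_nhds.congr' ?_
  filter_upwards [eventually_ge_atTop N₁, eventually_ge_atTop N₂] with J h1 h2
  rw [fourier_truncS hA i w v J hξ, chiBump_one, chiBump_zero, sub_zero, one_mul]
  · rw [norm_smul, zpow_natCast, norm_pow, Real.norm_two]
    have : (2 : ℝ) ^ N₂ ≤ 2 ^ J := pow_le_pow_right₀ one_le_two h2
    rw [div_lt_iff₀ hp] at hN₂
    nlinarith
  · rw [norm_smul, zpow_neg, zpow_natCast, norm_inv, norm_pow, Real.norm_two, inv_mul_le_one₀
      (by positivity)]
    exact hN₁.le.trans (pow_le_pow_right₀ one_le_two h1)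

/-- The gradient of the truncated kernel. -/
noncomputable def gradTrunc (hA : IsElliptic n 1 A) (i : Fin n) (J : ℕ) (z : Euc n) : W →L[ℝ] V :=
  ∑ j ∈ Finset.Ico (-(J : ℤ)) J, dy n (fun x => fderiv ℝ (kap hA) x (stdVec n i)) j z

theorem re_truncS_apply (hA : IsElliptic n 1 A) (i : Fin n) (w : W) (v : V) (J : ℕ) (z : Euc n) :
    (truncS hA i w v J z).re =
      ∑ j ∈ Finset.Ico (-(J : ℤ)) J, ((2 : ℝ) ^ j) ^ n * reF ((2 : ℝ) ^ j • z) (dkerS hA i w v) := by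
  rw [truncS, _root_.sum_apply, Complex.re_sum]
  refine Finset.sum_congr rfl fun j _ => ?_
  rw [fourierInv_dil (by simp [twoPow]; positivity), Complex.re_ofReal_mul, reF_apply]
  rfl

theorem gradTrunc_apply (hA : IsElliptic n 1 A) (i : Fin n) (J : ℕ) (z : Euc n) (w : W) :
    gradTrunc hA i J z w = ∑ a, ∑ b, ((truncS hA i (stdOrthonormalBasis ℝ W a)
      (stdOrthonormalBasis ℝ V b) J z).re * ⟪stdOrthonormalBasis ℝ W a, w⟫) •
        stdOrthonormalBasis ℝ V b := by
  simp only [re_truncS_apply, gradTrunc, _root_.sum_apply, dy, _root_.smul_apply,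
    fderiv_kap_apply, Finset.sum_mul, Finset.sum_smul, Finset.smul_sum]
  rw [Finset.sum_comm]
  refine Finset.sum_congr rfl fun a _ => ?_
  rw [Finset.sum_comm]
  refine Finset.sum_congr rfl fun b _ => Finset.sum_congr rfl fun j _ => ?_
  rw [smul_smul, mul_assoc]

theorem integral_gradTrunc (hA : IsElliptic n 1 A) (i : Fin n) (J : ℕ) {g : Euc n → W}
    (hg : MemLp g 2 volume) (x : Euc n) :
    ∫ y, gradTrunc hA i J (x - y) (g y) = ∑ a, ∑ b,
      (sconv (truncS hA i (stdOrthonormalBasis ℝ W a) (stdOrthonormalBasis ℝ V b) J)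
        (fun y => ((⟪stdOrthonormalBasis ℝ W a, g y⟫ : ℝ) : ℂ)) x).re •
          stdOrthonormalBasis ℝ V b := by
  have hga : ∀ a, MemLp (fun y => ((⟪stdOrthonormalBasis ℝ W a, g y⟫ : ℝ) : ℂ)) 2 volume :=
    fun a => (hg.const_inner _).ofReal
  have hint : ∀ a b, Integrable (fun y => (truncS hA i (stdOrthonormalBasis ℝ W a)
      (stdOrthonormalBasis ℝ V b) J (x - y)).re * ⟪stdOrthonormalBasis ℝ W a, g y⟫) := by
    intro a b
    have := (integrable_sconv (truncS hA i (stdOrthonormalBasis ℝ W a)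
      (stdOrthonormalBasis ℝ V b) J) (hga a) x).re
    refine this.congr (Eventually.of_forall fun y => ?_)
    simp
  simp_rw [gradTrunc_apply]
  rw [integral_finsetSum _ fun a _ => integrable_finsetSum _ fun b _ => (hint a b).smul_const _]
  refine Finset.sum_congr rfl fun a _ => ?_
  rw [integral_finsetSum _ fun b _ => (hint a b).smul_const _]
  refine Finset.sum_congr rfl fun b _ => ?_
  rw [integral_smul_const]
  congr 1
  rw [sconv]
  have := integral_re (integrable_sconv (truncS hA i (stdOrthonormalBasis ℝ W a)
      (stdOrthonormalBasis ℝ V b) J) (hga a) x)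
  simp only [RCLike.re_to_complex] at this
  rw [← this]
  simp

/-- Convolutions with the truncated gradient kernels are Cauchy in `L²`. -/
theorem gradTrunc_cauchy (hn : 1 ≤ n) (hA : IsElliptic n 1 A) (i : Fin n) {g : Euc n → W}
    (hg : MemLp g 2 volume) {ε : ℝ≥0∞} (hε : ε ≠ 0) :
    ∃ J₀, ∀ J ≥ J₀, ∀ J' ≥ J₀, eLpNorm (fun x => (∫ y, gradTrunc hA i J (x - y) (g y))
      - ∫ y, gradTrunc hA i J' (x - y) (g y)) 2 volume ≤ ε := by
  set wb := stdOrthonormalBasis ℝ W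
  set vb := stdOrthonormalBasis ℝ V
  set ga : _ → Euc n → ℂ := fun a y => ((⟪wb a, g y⟫ : ℝ) : ℂ) with hgad
  have hga : ∀ a, MemLp (ga a) 2 volume := fun a => (hg.const_inner _).ofReal
  set N : ℝ≥0∞ := (Module.finrank ℝ W : ℝ≥0∞) * (Module.finrank ℝ V : ℝ≥0∞) + 1 with hN
  have hNt : N ≠ ⊤ := by finiteness
  have hδ : ε / N ≠ 0 := ENNReal.div_ne_zero.2 ⟨hε, hNt⟩
  have hex : ∀ a b, ∃ J₀, ∀ J ≥ J₀, ∀ J' ≥ J₀, eLpNorm (sconv (truncS hA i (wb a) (vb b) J) (ga a) -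
      sconv (truncS hA i (wb a) (vb b) J') (ga a)) 2 volume ≤ ε / N := by
    intro a b
    obtain ⟨C, hC⟩ := exists_norm_fourier_truncS_le hn hA i (wb a) (vb b)
    refine sconv_cauchy _ hC (a := fun ξ => ((ξ i * ⟪dag A ξ (wb a), vb b⟫ : ℝ) : ℂ)) ?_ (hga a) hδ
    have : Nonempty (Fin n) := ⟨⟨0, hn⟩⟩
    have h0 : ∀ᵐ ξ : Euc n, ξ ≠ 0 := by
      simp [ae_iff]
    filter_upwards [h0] with ξ hξ
    exact tendsto_fourier_truncS hA i _ _ hξ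
  choose J₀ hJ₀ using hex
  refine ⟨∑ a, ∑ b, J₀ a b, fun J hJ J' hJ' => ?_⟩
  have hle : ∀ a b, J₀ a b ≤ ∑ a, ∑ b, J₀ a b := fun a b =>
    (Finset.single_le_sum (f := fun b => J₀ a b) (fun _ _ => Nat.zero_le _) (Finset.mem_univ b)).trans
      (Finset.single_le_sum (f := fun a => ∑ b, J₀ a b) (fun _ _ => Nat.zero_le _)
        (Finset.mem_univ a))
  set D : _ → _ → Euc n → ℂ := fun a b => sconv (truncS hA i (wb a) (vb b) J) (ga a) -
      sconv (truncS hA i (wb a) (vb b) J') (ga a) with hD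
  have hDm : ∀ a b, AEStronglyMeasurable (fun x => (D a b x).re • vb b) volume := by
    intro a b
    exact (Complex.continuous_re.comp_aestronglyMeasurable ((continuous_sconv _ (hga a)).sub
      (continuous_sconv _ (hga a)))).smul aestronglyMeasurable_const
  have hDn : ∀ a b, eLpNorm (fun x => (D a b x).re • vb b) 2 volume ≤ ε / N := by
    intro a b
    refine le_trans (eLpNorm_mono fun x => ?_) (hJ₀ a b J ((hle a b).trans hJ) J'
      ((hle a b).trans hJ'))
    rw [norm_smul, OrthonormalBasis.norm_eq_one, mul_one]
    exact Complex.abs_re_le_norm _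
  have e1 : (fun x => (∫ y, gradTrunc hA i J (x - y) (g y))
      - ∫ y, gradTrunc hA i J' (x - y) (g y)) = ∑ a, ∑ b, fun x => (D a b x).re • vb b := by
    ext x
    rw [integral_gradTrunc hA i J hg, integral_gradTrunc hA i J' hg]
    simp only [Finset.sum_apply, ← Finset.sum_sub_distrib, ← sub_smul, hD, Pi.sub_apply,
      Complex.sub_re]
    rfl
  rw [e1]
  calc eLpNorm (∑ a, ∑ b, fun x => (D a b x).re • vb b) 2 volume
      ≤ ∑ a, eLpNorm (∑ b, fun x => (D a b x).re • vb b) 2 volume :=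
        eLpNorm_sum_le (fun a _ => Finset.aestronglyMeasurable_sum _ fun b _ => hDm a b) (by norm_num)
    _ ≤ ∑ a, ∑ b, eLpNorm (fun x => (D a b x).re • vb b) 2 volume :=
        Finset.sum_le_sum fun a _ => eLpNorm_sum_le (fun b _ => hDm a b) (by norm_num)
    _ ≤ ∑ a : Fin (Module.finrank ℝ W), ∑ b : Fin (Module.finrank ℝ V), ε / N :=
        Finset.sum_le_sum fun a _ => Finset.sum_le_sum fun b _ => hDn a b
    _ = (Module.finrank ℝ W : ℝ≥0∞) * (Module.finrank ℝ V : ℝ≥0∞) * (ε / N) := by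
        simp [mul_assoc]
    _ ≤ N * (ε / N) := by gcongr; exact le_self_add
    _ ≤ ε := ENNReal.mul_div_le

end KernelL2

section Dyadic

/-- Powers of two in `ℝ≥0∞`. -/
noncomputable def pw (x : ℝ) : ℝ≥0∞ := (2 : ℝ≥0∞) ^ x

theorem pw_ne_top (x : ℝ) : pw x ≠ ⊤ := by simp [pw, ENNReal.rpow_eq_top_iff]

theorem pw_ne_zero (x : ℝ) : pw x ≠ 0 := by simp [pw, ENNReal.rpow_eq_zero_iff]

theorem pw_add (x y : ℝ) : pw (x + y) = pw x * pw y :=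
  ENNReal.rpow_add _ _ two_ne_zero ENNReal.ofNat_ne_top

theorem pw_zero : pw 0 = 1 := by simp [pw]

theorem pw_rpow (x y : ℝ) : pw x ^ y = pw (x * y) := (ENNReal.rpow_mul _ _ _).symm

theorem pw_mono {x y : ℝ} (h : x ≤ y) : pw x ≤ pw y :=
  ENNReal.rpow_le_rpow_of_exponent_le (by norm_num) h

theorem pw_neg (x : ℝ) : pw (-x) = (pw x)⁻¹ := ENNReal.rpow_neg _ _

theorem ofReal_two_rpow (x : ℝ) : ENNReal.ofReal ((2 : ℝ) ^ x) = pw x := by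
  rw [pw, ← ENNReal.ofReal_rpow_of_pos two_pos]
  simp

theorem ofReal_two_zpow (j : ℤ) : ENNReal.ofReal ((2 : ℝ) ^ j) = pw j := by
  rw [← ofReal_two_rpow, Real.rpow_intCast]

theorem ofReal_two_zpow_pow (j : ℤ) (m : ℕ) :
    ENNReal.ofReal (((2 : ℝ) ^ j) ^ m) = pw (j * m) := by
  rw [ENNReal.ofReal_pow (by positivity), ofReal_two_zpow, ← ENNReal.rpow_natCast, pw_rpow]

/-- The two-sided geometric series. -/
noncomputable def geo (a : ℝ) : ℝ≥0∞ := ∑' j : ℤ, pw (-a * |(j : ℝ)|)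

theorem geo_ne_top {a : ℝ} (ha : 0 < a) : geo a ≠ ⊤ := by
  have h1 : ∑' j : ℕ, pw (-a * j) ≠ ⊤ := by
    have : ∀ j : ℕ, pw (-a * j) = pw (-a) ^ j := fun j => by
      rw [← ENNReal.rpow_natCast, pw_rpow]
    simp_rw [this]
    rw [ENNReal.tsum_geometric]
    have : pw (-a) < 1 := by
      rw [pw, ENNReal.rpow_neg, ENNReal.inv_lt_one]
      exact ENNReal.one_lt_rpow (by norm_num) ha
    simpa [tsub_eq_zero_iff_le] using this
  rw [geo, tsum_of_nat_of_neg_add_one ENNReal.summable ENNReal.summable]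
  refine ENNReal.add_ne_top.2 ⟨by simpa using h1, ?_⟩
  refine ne_top_of_le_ne_top h1 (ENNReal.tsum_le_tsum fun j => pw_mono ?_)
  have : |(((-(j + 1) : ℤ)) : ℝ)| = j + 1 := by
    push_cast
    rw [abs_neg, abs_of_nonneg (by positivity)]
  simp only [Int.cast_neg, Int.cast_add, Int.cast_natCast, Int.cast_one] at this ⊢
  rw [this]
  nlinarith

theorem tsum_pw_shift (a : ℝ) (i : ℤ) : ∑' j : ℤ, pw (-a * |(j : ℝ) - i|) = geo a := by
  rw [geo, ← (Equiv.subRight i).tsum_eq fun j : ℤ => pw (-a * |(j : ℝ)|)]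
  simp

/-- Upward geometric sums. -/
theorem tsum_pw_le {a : ℝ} (i : ℤ) :
    ∑' j : ℤ, (if j ≤ i then pw (a * j) else 0) ≤ geo a * pw (a * i) := by
  rw [← tsum_pw_shift a i, ← ENNReal.tsum_mul_right]
  refine ENNReal.tsum_le_tsum fun j => ?_
  split_ifs with h
  · rw [← pw_add]
    apply pw_mono
    have : (j : ℝ) ≤ i := by exact_mod_cast h
    rw [abs_of_nonpos (by linarith)]
    linarith
  · exact zero_le

/-- Downward geometric sums. -/
theorem tsum_pw_ge {a : ℝ} (i : ℤ) :
    ∑' j : ℤ, (if i ≤ j then pw (-a * j) else 0) ≤ geo a * pw (-a * i) := by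
  rw [← tsum_pw_shift a i, ← ENNReal.tsum_mul_right]
  refine ENNReal.tsum_le_tsum fun j => ?_
  split_ifs with h
  · rw [← pw_add]
    apply pw_mono
    have : (i : ℝ) ≤ j := by exact_mod_cast h
    rw [abs_of_nonneg (by linarith)]
    linarith
  · exact zero_le

theorem ofReal_wt_le {n : ℕ} {x : Euc n} (hx : x ≠ 0) :
    ENNReal.ofReal (wt n x) ≤ ENNReal.ofReal ‖x‖ ^ (-(2 * n : ℝ)) := by
  have hp : 0 < ‖x‖ := norm_pos_iff.2 hx
  rw [ENNReal.ofReal_rpow_of_pos hp]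
  apply ENNReal.ofReal_le_ofReal
  rw [Real.rpow_neg hp.le, wt]
  gcongr
  rw [show (2 * n : ℝ) = ((2 * n : ℕ) : ℝ) by push_cast; ring, Real.rpow_natCast, pow_mul]
  gcongr
  linarith

theorem tsum_wt_le {n : ℕ} {m : ℝ} (hm : 0 < m) (hm' : m < 2 * n) :
    ∃ C : ℝ≥0∞, C ≠ ⊤ ∧ ∀ x : Euc n, x ≠ 0 →
      ∑' j : ℤ, pw (j * m) * ENNReal.ofReal (wt n ((2 : ℝ) ^ j • x)) ≤
        C * ENNReal.ofReal ‖x‖ ^ (-m) := by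
  set a := min m (2 * n - m) with ha
  have ha0 : 0 < a := lt_min hm (by linarith)
  refine ⟨geo a * pw m, ENNReal.mul_ne_top (geo_ne_top ha0) (pw_ne_top _), fun x hx => ?_⟩
  have hp : 0 < ‖x‖ := norm_pos_iff.2 hx
  obtain ⟨i, hi1, hi2⟩ := exists_mem_Ico_zpow hp (one_lt_two : (1 : ℝ) < 2)
  have e1 : pw i ≤ ENNReal.ofReal ‖x‖ := by
    rw [← ofReal_two_zpow]; exact ENNReal.ofReal_le_ofReal hi1
  have e2 : ENNReal.ofReal ‖x‖ ≤ pw (i + 1) := by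
    have := ENNReal.ofReal_le_ofReal hi2.le
    rw [ofReal_two_zpow] at this
    simpa using this
  have e3 : pw (-i * m) ≤ pw m * ENNReal.ofReal ‖x‖ ^ (-m) := by
    have : pw ((i + 1 : ℝ) * (-m)) ≤ ENNReal.ofReal ‖x‖ ^ (-m) := by
      rw [← pw_rpow, ENNReal.rpow_neg, ENNReal.rpow_neg]
      gcongr
    calc pw (-i * m) = pw m * pw ((i + 1 : ℝ) * (-m)) := by rw [← pw_add]; congr 1; ring
      _ ≤ _ := by gcongr
  have e4 : ∀ j : ℤ, pw (j * m) * ENNReal.ofReal (wt n ((2 : ℝ) ^ j • x)) ≤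
      pw (-a * |(j : ℝ) - (-i : ℤ)|) * pw (-i * m) := by
    intro j
    rw [← pw_add]
    rcases le_total j (-i) with h | h
    · have h' : (j : ℝ) ≤ (-i : ℤ) := by exact_mod_cast h
      calc _ ≤ pw (j * m) * 1 := by
            gcongr
            rw [← ENNReal.ofReal_one]
            exact ENNReal.ofReal_le_ofReal (wt_le_one _)
        _ ≤ _ := by
            rw [mul_one]
            apply pw_mono
            rw [abs_of_nonpos (by linarith)]
            push_cast at h' ⊢
            have : a ≤ m := min_le_left _ _
            nlinarith
    · have h' : ((-i : ℤ) : ℝ) ≤ j := by exact_mod_cast h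
      have e5 : ENNReal.ofReal (wt n ((2 : ℝ) ^ j • x)) ≤ pw ((j + i) * (-(2 * n : ℝ))) := by
        refine (ofReal_wt_le (smul_ne_zero (by positivity) hx)).trans ?_
        rw [norm_smul, Real.norm_of_nonneg (by positivity), ENNReal.ofReal_mul (by positivity),
          ofReal_two_zpow, ← pw_rpow, pw_add, ENNReal.rpow_neg, ENNReal.rpow_neg]
        gcongr
      calc _ ≤ pw (j * m) * pw ((j + i) * (-(2 * n : ℝ))) := by gcongr
        _ ≤ _ := by
            rw [← pw_add]
            apply pw_mono
            rw [abs_of_nonneg (by linarith)]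
            push_cast at h' ⊢
            have : a ≤ 2 * n - m := min_le_right _ _
            nlinarith
  calc _ ≤ ∑' j : ℤ, pw (-a * |(j : ℝ) - (-i : ℤ)|) * pw (-i * m) := ENNReal.tsum_le_tsum e4
    _ = geo a * pw (-i * m) := by rw [ENNReal.tsum_mul_right, tsum_pw_shift]
    _ ≤ geo a * (pw m * ENNReal.ofReal ‖x‖ ^ (-m)) := by gcongr
    _ = _ := by ring

end Dyadic

section Scaling

variable {n : ℕ}

theorem lintegral_comp_smul_pow (j : ℤ) (F : Euc n → ℝ≥0∞) :
    ∫⁻ x : Euc n, F ((2 : ℝ) ^ j • x) = pw (-(j * n)) * ∫⁻ x, F x := by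
  have hp : (0 : ℝ) < 2 ^ j := by positivity
  have h : MeasurableEmbedding (fun x : Euc n => (2 : ℝ) ^ j • x) :=
    (Homeomorph.smulOfNeZero ((2 : ℝ) ^ j) hp.ne').measurableEmbedding
  have h1 : ∫⁻ x : Euc n, F ((2 : ℝ) ^ j • x)
      = ∫⁻ x, F x ∂(Measure.map (fun x : Euc n => (2 : ℝ) ^ j • x) volume) :=
    (h.lintegral_map F).symm
  rw [h1, Measure.map_addHaar_smul _ hp.ne', lintegral_smul_measure, finrank_euclideanSpace_fin,
    abs_of_nonneg (by positivity), ENNReal.ofReal_inv_of_pos (by positivity), ofReal_two_zpow_pow,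
    ← pw_neg, smul_eq_mul]

/-- The `L¹`-normalised dyadic weights. -/
noncomputable def wj (n : ℕ) (j : ℤ) (x : Euc n) : ℝ≥0∞ :=
  pw (j * n) * ENNReal.ofReal (wt n ((2 : ℝ) ^ j • x))

theorem measurable_wj {j : ℤ} : Measurable (wj n j) := by
  have := (continuous_wt (n := n)).measurable
  unfold wj
  fun_prop

theorem wj_le {j : ℤ} (x : Euc n) : wj n j x ≤ pw (j * n) := by
  calc _ ≤ pw (j * n) * 1 := by
        unfold wj
        gcongr
        rw [← ENNReal.ofReal_one]
        exact ENNReal.ofReal_le_ofReal (wt_le_one _)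
    _ = _ := mul_one _

theorem wj_sub_comm (j : ℤ) (x y : Euc n) : wj n j (x - y) = wj n j (y - x) := by
  rw [wj, wj, wt, wt, norm_smul, norm_smul, norm_sub_rev]

theorem lintegral_wj (j : ℤ) (y : Euc n) :
    ∫⁻ x, wj n j (x - y) = ∫⁻ x : Euc n, ENNReal.ofReal (wt n x) := by
  rw [lintegral_sub_right_eq_self (wj n j) y]
  unfold wj
  rw [lintegral_const_mul' _ _ (pw_ne_top _),
    lintegral_comp_smul_pow j (fun x => ENNReal.ofReal (wt n x)), ← mul_assoc, ← pw_add]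
  simp [pw_zero]

theorem exists_slab_wj_le (hn : 1 ≤ n) : ∃ C : ℝ≥0∞, C ≠ ⊤ ∧ ∀ (j : ℤ) (ξ : Euc n), ‖ξ‖ = 1 →
    ∀ (z : Euc n) (φ : ℝ → ℝ≥0∞), Measurable φ →
      ∫⁻ y : Euc n, φ ⟪y, ξ⟫ * wj n j (y - z) ≤
        C * ∫⁻ t : ℝ, φ t * (pw j * ENNReal.ofReal ((1 + ((2 : ℝ) ^ j * (t - ⟪z, ξ⟫)) ^ 2)⁻¹)) := by
  obtain ⟨C, hC, h⟩ := lintegral_slab_le hn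
  refine ⟨C, hC, fun j ξ hξ z φ hφ => ?_⟩
  have hp : (0 : ℝ) < 2 ^ j := by positivity
  have h1 : ∫⁻ y : Euc n, φ ⟪y, ξ⟫ * wj n j (y - z) = ∫⁻ x : Euc n,
      φ (((2 : ℝ) ^ j)⁻¹ * ⟪x, ξ⟫ + ⟪z, ξ⟫) * ENNReal.ofReal (wt n x) := by
    rw [← lintegral_add_right_eq_self _ z]
    simp only [add_sub_cancel_right]
    rw [show ∫⁻ x : Euc n, φ (((2 : ℝ) ^ j)⁻¹ * ⟪x, ξ⟫ + ⟪z, ξ⟫) * ENNReal.ofReal (wt n x)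
      = pw (j * n) * (pw (-(j * n)) * ∫⁻ x : Euc n,
        φ (((2 : ℝ) ^ j)⁻¹ * ⟪x, ξ⟫ + ⟪z, ξ⟫) * ENNReal.ofReal (wt n x)) by
        rw [← mul_assoc, ← pw_add]; simp [pw_zero], ← lintegral_comp_smul_pow j, 
        ← lintegral_const_mul' _ _ (pw_ne_top _)]
    refine lintegral_congr fun x => ?_
    rw [real_inner_smul_left, inner_add_left, inv_mul_cancel_left₀ hp.ne', wj]
    ring
  have h2 : ∀ F : ℝ → ℝ≥0∞, ∫⁻ t, F t = ∫⁻ t, pw j * F ((2 : ℝ) ^ j * t) := by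
    intro F
    have he : MeasurableEmbedding (fun x : ℝ => (2 : ℝ) ^ j • x) :=
      (Homeomorph.smulOfNeZero ((2 : ℝ) ^ j) hp.ne').measurableEmbedding
    rw [lintegral_const_mul' _ _ (pw_ne_top _)]
    have h1 := he.lintegral_map (μ := volume) F
    rw [Measure.map_addHaar_smul _ hp.ne', lintegral_smul_measure] at h1
    simp only [smul_eq_mul] at h1
    rw [← h1, ← mul_assoc]
    simp only [Module.finrank_self, pow_one]
    rw [abs_of_nonneg (by positivity), ENNReal.ofReal_inv_of_pos hp, ofReal_two_zpow,
      ENNReal.mul_inv_cancel (pw_ne_zero _) (pw_ne_top _), one_mul]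
  rw [h1]
  refine (h ξ hξ (fun t => φ (((2 : ℝ) ^ j)⁻¹ * t + ⟪z, ξ⟫)) (by fun_prop)).trans ?_
  gcongr C * ?_
  rw [h2, ← lintegral_sub_right_eq_self _ ⟪z, ξ⟫]
  refine (lintegral_congr fun t => ?_).le
  rw [inv_mul_cancel_left₀ hp.ne', sub_add_cancel]
  ring

end Scaling

section Riesz

variable {n : ℕ}

theorem enorm_rpow_anti {s : ℝ} (hs : s ≤ 0) {a b : ℝ≥0∞} (h : a ≤ b) : b ^ s ≤ a ^ s := by
  rw [← neg_neg s, ENNReal.rpow_neg b, ENNReal.rpow_neg a]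
  exact ENNReal.inv_le_inv.2 (ENNReal.rpow_le_rpow h (by linarith))

theorem tsum_wt_le' {m : ℝ} (hm : 0 < m) (hm' : m < 2 * n) :
    ∃ C : ℝ≥0∞, C ≠ ⊤ ∧ ∀ x : Euc n,
      ∑' j : ℤ, pw (j * m) * ENNReal.ofReal (wt n ((2 : ℝ) ^ j • x)) ≤ C * ‖x‖ₑ ^ (-m) := by
  obtain ⟨C, hC, h⟩ := tsum_wt_le hm hm'
  refine ⟨C + 1, by finiteness, fun x => ?_⟩
  by_cases hx : x = 0
  · rw [hx, enorm_zero, ENNReal.zero_rpow_of_neg (by linarith), ENNReal.mul_top (by simp)]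
    exact le_top
  · refine (h x hx).trans ?_
    rw [← ofReal_norm]
    gcongr
    exact le_self_add

theorem lintegral_comp_smul_of_pos {c : ℝ} (hc : 0 < c) (F : Euc n → ℝ≥0∞) :
    ∫⁻ x : Euc n, F (c • x) = (ENNReal.ofReal (c ^ n))⁻¹ * ∫⁻ x, F x := by
  have h : MeasurableEmbedding (fun x : Euc n => c • x) :=
    (Homeomorph.smulOfNeZero c hc.ne').measurableEmbedding
  have h1 : ∫⁻ x : Euc n, F (c • x)
      = ∫⁻ x, F x ∂(Measure.map (fun x : Euc n => c • x) volume) :=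
    (h.lintegral_map F).symm
  rw [h1, Measure.map_addHaar_smul _ hc.ne', lintegral_smul_measure, finrank_euclideanSpace_fin,
    abs_of_nonneg (by positivity), ENNReal.ofReal_inv_of_pos (by positivity), smul_eq_mul]

theorem lintegral_ball_enorm_rpow (hn : 1 ≤ n) {s : ℝ} (hs : -(n : ℝ) < s) :
    ∃ C : ℝ≥0∞, C ≠ ⊤ ∧ ∀ ρ : ℝ, 0 < ρ →
      ∫⁻ x in ball (0 : Euc n) ρ, ‖x‖ₑ ^ s ≤ C * ENNReal.ofReal ρ ^ (n + s) := by
  have : Nontrivial (Euc n) := by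
    have : Nonempty (Fin n) := ⟨⟨0, hn⟩⟩
    infer_instance
  refine ⟨∫⁻ x in ball (0 : Euc n) 1, ‖x‖ₑ ^ s, ?_, fun ρ hρ => ?_⟩
  · have h1 : IntegrableOn (fun x : Euc n => ‖x‖ ^ s) (ball 0 1) volume := by
      refine integrableOn_ball_of_norm_le_rpow (C := 1) (α := -s) (by simpa using hn)
        (by simp; linarith) (ae_of_all _ fun x => ?_) ?_
      · rw [neg_neg, one_mul, Real.norm_of_nonneg (by positivity)]
      · exact (measurable_norm.pow_const s).aestronglyMeasurable
    have h2 := h1.2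
    rw [hasFiniteIntegral_iff_enorm] at h2
    refine ne_of_lt (lt_of_le_of_lt (lintegral_mono_ae ?_) h2)
    have h0 : ∀ᵐ x : Euc n ∂(volume.restrict (ball 0 1)), x ≠ 0 :=
      ae_restrict_of_ae (by simp [ae_iff])
    filter_upwards [h0] with x hx
    rw [Real.enorm_of_nonneg (by positivity), ← ENNReal.ofReal_rpow_of_pos (norm_pos_iff.2 hx),
      ofReal_norm]
  · have hρ0 : ENNReal.ofReal ρ ≠ 0 := by simpa using hρ
    have h := lintegral_comp_smul_of_pos hρ (n := n) (fun x => (ball (0 : Euc n) ρ).indicator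
      (fun x => ‖x‖ₑ ^ s) x)
    rw [lintegral_indicator measurableSet_ball] at h
    have h2 : ∀ x : Euc n, (ball (0 : Euc n) ρ).indicator (fun x => ‖x‖ₑ ^ s) (ρ • x) =
        ENNReal.ofReal ρ ^ s * (ball (0 : Euc n) 1).indicator (fun x => ‖x‖ₑ ^ s) x := by
      intro x
      have hmem : ρ • x ∈ ball (0 : Euc n) ρ ↔ x ∈ ball (0 : Euc n) 1 := by
        simp only [mem_ball_zero_iff, norm_smul, Real.norm_of_nonneg hρ.le]
        constructor <;> intro h <;> nlinarith
      by_cases hx : x ∈ ball (0 : Euc n) 1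
      · rw [Set.indicator_of_mem (hmem.2 hx), Set.indicator_of_mem hx, enorm_smul,
          Real.enorm_of_nonneg hρ.le, ENNReal.mul_rpow_of_ne_top (by simp) (by simp)]
      · rw [Set.indicator_of_notMem (fun h => hx (hmem.1 h)), Set.indicator_of_notMem hx, mul_zero]
    simp_rw [h2] at h
    rw [lintegral_const_mul' _ _ (by simp [ENNReal.rpow_eq_top_iff, hρ]),
      lintegral_indicator measurableSet_ball] at h
    have h3 : ENNReal.ofReal (ρ ^ n) ≠ 0 := by simp; positivity
    have h4 : ∫⁻ x in ball (0 : Euc n) ρ, ‖x‖ₑ ^ s = ENNReal.ofReal (ρ ^ n) *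
        (ENNReal.ofReal ρ ^ s * ∫⁻ x in ball (0 : Euc n) 1, ‖x‖ₑ ^ s) := by
      rw [h, ← mul_assoc, ENNReal.mul_inv_cancel h3 (by simp), one_mul]
    rw [h4, ENNReal.rpow_add _ _ hρ0 (by simp), ENNReal.rpow_natCast,
      ENNReal.ofReal_pow hρ.le]
    apply le_of_eq
    ring

theorem lintegral_set_enorm_rpow (hn : 1 ≤ n) {s : ℝ} (hs : -(n : ℝ) < s) (hs0 : s ≤ 0) :
    ∃ C : ℝ≥0∞, C ≠ ⊤ ∧ ∀ (S : Set (Euc n)) (y : Euc n), MeasurableSet S →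
      ∫⁻ x in S, ‖x - y‖ₑ ^ s ≤ C * volume S ^ (1 + s / n) := by
  have hn0 : (0 : ℝ) < n := by exact_mod_cast hn
  obtain ⟨C, hC, h⟩ := lintegral_ball_enorm_rpow hn hs
  have hpos : 0 < 1 + s / n := by
    have : -1 < s / n := by rw [lt_div_iff₀ hn0]; linarith
    linarith
  refine ⟨C + 1, by finiteness, fun S y hS => ?_⟩
  have hm : Measurable fun x : Euc n => ‖x - y‖ₑ ^ s := by fun_prop
  rcases eq_or_ne (volume S) 0 with h0 | h0
  · rw [Measure.restrict_eq_zero.2 h0]; simp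
  rcases eq_or_ne (volume S) ⊤ with ht | ht
  · rw [ht, ENNReal.top_rpow_of_pos hpos, ENNReal.mul_top (by simp)]
    exact le_top
  set ρ : ℝ := (volume S).toReal ^ (1 / n : ℝ) with hρ
  have hv : 0 < (volume S).toReal := ENNReal.toReal_pos h0 ht
  have hρ0 : 0 < ρ := by positivity
  have e1 : ENNReal.ofReal ρ = volume S ^ (1 / n : ℝ) := by
    rw [hρ, ← ENNReal.ofReal_rpow_of_pos hv, ENNReal.ofReal_toReal ht]
  have e2 : volume S ^ (1 + s / n) = ENNReal.ofReal ρ ^ (n + s) := by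
    rw [e1, ← ENNReal.rpow_mul]
    congr 1
    field_simp
  have b1 : ∫⁻ x in ball y ρ, ‖x - y‖ₑ ^ s ≤ C * ENNReal.ofReal ρ ^ (n + s) := by
    refine le_trans (le_of_eq ?_) (h ρ hρ0)
    rw [← lintegral_indicator measurableSet_ball, ← lintegral_indicator measurableSet_ball,
      ← lintegral_sub_right_eq_self ((ball (0 : Euc n) ρ).indicator fun x => ‖x‖ₑ ^ s) y]
    refine lintegral_congr fun x => ?_
    simp only [Set.indicator, mem_ball, dist_eq_norm, sub_zero]
  have b2 : ∫⁻ x in S \ ball y ρ, ‖x - y‖ₑ ^ s ≤ ENNReal.ofReal ρ ^ s * volume S := by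
    calc _ ≤ ∫⁻ x in S \ ball y ρ, ENNReal.ofReal ρ ^ s := by
          refine setLIntegral_mono measurable_const fun x hx => ?_
          have : ρ ≤ ‖x - y‖ := by
            have := hx.2
            rwa [mem_ball, dist_eq_norm, not_lt] at this
          rw [← ofReal_norm]
          have := ENNReal.ofReal_le_ofReal this
          exact enorm_rpow_anti hs0 this
      _ ≤ _ := by
          rw [setLIntegral_const]
          gcongr
          exact Set.sdiff_subset
  have e3 : ENNReal.ofReal ρ ^ s * volume S = ENNReal.ofReal ρ ^ (n + s) := by
    rw [add_comm, ENNReal.rpow_add _ _ (by simpa using hρ0) (by simp)]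
    congr 1
    rw [e1, ← ENNReal.rpow_mul]
    field_simp
    simp
  calc _ ≤ ∫⁻ x in ball y ρ ∪ S \ ball y ρ, ‖x - y‖ₑ ^ s :=
        lintegral_mono_set fun x hx => by
          by_cases hb : x ∈ ball y ρ
          · exact Or.inl hb
          · exact Or.inr ⟨hx, hb⟩
    _ ≤ _ := lintegral_union_le _ _ _
    _ ≤ C * ENNReal.ofReal ρ ^ (n + s) + ENNReal.ofReal ρ ^ s * volume S := add_le_add b1 b2
    _ = _ := by rw [e3, e2]; ring

theorem lintegral_ball_sub_enorm_rpow (hn : 1 ≤ n) {s : ℝ} (hs : -(n : ℝ) < s) (hs0 : s ≤ 0) :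
    ∃ C : ℝ≥0∞, C ≠ ⊤ ∧ ∀ (x y : Euc n) (r : ℝ), 0 < r →
      ∫⁻ z in ball x r, ‖z - y‖ₑ ^ s ≤ C * ENNReal.ofReal r ^ (n + s) := by
  have hn0 : (0 : ℝ) < n := by exact_mod_cast hn
  obtain ⟨C, hC, h⟩ := lintegral_set_enorm_rpow hn hs hs0
  have hpos : 0 ≤ 1 + s / n := by
    have : -1 < s / n := by rw [lt_div_iff₀ hn0]; linarith
    linarith
  refine ⟨C * volume (ball (0 : Euc n) 1) ^ (1 + s / n), ENNReal.mul_ne_top hC ?_,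
    fun x y r hr => (h _ y measurableSet_ball).trans (le_of_eq ?_)⟩
  · exact ENNReal.rpow_ne_top_of_nonneg hpos measure_ball_lt_top.ne
  · rw [Measure.addHaar_ball_of_pos _ _ hr, ENNReal.mul_rpow_of_nonneg _ _ hpos,
      finrank_euclideanSpace_fin, ENNReal.ofReal_pow hr.le, ← ENNReal.rpow_natCast,
      ← ENNReal.rpow_mul]
    rw [show (n : ℝ) * (1 + s / n) = n + s by field_simp]
    ring

theorem lintegral_compl_ball_enorm_rpow (hn : 1 ≤ n) {s : ℝ} (hs : s < -(n : ℝ)) :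
    ∃ C : ℝ≥0∞, C ≠ ⊤ ∧ ∀ (y : Euc n) (d : ℝ), 0 < d →
      ∫⁻ x in (ball y d)ᶜ, ‖x - y‖ₑ ^ s ≤ C * ENNReal.ofReal d ^ (n + s) := by
  have hn0 : (0 : ℝ) < n := by exact_mod_cast hn
  refine ⟨∫⁻ x in (ball (0 : Euc n) 1)ᶜ, ‖x‖ₑ ^ s, ?_, fun y d hd => ?_⟩
  · have h1 := finite_integral_one_add_norm (E := Euc n) (μ := volume) (r := -s) (by simp; linarith)
    have h2 : ∫⁻ x in (ball (0 : Euc n) 1)ᶜ, ‖x‖ₑ ^ s ≤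
        ∫⁻ x : Euc n, pw (-s) * ENNReal.ofReal ((1 + ‖x‖) ^ (- -s)) := by
      refine le_trans (setLIntegral_mono (by fun_prop) fun x hx => ?_) (setLIntegral_le_lintegral _ _)
      have hx1 : 1 ≤ ‖x‖ := by simpa using hx
      rw [← ofReal_two_rpow, ← ENNReal.ofReal_mul (by positivity), neg_neg, ← ofReal_norm,
        ENNReal.ofReal_rpow_of_pos (by linarith)]
      apply ENNReal.ofReal_le_ofReal
      rw [Real.rpow_neg (by norm_num), ← Real.inv_rpow (by norm_num),
        ← Real.mul_rpow (by norm_num) (by positivity)]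
      exact Real.rpow_le_rpow_of_nonpos (by positivity) (by linarith) (by linarith)
    rw [lintegral_const_mul' _ _ (pw_ne_top _)] at h2
    exact ne_top_of_le_ne_top (ENNReal.mul_ne_top (pw_ne_top _) h1.ne) h2
  · have hd0 : ENNReal.ofReal d ≠ 0 := by simpa using hd
    have e0 : ∫⁻ x in (ball y d)ᶜ, ‖x - y‖ₑ ^ s = ∫⁻ x in (ball (0 : Euc n) d)ᶜ, ‖x‖ₑ ^ s := by
      rw [← lintegral_indicator measurableSet_ball.compl,
        ← lintegral_indicator measurableSet_ball.compl,
        ← lintegral_sub_right_eq_self ((ball (0 : Euc n) d)ᶜ.indicator fun x => ‖x‖ₑ ^ s) y]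
      refine lintegral_congr fun x => ?_
      simp only [Set.indicator, Set.mem_compl_iff, mem_ball, dist_eq_norm, sub_zero]
    have h := lintegral_comp_smul_of_pos hd (n := n) (fun x => (ball (0 : Euc n) d)ᶜ.indicator
      (fun x => ‖x‖ₑ ^ s) x)
    rw [lintegral_indicator measurableSet_ball.compl] at h
    have h2 : ∀ x : Euc n, (ball (0 : Euc n) d)ᶜ.indicator (fun x => ‖x‖ₑ ^ s) (d • x) =
        ENNReal.ofReal d ^ s * (ball (0 : Euc n) 1)ᶜ.indicator (fun x => ‖x‖ₑ ^ s) x := by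
      intro x
      have hmem : d • x ∈ (ball (0 : Euc n) d)ᶜ ↔ x ∈ (ball (0 : Euc n) 1)ᶜ := by
        simp only [Set.mem_compl_iff, mem_ball_zero_iff, norm_smul, Real.norm_of_nonneg hd.le,
          not_lt]
        constructor <;> intro h <;> nlinarith
      by_cases hx : x ∈ (ball (0 : Euc n) 1)ᶜ
      · rw [Set.indicator_of_mem (hmem.2 hx), Set.indicator_of_mem hx, enorm_smul,
          Real.enorm_of_nonneg hd.le, ENNReal.mul_rpow_of_ne_top (by simp) (by simp)]
      · rw [Set.indicator_of_notMem (fun h => hx (hmem.1 h)), Set.indicator_of_notMem hx, mul_zero]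
    simp_rw [h2] at h
    rw [lintegral_const_mul' _ _ (by simp [ENNReal.rpow_eq_top_iff, hd]),
      lintegral_indicator measurableSet_ball.compl] at h
    have h3 : ENNReal.ofReal (d ^ n) ≠ 0 := by simp; positivity
    have h4 : ∫⁻ x in (ball (0 : Euc n) d)ᶜ, ‖x‖ₑ ^ s = ENNReal.ofReal (d ^ n) *
        (ENNReal.ofReal d ^ s * ∫⁻ x in (ball (0 : Euc n) 1)ᶜ, ‖x‖ₑ ^ s) := by
      rw [h, ← mul_assoc, ENNReal.mul_inv_cancel h3 (by simp), one_mul]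
    rw [e0, h4, ENNReal.rpow_add _ _ hd0 (by simp), ENNReal.rpow_natCast,
      ENNReal.ofReal_pow hd.le]
    apply le_of_eq
    ring

end Riesz

section SchwartzBounds

open scoped SchwartzMap

variable {n : ℕ} {E : Type*} [NormedAddCommGroup E] [NormedSpace ℝ E]

theorem exists_norm_le_wt (f : 𝓢(Euc n, E)) : ∃ C : ℝ, 0 ≤ C ∧ ∀ x, ‖f x‖ ≤ C * wt n x := by
  refine ⟨2 ^ (2 * n) * ((Finset.Iic (2 * n, 0)).sup fun m => SchwartzMap.seminorm ℝ m.1 m.2) f,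
    by positivity, fun x => ?_⟩
  have h := SchwartzMap.one_add_le_sup_seminorm_apply (𝕜 := ℝ) (m := (2 * n, 0)) le_rfl le_rfl f x
  rw [norm_iteratedFDeriv_zero] at h
  have h1 : (1 + ‖x‖ ^ 2) ^ n ≤ (1 + ‖x‖) ^ (2 * n) := by
    rw [pow_mul]
    gcongr
    nlinarith [norm_nonneg x]
  rw [wt, ← div_eq_mul_inv, le_div_iff₀ (by positivity), mul_comm]
  exact le_trans (by gcongr) h

theorem exists_norm_fderiv_le_wt (f : 𝓢(Euc n, E)) :
    ∃ C : ℝ, 0 ≤ C ∧ ∀ x, ‖f x‖ ≤ C * wt n x ∧ ‖fderiv ℝ f x‖ ≤ C * wt n x ∧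
      ‖fderiv ℝ (fderiv ℝ f) x‖ ≤ C * wt n x := by
  obtain ⟨C0, h0, H0⟩ := exists_norm_le_wt f
  obtain ⟨C1, h1, H1⟩ := exists_norm_le_wt (SchwartzMap.fderivCLM ℝ _ _ f)
  obtain ⟨C2, h2, H2⟩ := exists_norm_le_wt
    (SchwartzMap.fderivCLM ℝ _ _ (SchwartzMap.fderivCLM ℝ _ _ f))
  have hf : ⇑(SchwartzMap.fderivCLM ℝ _ _ f) = fderiv ℝ f := funext fun x =>
    SchwartzMap.fderivCLM_apply ℝ f x
  refine ⟨C0 + C1 + C2, by positivity, fun x => ⟨?_, ?_, ?_⟩⟩ <;> have hw := (wt_pos x).le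
  · exact (H0 x).trans (by gcongr; linarith)
  · rw [← hf]
    exact (H1 x).trans (by gcongr; linarith)
  · rw [← hf]
    have := H2 x
    rw [SchwartzMap.fderivCLM_apply] at this
    exact this.trans (by gcongr; linarith)

theorem enorm_dy_le {E : Type*} [NormedAddCommGroup E] [NormedSpace ℝ E] {h : Euc n → E} {C : ℝ}
    (hC : ∀ x, ‖h x‖ ≤ C * wt n x) (m : ℕ) (j : ℤ) (x : Euc n) :
    ‖dy m h j x‖ₑ ≤ ENNReal.ofReal C * (pw (j * m) * ENNReal.ofReal (wt n ((2 : ℝ) ^ j • x))) := by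
  have hC0 : 0 ≤ C := by
    by_contra hneg
    have := (norm_nonneg _).trans (hC 0)
    nlinarith [wt_pos (0 : Euc n)]
  rw [dy, enorm_smul, Real.enorm_of_nonneg (by positivity), ofReal_two_zpow_pow, mul_left_comm]
  gcongr
  rw [← ENNReal.ofReal_mul hC0, ← ofReal_norm]
  exact ENNReal.ofReal_le_ofReal (hC _)

theorem enorm_dy_le_wj {E : Type*} [NormedAddCommGroup E] [NormedSpace ℝ E] {h : Euc n → E}
    {C : ℝ} (hC : ∀ x, ‖h x‖ ≤ C * wt n x) (m : ℕ) (j : ℤ) (x : Euc n) :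
    ‖dy m h j x‖ₑ ≤ ENNReal.ofReal C * (pw (j * (m - n)) * wj n j x) := by
  refine (enorm_dy_le hC m j x).trans (le_of_eq ?_)
  rw [wj, ← mul_assoc (pw _) (pw _), ← pw_add]
  congr 4
  ring

theorem hasFDerivAt_dy {E : Type*} [NormedAddCommGroup E] [NormedSpace ℝ E] {h : Euc n → E}
    (hd : Differentiable ℝ h) (m : ℕ) (j : ℤ) (x : Euc n) :
    HasFDerivAt (dy m h j) (dy (m + 1) (fderiv ℝ h) j x) x := by
  have h1 : HasFDerivAt (fun x : Euc n => (2 : ℝ) ^ j • x)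
      ((2 : ℝ) ^ j • ContinuousLinearMap.id ℝ (Euc n)) x :=
    ((2 : ℝ) ^ j • ContinuousLinearMap.id ℝ (Euc n)).hasFDerivAt
  have h2 := ((hd ((2 : ℝ) ^ j • x)).hasFDerivAt.comp x h1).const_smul (((2 : ℝ) ^ j) ^ m)
  refine h2.congr_fderiv ?_
  rw [dy, pow_succ]
  ext v
  simp [smul_smul]

end SchwartzBounds

section Kernel

variable {n : ℕ} {V W : Type*}
  [NormedAddCommGroup V] [InnerProductSpace ℝ V] [FiniteDimensional ℝ V]
  [NormedAddCommGroup W] [InnerProductSpace ℝ W] [FiniteDimensional ℝ W]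
  {A : CoeffOp n 1 V W}

/-- The dyadic pieces of the fundamental kernel of `𝒜`. -/
noncomputable def kj (hA : IsElliptic n 1 A) (j : ℤ) : Euc n → W →L[ℝ] V := dy (n - 1) (kap hA) j

/-- The derivatives of the dyadic pieces. -/
noncomputable def dj (hA : IsElliptic n 1 A) (j : ℤ) : Euc n → Euc n →L[ℝ] W →L[ℝ] V :=
  dy n (fderiv ℝ (kap hA)) j

/-- The truncated kernel. -/
noncomputable def KJ (hA : IsElliptic n 1 A) (J : ℕ) (z : Euc n) : W →L[ℝ] V :=
  ∑ j ∈ Finset.Ico (-(J : ℤ)) J, kj hA j z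

open scoped Classical in
/-- The kernel. -/
noncomputable def KK (hA : IsElliptic n 1 A) (z : Euc n) : W →L[ℝ] V :=
  if z = 0 then 0 else ∑' j : ℤ, kj hA j z

/-- The dilates of the approximate identity. -/
noncomputable def et (n : ℕ) (j : ℤ) : Euc n → ℝ := dy n (etaS n) j

theorem hasFDerivAt_kj (hn : 1 < n) (hA : IsElliptic n 1 A) (j : ℤ) (x : Euc n) :
    HasFDerivAt (kj hA j) (dj hA j x) x := by
  have h := hasFDerivAt_dy (kap hA).differentiable (n - 1) j x
  rwa [Nat.sub_add_cancel hn.le] at h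

theorem contDiff_dy {E : Type*} [NormedAddCommGroup E] [NormedSpace ℝ E] {h : Euc n → E}
    (hd : ContDiff ℝ (⊤ : ℕ∞) h) (m : ℕ) (j : ℤ) : ContDiff ℝ (⊤ : ℕ∞) (dy m h j) := by
  unfold dy
  fun_prop

theorem contDiff_kj (hA : IsElliptic n 1 A) (j : ℤ) : ContDiff ℝ (⊤ : ℕ∞) (kj hA j) :=
  contDiff_dy ((kap hA).smooth _) _ _

theorem continuous_kj (hA : IsElliptic n 1 A) (j : ℤ) : Continuous (kj hA j) :=
  (contDiff_kj hA j).continuous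

theorem continuous_dj (hA : IsElliptic n 1 A) (j : ℤ) : Continuous (dj hA j) :=
  continuous_const (y := ((2 : ℝ) ^ j) ^ n) |>.smul
    ((((kap hA).smooth 1).continuous_fderiv one_ne_zero).comp
      (continuous_const_smul ((2 : ℝ) ^ j)))

theorem continuous_et (j : ℤ) : Continuous (et n j) :=
  (contDiff_dy ((etaS n).smooth _) _ _).continuous

theorem continuous_KJ (hA : IsElliptic n 1 A) (J : ℕ) : Continuous (KJ hA J) := by
  unfold KJ
  exact continuous_finsetSum _ fun j _ => continuous_kj hA j

theorem exists_enorm_kj_le (hn : 1 < n) (hA : IsElliptic n 1 A) : ∃ C : ℝ≥0∞, C ≠ ⊤ ∧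
    ∀ (j : ℤ) (x : Euc n),
      ‖kj hA j x‖ₑ ≤ C * (pw (j * (n - 1)) * ENNReal.ofReal (wt n ((2 : ℝ) ^ j • x))) ∧
      ‖dj hA j x‖ₑ ≤ C * (pw (j * n) * ENNReal.ofReal (wt n ((2 : ℝ) ^ j • x))) := by
  obtain ⟨C, hC, h⟩ := exists_norm_fderiv_le_wt (kap hA)
  refine ⟨ENNReal.ofReal C, by simp, fun j x => ⟨?_, ?_⟩⟩
  · have := enorm_dy_le (fun x => (h x).1) (n - 1) j x
    rwa [Nat.cast_sub hn.le, Nat.cast_one] at this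
  · exact enorm_dy_le (fun x => (h x).2.1) n j x

theorem exists_enorm_et_le : ∃ C : ℝ≥0∞, C ≠ ⊤ ∧
    ∀ (j : ℤ) (x : Euc n), ‖et n j x‖ₑ ≤ C * wj n j x := by
  obtain ⟨C, hC, h⟩ := exists_norm_le_wt (etaS n)
  exact ⟨ENNReal.ofReal C, by simp, fun j x => enorm_dy_le h n j x⟩

theorem exists_tsum_kj_le (hn : 1 < n) (hA : IsElliptic n 1 A) : ∃ C : ℝ≥0∞, C ≠ ⊤ ∧
    ∀ z : Euc n, ∑' j : ℤ, ‖kj hA j z‖ₑ ≤ C * ‖z‖ₑ ^ (1 - n : ℝ) := by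
  obtain ⟨C, hC, h⟩ := exists_enorm_kj_le hn hA
  have hn' : (1 : ℝ) < n := by exact_mod_cast hn
  obtain ⟨C', hC', h'⟩ := tsum_wt_le' (n := n) (m := n - 1) (by linarith) (by linarith)
  refine ⟨C * C', by finiteness, fun z => ?_⟩
  calc _ ≤ ∑' j : ℤ, C * (pw (j * (n - 1)) * ENNReal.ofReal (wt n ((2 : ℝ) ^ j • z))) :=
        ENNReal.tsum_le_tsum fun j => (h j z).1
    _ = C * ∑' j : ℤ, (pw (j * (n - 1)) * ENNReal.ofReal (wt n ((2 : ℝ) ^ j • z))) :=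
        ENNReal.tsum_mul_left
    _ ≤ C * (C' * ‖z‖ₑ ^ (-(n - 1) : ℝ)) := by gcongr; exact h' z
    _ = _ := by rw [mul_assoc, neg_sub]

theorem tendsto_Ico_int : Tendsto (fun J : ℕ => Finset.Ico (-(J : ℤ)) J) atTop atTop := by
  refine tendsto_atTop_finset_of_monotone (fun a b h => Finset.Ico_subset_Ico (by omega) (by omega))
    fun j => ⟨j.natAbs + 1, ?_⟩
  simp only [Finset.mem_Ico]
  omega

theorem summable_kj (hn : 1 < n) (hA : IsElliptic n 1 A) {z : Euc n} (hz : z ≠ 0) :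
    Summable fun j : ℤ => kj hA j z := by
  obtain ⟨C, hC, h⟩ := exists_tsum_kj_le hn hA
  refine Summable.of_norm (tsum_enorm_ne_top_iff_summable_norm.1 (ne_top_of_le_ne_top ?_ (h z)))
  refine ENNReal.mul_ne_top hC (ENNReal.rpow_ne_top_of_ne_zero (by simpa using hz) (by simp))

theorem tendsto_KJ (hn : 1 < n) (hA : IsElliptic n 1 A) {z : Euc n} (hz : z ≠ 0) :
    Tendsto (fun J => KJ hA J z) atTop (𝓝 (KK hA z)) := by
  have h := (summable_kj hn hA hz).hasSum.comp tendsto_Ico_int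
  rwa [KK, if_neg hz]

theorem enorm_finset_sum_le_tsum {ι E : Type*} [NormedAddCommGroup E] (f : ι → E) (s : Finset ι) :
    ‖∑ i ∈ s, f i‖ₑ ≤ ∑' i, ‖f i‖ₑ :=
  (enorm_sum_le s f).trans (ENNReal.sum_le_tsum s)

theorem enorm_tsum_le_tsum {ι E : Type*} [NormedAddCommGroup E] (f : ι → E) :
    ‖∑' i, f i‖ₑ ≤ ∑' i, ‖f i‖ₑ :=
  enorm_tsum_le_tsum_enorm

theorem enorm_zero_le {E : Type*} [NormedAddCommGroup E] (a : ℝ≥0∞) : ‖(0 : E)‖ₑ ≤ a := by simp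

theorem exists_enorm_KK_le (hn : 1 < n) (hA : IsElliptic n 1 A) : ∃ C : ℝ≥0∞, C ≠ ⊤ ∧
    (∀ J z, ‖KJ hA J z‖ₑ ≤ C * ‖z‖ₑ ^ (1 - n : ℝ)) ∧
    ∀ z, ‖KK hA z‖ₑ ≤ C * ‖z‖ₑ ^ (1 - n : ℝ) := by
  obtain ⟨C, hC, h⟩ := exists_tsum_kj_le hn hA
  refine ⟨C, hC, fun J z => ?_, fun z => ?_⟩
  · exact (enorm_finset_sum_le_tsum _ _).trans (h z)
  · rw [KK]
    split_ifs
    · exact enorm_zero_le _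
    · exact (enorm_tsum_le_tsum _).trans (h z)

theorem stronglyMeasurable_KK (hn : 1 < n) (hA : IsElliptic n 1 A) : StronglyMeasurable (KK hA) := by
  refine stronglyMeasurable_of_tendsto atTop (f := fun J z => ({0}ᶜ : Set (Euc n)).indicator
    (KJ hA J) z) (fun J => (continuous_KJ hA J).stronglyMeasurable.indicator
      (measurableSet_singleton _).compl) ?_
  rw [tendsto_pi_nhds]
  intro z
  by_cases hz : z = 0
  · simp [hz, KK]
  · simpa [hz] using tendsto_KJ hn hA hz

theorem et_succ_sub (j : ℤ) (x : Euc n) : ((2 : ℝ) ^ j) ^ n *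
    (2 ^ n * etaS n ((2 : ℝ) • (2 : ℝ) ^ j • x) - etaS n ((2 : ℝ) ^ j • x)) =
      et n (j + 1) x - et n j x := by
  simp only [et, dy]
  rw [zpow_add₀ two_ne_zero, zpow_one, smul_smul, mul_comm (2 : ℝ)]
  simp only [smul_eq_mul]
  ring

theorem sum_dj_coef (hA : IsElliptic n 1 A) (j : ℤ) (x : Euc n) (v : V) :
    ∑ i, dj hA j x (stdVec n i) (coefL A i v) = (et n (j + 1) x - et n j x) • v := by
  have h := sum_fderiv_kap_coef hA ((2 : ℝ) ^ j • x) v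
  simp only [dj, dy, _root_.smul_apply]
  rw [← Finset.smul_sum, h, smul_smul, et_succ_sub]

theorem sum_coef_dj (hA : IsElliptic n 1 A) (j : ℤ) (x : Euc n) {w : W}
    (hw : ∀ ξ ≠ 0, w ∈ LinearMap.range (symbolMap n 1 A ξ)) :
    ∑ i, coefL A i (dj hA j x (stdVec n i) w) = (et n (j + 1) x - et n j x) • w := by
  have h := sum_coef_fderiv_kap hA ((2 : ℝ) ^ j • x) hw
  simp only [dj, dy, _root_.smul_apply, map_smul]
  rw [← Finset.smul_sum, h, smul_smul, et_succ_sub]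

theorem gradTrunc_eq (hA : IsElliptic n 1 A) (i : Fin n) (J : ℕ) (z : Euc n) :
    gradTrunc hA i J z = ∑ j ∈ Finset.Ico (-(J : ℤ)) J, dj hA j z (stdVec n i) := by
  simp [gradTrunc, dj, dy]

theorem hasFDerivAt_KJ (hn : 1 < n) (hA : IsElliptic n 1 A) (J : ℕ) (z : Euc n) :
    HasFDerivAt (KJ hA J) (∑ j ∈ Finset.Ico (-(J : ℤ)) J, dj hA j z) z := by
  unfold KJ
  exact HasFDerivAt.fun_sum fun j _ => hasFDerivAt_kj hn hA j z

/-- The dilates of the approximate identity converge pointwise on bounded continuous functions. -/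
theorem tendsto_integral_et {E : Type*} [NormedAddCommGroup E] [NormedSpace ℝ E] [CompleteSpace E]
    {φ : Euc n → E} (hφ : Continuous φ) {C : ℝ} (hC : ∀ x, ‖φ x‖ ≤ C) (x : Euc n) :
    Tendsto (fun J : ℕ => ∫ y, et n J (x - y) • φ y) atTop (𝓝 (φ x)) := by
  have h1 : ∀ J : ℕ, ∫ y, et n J (x - y) • φ y =
      ∫ z, etaS n z • φ (x - ((2 : ℝ) ^ J)⁻¹ • z) := by
    intro J
    have hp : (0 : ℝ) < 2 ^ J := by positivity
    rw [← integral_sub_left_eq_self _ volume x]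
    simp only [sub_sub_cancel]
    have h2 := Measure.integral_comp_smul (volume : Measure (Euc n))
      (fun z => etaS n z • φ (x - ((2 : ℝ) ^ J)⁻¹ • z)) ((2 : ℝ) ^ J)
    rw [finrank_euclideanSpace_fin, abs_of_nonneg (by positivity)] at h2
    have h3 : ∀ z, et n J z • φ (x - z) = ((2 : ℝ) ^ J) ^ n • (etaS n ((2 : ℝ) ^ J • z) •
        φ (x - ((2 : ℝ) ^ J)⁻¹ • (2 : ℝ) ^ J • z)) := by
      intro z
      rw [inv_smul_smul₀ hp.ne', et, dy, zpow_natCast, smul_eq_mul, mul_smul]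
    simp_rw [h3]
    rw [integral_smul, h2, smul_smul, mul_inv_cancel₀ (by positivity), one_smul]
  simp_rw [h1]
  have h4 : φ x = ∫ z, etaS n z • φ x := by rw [integral_smul_const, integral_etaS, one_smul]
  rw [h4]
  refine tendsto_integral_of_dominated_convergence (fun z => ‖etaS n z‖ * C) (fun J => ?_)
    ((etaS n).integrable.norm.mul_const C) (fun J => ae_of_all _ fun z => ?_)
    (ae_of_all _ fun z => ?_)
  · exact ((etaS n).continuous.smul (by fun_prop)).aestronglyMeasurable
  · rw [norm_smul]
    gcongr
    exact hC _
  · refine tendsto_const_nhds.smul ((hφ.tendsto x).comp ?_)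
    have : Tendsto (fun J : ℕ => x - ((2 : ℝ) ^ J)⁻¹ • z) atTop (𝓝 (x - (0 : ℝ) • z)) := by
      refine tendsto_const_nhds.sub (Tendsto.smul_const ?_ z)
      simp_rw [← inv_pow]
      exact tendsto_pow_atTop_nhds_zero_of_lt_one (by norm_num) (by norm_num)
    simpa using this

theorem exists_norm_et_le : ∃ C : ℝ, 0 ≤ C ∧ ∀ (j : ℤ) (x : Euc n),
    ‖et n j x‖ ≤ ((2 : ℝ) ^ j) ^ n * C := by
  obtain ⟨C, hC, h⟩ := exists_norm_le_wt (etaS n)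
  refine ⟨C, hC, fun j x => ?_⟩
  rw [et, dy, norm_smul, Real.norm_of_nonneg (by positivity)]
  gcongr
  exact (h _).trans (mul_le_of_le_one_right hC (wt_le_one _))

end Kernel

section Potential

variable {n : ℕ} {V W : Type*}
  [NormedAddCommGroup V] [InnerProductSpace ℝ V] [FiniteDimensional ℝ V]
  [NormedAddCommGroup W] [InnerProductSpace ℝ W] [FiniteDimensional ℝ W]
  {A : CoeffOp n 1 V W}

/-- The Riesz potential of order one. -/
noncomputable def riesz (σ : Measure (Euc n)) (g : Euc n → ℝ≥0∞) (x : Euc n) : ℝ≥0∞ :=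
  ∫⁻ y, ‖x - y‖ₑ ^ (1 - n : ℝ) * g y ∂σ

/-- The potential `K * (f σ)`. -/
noncomputable def pot (hA : IsElliptic n 1 A) (σ : Measure (Euc n)) (f : Euc n → W) (x : Euc n) :
    V := ∫ y, KK hA (x - y) (f y) ∂σ

theorem lintegral_ball_riesz_le (n : ℕ) (hn : 1 < n) : ∃ C : ℝ≥0∞, C ≠ ⊤ ∧
    ∀ (σ : Measure (Euc n)) [SFinite σ] (g : Euc n → ℝ≥0∞), AEMeasurable g σ → ∀ x₀ r, 0 < r →
    ∫⁻ x in ball x₀ r, riesz σ g x ≤ C * ENNReal.ofReal r * ∫⁻ y, g y ∂σ := by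
  have hn' : (1 : ℝ) < n := by exact_mod_cast hn
  obtain ⟨C, hC, h⟩ := lintegral_ball_sub_enorm_rpow hn.le (s := (1 - n : ℝ)) (by linarith)
    (by linarith)
  refine ⟨C, hC, fun σ _ g hg x₀ r hr => ?_⟩
  unfold riesz
  rw [lintegral_lintegral_swap]
  · calc _ = ∫⁻ y, (∫⁻ x in ball x₀ r, ‖x - y‖ₑ ^ (1 - n : ℝ)) * g y ∂σ := by
          refine lintegral_congr fun y => lintegral_mul_const _ (by fun_prop)
      _ ≤ ∫⁻ y, (C * ENNReal.ofReal r) * g y ∂σ := by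
          gcongr with y
          simpa using h x₀ y r hr
      _ = _ := lintegral_const_mul' _ _ (by finiteness)
  · exact AEMeasurable.mul (by fun_prop) (hg.comp_snd)

theorem ae_riesz_ne_top (hn : 1 < n) (σ : Measure (Euc n)) [SFinite σ] {g : Euc n → ℝ≥0∞}
    (hg : AEMeasurable g σ) (hg' : ∫⁻ y, g y ∂σ ≠ ⊤) : ∀ᵐ x, riesz σ g x ≠ ⊤ := by
  obtain ⟨C, hC, h⟩ := lintegral_ball_riesz_le n hn
  have h1 : ∀ k : ℕ, ∀ᵐ x ∂(volume.restrict (ball (0 : Euc n) (k + 1))), riesz σ g x ≠ ⊤ := by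
    intro k
    have h2 := ne_top_of_le_ne_top (by finiteness) (h σ g hg 0 (k + 1) (by positivity))
    have h3 : AEMeasurable (fun x : Euc n => riesz σ g x)
        (volume.restrict (ball (0 : Euc n) (k + 1))) := by
      unfold riesz
      exact AEMeasurable.lintegral_prod_right' (f := fun p : Euc n × Euc n =>
        ‖p.1 - p.2‖ₑ ^ (1 - n : ℝ) * g p.2) (AEMeasurable.mul (by fun_prop) (hg.comp_snd))
    filter_upwards [ae_lt_top' h3 h2] with x hx using hx.ne
  have h2 : (⋃ k : ℕ, ball (0 : Euc n) (k + 1)) = Set.univ := by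
    refine Set.eq_univ_of_forall fun x => ?_
    obtain ⟨k, hk⟩ := exists_nat_gt ‖x‖
    exact Set.mem_iUnion.2 ⟨k, by simp; linarith⟩
  rw [← Measure.restrict_univ (μ := (volume : Measure (Euc n))), ← h2, ae_restrict_iUnion_iff]
  exact h1

/-- Transposition of an operator against a fixed vector. -/
theorem exists_transpose (e : V) : ∃ L : (W →L[ℝ] V) →L[ℝ] W, ∀ T w, ⟪w, L T⟫ = ⟪T w, e⟫ := by
  let b := stdOrthonormalBasis ℝ W
  refine ⟨∑ i, ((innerSL ℝ e) ∘L (ContinuousLinearMap.apply ℝ V (b i))).smulRight (b i),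
    fun T w => ?_⟩
  simp only [_root_.sum_apply, ContinuousLinearMap.smulRight_apply, ContinuousLinearMap.comp_apply,
    ContinuousLinearMap.apply_apply, innerSL_apply_apply, inner_sum, inner_smul_right]
  conv_rhs => rw [← b.sum_repr w, map_sum, sum_inner]
  refine Finset.sum_congr rfl fun i _ => ?_
  rw [map_smul, inner_smul_left, b.repr_apply_apply, real_inner_comm w, real_inner_comm e]
  simp [mul_comm]

theorem enorm_clm_apply_le {E F : Type*} [NormedAddCommGroup E] [NormedSpace ℝ E]
    [NormedAddCommGroup F] [NormedSpace ℝ F] (T : E →L[ℝ] F) (x : E) : ‖T x‖ₑ ≤ ‖T‖ₑ * ‖x‖ₑ :=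
  T.le_opENorm x

theorem norm_le_toReal_of_enorm_le {E : Type*} [NormedAddCommGroup E] {x : E} {a : ℝ≥0∞}
    (h : ‖x‖ₑ ≤ a) (ha : a ≠ ⊤) : ‖x‖ ≤ a.toReal := by
  rw [← toReal_enorm]
  exact ENNReal.toReal_mono ha h

theorem aestronglyMeasurable_clm_apply {α E F : Type*} [MeasurableSpace α] {μ : Measure α}
    [NormedAddCommGroup E] [NormedSpace ℝ E]
    [NormedAddCommGroup F] [NormedSpace ℝ F] {T : α → E →L[ℝ] F} {f : α → E}
    (hT : AEStronglyMeasurable T μ) (hf : AEStronglyMeasurable f μ) :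
    AEStronglyMeasurable (fun x => T x (f x)) μ :=
  (isBoundedBilinearMap_apply (𝕜 := ℝ)).continuous.comp_aestronglyMeasurable (hT.prodMk hf)

theorem exists_enorm_pot_le (hn : 1 < n) (hA : IsElliptic n 1 A) : ∃ C : ℝ≥0∞, C ≠ ⊤ ∧
    ∀ (σ : Measure (Euc n)) (f : Euc n → W) (x : Euc n),
      (∫⁻ y, ‖KK hA (x - y) (f y)‖ₑ ∂σ ≤ C * riesz σ (fun y => ‖f y‖ₑ) x) ∧
      (‖pot hA σ f x‖ₑ ≤ C * riesz σ (fun y => ‖f y‖ₑ) x) ∧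
      ∀ J, ‖∫ y, KJ hA J (x - y) (f y) ∂σ‖ₑ ≤ C * riesz σ (fun y => ‖f y‖ₑ) x := by
  obtain ⟨C, hC, h1, h2⟩ := exists_enorm_KK_le hn hA
  have key : ∀ (T : Euc n → W →L[ℝ] V), (∀ z, ‖T z‖ₑ ≤ C * ‖z‖ₑ ^ (1 - n : ℝ)) →
      ∀ (σ : Measure (Euc n)) (f : Euc n → W) (x : Euc n),
      ∫⁻ y, ‖T (x - y) (f y)‖ₑ ∂σ ≤ C * riesz σ (fun y => ‖f y‖ₑ) x := by
    intro T hT σ f x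
    unfold riesz
    rw [← lintegral_const_mul' _ _ hC]
    refine lintegral_mono fun y => (enorm_clm_apply_le _ _).trans ?_
    rw [← mul_assoc]
    gcongr
    exact hT _
  exact ⟨C, hC, fun σ f x => ⟨key _ h2 σ f x, (enorm_integral_le_lintegral_enorm _).trans
    (key _ h2 σ f x), fun J => (enorm_integral_le_lintegral_enorm _).trans
    (key _ (h1 J) σ f x)⟩⟩

theorem tendsto_integral_KJ (hn : 1 < n) (hA : IsElliptic n 1 A) (σ : Measure (Euc n))
    {f : Euc n → W} (hf : AEStronglyMeasurable f σ) {x : Euc n}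
    (hx : riesz σ (fun y => ‖f y‖ₑ) x ≠ ⊤) :
    Tendsto (fun J => ∫ y, KJ hA J (x - y) (f y) ∂σ) atTop (𝓝 (pot hA σ f x)) := by
  obtain ⟨C, hC, h1, h2⟩ := exists_enorm_KK_le hn hA
  have hn' : (1 : ℝ) < n := by exact_mod_cast hn
  have hm : AEMeasurable (fun y => ‖x - y‖ₑ ^ (1 - n : ℝ) * ‖f y‖ₑ) σ :=
    AEMeasurable.mul (by fun_prop) hf.enorm
  have hfin := ae_lt_top' hm hx
  have hi : Integrable (fun y => (C * (‖x - y‖ₑ ^ (1 - n : ℝ) * ‖f y‖ₑ)).toReal) σ := by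
    refine integrable_toReal_of_lintegral_ne_top (hm.const_mul _) ?_
    rw [lintegral_const_mul' _ _ hC]
    exact ENNReal.mul_ne_top hC hx
  refine tendsto_integral_of_dominated_convergence _ (fun J => ?_) hi (fun J => ?_) ?_
  · exact aestronglyMeasurable_clm_apply
      ((continuous_KJ hA J).comp (by fun_prop)).aestronglyMeasurable hf
  · filter_upwards [hfin] with y hy
    refine norm_le_toReal_of_enorm_le ((enorm_clm_apply_le _ _).trans ?_)
      (ENNReal.mul_ne_top hC hy.ne)
    rw [← mul_assoc]
    gcongr
    exact h1 J _
  · filter_upwards [hfin] with y hy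
    by_cases hxy : x - y = 0
    · have : f y = 0 := by
        by_contra h0
        rw [hxy, enorm_zero, ENNReal.zero_rpow_of_neg (by linarith), ENNReal.top_mul
          (by simpa using h0)] at hy
        exact lt_irrefl _ hy
      simp [this]
    · exact ((ContinuousLinearMap.apply ℝ V (f y)).continuous.tendsto _).comp
        (tendsto_KJ hn hA hxy)

/-- For compactly supported data the weak equation may be tested with all smooth maps. -/
theorem HasDistribA.apply_smooth {u : Euc n → V} {σ : Measure (Euc n)} {f : Euc n → W}
    (h : HasDistribA n 1 A u σ f) {R : ℝ} (hu : ∀ x, R ≤ ‖x‖ → u x = 0)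
    (hf : ∀ x, R ≤ ‖x‖ → f x = 0) {φ : Euc n → W} (hφ : ContDiff ℝ (⊤ : ℕ∞) φ) :
    -(∑ i, ∫ x, ⟪coefL A i (u x), fderiv ℝ φ x (stdVec n i)⟫) = ∫ x, ⟪f x, φ x⟫ ∂σ := by
  let χ : ContDiffBump (0 : Euc n) := ⟨|R| + 1, |R| + 2, by positivity, by linarith⟩
  have hχ : ∀ x : Euc n, ‖x‖ < R → (fun y => χ y • φ y) =ᶠ[𝓝 x] φ := by
    intro x hx
    have : ball (0 : Euc n) (|R| + 1) ∈ 𝓝 x := isOpen_ball.mem_nhds (by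
      simpa using hx.trans_le ((le_abs_self R).trans (by linarith)))
    filter_upwards [this] with y hy
    rw [χ.one_of_mem_closedBall (ball_subset_closedBall hy), one_smul]
  have h1 := hasDistribA_iff.1 h (fun y => χ y • φ y)
    ⟨χ.contDiff.smul hφ, χ.hasCompactSupport.smul_right⟩
  have h2 : ∀ i x, ⟪coef A i (u x), fderiv ℝ (fun y => χ y • φ y) x (stdVec n i)⟫ =
      ⟪coefL A i (u x), fderiv ℝ φ x (stdVec n i)⟫ := by
    intro i x
    by_cases hx : R ≤ ‖x‖
    · simp [hu x hx]
    · rw [(hχ x (not_le.1 hx)).fderiv_eq]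
      rfl
  have h3 : ∀ x, ⟪f x, χ x • φ x⟫ = ⟪f x, φ x⟫ := by
    intro x
    by_cases hx : R ≤ ‖x‖
    · simp [hf x hx]
    · rw [(hχ x (not_le.1 hx)).eq_of_nhds]
  simpa only [h2, h3] using h1

/-- A bounded continuous family applied to an integrable map is integrable. -/
theorem integrable_clm_apply {E F : Type*} [NormedAddCommGroup E] [NormedSpace ℝ E]
    [NormedAddCommGroup F] [NormedSpace ℝ F] {σ : Measure (Euc n)} {T : Euc n → E →L[ℝ] F}
    (hT : Continuous T) {C : ℝ} (hC : ∀ x, ‖T x‖ ≤ C) {f : Euc n → E} (hf : Integrable f σ) :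
    Integrable (fun x => T x (f x)) σ := by
  refine (hf.norm.const_mul C).mono' (aestronglyMeasurable_clm_apply
    hT.aestronglyMeasurable hf.1) (ae_of_all _ fun x => ?_)
  exact ((T x).le_opNorm _).trans (mul_le_mul_of_nonneg_right (hC x) (norm_nonneg _))

theorem norm_dy_le {E : Type*} [NormedAddCommGroup E] [NormedSpace ℝ E] {h : Euc n → E} {C : ℝ}
    (hC0 : 0 ≤ C) (hC : ∀ x, ‖h x‖ ≤ C * wt n x) (m : ℕ) (j : ℤ) (x : Euc n) :
    ‖dy m h j x‖ ≤ ((2 : ℝ) ^ j) ^ m * C := by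
  rw [dy, norm_smul, Real.norm_of_nonneg (by positivity)]
  gcongr
  exact (hC _).trans (mul_le_of_le_one_right hC0 (wt_le_one _))

theorem exists_norm_kj_le (hA : IsElliptic n 1 A) (j : ℤ) :
    ∃ C : ℝ, ∀ x, ‖kj hA j x‖ ≤ C ∧ ‖dj hA j x‖ ≤ C := by
  obtain ⟨C, hC, h⟩ := exists_norm_fderiv_le_wt (kap hA)
  refine ⟨max (((2 : ℝ) ^ j) ^ (n - 1) * C) (((2 : ℝ) ^ j) ^ n * C), fun x => ⟨?_, ?_⟩⟩
  · exact (norm_dy_le hC (fun x => (h x).1) _ _ _).trans (le_max_left _ _)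
  · exact (norm_dy_le hC (fun x => (h x).2.1) _ _ _).trans (le_max_right _ _)

/-- The dyadic pieces of the kernel reproduce the dyadic differences of the map. -/
theorem HasDistribA.integral_et_sub (hn : 1 < n) (hA : IsElliptic n 1 A) {u : Euc n → V}
    {σ : Measure (Euc n)} {f : Euc n → W} (h : HasDistribA n 1 A u σ f) {R : ℝ}
    (hu : ∀ x, R ≤ ‖x‖ → u x = 0) (hf : ∀ x, R ≤ ‖x‖ → f x = 0) (hui : Integrable u)
    (hfi : Integrable f σ) (j : ℤ) (x : Euc n) :
    ∫ y, (et n (j + 1) (x - y) - et n j (x - y)) • u y = ∫ y, kj hA j (x - y) (f y) ∂σ := by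
  obtain ⟨C, hC⟩ := exists_norm_kj_le hA j
  refine ext_inner_right ℝ fun e => ?_
  obtain ⟨L, hL⟩ := exists_transpose (W := W) e
  have hk : ContDiff ℝ (⊤ : ℕ∞) fun y => kj hA j (x - y) :=
    (contDiff_kj hA j).comp (by fun_prop)
  have hd : ∀ y, HasFDerivAt (fun y => L (kj hA j (x - y))) (L ∘L (-(dj hA j (x - y)))) y := by
    intro y
    have := (hasFDerivAt_kj hn hA j (x - y)).comp y ((hasFDerivAt_id y).const_sub x)
    refine L.hasFDerivAt.comp y ?_
    convert this using 1
    · rfl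
    · rw [ContinuousLinearMap.comp_neg, ContinuousLinearMap.comp_id]
  have h1 := h.apply_smooth hu hf (φ := fun y => L (kj hA j (x - y))) (by fun_prop)
  have h2 : ∀ i y, ⟪coefL A i (u y), fderiv ℝ (fun y => L (kj hA j (x - y))) y (stdVec n i)⟫ =
      -⟪dj hA j (x - y) (stdVec n i) (coefL A i (u y)), e⟫ := by
    intro i y
    rw [(hd y).fderiv]
    simp [hL]
  have h3 : ∀ i, Integrable fun y => dj hA j (x - y) (stdVec n i) (coefL A i (u y)) := by
    intro i
    refine integrable_clm_apply (T := fun y => dj hA j (x - y) (stdVec n i)) (C := C) ?_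
      (fun y => ?_) ((coefL A i).integrable_comp hui)
    · exact (((ContinuousLinearMap.apply ℝ (W →L[ℝ] V) (stdVec n i)).continuous.comp
        (continuous_dj hA j))).comp (by fun_prop)
    · refine ((dj hA j (x - y)).le_opNorm _).trans ?_
      simpa [stdVec] using (hC (x - y)).2
  have h4 : Integrable (fun y => kj hA j (x - y) (f y)) σ :=
    integrable_clm_apply ((continuous_kj hA j).comp (by fun_prop)) (fun y => (hC _).1) hfi
  simp only [h2, hL, integral_neg, Finset.sum_neg_distrib, neg_neg] at h1
  simp_rw [← sum_dj_coef hA]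
  rw [integral_finsetSum _ fun i _ => h3 i, sum_inner, real_inner_comm e (∫ y, _ ∂σ),
    ← integral_inner h4]
  have h5 : ∀ i, ⟪∫ y, dj hA j (x - y) (stdVec n i) (coefL A i (u y)), e⟫ =
      ∫ y, ⟪dj hA j (x - y) (stdVec n i) (coefL A i (u y)), e⟫ := fun i => by
    rw [real_inner_comm, ← integral_inner (h3 i)]
    simp only [real_inner_comm e]
  simp only [h5]
  rw [h1]
  exact integral_congr_ae (ae_of_all _ fun y => real_inner_comm _ _)

end Potential

section Representation

variable {n : ℕ} {V W : Type*}
  [NormedAddCommGroup V] [InnerProductSpace ℝ V] [FiniteDimensional ℝ V]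
  [NormedAddCommGroup W] [InnerProductSpace ℝ W] [FiniteDimensional ℝ W]
  {A : CoeffOp n 1 V W}

theorem integrable_et_sub_smul {E : Type*} [NormedAddCommGroup E] [NormedSpace ℝ E] {u : Euc n → E}
    (hu : Integrable u) (j : ℤ) (x : Euc n) : Integrable fun y => et n j (x - y) • u y := by
  obtain ⟨C, hC, h⟩ := exists_norm_et_le (n := n)
  exact hu.bdd_smul (((2 : ℝ) ^ j) ^ n * C)
    ((continuous_et j).comp (by fun_prop)).aestronglyMeasurable (ae_of_all _ fun y => h j _)

theorem integrable_kj_apply (hA : IsElliptic n 1 A) {σ : Measure (Euc n)} {f : Euc n → W}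
    (hf : Integrable f σ) (j : ℤ) (x : Euc n) : Integrable (fun y => kj hA j (x - y) (f y)) σ := by
  obtain ⟨C, hC⟩ := exists_norm_kj_le hA j
  exact integrable_clm_apply ((continuous_kj hA j).comp (by fun_prop)) (fun y => (hC _).1) hf

/-- The truncated kernels reproduce the differences of mollifications. -/
theorem HasDistribA.integral_KJ (hn : 1 < n) (hA : IsElliptic n 1 A) {u : Euc n → V}
    {σ : Measure (Euc n)} {f : Euc n → W} (h : HasDistribA n 1 A u σ f) {R : ℝ}
    (hu : ∀ x, R ≤ ‖x‖ → u x = 0) (hf : ∀ x, R ≤ ‖x‖ → f x = 0) (hui : Integrable u)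
    (hfi : Integrable f σ) (J : ℕ) (x : Euc n) :
    ∫ y, KJ hA J (x - y) (f y) ∂σ =
      (∫ y, et n J (x - y) • u y) - ∫ y, et n (-J) (x - y) • u y := by
  simp only [KJ, _root_.sum_apply]
  rw [integral_finsetSum _ fun j _ => integrable_kj_apply hA hfi j x]
  simp_rw [fun j => (h.integral_et_sub hn hA hu hf hui hfi j x).symm, sub_smul,
    fun j => integral_sub (integrable_et_sub_smul hui (j + 1) x) (integrable_et_sub_smul hui j x)]
  exact sum_Ico_telescope (fun j => ∫ y, et n j (x - y) • u y) J

theorem exists_integral_norm_et_le (n : ℕ) (hn : 1 ≤ n) : ∃ C : ℝ, ∀ (j : ℤ) (y : Euc n),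
    Integrable (fun x => et n j (x - y)) ∧ ∫ x, ‖et n j (x - y)‖ ≤ C := by
  obtain ⟨C, hC, h⟩ := exists_enorm_et_le (n := n)
  have h1 : ∀ (j : ℤ) (y : Euc n), ∫⁻ x, ‖et n j (x - y)‖ₑ ≤
      C * ∫⁻ x : Euc n, ENNReal.ofReal (wt n x) := fun j y => by
    rw [← lintegral_wj j y, ← lintegral_const_mul' _ _ hC]
    exact lintegral_mono fun x => h j _
  have h2 : C * ∫⁻ x : Euc n, ENNReal.ofReal (wt n x) ≠ ⊤ :=
    ENNReal.mul_ne_top hC (lintegral_wt_ne_top hn)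
  refine ⟨(C * ∫⁻ x : Euc n, ENNReal.ofReal (wt n x)).toReal, fun j y => ?_⟩
  have hm : AEStronglyMeasurable (fun x => et n j (x - y)) volume :=
    ((continuous_et j).comp (by fun_prop)).aestronglyMeasurable
  refine ⟨⟨hm, (h1 j y).trans_lt h2.lt_top⟩, ?_⟩
  rw [integral_norm_eq_lintegral_enorm hm]
  exact ENNReal.toReal_mono h2 (h1 j y)

theorem tendsto_two_zpow_neg_pow {m : ℕ} (hm : m ≠ 0) :
    Tendsto (fun J : ℕ => ((2 : ℝ) ^ (-J : ℤ)) ^ m) atTop (𝓝 0) := by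
  have : ∀ J : ℕ, ((2 : ℝ) ^ (-J : ℤ)) ^ m = (((2 : ℝ)⁻¹) ^ m) ^ J := fun J => by
    rw [zpow_neg, zpow_natCast, ← inv_pow, ← pow_mul, ← pow_mul, mul_comm]
  simp_rw [this]
  exact tendsto_pow_atTop_nhds_zero_of_lt_one (by positivity)
    (pow_lt_one₀ (by norm_num) (by norm_num) hm)

/-- Mollifications converge weakly. -/
theorem tendsto_integral_smul_et (hn : 1 ≤ n) {E : Type*} [NormedAddCommGroup E] [NormedSpace ℝ E]
    [CompleteSpace E] {u : Euc n → E} (hu : Integrable u) {ψ : Euc n → ℝ} (hψ : Continuous ψ)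
    (hc : HasCompactSupport ψ) : Tendsto (fun J : ℕ => ∫ x, ψ x • ((∫ y, et n J (x - y) • u y) -
      ∫ y, et n (-J) (x - y) • u y)) atTop (𝓝 (∫ x, ψ x • u x)) := by
  have hψi : Integrable ψ := hψ.integrable_of_hasCompactSupport hc
  obtain ⟨C, hC, h⟩ := exists_norm_et_le (n := n)
  obtain ⟨C', h'⟩ := exists_integral_norm_et_le n hn
  obtain ⟨M, hM⟩ := hψ.bounded_above_of_compact_support hc
  have hp : ∀ j : ℤ, Integrable (fun p : Euc n × Euc n => et n j (p.1 - p.2) • (ψ p.1 • u p.2))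
      (volume.prod volume) := fun j =>
    (hψi.smul_prod hu).bdd_smul (((2 : ℝ) ^ j) ^ n * C)
      ((continuous_et j).comp (by fun_prop)).aestronglyMeasurable (ae_of_all _ fun y => h j _)
  have hsm : ∀ (j : ℤ) x, ∫ y, et n j (x - y) • ψ x • u y = ψ x • ∫ y, et n j (x - y) • u y :=
    fun j x => by
      rw [← integral_smul]
      exact integral_congr_ae (ae_of_all _ fun y => smul_comm _ _ _)
  have hi : ∀ j : ℤ, Integrable fun x => ψ x • ∫ y, et n j (x - y) • u y := fun j => by
    simpa only [hsm] using (hp j).integral_prod_left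
  have h1 : ∀ J : ℕ, ∫ x, ψ x • ((∫ y, et n J (x - y) • u y) - ∫ y, et n (-J) (x - y) • u y) =
      (∫ y, (∫ x, et n J (x - y) * ψ x) • u y) - ∫ x, ψ x • ∫ y, et n (-J) (x - y) • u y := by
    intro J
    simp only [smul_sub]
    rw [integral_sub (hi _) (hi _)]
    congr 1
    simp only [← hsm]
    rw [integral_integral_swap (hp J)]
    simp only [smul_smul, integral_smul_const]
  simp_rw [h1]
  rw [← sub_zero (∫ x, ψ x • u x)]
  refine Tendsto.sub ?_ ?_
  · have hle : ∀ (j : ℤ) (y : Euc n), ‖∫ x, et n j (x - y) * ψ x‖ ≤ C' * M := by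
      intro j y
      refine (norm_integral_le_integral_norm _).trans ?_
      calc ∫ x, ‖et n j (x - y) * ψ x‖ ≤ ∫ x, ‖et n j (x - y)‖ * M := by
            refine integral_mono_of_nonneg (ae_of_all _ fun x => norm_nonneg _)
              ((h' j y).1.norm.mul_const M) (ae_of_all _ fun x => ?_)
            simp only [norm_mul]
            gcongr
            exact hM x
        _ = (∫ x, ‖et n j (x - y)‖) * M := integral_mul_const _ _
        _ ≤ _ := by
            gcongr
            · exact (norm_nonneg _).trans (hM 0)
            · exact (h' j y).2
    refine tendsto_integral_of_dominated_convergence (fun y => C' * M * ‖u y‖) (fun J => ?_)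
      (hu.norm.const_mul _) (fun J => ae_of_all _ fun y => ?_) (ae_of_all _ fun y => ?_)
    · refine AEStronglyMeasurable.smul ?_ hu.1
      refine (StronglyMeasurable.integral_prod_left'
        (f := fun p : Euc n × Euc n => et n J (p.1 - p.2) * ψ p.1) ?_).aestronglyMeasurable
      exact (((continuous_et J).comp (by fun_prop)).mul (by fun_prop)).stronglyMeasurable
    · rw [norm_smul]
      gcongr
      exact hle _ _
    · refine Tendsto.smul_const ?_ _
      have h2 := tendsto_integral_et (φ := fun z => ψ (-z)) (by fun_prop) (fun z => hM _) (-y)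
      rw [neg_neg] at h2
      refine h2.congr fun J => ?_
      rw [← integral_neg_eq_self]
      refine integral_congr_ae (ae_of_all _ fun x => ?_)
      simp [neg_add_eq_sub]
  · have hb : ∀ J : ℕ, ‖∫ x, ψ x • ∫ y, et n (-J) (x - y) • u y‖ ≤
        (((2 : ℝ) ^ (-J : ℤ)) ^ n * C * ∫ y, ‖u y‖) * ∫ x, ‖ψ x‖ := by
      intro J
      refine (norm_integral_le_integral_norm _).trans ?_
      rw [← integral_const_mul]
      refine integral_mono_of_nonneg (ae_of_all _ fun x => norm_nonneg _)
        (hψi.norm.const_mul _) (ae_of_all _ fun x => ?_)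
      simp only [norm_smul]
      rw [mul_comm]
      gcongr
      refine (norm_integral_le_integral_norm _).trans ?_
      rw [← integral_const_mul]
      refine integral_mono_of_nonneg (ae_of_all _ fun x => norm_nonneg _)
        (hu.norm.const_mul _) (ae_of_all _ fun y => ?_)
      simp only [norm_smul]
      gcongr
      exact h _ _
    refine squeeze_zero_norm hb ?_
    have h3 := tendsto_two_zpow_neg_pow (by omega : n ≠ 0)
    simpa using ((h3.mul_const C).mul_const (∫ y, ‖u y‖)).mul_const (∫ x, ‖ψ x‖)

theorem stronglyMeasurable_integral_KJ (hA : IsElliptic n 1 A) {σ : Measure (Euc n)} [SFinite σ]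
    {f : Euc n → W} (hf : StronglyMeasurable f) (J : ℕ) :
    StronglyMeasurable fun x => ∫ y, KJ hA J (x - y) (f y) ∂σ :=
  StronglyMeasurable.integral_prod_right' (f := fun p : Euc n × Euc n => KJ hA J (p.1 - p.2) (f p.2))
    ((isBoundedBilinearMap_apply (𝕜 := ℝ)).continuous.comp_stronglyMeasurable
      ((((continuous_KJ hA J).comp (by fun_prop)).stronglyMeasurable).prodMk
        (hf.comp_measurable measurable_snd)))

theorem aestronglyMeasurable_integral_KJ (hA : IsElliptic n 1 A) {σ : Measure (Euc n)} [SFinite σ]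
    {f : Euc n → W} (hf : AEStronglyMeasurable f σ) (J : ℕ) :
    AEStronglyMeasurable (fun x => ∫ y, KJ hA J (x - y) (f y) ∂σ) volume := by
  refine (stronglyMeasurable_integral_KJ hA (σ := σ) hf.stronglyMeasurable_mk
    J).aestronglyMeasurable.congr (ae_of_all _ fun x => integral_congr_ae ?_)
  filter_upwards [hf.ae_eq_mk] with y hy
  simp only [hy]

theorem aestronglyMeasurable_pot (hn : 1 < n) (hA : IsElliptic n 1 A) {σ : Measure (Euc n)}
    [SFinite σ] {f : Euc n → W} (hf : Integrable f σ) :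
    AEStronglyMeasurable (pot hA σ f) volume := by
  refine aestronglyMeasurable_of_tendsto_ae atTop
    (fun J => aestronglyMeasurable_integral_KJ hA hf.1 J) ?_
  filter_upwards [ae_riesz_ne_top hn σ hf.1.enorm hf.2.ne] with x hx
  exact tendsto_integral_KJ hn hA σ hf.1 hx

theorem lintegral_ball_pot_ne_top (hn : 1 < n) (hA : IsElliptic n 1 A) {σ : Measure (Euc n)}
    [SFinite σ] {f : Euc n → W} (hf : Integrable f σ) (x₀ : Euc n) (r : ℝ) :
    ∫⁻ x in ball x₀ r, ‖pot hA σ f x‖ₑ ≠ ⊤ := by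
  obtain ⟨C, hC, h⟩ := exists_enorm_pot_le hn hA
  obtain ⟨C', hC', h'⟩ := lintegral_ball_riesz_le n hn
  have h1 := h' σ _ hf.1.enorm x₀ (max r 1) (by positivity)
  have h2 := hf.2.ne
  refine ne_top_of_le_ne_top ?_ (((lintegral_mono_set (ball_subset_ball (le_max_left r 1))).trans
    (lintegral_mono fun x => (h σ f x).2.1)).trans
      ((lintegral_const_mul' _ _ hC).le.trans (mul_le_mul_right h1 C)))
  exact ENNReal.mul_ne_top hC (ENNReal.mul_ne_top (by finiteness) h2)

theorem locallyIntegrable_pot (hn : 1 < n) (hA : IsElliptic n 1 A) {σ : Measure (Euc n)}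
    [SFinite σ] {f : Euc n → W} (hf : Integrable f σ) : LocallyIntegrable (pot hA σ f) volume :=
  fun x => ⟨ball x 1, ball_mem_nhds x one_pos, (aestronglyMeasurable_pot hn hA hf).restrict,
    (lintegral_ball_pot_ne_top hn hA hf x 1).lt_top⟩

theorem tendsto_integral_bilin_KJ (hn : 1 < n) (hA : IsElliptic n 1 A) {σ : Measure (Euc n)}
    [SFinite σ] {f : Euc n → W} (hf : Integrable f σ) {E F : Type*} [NormedAddCommGroup E]
    [NormedSpace ℝ E] [NormedAddCommGroup F] [NormedSpace ℝ F] (B : E →L[ℝ] V →L[ℝ] F)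
    {ψ : Euc n → E} (hψ : Continuous ψ) (hc : HasCompactSupport ψ) :
    Tendsto (fun J => ∫ x, B (ψ x) (∫ y, KJ hA J (x - y) (f y) ∂σ)) atTop
      (𝓝 (∫ x, B (ψ x) (pot hA σ f x))) := by
  obtain ⟨C, hC, h⟩ := exists_enorm_pot_le hn hA
  obtain ⟨M, hM⟩ := hψ.bounded_above_of_compact_support hc
  obtain ⟨C', hC', h'⟩ := lintegral_ball_riesz_le n hn
  obtain ⟨R, hR⟩ := hc.isCompact.isBounded.subset_ball_lt 0 0
  have hI := ae_riesz_ne_top hn σ hf.1.enorm hf.2.ne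
  have hmI : AEMeasurable (riesz σ fun y => ‖f y‖ₑ) := by
    unfold riesz
    exact AEMeasurable.lintegral_prod_right' (f := fun p : Euc n × Euc n =>
        ‖p.1 - p.2‖ₑ ^ (1 - n : ℝ) * ‖f p.2‖ₑ) (AEMeasurable.mul (by fun_prop) hf.1.enorm.comp_snd)
  refine tendsto_integral_of_dominated_convergence
    ((ball (0 : Euc n) R).indicator fun x => ‖B‖ * M * (C * riesz σ (fun y => ‖f y‖ₑ) x).toReal)
    (fun J => ?_) ?_ (fun J => ?_) ?_
  · exact aestronglyMeasurable_clm_apply (B.continuous.comp hψ).aestronglyMeasurable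
      (aestronglyMeasurable_integral_KJ hA hf.1 J)
  · rw [integrable_indicator_iff measurableSet_ball]
    refine Integrable.const_mul (integrable_toReal_of_lintegral_ne_top
      (hmI.const_mul _).restrict ?_) _
    rw [lintegral_const_mul' _ _ hC]
    have h2 := hf.2.ne
    exact ENNReal.mul_ne_top hC (ne_top_of_le_ne_top (ENNReal.mul_ne_top (by finiteness) h2)
      (h' σ _ hf.1.enorm 0 R hR.1))
  · filter_upwards [hI] with x hx
    by_cases hxR : x ∈ ball (0 : Euc n) R
    · rw [Set.indicator_of_mem hxR]
      refine (B.le_opNorm₂ _ _).trans ?_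
      have := norm_le_toReal_of_enorm_le ((h σ f x).2.2 J) (ENNReal.mul_ne_top hC hx)
      have := hM x
      have := (norm_nonneg (ψ x)).trans this
      gcongr
    · rw [Set.indicator_of_notMem hxR, image_eq_zero_of_notMem_tsupport fun hx' => hxR (hR.2 hx')]
      simp
  · filter_upwards [hI] with x hx
    exact ((B (ψ x)).continuous.tendsto _).comp (tendsto_integral_KJ hn hA σ hf.1 hx)

/-- Compactly supported maps are the potentials of their `𝒜`-gradient. -/
theorem HasDistribA.ae_eq_pot (hn : 1 < n) (hA : IsElliptic n 1 A) {u : Euc n → V}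
    {σ : Measure (Euc n)} [SFinite σ] {f : Euc n → W} (h : HasDistribA n 1 A u σ f) {R : ℝ}
    (hu : ∀ x, R ≤ ‖x‖ → u x = 0) (hf : ∀ x, R ≤ ‖x‖ → f x = 0) (hui : Integrable u)
    (hfi : Integrable f σ) : ∀ᵐ x, u x = pot hA σ f x := by
  refine ae_eq_of_integral_contDiff_smul_eq hui.locallyIntegrable
    (locallyIntegrable_pot hn hA hfi) fun ψ hψ hc => ?_
  have h1 := tendsto_integral_smul_et hn.le hui hψ.continuous hc
  have h2 := tendsto_integral_bilin_KJ hn hA hfi (ContinuousLinearMap.lsmul ℝ ℝ) hψ.continuous hc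
  simp only [ContinuousLinearMap.lsmul_apply, h.integral_KJ hn hA hu hf hui hfi] at h2
  exact tendsto_nhds_unique h1 h2

end Representation

section ConstantDensity

variable {n : ℕ} {V W : Type*}
  [NormedAddCommGroup V] [InnerProductSpace ℝ V] [FiniteDimensional ℝ V]
  [NormedAddCommGroup W] [InnerProductSpace ℝ W] [FiniteDimensional ℝ W]
  {A : CoeffOp n 1 V W}

theorem integral_coef_KJ (hn : 1 < n) (hA : IsElliptic n 1 A) {w : W}
    (hw : ∀ ξ ≠ 0, w ∈ LinearMap.range (symbolMap n 1 A ξ)) {φ : Euc n → W}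
    (hφ : IsTestFun n φ) (J : ℕ) (y : Euc n) :
    ∑ i, ∫ x, ⟪coefL A i (KJ hA J (x - y) w), fderiv ℝ φ x (stdVec n i)⟫ =
      -∫ x, (et n J (x - y) - et n (-J) (x - y)) * ⟪w, φ x⟫ := by
  have hK : Continuous fun x => KJ hA J (x - y) := (continuous_KJ hA J).comp (by fun_prop)
  have hD : ∀ i, Continuous fun x => (∑ j ∈ Finset.Ico (-(J : ℤ)) J, dj hA j (x - y)) (stdVec n i) :=
    fun i => by
      have : ∀ j : ℤ, Continuous fun x => dj hA j (x - y) :=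
        fun j => (continuous_dj hA j).comp (by fun_prop)
      have h2 : Continuous fun x => ∑ j ∈ Finset.Ico (-(J : ℤ)) J, dj hA j (x - y) :=
        continuous_finsetSum _ fun j _ => this j
      exact (ContinuousLinearMap.apply ℝ (W →L[ℝ] V) (stdVec n i)).continuous.comp h2
  have hKw : Continuous fun x => KJ hA J (x - y) w :=
    (ContinuousLinearMap.apply ℝ V w).continuous.comp hK
  have hDw : ∀ i, Continuous fun x =>
      coefL A i ((∑ j ∈ Finset.Ico (-(J : ℤ)) J, dj hA j (x - y)) (stdVec n i) w) :=
    fun i => (coefL A i ∘L ContinuousLinearMap.apply ℝ V w).continuous.comp (hD i)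
  have hint : ∀ {g : Euc n → W}, Continuous g → Integrable fun x => ⟪g x, φ x⟫ := fun {g} hg =>
    locallyIntegrable_inner_test hg.locallyIntegrable hφ.1.continuous hφ.2
  have h : ∀ i, ∫ x, ⟪coefL A i (KJ hA J (x - y) w), fderiv ℝ φ x (stdVec n i)⟫ =
      -∫ x, ⟪coefL A i ((∑ j ∈ Finset.Ico (-(J : ℤ)) J, dj hA j (x - y)) (stdVec n i) w), φ x⟫ := by
    intro i
    refine integral_bilinear_hasLineDerivAt_right_eq_neg_left_of_integrable (μ := volume)
      (f := fun x => coefL A i (KJ hA J (x - y) w)) (v := stdVec n i)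
      (g' := fun x => fderiv ℝ φ x (stdVec n i))
      (f' := fun x => coefL A i ((∑ j ∈ Finset.Ico (-(J : ℤ)) J, dj hA j (x - y)) (stdVec n i) w))
      (B := innerSL ℝ) (hint (hDw i))
      (locallyIntegrable_inner_test ((coefL A i).continuous.comp hKw).locallyIntegrable
        (hφ.fderiv_apply_eq _).1.continuous (hφ.fderiv_apply_eq _).2)
      (hint ((coefL A i).continuous.comp hKw))
      (fun x _ => ?_) (fun x _ => ?_)
    · have h1 := (hasFDerivAt_KJ hn hA J (x - y)).comp x ((hasFDerivAt_id x).sub_const y)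
      have h2 := ((coefL A i ∘L ContinuousLinearMap.apply ℝ V w).hasFDerivAt.comp x h1)
      exact h2.hasLineDerivAt (stdVec n i)
    · exact ((hφ.1.differentiable (by simp)) x).hasFDerivAt.hasLineDerivAt _
  simp only [h, Finset.sum_neg_distrib]
  rw [← integral_finsetSum _ fun i _ => hint (hDw i)]
  congr 1
  refine integral_congr_ae (ae_of_all _ fun x => ?_)
  simp only [← sum_inner]
  have h3 : ∑ i, coefL A i ((∑ j ∈ Finset.Ico (-(J : ℤ)) J, dj hA j (x - y)) (stdVec n i) w) =
      ∑ j ∈ Finset.Ico (-(J : ℤ)) J, (et n (j + 1) (x - y) - et n j (x - y)) • w := by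
    simp_rw [← sum_coef_dj hA _ (x - y) hw]
    rw [Finset.sum_comm]
    simp [_root_.sum_apply, map_sum]
  rw [h3, ← Finset.sum_smul, sum_Ico_telescope (fun j => et n j (x - y)), real_inner_smul_left]

/-- The potential of a constant density in all the images of the symbol solves `𝒜 u = w σ`. -/
theorem hasDistribA_pot_const (hn : 1 < n) (hA : IsElliptic n 1 A) {w : W}
    (hw : ∀ ξ ≠ 0, w ∈ LinearMap.range (symbolMap n 1 A ξ)) (σ : Measure (Euc n))
    [IsFiniteMeasure σ] : HasDistribA n 1 A (pot hA σ fun _ => w) σ fun _ => w := by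
  rw [hasDistribA_iff]
  intro φ hφ
  have hwi : Integrable (fun _ : Euc n => w) σ := integrable_const w
  obtain ⟨M, hM⟩ := hφ.1.continuous.bounded_above_of_compact_support hφ.2
  have hψ : Continuous fun x => ⟪w, φ x⟫ := continuous_const.inner hφ.1.continuous
  have hψc : HasCompactSupport fun x => ⟪w, φ x⟫ := hφ.2.comp_left (by simp)
  have hψi : Integrable fun x => ⟪w, φ x⟫ := hψ.integrable_of_hasCompactSupport hψc
  have hψM : ∀ x, ‖⟪w, φ x⟫‖ ≤ ‖w‖ * M := fun x =>
    (norm_inner_le_norm _ _).trans (by gcongr; exact hM x)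
  obtain ⟨C, hC, hCe⟩ := exists_norm_et_le (n := n)
  obtain ⟨C', hC'⟩ := exists_integral_norm_et_le n hn.le
  have h1 : Tendsto (fun J : ℕ => -∑ i, ∫ x, ⟪coefL A i (∫ y, KJ hA J (x - y) w ∂σ),
      fderiv ℝ φ x (stdVec n i)⟫) atTop
      (𝓝 (-∑ i, ∫ x, ⟪coef A i (pot hA σ (fun _ => w) x), fderiv ℝ φ x (stdVec n i)⟫)) := by
    refine (tendsto_finsetSum _ fun i _ => ?_).neg
    exact tendsto_integral_bilin_KJ hn hA hwi ((innerSL ℝ ∘L coefL A i).flip)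
      (hφ.fderiv_apply_eq (stdVec n i)).1.continuous (hφ.fderiv_apply_eq (stdVec n i)).2
  have h2 : ∀ J : ℕ, -∑ i, ∫ x, ⟪coefL A i (∫ y, KJ hA J (x - y) w ∂σ),
      fderiv ℝ φ x (stdVec n i)⟫ =
      ∫ y, (∫ x, (et n J (x - y) - et n (-J) (x - y)) * ⟪w, φ x⟫) ∂σ := by
    intro J
    have hKc : Continuous fun p : Euc n × Euc n => KJ hA J (p.1 - p.2) w :=
      (ContinuousLinearMap.apply ℝ V w).continuous.comp
        ((continuous_KJ hA J).comp (by fun_prop))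
    have hKb : ∃ D, ∀ z, ‖KJ hA J z w‖ ≤ D := by
      choose D hD using fun j => exists_norm_kj_le hA j
      refine ⟨(∑ j ∈ Finset.Ico (-(J : ℤ)) J, D j) * ‖w‖, fun z => ?_⟩
      refine (ContinuousLinearMap.le_opNorm _ _).trans ?_
      gcongr
      exact (norm_sum_le _ _).trans (Finset.sum_le_sum fun j _ => (hD j z).1)
    obtain ⟨D, hD⟩ := hKb
    have hD' : ∀ (i) (e : W) (z), ‖⟪coefL A i (KJ hA J z w), e⟫‖ ≤ ‖coefL A i‖ * D * ‖e‖ :=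
      fun i e z => (norm_inner_le_norm _ _).trans (by
        gcongr
        exact ((coefL A i).le_opNorm _).trans (by gcongr; exact hD z))
    have hdi : ∀ i, Integrable (fun p : Euc n × Euc n =>
        ⟪coefL A i (KJ hA J (p.1 - p.2) w), fderiv ℝ φ p.1 (stdVec n i)⟫)
        (volume.prod σ) := by
      intro i
      have hd := hφ.fderiv_apply_eq (stdVec n i)
      have hdint : Integrable (fun x => ‖coefL A i‖ * D * ‖fderiv ℝ φ x (stdVec n i)‖) :=
        (hd.1.continuous.integrable_of_hasCompactSupport hd.2).norm.const_mul _
      refine (hdint.comp_fst σ).mono' ?_ (ae_of_all _ fun p => hD' _ _ _)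
      exact (((coefL A i).continuous.comp hKc).inner
        (hd.1.continuous.comp continuous_fst)).aestronglyMeasurable
    have hstep : ∀ i, ∫ x, ⟪coefL A i (∫ y, KJ hA J (x - y) w ∂σ), fderiv ℝ φ x (stdVec n i)⟫ =
        ∫ y, (∫ x, ⟪coefL A i (KJ hA J (x - y) w), fderiv ℝ φ x (stdVec n i)⟫) ∂σ := by
      intro i
      rw [← integral_integral_swap (hdi i)]
      refine integral_congr_ae (ae_of_all _ fun x => ?_)
      have hKi : Integrable (fun y => KJ hA J (x - y) w) σ :=
        Integrable.of_bound (hKc.comp (by fun_prop : Continuous fun y => (x, y))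
          |>.aestronglyMeasurable) D (ae_of_all _ fun y => hD _)
      exact (((innerSL ℝ ∘L coefL A i).flip
        (fderiv ℝ φ x (stdVec n i))).integral_comp_comm hKi).symm
    simp only [hstep]
    rw [← integral_finsetSum _ fun i _ => (hdi i).integral_prod_right, ← integral_neg]
    refine integral_congr_ae (ae_of_all _ fun y => ?_)
    simp only []
    rw [integral_coef_KJ hn hA hw hφ, neg_neg]
  have h3 : Tendsto (fun J : ℕ =>
      ∫ y, (∫ x, (et n J (x - y) - et n (-J) (x - y)) * ⟪w, φ x⟫) ∂σ) atTop
      (𝓝 (∫ y, ⟪w, φ y⟫ ∂σ)) := by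
    have hb : ∀ (j : ℤ) y, ‖∫ x, et n j (x - y) * ⟪w, φ x⟫‖ ≤ C' * (‖w‖ * M) := by
      intro j y
      refine (norm_integral_le_integral_norm _).trans ?_
      calc ∫ x, ‖et n j (x - y) * ⟪w, φ x⟫‖ ≤ ∫ x, ‖et n j (x - y)‖ * (‖w‖ * M) := by
            refine integral_mono_of_nonneg (ae_of_all _ fun x => norm_nonneg _)
              ((hC' j y).1.norm.mul_const _) (ae_of_all _ fun x => ?_)
            simp only [norm_mul]
            gcongr
            exact hψM x
        _ = (∫ x, ‖et n j (x - y)‖) * (‖w‖ * M) := integral_mul_const _ _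
        _ ≤ _ := by
            gcongr
            · exact (norm_nonneg _).trans (hψM 0)
            · exact (hC' j y).2
    have hbi : ∀ (j : ℤ) y, Integrable fun x => et n j (x - y) * ⟪w, φ x⟫ := fun j y =>
      (hC' j y).1.mul_bdd hψ.aestronglyMeasurable (ae_of_all _ hψM)
    simp only [sub_mul, fun (j : ℤ) (k : ℤ) y => integral_sub (hbi j y) (hbi k y)]
    refine tendsto_integral_of_dominated_convergence (fun y => 2 * (C' * (‖w‖ * M)))
      (fun J => ?_) (integrable_const _) (fun J => ae_of_all _ fun y => ?_)
      (ae_of_all _ fun y => ?_)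
    · refine StronglyMeasurable.aestronglyMeasurable ?_
      refine StronglyMeasurable.sub ?_ ?_
      all_goals
        refine StronglyMeasurable.integral_prod_left'
          (f := fun p : Euc n × Euc n => et n _ (p.1 - p.2) * ⟪w, φ p.1⟫) ?_
        exact (((continuous_et _).comp (by fun_prop)).mul (hψ.comp
          continuous_fst)).stronglyMeasurable
    · exact (norm_sub_le _ _).trans (by linarith [hb J y, hb (-J) y])
    · rw [← sub_zero ⟪w, φ y⟫]
      refine Tendsto.sub ?_ ?_
      · have h2 := tendsto_integral_et (φ := fun z => ⟪w, φ (-z)⟫) (hψ.comp continuous_neg)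
          (fun z => hψM _) (-y)
        rw [neg_neg] at h2
        refine h2.congr fun J => ?_
        rw [← integral_neg_eq_self]
        refine integral_congr_ae (ae_of_all _ fun x => ?_)
        simp [neg_add_eq_sub]
      · have hb : ∀ J : ℕ, ‖∫ x, et n (-J) (x - y) * ⟪w, φ x⟫‖ ≤
            ((2 : ℝ) ^ (-J : ℤ)) ^ n * C * ∫ x, ‖⟪w, φ x⟫‖ := by
          intro J
          refine (norm_integral_le_integral_norm _).trans ?_
          rw [← integral_const_mul]
          refine integral_mono_of_nonneg (ae_of_all _ fun x => norm_nonneg _)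
            (hψi.norm.const_mul _) (ae_of_all _ fun x => ?_)
          simp only [norm_mul]
          gcongr
          exact hCe _ _
        refine squeeze_zero_norm hb ?_
        simpa using ((tendsto_two_zpow_neg_pow (by omega : n ≠ 0)).mul_const C).mul_const
          (∫ x, ‖⟪w, φ x⟫‖)
  simp only [h2] at h1
  exact tendsto_nhds_unique h1 h3

end ConstantDensity

section NotCanceling

open scoped Pointwise

variable {n : ℕ} {V W : Type*}
  [NormedAddCommGroup V] [InnerProductSpace ℝ V] [FiniteDimensional ℝ V]
  [NormedAddCommGroup W] [InnerProductSpace ℝ W] [FiniteDimensional ℝ W]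
  {A : CoeffOp n 1 V W}

theorem mem_range_symbolMap_smul {ξ : Euc n} {w : W} {c : ℝ} (hc : c ≠ 0)
    (h : w ∈ LinearMap.range (symbolMap n 1 A ξ)) :
    w ∈ LinearMap.range (symbolMap n 1 A (c • ξ)) := by
  obtain ⟨v, rfl⟩ := h
  refine ⟨c⁻¹ • v, ?_⟩
  simp [symbolMap_one, mul_smul, ← Finset.smul_sum, hc]

theorem exists_mem_range_of_not_isCanceling (h : ¬ IsCanceling n 1 A) :
    ∃ w : W, ‖w‖ = 1 ∧ ∀ ξ ≠ 0, w ∈ LinearMap.range (symbolMap n 1 A ξ) := by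
  have h1 : ∃ w : W, w ≠ 0 ∧ ∀ ξ ∈ sphere (0 : Euc n) 1,
      w ∈ LinearMap.range (symbolMap n 1 A ξ) := by
    by_contra! hc
    refine h (Set.Subset.antisymm (fun w hw => ?_) ?_)
    · by_contra hw0
      obtain ⟨ξ, hξ, hx⟩ := hc w hw0
      exact hx (Set.mem_iInter₂.1 hw ξ hξ)
    · rintro w rfl
      exact Set.mem_iInter₂.2 fun ξ _ => zero_mem _
  obtain ⟨w, hw0, hw⟩ := h1
  refine ⟨‖w‖⁻¹ • w, ?_, fun ξ hξ => ?_⟩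
  · rw [norm_smul, norm_inv, norm_norm, inv_mul_cancel₀ (norm_ne_zero_iff.2 hw0)]
  · refine Submodule.smul_mem _ _ ?_
    have := mem_range_symbolMap_smul (c := ‖ξ‖) (norm_ne_zero_iff.2 hξ) (hw (‖ξ‖⁻¹ • ξ) ?_)
    · rwa [smul_smul, mul_inv_cancel₀ (norm_ne_zero_iff.2 hξ), one_smul] at this
    · rw [mem_sphere_zero_iff_norm, norm_smul, norm_inv, norm_norm,
        inv_mul_cancel₀ (norm_ne_zero_iff.2 hξ)]

/-- Weak-type estimate for Riesz potentials of order one. -/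
theorem exists_volume_riesz_le (n : ℕ) (hn : 1 < n) : ∃ C : ℝ≥0∞, C ≠ ⊤ ∧
    ∀ (σ : Measure (Euc n)) [SFinite σ] (S : Set (Euc n)), MeasurableSet S → volume S ≠ ⊤ →
    ∀ s : ℝ≥0∞, s ≠ ⊤ → (∀ x ∈ S, s ≤ riesz σ (fun _ => 1) x) →
      s ^ ((n : ℝ) / (n - 1)) * volume S ≤ (C * σ Set.univ) ^ ((n : ℝ) / (n - 1)) := by
  have hn' : (1 : ℝ) < n := by exact_mod_cast hn
  have hn0 : (0 : ℝ) < (n : ℝ) - 1 := by linarith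
  obtain ⟨C, hC, h⟩ := lintegral_set_enorm_rpow hn.le (s := (1 - n : ℝ)) (by linarith)
    (by linarith)
  refine ⟨C, hC, fun σ _ S hS hSt s hst hs => ?_⟩
  have h1 : s * volume S ≤ C * σ Set.univ * volume S ^ (1 / n : ℝ) := by
    calc s * volume S = ∫⁻ x in S, s := by simp
      _ ≤ ∫⁻ x in S, riesz σ (fun _ => 1) x := setLIntegral_mono' hS hs
      _ = ∫⁻ y, (∫⁻ x in S, ‖x - y‖ₑ ^ (1 - n : ℝ)) ∂σ := by
          unfold riesz
          simp only [mul_one]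
          rw [lintegral_lintegral_swap]
          fun_prop
      _ ≤ ∫⁻ y, C * volume S ^ (1 + (1 - n : ℝ) / n) ∂σ := by
          gcongr with y
          exact h S y hS
      _ = _ := by
          rw [lintegral_const, mul_right_comm]
          congr 2
          field_simp
          ring
  by_cases h0 : volume S = 0
  · rw [h0, mul_zero]; exact zero_le
  have h2 : s * volume S ^ (((n : ℝ) - 1) / n) ≤ C * σ Set.univ := by
    have h3 : volume S ^ (((n : ℝ) - 1) / n) * volume S ^ (1 / n : ℝ) = volume S := by
      rw [← ENNReal.rpow_add _ _ h0 hSt]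
      convert ENNReal.rpow_one _ using 2
      field_simp
      ring
    have h4 : s * volume S ^ (((n : ℝ) - 1) / n) * volume S ^ (1 / n : ℝ) ≤
        C * σ Set.univ * volume S ^ (1 / n : ℝ) := by rwa [mul_assoc, h3]
    exact (ENNReal.mul_le_mul_iff_left (by simp [ENNReal.rpow_eq_zero_iff, h0, hSt])
      (ENNReal.rpow_ne_top_of_nonneg (by positivity) hSt)).1 h4
  calc _ = (s * volume S ^ (((n : ℝ) - 1) / n)) ^ ((n : ℝ) / (n - 1)) := by
        rw [ENNReal.mul_rpow_of_nonneg _ _ (by positivity), ← ENNReal.rpow_mul]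
        congr 1
        rw [div_mul_div_cancel₀ (by positivity), div_self hn0.ne', ENNReal.rpow_one]
    _ ≤ _ := by gcongr

theorem KK_zpow_smul (hA : IsElliptic n 1 A) (l : ℤ) (z : Euc n) :
    KK hA (((2 : ℝ) ^ l)⁻¹ • z) = ((2 : ℝ) ^ l) ^ (n - 1) • KK hA z := by
  by_cases hz : z = 0
  · simp [hz, KK]
  have hz' : ((2 : ℝ) ^ l)⁻¹ • z ≠ 0 := smul_ne_zero (by positivity) hz
  rw [KK, KK, if_neg hz, if_neg hz', ← tsum_const_smul'']
  rw [← (Equiv.addRight l).tsum_eq fun j => kj hA j (((2 : ℝ) ^ l)⁻¹ • z)]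
  refine tsum_congr fun j => ?_
  simp only [kj, dy, Equiv.coe_addRight]
  rw [zpow_add₀ two_ne_zero, smul_smul, smul_smul, ← mul_pow, mul_inv_cancel_right₀ (by positivity),
    mul_comm]

theorem exists_volume_KK_ne_zero (hn : 1 < n) (hA : IsElliptic n 1 A) {w : W} (hw1 : ‖w‖ = 1)
    (hw : ∀ ξ ≠ 0, w ∈ LinearMap.range (symbolMap n 1 A ξ)) :
    ∃ t₀ R : ℝ, 0 < t₀ ∧ 0 < R ∧ volume {z | t₀ < ‖KK hA z w‖ ∧ ‖z‖ < R} ≠ 0 := by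
  by_contra! hc
  have h1 : ∀ᵐ z, KK hA z w = 0 := by
    have : ∀ k : ℕ, ∀ᵐ z, ¬(1 / ((k : ℝ) + 1) < ‖KK hA z w‖ ∧ ‖z‖ < k + 1) := fun k => by
      rw [ae_iff]
      simpa using hc (1 / ((k : ℝ) + 1)) (k + 1) (by positivity) (by positivity)
    filter_upwards [ae_all_iff.2 this] with z hz
    by_contra h0
    obtain ⟨a, ha⟩ := exists_nat_one_div_lt (norm_pos_iff.2 h0)
    obtain ⟨b, hb⟩ := exists_nat_gt ‖z‖
    refine hz (max a b) ⟨lt_of_le_of_lt ?_ ha, hb.trans_le ?_⟩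
    · gcongr
      exact le_max_left _ _
    · push_cast
      linarith [le_max_right (a : ℝ) b]
  have h2 := hasDistribA_pot_const hn hA hw (Measure.dirac 0)
  rw [hasDistribA_iff] at h2
  let χ : ContDiffBump (0 : Euc n) := ⟨1, 2, by norm_num, by norm_num⟩
  have h3 := h2 (fun x => χ x • w) ⟨χ.contDiff.smul contDiff_const, χ.hasCompactSupport.smul_right⟩
  rw [integral_dirac] at h3
  have h4 : χ (0 : Euc n) = 1 := χ.one_of_mem_closedBall (by simp [χ])
  rw [h4, one_smul, real_inner_self_eq_norm_sq, hw1] at h3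
  have h5 : ∀ i, ∫ x, ⟪coef A i (pot hA (Measure.dirac 0) (fun _ => w) x),
      fderiv ℝ (fun x => χ x • w) x (stdVec n i)⟫ = 0 := fun i => by
    refine integral_eq_zero_of_ae ?_
    filter_upwards [h1] with x hx
    simp [pot, hx]
  simp [h5] at h3

theorem exists_volume_KK_ge (hn : 1 < n) (hA : IsElliptic n 1 A) {w : W} (hw1 : ‖w‖ = 1)
    (hw : ∀ ξ ≠ 0, w ∈ LinearMap.range (symbolMap n 1 A ξ)) :
    ∃ c : ℝ≥0∞, c ≠ 0 ∧ c ≠ ⊤ ∧ ∀ ρ > 0, ∃ T > 0, ∀ t > T,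
      c ≤ ENNReal.ofReal t ^ ((n : ℝ) / (n - 1)) * volume {z | t < ‖KK hA z w‖ ∧ ‖z‖ < ρ} := by
  have hn' : (1 : ℝ) < n := by exact_mod_cast hn
  have hn0 : (0 : ℝ) < (n : ℝ) - 1 := by linarith
  obtain ⟨t₀, R, ht₀, hR, ha⟩ := exists_volume_KK_ne_zero hn hA hw1 hw
  set E : Set (Euc n) := {z | t₀ < ‖KK hA z w‖ ∧ ‖z‖ < R} with hE
  have hEt : volume E ≠ ⊤ := ne_top_of_le_ne_top (measure_ball_lt_top (x := 0) (r := R)).ne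
    (measure_mono fun z hz => by simpa using hz.2)
  refine ⟨ENNReal.ofReal (t₀ ^ ((n : ℝ) / (n - 1)) * ((2 : ℝ) ^ n)⁻¹) * volume E, ?_, ?_,
    fun ρ hρ => ⟨t₀ * (1 + (R / ρ) ^ (n - 1)), by positivity, fun t ht => ?_⟩⟩
  · refine mul_ne_zero ?_ ha
    simp only [ne_eq, ENNReal.ofReal_eq_zero, not_le]
    positivity
  · exact ENNReal.mul_ne_top (by simp) hEt
  have ht0 : 0 < t := lt_trans (by positivity) ht
  have ht1 : 1 + (R / ρ) ^ (n - 1) < t / t₀ := by rwa [lt_div_iff₀' ht₀]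
  have hRρ : 0 ≤ (R / ρ) ^ (n - 1) := by positivity
  obtain ⟨i, hi1, hi2⟩ := exists_nat_pow_near (x := t / t₀) (y := (2 : ℝ) ^ (n - 1)) (by linarith)
    (one_lt_pow₀ (by norm_num) (by omega))
  rw [← pow_mul, mul_comm, pow_mul] at hi1 hi2
  set a : ℝ := (2 : ℝ) ^ (i + 1) with hadef
  have ha0 : 0 < a := by positivity
  have hRa : R / ρ < a := lt_of_pow_lt_pow_left₀ (n - 1) ha0.le (by linarith)
  have hsub : (fun z => a⁻¹ • z) '' E ⊆ {z | t < ‖KK hA z w‖ ∧ ‖z‖ < ρ} := by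
    rintro _ ⟨z, hz, rfl⟩
    have hk := KK_zpow_smul hA ((i + 1 : ℕ) : ℤ) z
    rw [zpow_natCast, ← hadef] at hk
    refine ⟨?_, ?_⟩
    · simp only [hk, _root_.smul_apply, norm_smul, Real.norm_of_nonneg (pow_nonneg ha0.le _)]
      rw [div_lt_iff₀ ht₀] at hi2
      refine hi2.trans_le ?_
      gcongr
      exact hz.1.le
    · simp only [norm_smul, norm_inv, Real.norm_of_nonneg ha0.le]
      rw [inv_mul_lt_iff₀ ha0]
      rw [div_lt_iff₀ hρ] at hRa
      exact hz.2.trans hRa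
  refine le_trans ?_ (mul_le_mul_right (measure_mono hsub) _)
  rw [Set.image_smul, Measure.addHaar_smul, finrank_euclideanSpace_fin, ENNReal.ofReal_rpow_of_pos ht0, ← mul_assoc,
    ← ENNReal.ofReal_mul (by positivity), abs_of_nonneg (by positivity)]
  refine mul_le_mul_left (ENNReal.ofReal_le_ofReal ?_) _
  have h5 : a ^ n ≤ 2 ^ n * (t / t₀) ^ ((n : ℝ) / (n - 1)) := by
    have h6 : (((2 : ℝ) ^ i) ^ (n - 1)) ^ ((n : ℝ) / (n - 1)) = ((2 : ℝ) ^ i) ^ n := by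
      rw [← Real.rpow_natCast, ← Real.rpow_mul (by positivity), Nat.cast_sub hn.le, Nat.cast_one,
        mul_div_cancel₀ _ hn0.ne', Real.rpow_natCast]
    rw [hadef, pow_succ, mul_pow, ← h6, mul_comm]
    gcongr
  rw [Real.div_rpow ht0.le ht₀.le, ← mul_div_assoc, le_div_iff₀ (by positivity)] at h5
  rw [inv_pow, ← div_eq_mul_inv, ← div_eq_mul_inv, div_le_div_iff₀ (by positivity) (by positivity)]
  linarith

theorem volume_pot_ge (hn : 1 < n) (hA : IsElliptic n 1 A) {w : W} (hw1 : ‖w‖ = 1)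
    (hw : ∀ ξ ≠ 0, w ∈ LinearMap.range (symbolMap n 1 A ξ)) (ν : Measure (Euc n))
    [IsFiniteMeasure ν] {x₀ : Euc n} (hx₀ : ν {x₀} ≠ 0) {r : ℝ} (hr : 0 < r) (M : ℝ) :
    ∃ c : ℝ≥0∞, c ≠ 0 ∧ ∃ T > 0, ∀ t > T, c ≤ ENNReal.ofReal t ^ ((n : ℝ) / (n - 1)) *
      volume {z | t + M < ‖pot hA ν (fun _ => w) z‖ ∧ z ∈ ball x₀ r} := by
  have hn' : (1 : ℝ) < n := by exact_mod_cast hn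
  have hn0 : (0 : ℝ) < (n : ℝ) - 1 := by linarith
  obtain ⟨c, hc0, hct, hc⟩ := exists_volume_KK_ge hn hA hw1 hw
  obtain ⟨C, hC, hCr⟩ := exists_volume_riesz_le n hn
  obtain ⟨D, hD, hDK⟩ := exists_enorm_pot_le hn hA
  set p : ℝ := (n : ℝ) / (n - 1) with hp
  have hp0 : 0 < p := by positivity
  set m : ℝ := (ν {x₀}).toReal with hm
  have hm0 : 0 < m := ENNReal.toReal_pos hx₀ (measure_ne_top _ _)
  have hc' : c * ENNReal.ofReal (m / 4) ^ p / 2 ≠ 0 := by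
    simp [hc0, ENNReal.rpow_eq_zero_iff, hm0]
  obtain ⟨ρ, hρ, hρr, hsmall⟩ : ∃ ρ > 0, ρ < r ∧
      (C * (D * ν (ball x₀ (2 * ρ) \ {x₀}))) ^ p ≤ c * ENNReal.ofReal (m / 4) ^ p / 2 := by
    have h1 : Tendsto (fun k : ℕ => ν (ball x₀ (2 * (r / (k + 2))) \ {x₀})) atTop (𝓝 0) := by
      have h2 := tendsto_measure_iInter_atTop (μ := ν)
        (s := fun k : ℕ => ball x₀ (2 * (r / (k + 2))) \ {x₀})
        (fun k => (measurableSet_ball.diff (measurableSet_singleton _)).nullMeasurableSet)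
        (fun a b hab => Set.sdiff_subset_sdiff_left (ball_subset_ball (by gcongr)))
        ⟨0, measure_ne_top _ _⟩
      suffices h3 : ⋂ k : ℕ, ball x₀ (2 * (r / (k + 2))) \ {x₀} = ∅ by
        rw [h3, measure_empty] at h2
        exact h2
      refine Set.eq_empty_of_forall_notMem fun z hz => ?_
      rw [Set.mem_iInter] at hz
      have hz0 : 0 < dist z x₀ := dist_pos.2 (hz 0).2
      obtain ⟨k, hk⟩ := exists_nat_gt (2 * r / dist z x₀)
      have h3 := mem_ball.1 (hz k).1
      rw [← mul_div_assoc, lt_div_iff₀ (by positivity)] at h3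
      rw [div_lt_iff₀ hz0] at hk
      nlinarith
    have h2 : Tendsto (fun k : ℕ => (C * (D * ν (ball x₀ (2 * (r / (k + 2))) \ {x₀}))) ^ p) atTop
        (𝓝 ((C * (D * 0)) ^ p)) :=
      ((ENNReal.continuous_rpow_const.tendsto _).comp (ENNReal.Tendsto.const_mul
        (ENNReal.Tendsto.const_mul h1 (Or.inr hD)) (Or.inr hC)))
    rw [mul_zero, mul_zero, ENNReal.zero_rpow_of_pos hp0] at h2
    obtain ⟨k, hk⟩ := (h2.eventually (eventually_lt_nhds (pos_iff_ne_zero.2 hc'))).exists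
    refine ⟨r / (k + 2), by positivity, ?_, hk.le⟩
    rw [div_lt_iff₀ (by positivity)]
    nlinarith [(k.cast_nonneg : (0 : ℝ) ≤ k)]
  obtain ⟨T, hT, hTc⟩ := hc ρ hρ
  set near : Set (Euc n) := ball x₀ (2 * ρ) \ {x₀} with hnear
  have hnearm : MeasurableSet near := measurableSet_ball.diff (measurableSet_singleton _)
  set Fρ : ℝ≥0∞ := D * (ENNReal.ofReal ρ ^ (1 - n : ℝ) * ν Set.univ) with hFρ
  have hFt : Fρ ≠ ⊤ := ENNReal.mul_ne_top hD (ENNReal.mul_ne_top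
    (ENNReal.rpow_ne_top_of_ne_zero (by simpa using hρ) (by simp)) (measure_ne_top _ _))
  refine ⟨_, hc', max T (max (T * m) (max M Fρ.toReal)), lt_max_of_lt_left hT, fun t ht => ?_⟩
  obtain ⟨htT, ht1, htM, htF⟩ : T < t ∧ T * m < t ∧ M < t ∧ Fρ.toReal < t := by
    simpa only [gt_iff_lt, max_lt_iff] using ht
  have ht0 : 0 < t := hT.trans htT
  set big : Set (Euc n) := {y | 4 * t / m < ‖KK hA (y - x₀) w‖ ∧ ‖y - x₀‖ < ρ} with hbig
  set N : Set (Euc n) := {y | ENNReal.ofReal t ≤ riesz (D • ν.restrict near) (fun _ => 1) y} ∩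
    ball x₀ ρ with hN
  have hNm : MeasurableSet N := by
    refine (measurableSet_le measurable_const ?_).inter measurableSet_ball
    unfold riesz
    refine Measurable.lintegral_prod_right' (f := fun q : Euc n × Euc n =>
      ‖q.1 - q.2‖ₑ ^ (1 - n : ℝ) * 1) ?_
    fun_prop
  have hNv : ENNReal.ofReal t ^ p * volume N ≤ c * ENNReal.ofReal (m / 4) ^ p / 2 := by
    refine (hCr (D • ν.restrict near) N hNm
      (ne_top_of_le_ne_top measure_ball_lt_top.ne (measure_mono Set.inter_subset_right))
      _ ENNReal.ofReal_ne_top fun x hx => hx.1).trans ?_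
    simpa using hsmall
  have hbigv : c * ENNReal.ofReal (m / 4) ^ p ≤ ENNReal.ofReal t ^ p * volume big := by
    have h1 := hTc (4 * t / m) (by rw [gt_iff_lt, lt_div_iff₀ hm0]; linarith)
    have h2 : volume big = volume {z | 4 * t / m < ‖KK hA z w‖ ∧ ‖z‖ < ρ} := by
      rw [← measure_preimage_add_right volume (-x₀)
        {z | 4 * t / m < ‖KK hA z w‖ ∧ ‖z‖ < ρ}]
      simp [hbig, sub_eq_add_neg]
    rw [h2]
    have h3 : ENNReal.ofReal (4 * t / m) * ENNReal.ofReal (m / 4) = ENNReal.ofReal t := by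
      rw [← ENNReal.ofReal_mul (by positivity)]
      congr 1
      field_simp
    rw [← h3, ENNReal.mul_rpow_of_nonneg _ _ hp0.le, mul_right_comm]
    gcongr
  have hsub : big \ N ≤ᵐ[volume] {z | t + M < ‖pot hA ν (fun _ => w) z‖ ∧ z ∈ ball x₀ r} := by
    filter_upwards [ae_riesz_ne_top hn ν (g := fun _ => 1) aemeasurable_const (by simp)]
      with y hy hyb
    obtain ⟨⟨hy1, hy2⟩, hyN⟩ := hyb
    have hyρ : y ∈ ball x₀ ρ := by rwa [mem_ball_iff_norm]
    have hw1e : ‖w‖ₑ = 1 := by rw [← ofReal_norm, hw1, ENNReal.ofReal_one]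
    have hgm : StronglyMeasurable fun z => KK hA (y - z) w :=
      (ContinuousLinearMap.apply ℝ V w).continuous.comp_stronglyMeasurable
        ((stronglyMeasurable_KK hn hA).comp_measurable (by fun_prop))
    have hgi : Integrable (fun z => KK hA (y - z) w) ν := by
      refine ⟨hgm.aestronglyMeasurable, lt_of_le_of_lt (hDK ν (fun _ => w) y).1 ?_⟩
      simp only [hw1e]
      exact ENNReal.mul_lt_top hD.lt_top hy.lt_top
    have hne : ∫⁻ z in near, ‖KK hA (y - z) w‖ₑ ∂ν < ENNReal.ofReal t := by
      refine lt_of_le_of_lt (hDK (ν.restrict near) (fun _ => w) y).1 ?_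
      have h1 : ¬ ENNReal.ofReal t ≤ riesz (D • ν.restrict near) (fun _ => 1) y := fun h =>
        hyN ⟨h, hyρ⟩
      rw [not_le, riesz, lintegral_smul_measure, smul_eq_mul] at h1
      simpa only [hw1e, riesz] using h1
    have hfar : ∫⁻ z in (ball x₀ (2 * ρ))ᶜ, ‖KK hA (y - z) w‖ₑ ∂ν < ENNReal.ofReal t := by
      refine lt_of_le_of_lt ((hDK (ν.restrict (ball x₀ (2 * ρ))ᶜ) (fun _ => w) y).1.trans ?_)
        ((ENNReal.lt_ofReal_iff_toReal_lt hFt).2 htF)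
      rw [hFρ, riesz]
      refine mul_le_mul_right ?_ _
      calc ∫⁻ z in (ball x₀ (2 * ρ))ᶜ, ‖y - z‖ₑ ^ (1 - n : ℝ) * ‖w‖ₑ ∂ν
          ≤ ∫⁻ z in (ball x₀ (2 * ρ))ᶜ, ENNReal.ofReal ρ ^ (1 - n : ℝ) ∂ν := by
            refine setLIntegral_mono' measurableSet_ball.compl fun z hz => ?_
            rw [hw1e, mul_one]
            refine enorm_rpow_anti (by linarith) ?_
            rw [Set.mem_compl_iff, mem_ball, not_lt] at hz
            rw [mem_ball] at hyρ
            rw [← ofReal_norm, ← dist_eq_norm]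
            refine ENNReal.ofReal_le_ofReal ?_
            linarith [dist_triangle z y x₀, dist_comm z y]
        _ ≤ _ := by
            rw [lintegral_const]
            gcongr
            exact Measure.restrict_le_self
    have hrest : ‖∫ z in {x₀}ᶜ, KK hA (y - z) w ∂ν‖ < t + t := by
      rw [← ENNReal.ofReal_lt_ofReal_iff (by positivity), ofReal_norm]
      refine lt_of_le_of_lt (enorm_integral_le_lintegral_enorm _) ?_
      have h1 : ({x₀}ᶜ : Set (Euc n)) ⊆ near ∪ (ball x₀ (2 * ρ))ᶜ := fun z hz => by
        by_cases hz' : z ∈ ball x₀ (2 * ρ)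
        · exact Or.inl ⟨hz', hz⟩
        · exact Or.inr hz'
      refine lt_of_le_of_lt ((lintegral_mono_set h1).trans (lintegral_union_le _ _ _)) ?_
      rw [ENNReal.ofReal_add ht0.le ht0.le]
      exact ENNReal.add_lt_add hne hfar
    have hmain : 4 * t < ‖∫ z in {x₀}, KK hA (y - z) w ∂ν‖ := by
      rw [integral_singleton, norm_smul, Measure.real, ← hm, Real.norm_of_nonneg hm0.le]
      rwa [div_lt_iff₀' hm0] at hy1
    refine ⟨?_, ball_subset_ball hρr.le hyρ⟩
    have h1 := integral_add_compl (measurableSet_singleton x₀) hgi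
    simp only [pot]
    rw [← h1]
    have h2 := norm_sub_le_norm_add (∫ z in {x₀}, KK hA (y - z) w ∂ν)
      (∫ z in {x₀}ᶜ, KK hA (y - z) w ∂ν)
    linarith
  calc c * ENNReal.ofReal (m / 4) ^ p / 2
      = c * ENNReal.ofReal (m / 4) ^ p - c * ENNReal.ofReal (m / 4) ^ p / 2 := by
        rw [ENNReal.sub_half]
        exact ENNReal.mul_ne_top hct (by finiteness)
    _ ≤ ENNReal.ofReal t ^ p * volume big - ENNReal.ofReal t ^ p * volume N := by gcongr
    _ = ENNReal.ofReal t ^ p * (volume big - volume N) :=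
        (ENNReal.mul_sub fun _ _ => by finiteness).symm
    _ ≤ ENNReal.ofReal t ^ p * volume (big \ N) := by
        gcongr
        exact le_measure_sdiff
    _ ≤ _ := mul_le_mul_right (measure_mono_ae hsub) _

theorem exists_not_differentiable_of_not_canceling (hn : 1 < n) (hA : IsElliptic n 1 A)
    (hC : ¬ IsCanceling n 1 A) {q : ℝ} (hq : 0 < q) :
    ∃ u, MemBVAloc n 1 A u ∧ ∀ x, ¬ MemTLorentz n 1 ((n : ℝ) / ((n : ℝ) - 1)) q u x := by
  have hn' : (1 : ℝ) < n := by exact_mod_cast hn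
  have hn0 : (0 : ℝ) < (n : ℝ) - 1 := by linarith
  obtain ⟨w, hw1, hw⟩ := exists_mem_range_of_not_isCanceling hC
  set ν : Measure (Euc n) := Measure.sum fun k : ℕ =>
    (2 : ℝ≥0∞)⁻¹ ^ k • Measure.dirac (TopologicalSpace.denseSeq (Euc n) k) with hν
  have hνu : ν Set.univ = 2 := by
    simp [hν, Measure.sum_apply]
  have hfin : IsFiniteMeasure ν := ⟨by simp [hνu]⟩
  refine ⟨pot hA ν fun _ => w, ⟨locallyIntegrable_pot hn hA (integrable_const w), ν, fun _ => w,
    inferInstance, locallyIntegrable_const w, by simp [hw1],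
    hasDistribA_pot_const hn hA hw ν⟩, fun x => ?_⟩
  refine not_memTLorentz (by positivity) hq fun r hr M => ?_
  obtain ⟨k, hk⟩ := (TopologicalSpace.denseRange_denseSeq (Euc n)).exists_mem_open
    isOpen_ball ⟨x, mem_ball_self (half_pos hr)⟩
  have hνk : ν {TopologicalSpace.denseSeq (Euc n) k} ≠ 0 := by
    rw [hν, Measure.sum_apply _ (measurableSet_singleton _)]
    refine (ENNReal.summable.tsum_ne_zero_iff).2 ⟨k, ?_⟩
    simp
  obtain ⟨c, hc, T, hT, h⟩ := volume_pot_ge hn hA hw1 hw ν hνk (half_pos hr) M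
  refine ⟨c ^ (1 / ((n : ℝ) / (n - 1))), ?_, T, hT, fun t ht => ?_⟩
  · rw [ne_eq, ENNReal.rpow_eq_zero_iff, not_or]
    exact ⟨fun h => hc h.1, fun h => absurd h.2 (not_lt.2 (by positivity))⟩
  · refine (ENNReal.rpow_le_rpow (h t ht) (by positivity)).trans ?_
    rw [ENNReal.mul_rpow_of_nonneg _ _ (by positivity), ← ENNReal.rpow_mul,
      mul_one_div_cancel (by positivity), ENNReal.rpow_one]
    gcongr
    intro z hz
    refine ⟨?_, hz.1⟩
    rw [mem_ball] at hk ⊢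
    have h1 := mem_ball.1 hz.2
    linarith [dist_triangle z (TopologicalSpace.denseSeq (Euc n) k) x]

end NotCanceling

section Taylor

open scoped SchwartzMap

variable {n : ℕ} {E : Type*} [NormedAddCommGroup E] [NormedSpace ℝ E]

theorem exists_tsum_wt_real_le {m : ℕ} (hm : 0 < m) (hm' : m < 2 * n) :
    ∃ C : ℝ, 0 ≤ C ∧ ∀ a : Euc n, a ≠ 0 →
      Summable (fun j : ℤ => ((2 : ℝ) ^ j) ^ m * wt n ((2 : ℝ) ^ j • a)) ∧
      ∑' j : ℤ, ((2 : ℝ) ^ j) ^ m * wt n ((2 : ℝ) ^ j • a) ≤ C * (‖a‖ ^ m)⁻¹ := by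
  obtain ⟨C, hC, h⟩ := tsum_wt_le' (n := n) (m := m) (by exact_mod_cast hm) (by exact_mod_cast hm')
  refine ⟨C.toReal, ENNReal.toReal_nonneg, fun a ha => ?_⟩
  have h0 : ∀ j : ℤ, 0 ≤ ((2 : ℝ) ^ j) ^ m * wt n ((2 : ℝ) ^ j • a) := fun j =>
    mul_nonneg (by positivity) (wt_pos _).le
  have h1 : ∑' j : ℤ, ENNReal.ofReal (((2 : ℝ) ^ j) ^ m * wt n ((2 : ℝ) ^ j • a))
      ≤ C * ‖a‖ₑ ^ (-(m : ℝ)) := by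
    refine (le_of_eq (tsum_congr fun j => ?_)).trans (h a)
    rw [ENNReal.ofReal_mul (by positivity), ofReal_two_zpow_pow]
  have h2 : C * ‖a‖ₑ ^ (-(m : ℝ)) = ENNReal.ofReal (C.toReal * (‖a‖ ^ m)⁻¹) := by
    have : 0 < ‖a‖ := norm_pos_iff.2 ha
    rw [ENNReal.ofReal_mul ENNReal.toReal_nonneg, ENNReal.ofReal_toReal hC, ← ofReal_norm,
      ENNReal.ofReal_rpow_of_pos this, Real.rpow_neg this.le, Real.rpow_natCast]
  rw [h2] at h1
  have h3 : Summable (fun j : ℤ => ((2 : ℝ) ^ j) ^ m * wt n ((2 : ℝ) ^ j • a)) := by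
    have := ENNReal.summable_toReal (ne_top_of_le_ne_top ENNReal.ofReal_ne_top h1)
    simpa only [ENNReal.toReal_ofReal (h0 _)] using this
  refine ⟨h3, ?_⟩
  rw [← ENNReal.ofReal_tsum_of_nonneg h0 h3] at h1
  exact (ENNReal.ofReal_le_ofReal_iff (by positivity)).1 h1

theorem wt_le_of_half_le {a b : Euc n} (h : ‖a‖ / 2 ≤ ‖b‖) : wt n b ≤ 4 ^ n * wt n a := by
  unfold wt
  rw [← div_eq_mul_inv, le_div_iff₀ (by positivity), inv_mul_le_iff₀ (by positivity), mul_comm,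
    ← mul_pow]
  gcongr
  nlinarith [norm_nonneg a]

theorem norm_dy_le' {h : Euc n → E} {C : ℝ} (hC : ∀ x, ‖h x‖ ≤ C * wt n x) (m : ℕ) (j : ℤ)
    (x : Euc n) : ‖dy m h j x‖ ≤ C * (((2 : ℝ) ^ j) ^ m * wt n ((2 : ℝ) ^ j • x)) := by
  unfold dy
  rw [norm_smul, Real.norm_of_nonneg (by positivity)]
  calc _ ≤ ((2 : ℝ) ^ j) ^ m * (C * wt n ((2 : ℝ) ^ j • x)) := by gcongr; exact hC _
    _ = _ := by ring

theorem taylor_dy (hn : 1 ≤ n) {f : Euc n → E} (hf : ContDiff ℝ 2 f) {C : ℝ} (hC0 : 0 ≤ C)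
    (hC : ∀ x, ‖fderiv ℝ (fderiv ℝ f) x‖ ≤ C * wt n x) {a h : Euc n} (hh : ‖h‖ ≤ ‖a‖ / 2)
    (j : ℤ) :
    ‖dy (n - 1) f j (a + h) - dy (n - 1) f j a - dy n (fderiv ℝ f) j a h‖
      ≤ C * 4 ^ n * (((2 : ℝ) ^ j) ^ (n + 1) * wt n ((2 : ℝ) ^ j • a)) * ‖h‖ ^ 2 ∧
    ‖dy n (fderiv ℝ f) j (a + h) - dy n (fderiv ℝ f) j a‖
      ≤ C * 4 ^ n * (((2 : ℝ) ^ j) ^ (n + 1) * wt n ((2 : ℝ) ^ j • a)) * ‖h‖ := by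
  set B := C * 4 ^ n * (((2 : ℝ) ^ j) ^ (n + 1) * wt n ((2 : ℝ) ^ j • a)) with hB
  have hB0 : 0 ≤ B := by have := (wt_pos (n := n) ((2 : ℝ) ^ j • a)).le; positivity
  have hd1 : ∀ x, HasFDerivAt (dy (n - 1) f j) (dy n (fderiv ℝ f) j x) x := fun x => by
    have := hasFDerivAt_dy (hf.differentiable (by norm_num)) (n - 1) j x
    rwa [Nat.sub_add_cancel hn] at this
  have hd2 : ∀ x, HasFDerivAt (dy n (fderiv ℝ f) j) (dy (n + 1) (fderiv ℝ (fderiv ℝ f)) j x) x :=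
    fun x => hasFDerivAt_dy ((hf.fderiv_right (m := 1) (by norm_num)).differentiable
      (by norm_num)) n j x
  have hlow : ∀ x ∈ closedBall a ‖h‖, ‖a‖ / 2 ≤ ‖x‖ := fun x hx => by
    have h1 : ‖a - x‖ ≤ ‖h‖ := by rw [norm_sub_rev]; exact mem_closedBall_iff_norm.1 hx
    have := norm_sub_norm_le a x
    linarith
  have hb2 : ∀ x ∈ closedBall a ‖h‖, ‖dy (n + 1) (fderiv ℝ (fderiv ℝ f)) j x‖ ≤ B := fun x hx => by
    refine (norm_dy_le' hC (n + 1) j x).trans ?_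
    have h1 : wt n ((2 : ℝ) ^ j • x) ≤ 4 ^ n * wt n ((2 : ℝ) ^ j • a) := by
      apply wt_le_of_half_le
      rw [norm_smul, norm_smul, mul_div_assoc]
      have := hlow x hx
      gcongr
    calc _ ≤ C * (((2 : ℝ) ^ j) ^ (n + 1) * (4 ^ n * wt n ((2 : ℝ) ^ j • a))) := by gcongr
      _ = B := by rw [hB]; ring
  have ha : a ∈ closedBall a ‖h‖ := mem_closedBall_self (norm_nonneg _)
  have hah : a + h ∈ closedBall a ‖h‖ := by simp
  have hb1 : ∀ x ∈ closedBall a ‖h‖, ‖dy n (fderiv ℝ f) j x - dy n (fderiv ℝ f) j a‖ ≤ B * ‖h‖ :=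
    fun x hx => by
      refine ((convex_closedBall a ‖h‖).norm_image_sub_le_of_norm_hasFDerivWithin_le
        (fun x _ => (hd2 x).hasFDerivWithinAt) hb2 ha hx).trans ?_
      have := mem_closedBall_iff_norm.1 hx
      gcongr
  refine ⟨?_, hb1 _ hah⟩
  have := (convex_closedBall a ‖h‖).norm_image_sub_le_of_norm_hasFDerivWithin_le'
    (fun x _ => (hd1 x).hasFDerivWithinAt) hb1 ha hah
  rw [add_sub_cancel_left] at this
  linarith [this]

theorem norm_tsum_sub_tsum_le {G : Type*} [NormedAddCommGroup G] {u v : ℤ → G} {b : ℤ → ℝ}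
    (hu : Summable u) (hv : Summable v) (hb : Summable b) (h : ∀ j, ‖u j - v j‖ ≤ b j) :
    ‖∑' j, u j - ∑' j, v j‖ ≤ ∑' j, b j := by
  rw [← hu.tsum_sub hv]
  exact tsum_of_norm_bounded hb.hasSum h

theorem norm_tsum_taylor_le {u v : ℤ → E} {T : ℤ → Euc n →L[ℝ] E} {x : Euc n} {b : ℤ → ℝ}
    (hu : Summable u) (hv : Summable v) (hT : Summable T) (hb : Summable b)
    (h : ∀ j, ‖u j - v j - T j x‖ ≤ b j) :
    ‖∑' j, u j - ∑' j, v j - (∑' j, T j) x‖ ≤ ∑' j, b j := by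
  have e : (∑' j, T j) x = ∑' j, T j x := (ContinuousLinearMap.apply ℝ E x).map_tsum hT
  rw [e, ← hu.tsum_sub hv]
  exact norm_tsum_sub_tsum_le (hu.sub hv) ((ContinuousLinearMap.apply ℝ E x).summable hT) hb h

/-- `K` is a kernel of homogeneity `1 - n` with derivative `DK`, in a quantitative form. -/
structure IsKer (n : ℕ) (C : ℝ) (K : Euc n → E) (DK : Euc n → Euc n →L[ℝ] E) : Prop where
  nonneg : 0 ≤ C
  zero : K 0 = 0
  bound : ∀ a, a ≠ 0 → ‖K a‖ ≤ C * (‖a‖ ^ (n - 1))⁻¹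
  taylor : ∀ a h, a ≠ 0 → ‖h‖ ≤ ‖a‖ / 2 →
    ‖K (a + h) - K a - DK a h‖ ≤ C * ‖h‖ ^ 2 * (‖a‖ ^ (n + 1))⁻¹
  norm_deriv_le : ∀ a h, a ≠ 0 → ‖h‖ ≤ ‖a‖ / 2 →
    ‖DK (a + h) - DK a‖ ≤ C * ‖h‖ * (‖a‖ ^ (n + 1))⁻¹

open scoped Classical in
theorem exists_isKer [CompleteSpace E] (hn : 1 < n) (f : 𝓢(Euc n, E)) : ∃ C,
    IsKer n C (fun z => if z = 0 then 0 else ∑' j : ℤ, dy (n - 1) f j z)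
      (fun z => ∑' j : ℤ, dy n (fderiv ℝ f) j z) := by
  obtain ⟨C, hC0, hC⟩ := exists_norm_fderiv_le_wt f
  obtain ⟨C₁, hC₁0, h₁⟩ := exists_tsum_wt_real_le (n := n) (m := n - 1) (by omega) (by omega)
  obtain ⟨C₂, hC₂0, h₂⟩ := exists_tsum_wt_real_le (n := n) (m := n) (by omega) (by omega)
  obtain ⟨C₃, hC₃0, h₃⟩ := exists_tsum_wt_real_le (n := n) (m := n + 1) (by omega) (by omega)
  have s1 : ∀ a : Euc n, a ≠ 0 → Summable (fun j : ℤ => ‖dy (n - 1) f j a‖) := fun a ha =>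
    Summable.of_nonneg_of_le (fun _ => norm_nonneg _)
      (fun j => norm_dy_le' (fun x => (hC x).1) (n - 1) j a) ((h₁ a ha).1.mul_left C)
  have s2 : ∀ a : Euc n, a ≠ 0 → Summable (fun j : ℤ => dy n (fderiv ℝ f) j a) := fun a ha =>
    Summable.of_norm_bounded ((h₂ a ha).1.mul_left C)
      (fun j => norm_dy_le' (fun x => (hC x).2.1) n j a)
  have hf2 : ContDiff ℝ 2 f := f.smooth 2
  have hne : ∀ a h : Euc n, a ≠ 0 → ‖h‖ ≤ ‖a‖ / 2 → a + h ≠ 0 := fun a h ha hh h0 => by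
    have h1 : h = -a := by rw [eq_neg_iff_add_eq_zero, add_comm]; exact h0
    rw [h1, norm_neg] at hh
    have := norm_pos_iff.2 ha
    linarith
  refine ⟨C * C₁ + C * 4 ^ n * C₃, by positivity, by simp, fun a ha => ?_, fun a h ha hh => ?_,
    fun a h ha hh => ?_⟩
  · rw [if_neg ha]
    refine (norm_tsum_le_tsum_norm (s1 a ha)).trans ?_
    refine ((s1 a ha).tsum_le_tsum (fun j => norm_dy_le' (fun x => (hC x).1) (n - 1) j a)
      ((h₁ a ha).1.mul_left C)).trans ?_
    rw [tsum_mul_left, add_mul]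
    have h4 : 0 ≤ C * 4 ^ n * C₃ * (‖a‖ ^ (n - 1))⁻¹ := by positivity
    have := mul_le_mul_of_nonneg_left (h₁ a ha).2 hC0
    linarith
  · have hah := hne a h ha hh
    rw [if_neg ha, if_neg hah]
    have hs := ((h₃ a ha).1.mul_left (C * 4 ^ n)).mul_right (‖h‖ ^ 2)
    refine (norm_tsum_taylor_le (s1 _ hah).of_norm (s1 _ ha).of_norm (s2 a ha) hs
      fun j => (taylor_dy hn.le hf2 hC0 (fun x => (hC x).2.2) hh j).1).trans ?_
    rw [tsum_mul_right, tsum_mul_left]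
    have := mul_le_mul_of_nonneg_left (h₃ a ha).2 (by positivity : 0 ≤ C * 4 ^ n * ‖h‖ ^ 2)
    have h4 : 0 ≤ C * C₁ * ‖h‖ ^ 2 * (‖a‖ ^ (n + 1))⁻¹ := by positivity
    linarith
  · have hah := hne a h ha hh
    have hs := ((h₃ a ha).1.mul_left (C * 4 ^ n)).mul_right ‖h‖
    refine (norm_tsum_sub_tsum_le (s2 _ hah) (s2 _ ha) hs
      fun j => (taylor_dy hn.le hf2 hC0 (fun x => (hC x).2.2) hh j).2).trans ?_
    rw [tsum_mul_right, tsum_mul_left]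
    have := mul_le_mul_of_nonneg_left (h₃ a ha).2 (by positivity : 0 ≤ C * 4 ^ n * ‖h‖)
    have h4 : 0 ≤ C * C₁ * ‖h‖ * (‖a‖ ^ (n + 1))⁻¹ := by positivity
    linarith

end Taylor

section KernelApply

open scoped SchwartzMap

variable {n : ℕ} {V W : Type*}
  [NormedAddCommGroup V] [InnerProductSpace ℝ V] [FiniteDimensional ℝ V]
  [NormedAddCommGroup W] [InnerProductSpace ℝ W] [FiniteDimensional ℝ W]
  {A : CoeffOp n 1 V W}

theorem exists_isKer_KK_apply (hn : 1 < n) (hA : IsElliptic n 1 A) (w : W) :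
    ∃ C DK, IsKer n C (fun z => KK hA z w) DK := by
  classical
  obtain ⟨C, hC⟩ := exists_isKer hn
    (SchwartzMap.postcompCLM (𝕜 := ℝ) (ContinuousLinearMap.apply ℝ V w) (kap hA))
  refine ⟨C, fun z => ∑' j : ℤ, dy n (fderiv ℝ (SchwartzMap.postcompCLM (𝕜 := ℝ)
    (ContinuousLinearMap.apply ℝ V w) (kap hA))) j z, ?_⟩
  have e : (fun z => KK hA z w) = fun z => if z = 0 then 0 else
      ∑' j : ℤ, dy (n - 1) (SchwartzMap.postcompCLM (𝕜 := ℝ)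
        (ContinuousLinearMap.apply ℝ V w) (kap hA)) j z := by
    funext z
    unfold KK
    split_ifs with hz
    · rfl
    · exact (ContinuousLinearMap.apply ℝ V w).map_tsum (summable_kj hn hA hz)
  rw [e]
  exact hC

end KernelApply

section Averaging

variable {n : ℕ} {E : Type*} [NormedAddCommGroup E] [NormedSpace ℝ E] [CompleteSpace E]

/-- The uniform probability measure on the unit ball. -/
noncomputable def unif (n : ℕ) : Measure (Euc n) :=
  (volume (ball (0 : Euc n) 1))⁻¹ • volume.restrict (ball 0 1)

instance isProbabilityMeasure_unif : IsProbabilityMeasure (unif n) := by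
  refine ⟨?_⟩
  unfold unif
  rw [Measure.smul_apply, Measure.restrict_apply MeasurableSet.univ, Set.univ_inter, smul_eq_mul,
    ENNReal.inv_mul_cancel (measure_ball_pos _ _ one_pos).ne' measure_ball_lt_top.ne]

theorem ae_unif_norm_le : ∀ᵐ ζ ∂(unif n), ‖ζ‖ ≤ 1 := by
  refine Measure.ae_smul_measure ?_ _
  filter_upwards [ae_restrict_mem measurableSet_ball] with ζ hζ
  exact (mem_ball_zero_iff.1 hζ).le

theorem integral_unif_clm (T : Euc n →L[ℝ] E) : ∫ ζ, T ζ ∂(unif n) = 0 := by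
  have h1 : ∫ ζ in ball (0 : Euc n) 1, T ζ = 0 := by
    have h2 := integral_neg_eq_self (fun ζ => (ball (0 : Euc n) 1).indicator T ζ) volume
    have h3 : ∀ ζ, (ball (0 : Euc n) 1).indicator T (-ζ) = -(ball (0 : Euc n) 1).indicator T ζ := by
      intro ζ
      by_cases h : ζ ∈ ball (0 : Euc n) 1
      · rw [Set.indicator_of_mem h, Set.indicator_of_mem (by simpa using h), map_neg]
      · rw [Set.indicator_of_notMem h, Set.indicator_of_notMem (by simpa using h), neg_zero]
    simp_rw [h3] at h2
    rw [integral_neg, integral_indicator measurableSet_ball] at h2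
    have h4 : (2 : ℝ) • ∫ ζ in ball (0 : Euc n) 1, T ζ = 0 := by
      rw [two_smul]
      nth_rewrite 1 [← h2]
      exact neg_add_cancel _
    exact (smul_eq_zero.1 h4).resolve_left two_ne_zero
  unfold unif
  rw [integral_smul_measure, h1, smul_zero]

/-- The difference between a kernel and its average at scale `δ`. -/
noncomputable def avgDiff {G : Type*} [NormedAddCommGroup G] [NormedSpace ℝ G] (K : Euc n → G)
    (δ : ℝ) (a : Euc n) : G :=
  K a - ∫ ζ, K (a - δ • ζ) ∂(unif n)

variable {C : ℝ} {K : Euc n → E} {DK : Euc n → Euc n →L[ℝ] E}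

theorem tendsto_sub_nhds_zero (a : Euc n) : Tendsto (fun b : Euc n => b - a) (𝓝 a) (𝓝 0) := by
  have : Tendsto (fun b : Euc n => b - a) (𝓝 a) (𝓝 (a - a)) :=
    tendsto_id.sub tendsto_const_nhds
  rwa [sub_self] at this

theorem IsKer.eventually (ha : (a : Euc n) ≠ 0) : ∀ᶠ b in 𝓝 a, ‖b - a‖ ≤ ‖a‖ / 2 := by
  have h : 0 < ‖a‖ / 2 := half_pos (norm_pos_iff.2 ha)
  filter_upwards [closedBall_mem_nhds a h] with b hb
  exact mem_closedBall_iff_norm.1 hb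

theorem IsKer.continuousOn (hK : IsKer n C K DK) : ContinuousOn K {0}ᶜ := by
  intro a ha
  have ha : a ≠ 0 := ha
  refine ContinuousAt.continuousWithinAt ?_
  have h0 := (tendsto_sub_nhds_zero a).norm
  rw [norm_zero] at h0
  have h1 : Tendsto (fun b => C * ‖b - a‖ ^ 2 * (‖a‖ ^ (n + 1))⁻¹ + ‖DK a‖ * ‖b - a‖) (𝓝 a)
      (𝓝 0) := by
    have := (((h0.pow 2).const_mul C).mul_const ((‖a‖ ^ (n + 1))⁻¹)).add (h0.const_mul ‖DK a‖)
    simpa using this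
  rw [ContinuousAt, tendsto_iff_norm_sub_tendsto_zero]
  refine squeeze_zero' (Eventually.of_forall fun _ => norm_nonneg _) ?_ h1
  filter_upwards [IsKer.eventually ha] with b hb
  have h2 := hK.taylor a (b - a) ha hb
  rw [add_sub_cancel] at h2
  have h3 := (DK a).le_opNorm (b - a)
  have h4 : K b - K a = (K b - K a - DK a (b - a)) + DK a (b - a) := by abel
  rw [h4]
  exact (norm_add_le _ _).trans (add_le_add h2 h3)

theorem IsKer.continuousOn_deriv (hK : IsKer n C K DK) : ContinuousOn DK {0}ᶜ := by
  intro a ha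
  have ha : a ≠ 0 := ha
  refine ContinuousAt.continuousWithinAt ?_
  have h0 := (tendsto_sub_nhds_zero a).norm
  rw [norm_zero] at h0
  have h1 : Tendsto (fun b => C * ‖b - a‖ * (‖a‖ ^ (n + 1))⁻¹) (𝓝 a) (𝓝 0) := by
    have := ((h0.const_mul C).mul_const ((‖a‖ ^ (n + 1))⁻¹))
    simpa using this
  rw [ContinuousAt, tendsto_iff_norm_sub_tendsto_zero]
  refine squeeze_zero' (Eventually.of_forall fun _ => norm_nonneg _) ?_ h1
  filter_upwards [IsKer.eventually ha] with b hb
  have h2 := hK.norm_deriv_le a (b - a) ha hb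
  rwa [add_sub_cancel] at h2

theorem IsKer.stronglyMeasurable (hK : IsKer n C K DK) : StronglyMeasurable K :=
  hK.continuousOn.stronglyMeasurable_of_countable_compl (by simp)

theorem IsKer.stronglyMeasurable_deriv (hK : IsKer n C K DK) : StronglyMeasurable DK :=
  hK.continuousOn_deriv.stronglyMeasurable_of_countable_compl (by simp)

theorem measurable_sub_smul (a : Euc n) (δ : ℝ) : Measurable fun ζ : Euc n => a - δ • ζ := by
  fun_prop

theorem norm_smul_le_of_le {δ : ℝ} (hδ : 0 < δ) {ζ : Euc n} (h : ‖ζ‖ ≤ 1) : ‖δ • ζ‖ ≤ δ := by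
  rw [norm_smul, Real.norm_of_nonneg hδ.le]
  nlinarith

theorem ne_zero_of_two_mul_le {δ : ℝ} (hδ : 0 < δ) {a : Euc n} (ha : 2 * δ ≤ ‖a‖) : a ≠ 0 :=
  norm_pos_iff.1 (by linarith)

theorem IsKer.norm_sub_shift_le (hK : IsKer n C K DK) {δ : ℝ} (hδ : 0 < δ) {a ζ : Euc n}
    (ha : 2 * δ ≤ ‖a‖) (hζ : ‖ζ‖ ≤ 1) :
    ‖K (a - δ • ζ) - K a + δ • DK a ζ‖ ≤ C * δ ^ 2 * (‖a‖ ^ (n + 1))⁻¹ ∧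
    ‖DK (a - δ • ζ) - DK a‖ ≤ C * δ * (‖a‖ ^ (n + 1))⁻¹ := by
  have h0 := ne_zero_of_two_mul_le hδ ha
  have h1 := norm_smul_le_of_le hδ hζ
  have h2 : ‖-(δ • ζ)‖ ≤ ‖a‖ / 2 := by rw [norm_neg]; linarith
  have h3 := hK.taylor a (-(δ • ζ)) h0 h2
  have h4 := hK.norm_deriv_le a (-(δ • ζ)) h0 h2
  rw [norm_neg] at h3 h4
  rw [map_neg, map_smul, sub_neg_eq_add, ← sub_eq_add_neg] at h3
  rw [← sub_eq_add_neg] at h4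
  have hC := hK.nonneg
  exact ⟨h3.trans (by gcongr), h4.trans (by gcongr)⟩

theorem IsKer.integrable_shift (hK : IsKer n C K DK) {δ : ℝ} (hδ : 0 < δ) {a : Euc n}
    (ha : 2 * δ ≤ ‖a‖) : Integrable (fun ζ => K (a - δ • ζ)) (unif n) ∧
      Integrable (fun ζ => DK (a - δ • ζ)) (unif n) := by
  constructor
  · refine Integrable.of_bound (C := C * δ ^ 2 * (‖a‖ ^ (n + 1))⁻¹ + ‖K a‖ + δ * ‖DK a‖)
      (hK.stronglyMeasurable.comp_measurable (measurable_sub_smul a δ)).aestronglyMeasurable ?_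
    filter_upwards [ae_unif_norm_le] with ζ hζ
    have h1 := (hK.norm_sub_shift_le hδ ha hζ).1
    have h2 : ‖δ • DK a ζ‖ ≤ δ * ‖DK a‖ := by
      rw [norm_smul, Real.norm_of_nonneg hδ.le]
      have h3 := (DK a).le_opNorm ζ
      have h4 := norm_nonneg (DK a)
      gcongr
      nlinarith
    have e : K (a - δ • ζ) = (K (a - δ • ζ) - K a + δ • DK a ζ) + K a - δ • DK a ζ := by abel
    rw [e]
    refine (norm_sub_le _ _).trans ((add_le_add (norm_add_le _ _) h2).trans ?_)
    linarith
  · refine Integrable.of_bound (C := C * δ * (‖a‖ ^ (n + 1))⁻¹ + ‖DK a‖)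
      (hK.stronglyMeasurable_deriv.comp_measurable
        (measurable_sub_smul a δ)).aestronglyMeasurable ?_
    filter_upwards [ae_unif_norm_le] with ζ hζ
    have h1 := (hK.norm_sub_shift_le hδ ha hζ).2
    have := norm_sub_norm_le (DK (a - δ • ζ)) (DK a)
    linarith

theorem integrable_unif_clm (T : Euc n →L[ℝ] E) : Integrable (fun ζ => T ζ) (unif n) := by
  refine Integrable.of_bound (C := ‖T‖) T.continuous.aestronglyMeasurable ?_
  filter_upwards [ae_unif_norm_le] with ζ hζ
  have h3 := T.le_opNorm ζ
  have h4 := norm_nonneg T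
  nlinarith

theorem norm_integral_unif_le {G : Type*} [NormedAddCommGroup G] [NormedSpace ℝ G] {f : Euc n → G}
    {c : ℝ} (h : ∀ ζ, ‖ζ‖ ≤ 1 → ‖f ζ‖ ≤ c) : ‖∫ ζ, f ζ ∂(unif n)‖ ≤ c := by
  have := norm_integral_le_of_norm_le_const (μ := unif n) (f := f) (C := c)
    (by filter_upwards [ae_unif_norm_le] with ζ hζ using h ζ hζ)
  simpa using this

theorem IsKer.norm_avgDiff_le (hK : IsKer n C K DK) {δ : ℝ} (hδ : 0 < δ) {a : Euc n}
    (ha : 2 * δ ≤ ‖a‖) : ‖avgDiff K δ a‖ ≤ C * δ ^ 2 * (‖a‖ ^ (n + 1))⁻¹ := by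
  have h := norm_integral_unif_le (f := fun ζ => K (a - δ • ζ) - K a + δ • DK a ζ)
    fun ζ hζ => (hK.norm_sub_shift_le hδ ha hζ).1
  have h1 := (hK.integrable_shift hδ ha).1
  have h2 : Integrable (fun ζ => δ • DK a ζ) (unif n) := (integrable_unif_clm (DK a)).smul δ
  have h3 : Integrable (fun ζ => K (a - δ • ζ) - K a) (unif n) := h1.sub (integrable_const _)
  rw [integral_add h3 h2,
    integral_sub h1 (integrable_const _), integral_smul, integral_unif_clm, smul_zero,
    add_zero, integral_const, probReal_univ, one_smul] at h
  unfold avgDiff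
  rwa [norm_sub_rev]

theorem IsKer.norm_avgDiff_deriv_le (hK : IsKer n C K DK) {δ : ℝ} (hδ : 0 < δ) {a : Euc n}
    (ha : 2 * δ ≤ ‖a‖) : ‖avgDiff DK δ a‖ ≤ C * δ * (‖a‖ ^ (n + 1))⁻¹ := by
  have h := norm_integral_unif_le (f := fun ζ => DK (a - δ • ζ) - DK a)
    fun ζ hζ => (hK.norm_sub_shift_le hδ ha hζ).2
  have h1 := (hK.integrable_shift hδ ha).2
  rw [integral_sub h1 (integrable_const _), integral_const, probReal_univ, one_smul] at h
  unfold avgDiff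
  rwa [norm_sub_rev]

theorem inv_pow_le_of_half_le {a b : Euc n} (ha : a ≠ 0) (h : ‖a‖ / 2 ≤ ‖b‖) :
    (‖b‖ ^ (n + 1))⁻¹ ≤ 2 ^ (n + 1) * (‖a‖ ^ (n + 1))⁻¹ := by
  have h0 := norm_pos_iff.2 ha
  rw [← div_eq_mul_inv, ← div_pow, ← inv_pow]
  refine pow_le_pow_left₀ (by positivity) ?_ _
  rw [← inv_div]
  exact inv_anti₀ (by positivity) h

theorem IsKer.norm_avgDiff_sub_le (hK : IsKer n C K DK) {δ : ℝ} (hδ : 0 < δ) {a h : Euc n}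
    (ha : 4 * δ ≤ ‖a‖) (hh : ‖h‖ ≤ ‖a‖ / 4) :
    ‖avgDiff K δ (a + h) - avgDiff K δ a - avgDiff DK δ a h‖
      ≤ C * (1 + 2 ^ (n + 1)) * ‖h‖ ^ 2 * (‖a‖ ^ (n + 1))⁻¹ := by
  have ha2 : 2 * δ ≤ ‖a‖ := by linarith
  have h0 := ne_zero_of_two_mul_le hδ ha2
  have hC := hK.nonneg
  have hah : 2 * δ ≤ ‖a + h‖ := by
    have := norm_sub_le (a + h) h
    rw [add_sub_cancel_right] at this
    linarith
  have i1 := (hK.integrable_shift hδ ha2).1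
  have i2 := (hK.integrable_shift hδ ha2).2
  have i3 := (hK.integrable_shift hδ hah).1
  have k := norm_integral_unif_le (f := fun ζ => K (a + h - δ • ζ) - K (a - δ • ζ)
      - DK (a - δ • ζ) h) (c := C * ‖h‖ ^ 2 * (2 ^ (n + 1) * (‖a‖ ^ (n + 1))⁻¹)) fun ζ hζ => by
    have h1 := norm_smul_le_of_le hδ hζ
    have h2 : ‖a‖ * (3 / 4) ≤ ‖a - δ • ζ‖ := by
      have := norm_sub_norm_le a (δ • ζ)
      linarith
    have h3 : a - δ • ζ ≠ 0 := norm_pos_iff.1 (by linarith)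
    have h4 := hK.taylor (a - δ • ζ) h h3 (by linarith [norm_nonneg a])
    rw [show a - δ • ζ + h = a + h - δ • ζ by abel] at h4
    refine h4.trans ?_
    gcongr
    exact inv_pow_le_of_half_le h0 (by linarith [norm_nonneg a])
  have i4 : Integrable (fun ζ => DK (a - δ • ζ) h) (unif n) := i2.apply_continuousLinearMap h
  have i5 : Integrable (fun ζ => K (a + h - δ • ζ) - K (a - δ • ζ)) (unif n) := i3.sub i1
  rw [integral_sub i5 i4, integral_sub i3 i1,
    ContinuousLinearMap.integral_apply i2 h |>.symm] at k
  have k' := hK.taylor a h h0 (by linarith [norm_nonneg a])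
  unfold avgDiff
  have e : (K (a + h) - ∫ ζ, K (a + h - δ • ζ) ∂(unif n)) - (K a - ∫ ζ, K (a - δ • ζ) ∂(unif n))
      - (DK a - ∫ ζ, DK (a - δ • ζ) ∂(unif n)) h
      = (K (a + h) - K a - DK a h) - ((∫ ζ, K (a + h - δ • ζ) ∂(unif n))
        - (∫ ζ, K (a - δ • ζ) ∂(unif n)) - (∫ ζ, DK (a - δ • ζ) ∂(unif n)) h) := by
    rw [_root_.sub_apply]
    abel
  rw [e]
  refine (norm_sub_le _ _).trans ((add_le_add k' k).trans (le_of_eq ?_))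
  ring

theorem lintegral_unif_le (F : Euc n → ℝ≥0∞) :
    ∫⁻ ζ, F ζ ∂(unif n) = (volume (ball (0 : Euc n) 1))⁻¹ * ∫⁻ ζ in ball 0 1, F ζ := by
  unfold unif
  rw [lintegral_smul_measure, smul_eq_mul]

theorem IsKer.enorm_le (hn : 1 < n) (hK : IsKer n C K DK) (a : Euc n) :
    ‖K a‖ₑ ≤ ENNReal.ofReal C * ‖a‖ₑ ^ (1 - n : ℝ) := by
  by_cases ha : a = 0
  · rw [ha, hK.zero, enorm_zero]
    exact zero_le
  · have h0 := norm_pos_iff.2 ha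
    rw [← ofReal_norm, ← ofReal_norm, ENNReal.ofReal_rpow_of_pos h0,
      ← ENNReal.ofReal_mul hK.nonneg]
    refine ENNReal.ofReal_le_ofReal ((hK.bound a ha).trans (le_of_eq ?_))
    rw [show (1 - n : ℝ) = -((n - 1 : ℕ) : ℝ) by rw [Nat.cast_sub hn.le]; simp,
      Real.rpow_neg h0.le, Real.rpow_natCast]

theorem IsKer.exists_lintegral_avgDiff_le (hn : 1 < n) (hK : IsKer n C K DK) :
    ∃ C' : ℝ, 0 ≤ C' ∧ ∀ δ : ℝ, 0 < δ →
      ∫⁻ a, ‖avgDiff K δ a‖ₑ ≤ ENNReal.ofReal (C' * δ) := by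
  have hn1 : (1 : ℝ) < n := by exact_mod_cast hn
  obtain ⟨C₁, hC₁, h₁⟩ := lintegral_ball_sub_enorm_rpow (n := n) hn.le (s := 1 - n) (by linarith)
    (by linarith)
  obtain ⟨C₂, hC₂, h₂⟩ := lintegral_compl_ball_enorm_rpow (n := n) hn.le (s := -(n + 1 : ℝ))
    (by linarith)
  set c := ENNReal.ofReal C with hc
  set D := c * C₁ * 2 + c * C₁ * 2 + c * C₂ with hD
  have hDt : D ≠ ⊤ := by rw [hD, hc]; finiteness
  refine ⟨D.toReal, ENNReal.toReal_nonneg, fun δ hδ => ?_⟩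
  rw [ENNReal.ofReal_mul ENNReal.toReal_nonneg, ENNReal.ofReal_toReal hDt]
  have hδ0 : ENNReal.ofReal δ ≠ 0 := by simpa using hδ
  have near : ∀ y : Euc n, ∫⁻ a in ball (0 : Euc n) (2 * δ), ‖K (a - y)‖ₑ
      ≤ c * C₁ * 2 * ENNReal.ofReal δ := fun y => by
    calc _ ≤ ∫⁻ a in ball (0 : Euc n) (2 * δ), c * ‖a - y‖ₑ ^ (1 - n : ℝ) :=
          lintegral_mono fun a => hK.enorm_le hn _
      _ = c * ∫⁻ a in ball (0 : Euc n) (2 * δ), ‖a - y‖ₑ ^ (1 - n : ℝ) :=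
          lintegral_const_mul' _ _ ENNReal.ofReal_ne_top
      _ ≤ c * (C₁ * ENNReal.ofReal (2 * δ) ^ (n + (1 - n) : ℝ)) := by
          gcongr
          exact h₁ 0 y (2 * δ) (by linarith)
      _ = c * C₁ * 2 * ENNReal.ofReal δ := by
          rw [add_sub_cancel, ENNReal.rpow_one, ENNReal.ofReal_mul (by norm_num),
            ENNReal.ofReal_ofNat]
          ring
  have hmeas : Measurable (Function.uncurry fun a ζ : Euc n => ‖K (a - δ • ζ)‖ₑ) := by
    have : Measurable fun p : Euc n × Euc n => p.1 - δ • p.2 := by fun_prop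
    exact (hK.stronglyMeasurable.comp_measurable this).enorm
  have inner : ∫⁻ a in ball (0 : Euc n) (2 * δ), ‖avgDiff K δ a‖ₑ
      ≤ (c * C₁ * 2 + c * C₁ * 2) * ENNReal.ofReal δ := by
    calc _ ≤ ∫⁻ a in ball (0 : Euc n) (2 * δ), (‖K a‖ₑ + ∫⁻ ζ, ‖K (a - δ • ζ)‖ₑ ∂(unif n)) := by
          refine lintegral_mono fun a => enorm_sub_le.trans ?_
          gcongr
          exact enorm_integral_le_lintegral_enorm _
      _ = (∫⁻ a in ball (0 : Euc n) (2 * δ), ‖K a‖ₑ)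
          + ∫⁻ a in ball (0 : Euc n) (2 * δ), ∫⁻ ζ, ‖K (a - δ • ζ)‖ₑ ∂(unif n) :=
          lintegral_add_left hK.stronglyMeasurable.enorm _
      _ = (∫⁻ a in ball (0 : Euc n) (2 * δ), ‖K a‖ₑ)
          + ∫⁻ ζ, (∫⁻ a in ball (0 : Euc n) (2 * δ), ‖K (a - δ • ζ)‖ₑ) ∂(unif n) := by
          rw [lintegral_lintegral_swap hmeas.aemeasurable]
      _ ≤ c * C₁ * 2 * ENNReal.ofReal δ + ∫⁻ _ζ, c * C₁ * 2 * ENNReal.ofReal δ ∂(unif n) := by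
          refine add_le_add ?_ (lintegral_mono fun ζ => near _)
          simpa using near 0
      _ = _ := by
          rw [lintegral_const, measure_univ, mul_one, add_mul]
  have outer : ∫⁻ a in (ball (0 : Euc n) (2 * δ))ᶜ, ‖avgDiff K δ a‖ₑ
      ≤ c * C₂ * ENNReal.ofReal δ := by
    have hb : ∀ a ∈ (ball (0 : Euc n) (2 * δ))ᶜ, ‖avgDiff K δ a‖ₑ
        ≤ c * ENNReal.ofReal δ ^ 2 * ‖a - 0‖ₑ ^ (-(n + 1 : ℝ)) := fun a ha => by
      have ha' : 2 * δ ≤ ‖a‖ := by simpa using ha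
      have h0 : 0 < ‖a‖ := by linarith
      rw [sub_zero, ← ofReal_norm, ← ofReal_norm, ENNReal.ofReal_rpow_of_pos h0, hc,
        ← ENNReal.ofReal_pow hδ.le, ← ENNReal.ofReal_mul hK.nonneg,
        ← ENNReal.ofReal_mul (mul_nonneg hK.nonneg (by positivity))]
      refine ENNReal.ofReal_le_ofReal ((hK.norm_avgDiff_le hδ ha').trans (le_of_eq ?_))
      rw [show (-(n + 1) : ℝ) = -((n + 1 : ℕ) : ℝ) by push_cast; ring,
        Real.rpow_neg h0.le, Real.rpow_natCast]
    calc _ ≤ ∫⁻ a in (ball (0 : Euc n) (2 * δ))ᶜ,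
          c * ENNReal.ofReal δ ^ 2 * ‖a - 0‖ₑ ^ (-(n + 1 : ℝ)) :=
          setLIntegral_mono' measurableSet_ball.compl hb
      _ = c * ENNReal.ofReal δ ^ 2 *
          ∫⁻ a in (ball (0 : Euc n) (2 * δ))ᶜ, ‖a - 0‖ₑ ^ (-(n + 1 : ℝ)) :=
          lintegral_const_mul' _ _ (by finiteness)
      _ ≤ c * ENNReal.ofReal δ ^ 2 * (C₂ * (ENNReal.ofReal δ)⁻¹) := by
          refine mul_le_mul_right ((h₂ 0 (2 * δ) (by linarith)).trans ?_) _
          rw [show (n : ℝ) + -(n + 1) = -1 by ring, ENNReal.rpow_neg_one]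
          gcongr
          linarith
      _ = c * C₂ * ENNReal.ofReal δ * (ENNReal.ofReal δ * (ENNReal.ofReal δ)⁻¹) := by ring
      _ = _ := by rw [ENNReal.mul_inv_cancel hδ0 ENNReal.ofReal_ne_top, mul_one]
  rw [← lintegral_add_compl _ measurableSet_ball, hD, add_mul _ (c * C₂)]
  exact add_le_add inner outer

end Averaging

section Theta

variable {n : ℕ} {E : Type*} [NormedAddCommGroup E] [NormedSpace ℝ E] [CompleteSpace E]
  {C : ℝ} {K : Euc n → E} {DK : Euc n → Euc n →L[ℝ] E}

theorem volume_ball_eq (x : Euc n) {r : ℝ} (hr : 0 < r) :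
    volume (ball x r) = ENNReal.ofReal (r ^ n * (volume (ball (0 : Euc n) 1)).toReal) := by
  rw [Measure.addHaar_ball_of_pos _ _ hr, finrank_euclideanSpace_fin,
    ENNReal.ofReal_mul (by positivity), ENNReal.ofReal_toReal measure_ball_lt_top.ne]

theorem lintegral_ball_le_of_norm_le {f : Euc n → E} {c r : ℝ} (hc : 0 ≤ c) (hr : 0 < r)
    (h : ∀ x, ‖x‖ < r → ‖f x‖ ≤ c) :
    ∫⁻ x in ball (0 : Euc n) r, ‖f x‖ₑ
      ≤ ENNReal.ofReal ((volume (ball (0 : Euc n) 1)).toReal * (c * r ^ n)) := by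
  calc _ ≤ ∫⁻ x in ball (0 : Euc n) r, ENNReal.ofReal c :=
        setLIntegral_mono' measurableSet_ball fun x hx => by
          rw [← ofReal_norm]
          exact ENNReal.ofReal_le_ofReal (h x (mem_ball_zero_iff.1 hx))
    _ = _ := by
        rw [setLIntegral_const, volume_ball_eq _ hr, ← ENNReal.ofReal_mul hc]
        congr 1
        ring

theorem IsKer.exists_lintegral_taylor_avgDiff_le (hn : 1 < n) (hK : IsKer n C K DK) :
    ∃ C' : ℝ, 0 ≤ C' ∧ ∀ (δ : ℝ) (a : Euc n) (r : ℝ), 0 < δ → 4 * δ ≤ ‖a‖ → 0 < r →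
      ∫⁻ h in ball (0 : Euc n) r, ‖avgDiff K δ (a + h) - avgDiff K δ a - avgDiff DK δ a h‖ₑ
        ≤ ENNReal.ofReal (C' * r ^ (n + 1) * (δ * (‖a‖ ^ (n + 1))⁻¹)) ∧
      (4 * r ≤ ‖a‖ →
        ∫⁻ h in ball (0 : Euc n) r, ‖avgDiff K δ (a + h) - avgDiff K δ a - avgDiff DK δ a h‖ₑ
          ≤ ENNReal.ofReal (C' * r ^ (n + 1) * (r * (‖a‖ ^ (n + 1))⁻¹))) := by
  obtain ⟨C₁, hC₁, h₁⟩ := hK.exists_lintegral_avgDiff_le hn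
  have hC := hK.nonneg
  set ω := (volume (ball (0 : Euc n) 1)).toReal with hω
  have hω0 : 0 ≤ ω := ENNReal.toReal_nonneg
  refine ⟨ω * (C * (2 + 2 ^ (n + 1))) + C₁ * 4 ^ (n + 1), by positivity,
    fun δ a r hδ ha hr => ?_⟩
  have ha2 : 2 * δ ≤ ‖a‖ := by linarith
  have h0 := ne_zero_of_two_mul_le hδ ha2
  have h0' := norm_pos_iff.2 h0
  set X := (‖a‖ ^ (n + 1))⁻¹ with hX
  have hX0 : 0 ≤ X := by positivity
  have far : 4 * r ≤ ‖a‖ → ∫⁻ h in ball (0 : Euc n) r,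
      ‖avgDiff K δ (a + h) - avgDiff K δ a - avgDiff DK δ a h‖ₑ
        ≤ ENNReal.ofReal (ω * ((C * (1 + 2 ^ (n + 1)) * r ^ 2 * X) * r ^ n)) := fun har =>
    lintegral_ball_le_of_norm_le (by positivity) hr fun h hh => by
      refine (hK.norm_avgDiff_sub_le hδ ha (by linarith)).trans ?_
      gcongr
  have hS := hK.norm_avgDiff_le hδ ha2
  have hDS : ∀ h : Euc n, ‖h‖ < r → ‖avgDiff DK δ a h‖ ≤ C * δ * X * r := fun h hh => by
    refine ((avgDiff DK δ a).le_opNorm h).trans ?_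
    have := hK.norm_avgDiff_deriv_le hδ ha2
    gcongr
  refine ⟨?_, fun har => (far har).trans (ENNReal.ofReal_le_ofReal ?_)⟩
  swap
  · have e : ω * (C * (1 + 2 ^ (n + 1)) * r ^ 2 * X * r ^ n)
        = ω * (C * (1 + 2 ^ (n + 1))) * r ^ (n + 1) * (r * X) := by ring
    rw [e]
    gcongr ?_ * _ * _
    have : 0 ≤ C₁ * 4 ^ (n + 1) := by positivity
    have : ω * (C * (1 + 2 ^ (n + 1))) ≤ ω * (C * (2 + 2 ^ (n + 1))) := by gcongr; norm_num
    linarith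
  · rcases le_or_gt (4 * r) ‖a‖ with har | har
    · rcases le_or_gt r δ with hrδ | hrδ
      · refine (far har).trans (ENNReal.ofReal_le_ofReal ?_)
        have e : ω * (C * (1 + 2 ^ (n + 1)) * r ^ 2 * X * r ^ n)
            = ω * (C * (1 + 2 ^ (n + 1))) * r ^ (n + 1) * (r * X) := by ring
        rw [e]
        have : 0 ≤ C₁ * 4 ^ (n + 1) := by positivity
        have : ω * (C * (1 + 2 ^ (n + 1))) ≤ ω * (C * (2 + 2 ^ (n + 1))) := by gcongr; norm_num
        gcongr ?_ * _ * (?_ * _)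
        linarith
      · have hp : ∀ h : Euc n, ‖h‖ < r →
            ‖avgDiff K δ (a + h) - avgDiff K δ a - avgDiff DK δ a h‖
              ≤ C * (2 + 2 ^ (n + 1)) * (δ * r * X) := fun h hh => by
          have hlow : ‖a‖ * (3 / 4) ≤ ‖a + h‖ := by
            have := norm_sub_le (a + h) h
            rw [add_sub_cancel_right] at this
            linarith
          have h3 := hK.norm_avgDiff_le hδ (a := a + h) (by linarith)
          have h4 := inv_pow_le_of_half_le h0 (show ‖a‖ / 2 ≤ ‖a + h‖ by linarith)
          have h5 : ‖avgDiff K δ (a + h)‖ ≤ C * (δ * r) * (2 ^ (n + 1) * X) :=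
            h3.trans (by rw [pow_two]; gcongr)
          have h6 : ‖avgDiff K δ a‖ ≤ C * (δ * r) * X := hS.trans (by rw [pow_two]; gcongr)
          have h7 := hDS h hh
          refine (norm_sub_le _ _).trans ((add_le_add_left (norm_sub_le _ _) _).trans ?_)
          calc _ ≤ C * (δ * r) * (2 ^ (n + 1) * X) + C * (δ * r) * X + C * δ * X * r := by gcongr
            _ = _ := by ring
        refine (lintegral_ball_le_of_norm_le (by positivity) hr hp).trans
          (ENNReal.ofReal_le_ofReal ?_)
        have e : ω * (C * (2 + 2 ^ (n + 1)) * (δ * r * X) * r ^ n)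
            = ω * (C * (2 + 2 ^ (n + 1))) * r ^ (n + 1) * (δ * X) := by ring
        rw [e]
        gcongr ?_ * _ * _
        have : 0 ≤ C₁ * 4 ^ (n + 1) := by positivity
        linarith
    · have hδr : δ ≤ r := by linarith
      have hp : ∀ h : Euc n, ‖h‖ < r →
          ‖avgDiff K δ a + avgDiff DK δ a h‖ ≤ C * 2 * (δ * r * X) := fun h hh => by
        have h6 : ‖avgDiff K δ a‖ ≤ C * (δ * r) * X := hS.trans (by rw [pow_two]; gcongr)
        have h7 := hDS h hh
        refine (norm_add_le _ _).trans ?_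
        linarith
      have hq := lintegral_ball_le_of_norm_le (by positivity) hr hp
      have htr : ∫⁻ h in ball (0 : Euc n) r, ‖avgDiff K δ (a + h)‖ₑ ≤ ENNReal.ofReal (C₁ * δ) := by
        refine (setLIntegral_le_lintegral _ _).trans ?_
        rw [lintegral_add_left_eq_self (fun h => ‖avgDiff K δ h‖ₑ) a]
        exact h₁ δ hδ
      calc _ ≤ ∫⁻ h in ball (0 : Euc n) r, (‖avgDiff K δ (a + h)‖ₑ
            + ‖avgDiff K δ a + avgDiff DK δ a h‖ₑ) :=
            lintegral_mono fun h => by rw [sub_sub]; exact enorm_sub_le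
        _ = (∫⁻ h in ball (0 : Euc n) r, ‖avgDiff K δ (a + h)‖ₑ)
            + ∫⁻ h in ball (0 : Euc n) r, ‖avgDiff K δ a + avgDiff DK δ a h‖ₑ := by
            refine lintegral_add_right _ ?_
            exact (continuous_const.add (avgDiff DK δ a).continuous).enorm.measurable
        _ ≤ _ := add_le_add htr hq
        _ ≤ _ := by
            rw [← ENNReal.ofReal_add (by positivity) (by positivity)]
            refine ENNReal.ofReal_le_ofReal ?_
            have h8 : 1 ≤ (4 * r) ^ (n + 1) * X := by
              rw [hX, ← div_eq_mul_inv, one_le_div (by positivity)]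
              gcongr
            have h9 : C₁ * δ ≤ C₁ * δ * ((4 * r) ^ (n + 1) * X) :=
              le_mul_of_one_le_right (by positivity) h8
            have h10 : 0 ≤ ω * (C * 2 ^ (n + 1)) * r ^ (n + 1) * (δ * X) := by positivity
            have e : (ω * (C * (2 + 2 ^ (n + 1))) + C₁ * 4 ^ (n + 1)) * r ^ (n + 1) * (δ * X)
              = C₁ * δ * ((4 * r) ^ (n + 1) * X) + ω * (C * 2 * (δ * r * X) * r ^ n)
                + ω * (C * 2 ^ (n + 1)) * r ^ (n + 1) * (δ * X) := by rw [mul_pow]; ring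
            rw [e]
            linarith

end Theta

section LOneDiff

variable {n : ℕ} {E : Type*} [NormedAddCommGroup E] [NormedSpace ℝ E]

/-- `L¹`-differentiability at a point. -/
def L1Diff (u : Euc n → E) (x : Euc n) : Prop :=
  ∃ (a : E) (L : Euc n →L[ℝ] E),
    Tendsto (fun r => (∫⁻ h in ball (0 : Euc n) r, ‖u (x + h) - a - L h‖ₑ)
      / ENNReal.ofReal (r ^ (n + 1))) (𝓝[>] 0) (𝓝 0)

theorem L1Diff.add {u v : Euc n → E} {x : Euc n} (hu : L1Diff u x) (hv : L1Diff v x)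
    (hum : AEStronglyMeasurable u volume) : L1Diff (u + v) x := by
  obtain ⟨a, L, h⟩ := hu
  obtain ⟨b, M, k⟩ := hv
  refine ⟨a + b, L + M, tendsto_of_tendsto_of_tendsto_of_le_of_le tendsto_const_nhds
    (by simpa using h.add k) (fun _ => zero_le) fun r => ?_⟩
  simp only
  rw [← ENNReal.add_div]
  gcongr
  rw [← lintegral_add_left']
  · refine lintegral_mono fun z => ?_
    simp only [Pi.add_apply, _root_.add_apply]
    refine le_trans (le_of_eq ?_) (enorm_add_le _ _)
    congr 1
    abel
  · have : AEStronglyMeasurable (fun z => u (x + z)) volume :=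
      hum.comp_measurePreserving (measurePreserving_add_left volume x)
    exact (((this.sub aestronglyMeasurable_const).sub
      L.continuous.aestronglyMeasurable).enorm).restrict

theorem L1Diff.neg {u : Euc n → E} {x : Euc n} (hu : L1Diff u x) : L1Diff (-u) x := by
  obtain ⟨a, L, h⟩ := hu
  refine ⟨-a, -L, h.congr fun r => ?_⟩
  congr 1
  refine lintegral_congr fun z => ?_
  rw [← enorm_neg]
  congr 1
  simp only [Pi.neg_apply, _root_.neg_apply]
  abel

theorem L1Diff.congr {u v : Euc n → E} {x : Euc n} (hu : L1Diff u x) {s : Set (Euc n)}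
    (hs : s ∈ 𝓝 x) (h : ∀ᵐ y, y ∈ s → u y = v y) : L1Diff v x := by
  obtain ⟨a, L, hL⟩ := hu
  obtain ⟨ρ, hρ, hρs⟩ := Metric.mem_nhds_iff.1 hs
  refine ⟨a, L, hL.congr' ?_⟩
  filter_upwards [Ioo_mem_nhdsGT hρ] with r hr
  congr 1
  refine setLIntegral_congr_fun_ae measurableSet_ball ?_
  have h1 : ∀ᵐ z, x + z ∈ s → u (x + z) = v (x + z) :=
    (measurePreserving_add_left volume x).quasiMeasurePreserving.ae h
  filter_upwards [h1] with z hz hzr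
  rw [hz (hρs _)]
  rw [mem_ball_iff_norm, add_sub_cancel_left]
  exact (mem_ball_zero_iff.1 hzr).trans hr.2

theorem L1Diff.zero (x : Euc n) : L1Diff (0 : Euc n → E) x :=
  ⟨0, 0, by simp⟩

end LOneDiff

section BadPart

variable {n : ℕ} {E : Type*} [NormedAddCommGroup E] [NormedSpace ℝ E] [CompleteSpace E]
  {C : ℝ} {K : Euc n → E} {DK : Euc n → Euc n →L[ℝ] E}

theorem stronglyMeasurable_avgDiff {G : Type*} [NormedAddCommGroup G] [NormedSpace ℝ G]
    {K : Euc n → G} (hK : StronglyMeasurable K) :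
    StronglyMeasurable fun p : ℝ × Euc n => avgDiff K p.1 p.2 := by
  refine (hK.comp_measurable measurable_snd).sub ?_
  have : Measurable fun p : (ℝ × Euc n) × Euc n => p.1.2 - p.1.1 • p.2 := by fun_prop
  exact (hK.comp_measurable this).integral_prod_right'

theorem avgDiff_zero {G : Type*} [NormedAddCommGroup G] [NormedSpace ℝ G] [CompleteSpace G]
    (K : Euc n → G) (a : Euc n) : avgDiff K 0 a = 0 := by
  unfold avgDiff
  simp

theorem ae_lintegral_infDist_ne_top (hn : 1 < n) (σ : Measure (Euc n)) [IsFiniteMeasure σ]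
    {F : Set (Euc n)} (hF : MeasurableSet F) :
    ∀ᵐ x, x ∈ F → ∫⁻ y, ENNReal.ofReal (infDist y F) * ‖x - y‖ₑ ^ (-(n + 1 : ℝ)) ∂σ ≠ ⊤ := by
  obtain ⟨C, hC, h⟩ := lintegral_compl_ball_enorm_rpow (n := n) hn.le (s := -(n + 1 : ℝ))
    (by linarith)
  have hm : Measurable (Function.uncurry fun x y : Euc n =>
      ENNReal.ofReal (infDist y F) * ‖x - y‖ₑ ^ (-(n + 1 : ℝ))) := by
    have h1 : Measurable fun p : Euc n × Euc n => infDist p.2 F :=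
      ((continuous_infDist_pt F).comp continuous_snd).measurable
    have h2 : Measurable fun p : Euc n × Euc n => ‖p.1 - p.2‖ₑ ^ (-(n + 1 : ℝ)) := by fun_prop
    exact h1.ennreal_ofReal.mul h2
  have key : ∫⁻ x in F, ∫⁻ y, ENNReal.ofReal (infDist y F) * ‖x - y‖ₑ ^ (-(n + 1 : ℝ)) ∂σ ≠ ⊤ := by
    rw [lintegral_lintegral_swap hm.aemeasurable]
    refine ne_top_of_le_ne_top (b := ∫⁻ _y, C ∂σ) (by simp; finiteness) (lintegral_mono fun y => ?_)
    rw [lintegral_const_mul' _ _ ENNReal.ofReal_ne_top]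
    by_cases hy : infDist y F = 0
    · rw [hy, ENNReal.ofReal_zero, zero_mul]
      exact zero_le
    · have hd : 0 < infDist y F := lt_of_le_of_ne infDist_nonneg (Ne.symm hy)
      have hsub : F ⊆ (ball y (infDist y F))ᶜ := fun x hx hx' => by
        have := infDist_le_dist_of_mem (x := y) hx
        rw [mem_ball, dist_comm] at hx'
        linarith
      calc _ ≤ ENNReal.ofReal (infDist y F) * (C * ENNReal.ofReal (infDist y F)
            ^ ((n : ℝ) + -(n + 1))) :=
            mul_le_mul_right ((lintegral_mono_set hsub).trans (h y _ hd)) _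
        _ = C * (ENNReal.ofReal (infDist y F) * (ENNReal.ofReal (infDist y F))⁻¹) := by
            rw [show (n : ℝ) + -(n + 1) = -1 by ring, ENNReal.rpow_neg_one]
            ring
        _ = C := by
            rw [ENNReal.mul_inv_cancel (by simpa using hd) ENNReal.ofReal_ne_top, mul_one]
  have := ae_lt_top' (hm.lintegral_prod_right').aemeasurable key
  rw [ae_restrict_iff' hF] at this
  filter_upwards [this] with x hx hxF using (hx hxF).ne

/-- The oscillating part of the potential. -/
noncomputable def oscPart (K : Euc n → E) (σ : Measure (Euc n)) (F : Set (Euc n)) (x : Euc n) : E :=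
  ∫ y, avgDiff K (infDist y F / 4) (x - y) ∂σ

theorem L1Diff.of_lintegral_le {u : Euc n → E} {x : Euc n} (a : E) (L : Euc n →L[ℝ] E)
    (σ : Measure (Euc n)) [SFinite σ] {Q : Euc n × Euc n → ℝ≥0∞} (hQ : Measurable Q)
    {G : Euc n → ℝ≥0∞} (hG : ∫⁻ y, G y ∂σ ≠ ⊤)
    (hle : ∀ᵐ h, ‖u (x + h) - a - L h‖ₑ ≤ ∫⁻ y, Q (y, h) ∂σ)
    (hQG : ∀ r : ℝ, 0 < r → ∀ y, ∫⁻ h in ball (0 : Euc n) r, Q (y, h)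
      ≤ G y * ENNReal.ofReal (r ^ (n + 1)))
    (hlim : ∀ y, Tendsto (fun r : ℝ => (∫⁻ h in ball (0 : Euc n) r, Q (y, h))
      / ENNReal.ofReal (r ^ (n + 1))) (𝓝[>] 0) (𝓝 0)) : L1Diff u x := by
  refine ⟨a, L, ?_⟩
  have h1 : ∀ r : ℝ, ∫⁻ h in ball (0 : Euc n) r, ‖u (x + h) - a - L h‖ₑ
      ≤ ∫⁻ y, (∫⁻ h in ball (0 : Euc n) r, Q (y, h)) ∂σ := fun r => by
    rw [lintegral_lintegral_swap (f := fun y h => Q (y, h)) hQ.aemeasurable]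
    exact lintegral_mono_ae (ae_restrict_of_ae hle)
  have h2 : Tendsto (fun r : ℝ => ∫⁻ y, (∫⁻ h in ball (0 : Euc n) r, Q (y, h))
      / ENNReal.ofReal (r ^ (n + 1)) ∂σ) (𝓝[>] 0) (𝓝 (∫⁻ _y, 0 ∂σ)) := by
    refine tendsto_lintegral_filter_of_dominated_convergence G ?_ ?_ hG (ae_of_all _ hlim)
    · exact Eventually.of_forall fun r => Measurable.div_const hQ.lintegral_prod_right' _
    · filter_upwards [self_mem_nhdsWithin] with r (hr : 0 < r)
      exact ae_of_all _ fun y => ENNReal.div_le_of_le_mul (hQG r hr y)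
  rw [lintegral_zero] at h2
  refine tendsto_of_tendsto_of_tendsto_of_le_of_le tendsto_const_nhds h2
    (fun _ => zero_le) fun r => ?_
  have hd : ∫⁻ y, (∫⁻ h in ball (0 : Euc n) r, Q (y, h)) / ENNReal.ofReal (r ^ (n + 1)) ∂σ
      = (∫⁻ y, (∫⁻ h in ball (0 : Euc n) r, Q (y, h)) ∂σ) / ENNReal.ofReal (r ^ (n + 1)) := by
    simp only [div_eq_mul_inv]
    exact lintegral_mul_const _ hQ.lintegral_prod_right'
  simp only
  rw [hd]
  exact ENNReal.div_le_div_right (h1 r) _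

theorem IsKer.ae_l1Diff_oscPart (hn : 1 < n) (hK : IsKer n C K DK) (σ : Measure (Euc n))
    [IsFiniteMeasure σ] {F : Set (Euc n)} (hF : MeasurableSet F) {R : ℝ}
    (hR : ∀ᵐ y ∂σ, infDist y F ≤ R) : ∀ᵐ x, x ∈ F → L1Diff (oscPart K σ F) x := by
  obtain ⟨C₁, hC₁, h₁⟩ := hK.exists_lintegral_avgDiff_le hn
  obtain ⟨C₂, hC₂, h₂⟩ := hK.exists_lintegral_taylor_avgDiff_le hn
  have hdm : Measurable fun y => infDist y F := (continuous_infDist_pt F).measurable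
  have hmS : StronglyMeasurable fun p : Euc n × Euc n =>
      avgDiff K (infDist p.2 F / 4) (p.1 - p.2) :=
    (stronglyMeasurable_avgDiff hK.stronglyMeasurable).comp_measurable
      (((hdm.comp measurable_snd).div_const 4).prodMk (measurable_fst.sub measurable_snd))
  have hmD : StronglyMeasurable fun p : Euc n × Euc n =>
      avgDiff DK (infDist p.2 F / 4) (p.1 - p.2) :=
    (stronglyMeasurable_avgDiff hK.stronglyMeasurable_deriv).comp_measurable
      (((hdm.comp measurable_snd).div_const 4).prodMk (measurable_fst.sub measurable_snd))
  have hint : ∀ᵐ x, Integrable (fun y => avgDiff K (infDist y F / 4) (x - y)) σ := by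
    have key : ∫⁻ x, ∫⁻ y, ‖avgDiff K (infDist y F / 4) (x - y)‖ₑ ∂σ ≠ ⊤ := by
      rw [lintegral_lintegral_swap hmS.enorm.aemeasurable]
      refine ne_top_of_le_ne_top (b := ∫⁻ _y, ENNReal.ofReal (C₁ * (R / 4)) ∂σ)
        (by simp; finiteness) (lintegral_mono_ae ?_)
      filter_upwards [hR] with y hy
      rw [lintegral_sub_right_eq_self (fun z => ‖avgDiff K (infDist y F / 4) z‖ₑ) y]
      rcases (infDist_nonneg (x := y) (s := F)).eq_or_lt with h0 | h0
      · rw [← h0, zero_div]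
        simp [avgDiff_zero]
      · refine (h₁ _ (by linarith)).trans (ENNReal.ofReal_le_ofReal ?_)
        gcongr
    filter_upwards [ae_lt_top' (hmS.enorm.lintegral_prod_right').aemeasurable key] with x hx
    exact ⟨(hmS.comp_measurable measurable_prodMk_left).aestronglyMeasurable, hx⟩
  filter_upwards [ae_lintegral_infDist_ne_top hn σ hF, hint] with x hJ hix hxF
  replace hJ := hJ hxF
  have hdist : ∀ y, 4 * (infDist y F / 4) ≤ ‖x - y‖ := fun y => by
    have := infDist_le_dist_of_mem (x := y) hxF
    rw [dist_comm, dist_eq_norm] at this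
    linarith
  have hXe : ∀ {c : ℝ} (y : Euc n), 0 ≤ c → 0 < infDist y F →
      ENNReal.ofReal (c * ((infDist y F / 4) * (‖x - y‖ ^ (n + 1))⁻¹))
        ≤ ENNReal.ofReal c * (ENNReal.ofReal (infDist y F) * ‖x - y‖ₑ ^ (-(n + 1 : ℝ))) :=
    fun y hc hy => by
      have h0 : 0 < ‖x - y‖ := by linarith [hdist y]
      rw [← ofReal_norm, ENNReal.ofReal_rpow_of_pos h0, ← ENNReal.ofReal_mul infDist_nonneg,
        ← ENNReal.ofReal_mul hc,
        show (-(n + 1) : ℝ) = -((n + 1 : ℕ) : ℝ) by push_cast; ring, Real.rpow_neg h0.le,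
        Real.rpow_natCast]
      refine ENNReal.ofReal_le_ofReal ?_
      gcongr
      linarith
  have hiD : Integrable (fun y => avgDiff DK (infDist y F / 4) (x - y)) σ := by
    refine ⟨(hmD.comp_measurable measurable_prodMk_left).aestronglyMeasurable, ?_⟩
    have hb : ∫⁻ y, ‖avgDiff DK (infDist y F / 4) (x - y)‖ₑ ∂σ ≤ ∫⁻ y, ENNReal.ofReal C
        * (ENNReal.ofReal (infDist y F) * ‖x - y‖ₑ ^ (-(n + 1 : ℝ))) ∂σ := by
      refine lintegral_mono fun y => ?_
      simp only
      rcases (infDist_nonneg (x := y) (s := F)).eq_or_lt with h0 | h0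
      · rw [← h0, zero_div, avgDiff_zero]
        exact enorm_zero_le _
      · refine le_trans ?_ (hXe y hK.nonneg h0)
        rw [← ofReal_norm, ← mul_assoc]
        exact ENNReal.ofReal_le_ofReal (hK.norm_avgDiff_deriv_le (by linarith)
          (by linarith [hdist y]))
    rw [lintegral_const_mul' _ _ ENNReal.ofReal_ne_top] at hb
    exact hb.trans_lt (lt_top_iff_ne_top.2 (ENNReal.mul_ne_top ENNReal.ofReal_ne_top hJ))
  have hmQ : Measurable fun p : Euc n × Euc n => ‖avgDiff K (infDist p.1 F / 4) (x - p.1 + p.2)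
      - avgDiff K (infDist p.1 F / 4) (x - p.1)
      - avgDiff DK (infDist p.1 F / 4) (x - p.1) p.2‖ₑ := by
    have e1 : Measurable fun p : Euc n × Euc n => (x + p.2, p.1) := by fun_prop
    have e2 : Measurable fun p : Euc n × Euc n => (x, p.1) := by fun_prop
    have m1 := hmS.comp_measurable e1
    have m2 := hmS.comp_measurable e2
    have m3 := hmD.comp_measurable e2
    have m4 : StronglyMeasurable fun p : Euc n × Euc n =>
        avgDiff DK (infDist p.1 F / 4) (x - p.1) p.2 :=
      (ContinuousLinearMap.apply ℝ E).continuous₂.comp_stronglyMeasurable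
        (measurable_snd.stronglyMeasurable.prodMk m3)
    have e : (fun p : Euc n × Euc n => avgDiff K (infDist p.1 F / 4) (x - p.1 + p.2))
        = (fun p : Euc n × Euc n => avgDiff K (infDist p.2 F / 4) (p.1 - p.2)) ∘
          fun p : Euc n × Euc n => (x + p.2, p.1) := by
      funext p
      simp only [Function.comp]
      congr 1
      abel
    rw [← e] at m1
    exact StronglyMeasurable.enorm ((m1.sub m2).sub m4)
  refine L1Diff.of_lintegral_le (oscPart K σ F x)
    (∫ y, avgDiff DK (infDist y F / 4) (x - y) ∂σ) σ hmQ
    (G := fun y => ENNReal.ofReal C₂ * (ENNReal.ofReal (infDist y F)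
      * ‖x - y‖ₑ ^ (-(n + 1 : ℝ)))) ?_ ?_ ?_ ?_
  · rw [lintegral_const_mul' _ _ ENNReal.ofReal_ne_top]
    exact ENNReal.mul_ne_top ENNReal.ofReal_ne_top hJ
  · have h3 : ∀ᵐ h, Integrable (fun y => avgDiff K (infDist y F / 4) (x + h - y)) σ :=
      (measurePreserving_add_left volume x).quasiMeasurePreserving.ae hint
    filter_upwards [h3] with h hh
    unfold oscPart
    have h4 : (∫ y, avgDiff DK (infDist y F / 4) (x - y) ∂σ) h
        = ∫ y, avgDiff DK (infDist y F / 4) (x - y) h ∂σ :=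
      ContinuousLinearMap.integral_apply hiD h
    have h5 : Integrable (fun y => avgDiff K (infDist y F / 4) (x + h - y)
        - avgDiff K (infDist y F / 4) (x - y)) σ := hh.sub hix
    rw [h4, ← integral_sub hh hix, ← integral_sub h5 (hiD.apply_continuousLinearMap h)]
    refine (enorm_integral_le_lintegral_enorm _).trans (le_of_eq (lintegral_congr fun y => ?_))
    rw [show x - y + h = x + h - y by abel]
  · intro r hr y
    rcases (infDist_nonneg (x := y) (s := F)).eq_or_lt with h0 | h0
    · simp only [← h0, zero_div, avgDiff_zero, _root_.zero_apply, sub_zero, enorm_zero,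
        lintegral_zero]
      exact zero_le
    · refine (h₂ _ _ r (by linarith) (hdist y) hr).1.trans ?_
      rw [mul_assoc, mul_left_comm, mul_comm, ENNReal.ofReal_mul' (by positivity)]
      exact mul_le_mul_left (hXe y hC₂ h0) _
  · intro y
    rcases (infDist_nonneg (x := y) (s := F)).eq_or_lt with h0 | h0
    · simp only [← h0, zero_div, avgDiff_zero, _root_.zero_apply, sub_zero, enorm_zero,
        lintegral_zero, ENNReal.zero_div]
      exact tendsto_const_nhds
    · have hxy : 0 < ‖x - y‖ := by linarith [hdist y]
      have t : Tendsto (fun r : ℝ => ENNReal.ofReal (C₂ * (r * (‖x - y‖ ^ (n + 1))⁻¹)))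
          (𝓝[>] 0) (𝓝 0) := by
        have : Tendsto (fun r : ℝ => ENNReal.ofReal (C₂ * (r * (‖x - y‖ ^ (n + 1))⁻¹)))
          (𝓝 0) (𝓝 (ENNReal.ofReal (C₂ * (0 * (‖x - y‖ ^ (n + 1))⁻¹)))) :=
          (ENNReal.continuous_ofReal.comp (by fun_prop)).tendsto 0
        rw [zero_mul, mul_zero, ENNReal.ofReal_zero] at this
        exact this.mono_left nhdsWithin_le_nhds
      refine tendsto_of_tendsto_of_tendsto_of_le_of_le' tendsto_const_nhds t
        (Eventually.of_forall fun _ => zero_le) ?_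
      filter_upwards [Ioo_mem_nhdsGT (show 0 < ‖x - y‖ / 4 by linarith)] with r hr
      refine ENNReal.div_le_of_le_mul ?_
      refine ((h₂ _ _ r (by linarith) (hdist y) hr.1).2 (by linarith [hr.2])).trans ?_
      have := hr.1
      rw [← ENNReal.ofReal_mul (by positivity)]
      refine ENNReal.ofReal_le_ofReal (le_of_eq (by ring))

end BadPart

section Sobolev

variable {n : ℕ} {E : Type*} [NormedAddCommGroup E] [NormedSpace ℝ E] [CompleteSpace E]

theorem enorm_sub_sub_le_lintegral {w : Euc n → E} {Dw : Euc n → Euc n →L[ℝ] E}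
    (hw : ∀ x, HasFDerivAt w (Dw x) x) (hc : Continuous Dw) (x h : Euc n)
    (L : Euc n →L[ℝ] E) : ‖w (x + h) - w x - L h‖ₑ
      ≤ ‖h‖ₑ * ∫⁻ s in Set.Ioc (0 : ℝ) 1, ‖Dw (x + s • h) - L‖ₑ := by
  have hd : ∀ s : ℝ, HasDerivAt (fun s : ℝ => w (x + s • h) - s • L h)
      ((Dw (x + s • h) - L) h) s := fun s => by
    have h1 : HasDerivAt (fun s : ℝ => x + s • h) h s := by
      simpa using ((hasDerivAt_id s).smul_const h).const_add x
    have h2 := (hw (x + s • h)).comp_hasDerivAt s h1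
    have h3 : HasDerivAt (fun s : ℝ => s • L h) (L h) s := by
      simpa using (hasDerivAt_id s).smul_const (L h)
    exact h2.sub h3
  have hcd : Continuous fun s : ℝ => (Dw (x + s • h) - L) h := by fun_prop
  have := intervalIntegral.integral_eq_sub_of_hasDerivAt (a := 0) (b := 1) (fun s _ => hd s)
    (hcd.intervalIntegrable _ _)
  simp only [one_smul, zero_smul, add_zero, sub_zero] at this
  rw [show w (x + h) - w x - L h = w (x + h) - L h - w x by abel, ← this,
    intervalIntegral.integral_of_le zero_le_one]
  refine (enorm_integral_le_lintegral_enorm _).trans ?_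
  rw [← lintegral_const_mul' _ _ enorm_ne_top]
  refine lintegral_mono fun s => ?_
  rw [mul_comm]
  exact enorm_clm_apply_le _ _

theorem ae_liminf_eq_zero {Q : ℕ → Euc n → ℝ≥0∞} (hQ : ∀ J, Measurable (Q J))
    (hlim : ∀ R : ℝ, Tendsto (fun J => ∫⁻ x in ball (0 : Euc n) R, Q J x) atTop (𝓝 0)) :
    ∀ᵐ x, ∀ᵐ h, h ∈ ball (0 : Euc n) 1 →
      liminf (fun J => ∫⁻ s in Set.Ioc (0 : ℝ) 1, Q J (x + s • h)) atTop = 0 := by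
  have hm : ∀ J, Measurable fun p : Euc n × Euc n =>
      ∫⁻ s in Set.Ioc (0 : ℝ) 1, Q J (p.1 + s • p.2) := fun J => by
    refine Measurable.lintegral_prod_right' (f := fun p : (Euc n × Euc n) × ℝ =>
      Q J (p.1.1 + p.2 • p.1.2)) ((hQ J).comp ?_)
    fun_prop
  have key : ∀ R : ℕ, ∀ᵐ p ∂((volume.restrict (ball (0 : Euc n) R)).prod
      (volume.restrict (ball (0 : Euc n) 1))),
      liminf (fun J => ∫⁻ s in Set.Ioc (0 : ℝ) 1, Q J (p.1 + s • p.2)) atTop = 0 := fun R => by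
    have hb : ∀ J, ∫⁻ p : Euc n × Euc n, (∫⁻ s in Set.Ioc (0 : ℝ) 1, Q J (p.1 + s • p.2))
        ∂((volume.restrict (ball (0 : Euc n) R)).prod (volume.restrict (ball (0 : Euc n) 1)))
        ≤ (∫⁻ x in ball (0 : Euc n) (R + 1), Q J x) * volume (ball (0 : Euc n) 1) := fun J => by
      rw [lintegral_prod_symm' _ (hm J), ← setLIntegral_const]
      refine setLIntegral_mono measurable_const fun h hh => ?_
      rw [lintegral_lintegral_swap]
      swap
      · exact ((hQ J).comp (f := fun p : Euc n × ℝ => p.1 + p.2 • h) (by fun_prop)).aemeasurable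
      calc _ ≤ ∫⁻ _s in Set.Ioc (0 : ℝ) 1, (∫⁻ x in ball (0 : Euc n) (R + 1), Q J x) := by
            refine setLIntegral_mono measurable_const fun s hs => ?_
            rw [← lintegral_indicator measurableSet_ball, ← lintegral_indicator measurableSet_ball,
              ← lintegral_add_right_eq_self ((ball (0 : Euc n) (R + 1)).indicator (Q J)) (s • h)]
            refine lintegral_mono fun x => ?_
            by_cases hx : x ∈ ball (0 : Euc n) R
            · have : x + s • h ∈ ball (0 : Euc n) (R + 1) := by
                rw [mem_ball_zero_iff] at hx hh ⊢
                have := norm_add_le x (s • h)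
                rw [norm_smul, Real.norm_eq_abs, abs_of_pos hs.1] at this
                nlinarith [hs.1, hs.2, norm_nonneg h]
              rw [Set.indicator_of_mem hx, Set.indicator_of_mem this]
            · rw [Set.indicator_of_notMem hx]
              exact zero_le
        _ = _ := by simp
    have h0 : ∫⁻ p : Euc n × Euc n, liminf (fun J => ∫⁻ s in Set.Ioc (0 : ℝ) 1, Q J (p.1 + s • p.2)) atTop
        ∂((volume.restrict (ball (0 : Euc n) R)).prod (volume.restrict (ball (0 : Euc n) 1)))
        = 0 := by
      refine le_antisymm ((lintegral_liminf_le hm).trans ?_) zero_le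
      have t : Tendsto (fun J => (∫⁻ x in ball (0 : Euc n) (R + 1), Q J x)
          * volume (ball (0 : Euc n) 1)) atTop (𝓝 0) := by
        simpa using ENNReal.Tendsto.mul_const (hlim (R + 1))
          (Or.inr (measure_ball_lt_top (x := (0 : Euc n)) (r := 1)).ne)
      rw [← t.liminf_eq]
      exact liminf_le_liminf (Eventually.of_forall hb)
    exact (lintegral_eq_zero_iff (Measurable.liminf hm)).1 h0
  have key' : ∀ᵐ x, ∀ R : ℕ, x ∈ ball (0 : Euc n) R → ∀ᵐ h, h ∈ ball (0 : Euc n) 1 →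
      liminf (fun J => ∫⁻ s in Set.Ioc (0 : ℝ) 1, Q J (x + s • h)) atTop = 0 := by
    refine ae_all_iff.2 fun R => ?_
    have := Measure.ae_ae_of_ae_prod (key R)
    rw [ae_restrict_iff' measurableSet_ball] at this
    filter_upwards [this] with x hx hxR
    have := hx hxR
    rwa [ae_restrict_iff' measurableSet_ball] at this
  filter_upwards [key'] with x hx
  obtain ⟨R, hR⟩ := exists_nat_gt ‖x‖
  exact hx R (by simpa using hR)

theorem tendsto_lintegral_segments {φ : Euc n → ℝ≥0∞} (hφ : Measurable φ) {x : Euc n}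
    (h : Tendsto (fun r => (∫⁻ k in closedBall x r, φ k) / volume (closedBall x r))
      (𝓝[>] 0) (𝓝 0)) :
    Tendsto (fun r : ℝ => (∫⁻ h in ball (0 : Euc n) r, ‖h‖ₑ *
      ∫⁻ s in Set.Ioc (0 : ℝ) 1, φ (x + s • h)) / ENNReal.ofReal (r ^ (n + 1))) (𝓝[>] 0) (𝓝 0) := by
  set v := volume (ball (0 : Euc n) 1)
  have hv : v ≠ ⊤ := measure_ball_lt_top.ne
  have hvol : ∀ (y : Euc n) {r : ℝ}, 0 < r → volume (closedBall y r) = ENNReal.ofReal (r ^ n) * v :=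
    fun y r hr => by
      rw [Measure.addHaar_closedBall _ _ hr.le, finrank_euclideanSpace_fin]
  have hball : ∀ {r : ℝ} {ε : ℝ≥0∞}, 0 < r → (∀ ρ : ℝ, 0 < ρ → ρ ≤ r →
      ∫⁻ k in closedBall x ρ, φ k ≤ ε * volume (closedBall x ρ)) →
      ∫⁻ h in ball (0 : Euc n) r, ‖h‖ₑ * ∫⁻ s in Set.Ioc (0 : ℝ) 1, φ (x + s • h)
        ≤ ENNReal.ofReal (r ^ (n + 1)) * (ε * v) := fun {r ε} hr hε => by
    have hm : Measurable fun p : Euc n × ℝ => φ (x + p.2 • p.1) := hφ.comp (by fun_prop)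
    calc _ ≤ ∫⁻ h in ball (0 : Euc n) r, ENNReal.ofReal r *
          ∫⁻ s in Set.Ioc (0 : ℝ) 1, φ (x + s • h) := by
          refine setLIntegral_mono (hm.lintegral_prod_right'.const_mul _) fun h hh => ?_
          refine mul_le_mul_left ?_ _
          rw [← ofReal_norm]
          exact ENNReal.ofReal_le_ofReal (mem_ball_zero_iff.1 hh).le
      _ = ENNReal.ofReal r * ∫⁻ s in Set.Ioc (0 : ℝ) 1, (∫⁻ h in ball (0 : Euc n) r,
          φ (x + s • h)) := by
          rw [lintegral_const_mul' _ _ ENNReal.ofReal_ne_top,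
            lintegral_lintegral_swap (f := fun h s => φ (x + s • h)) hm.aemeasurable]
      _ ≤ ENNReal.ofReal r * ∫⁻ s in Set.Ioc (0 : ℝ) 1, ε * (ENNReal.ofReal (r ^ n) * v) := by
          refine mul_le_mul_right (setLIntegral_mono measurable_const fun s hs => ?_) _
          have h1 := hε (s * r) (mul_pos hs.1 hr) (by nlinarith [hs.2])
          rw [hvol x (mul_pos hs.1 hr)] at h1
          have h2 : ∫⁻ h in ball (0 : Euc n) r, φ (x + s • h)
              ≤ (ENNReal.ofReal (s ^ n))⁻¹ * ∫⁻ k in closedBall x (s * r), φ k := by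
            rw [← lintegral_indicator isClosed_closedBall.measurableSet,
              ← lintegral_add_left_eq_self ((closedBall x (s * r)).indicator φ) x,
              ← lintegral_comp_smul_of_pos hs.1
                (fun k => (closedBall x (s * r)).indicator φ (x + k)),
              ← lintegral_indicator measurableSet_ball]
            refine lintegral_mono fun k => ?_
            by_cases hk : k ∈ ball (0 : Euc n) r
            · have : x + s • k ∈ closedBall x (s * r) := by
                rw [mem_ball_zero_iff] at hk
                rw [mem_closedBall, dist_self_add_left, norm_smul, Real.norm_eq_abs,
                  abs_of_pos hs.1]
                exact mul_le_mul_of_nonneg_left hk.le hs.1.le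
              rw [Set.indicator_of_mem hk, Set.indicator_of_mem this]
            · rw [Set.indicator_of_notMem hk]
              exact zero_le
          refine h2.trans ((mul_le_mul_right h1 _).trans (le_of_eq ?_))
          have hs0 : ENNReal.ofReal (s ^ n) ≠ 0 := by simpa using pow_pos hs.1 n
          rw [mul_pow, ENNReal.ofReal_mul (pow_nonneg hs.1.le _)]
          calc _ = ((ENNReal.ofReal (s ^ n))⁻¹ * ENNReal.ofReal (s ^ n))
                * (ε * (ENNReal.ofReal (r ^ n) * v)) := by ring
            _ = _ := by rw [ENNReal.inv_mul_cancel hs0 ENNReal.ofReal_ne_top, one_mul]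
      _ = _ := by
          rw [setLIntegral_const, Real.volume_Ioc, sub_zero, ENNReal.ofReal_one, mul_one, pow_succ,
            ENNReal.ofReal_mul (by positivity)]
          ring
  rw [ENNReal.tendsto_nhds_zero] at h ⊢
  intro ε hε
  have hε' : 0 < ε / (v + 1) := ENNReal.div_pos hε.ne' (by finiteness)
  obtain ⟨r₀, hr₀, hr⟩ := mem_nhdsGT_iff_exists_Ioo_subset.1 (h _ hε')
  filter_upwards [Ioo_mem_nhdsGT hr₀] with r hrr
  refine ENNReal.div_le_of_le_mul ((hball (ε := ε / (v + 1)) hrr.1 fun ρ h1 h2 => ?_).trans ?_)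
  · have := hr (show ρ ∈ Set.Ioo 0 r₀ from ⟨h1, h2.trans_lt hrr.2⟩)
    have h3 : (∫⁻ k in closedBall x ρ, φ k) / volume (closedBall x ρ) ≤ ε / (v + 1) := this
    rwa [ENNReal.div_le_iff_le_mul (Or.inl (measure_closedBall_pos _ _ h1).ne')
      (Or.inl measure_closedBall_lt_top.ne)] at h3
  · rw [mul_comm]
    refine mul_le_mul_left ?_ _
    calc ε / (v + 1) * v ≤ ε / (v + 1) * (v + 1) := by gcongr; exact le_self_add
      _ ≤ ε := ENNReal.le_div_iff_mul_le (Or.inl (by simp)) (Or.inl (by finiteness)) |>.1 le_rfl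

theorem ae_l1Diff_of_approx [FiniteDimensional ℝ E] {U : Euc n → E} {w : ℕ → Euc n → E}
    {Dw : ℕ → Euc n → Euc n →L[ℝ] E} (hw : ∀ J x, HasFDerivAt (w J) (Dw J x) x)
    (hc : ∀ J, Continuous (Dw J)) {G : Euc n → Euc n →L[ℝ] E} (hGm : StronglyMeasurable G)
    (hG : LocallyIntegrable G volume)
    (hlim : ∀ R : ℝ, Tendsto (fun J => ∫⁻ x in ball (0 : Euc n) R, ‖Dw J x - G x‖ₑ) atTop (𝓝 0))
    (hU : ∀ᵐ x, Tendsto (fun J => w J x) atTop (𝓝 (U x))) : ∀ᵐ x, L1Diff U x := by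
  have hleb := (Besicovitch.vitaliFamily (volume : Measure (Euc n))).ae_tendsto_lintegral_enorm_sub_div hG
  have hQm : ∀ J, Measurable fun x => ‖Dw J x - G x‖ₑ := fun J =>
    ((hc J).stronglyMeasurable.sub hGm).enorm
  filter_upwards [hleb, ae_liminf_eq_zero hQm hlim, hU] with x hx hx0 hxU
  have hφ : Measurable fun y => ‖G y - G x‖ₑ := (hGm.sub stronglyMeasurable_const).enorm
  have t := tendsto_lintegral_segments hφ (hx.comp (Besicovitch.tendsto_filterAt _ x))
  refine ⟨U x, G x, ?_⟩
  refine tendsto_of_tendsto_of_tendsto_of_le_of_le' tendsto_const_nhds t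
    (Eventually.of_forall fun _ => zero_le) ?_
  filter_upwards [Ioo_mem_nhdsGT (zero_lt_one' ℝ)] with r hr
  refine ENNReal.div_le_div_right ?_ _
  refine lintegral_mono_ae ((ae_restrict_iff' measurableSet_ball).2 ?_)
  have hUx := (measurePreserving_add_left volume x).quasiMeasurePreserving.ae hU
  filter_upwards [hx0, hUx] with h h0 hUh hhr
  replace h0 := h0 (ball_subset_ball hr.2.le hhr)
  set B := ∫⁻ s in Set.Ioc (0 : ℝ) 1, ‖G (x + s • h) - G x‖ₑ with hB
  have hstep : ∀ J, ‖w J (x + h) - w J x - G x h‖ₑ ≤ ‖h‖ₑ *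
      (B + ∫⁻ s in Set.Ioc (0 : ℝ) 1, ‖Dw J (x + s • h) - G (x + s • h)‖ₑ) := fun J => by
    refine (enorm_sub_sub_le_lintegral (hw J) (hc J) x h (G x)).trans (mul_le_mul_right ?_ _)
    have hmm : Measurable fun s : ℝ => ‖G (x + s • h) - G x‖ₑ :=
      hφ.comp (g := fun y => ‖G y - G x‖ₑ) (f := fun s : ℝ => x + s • h) (by fun_prop)
    rw [hB, ← lintegral_add_left hmm]
    refine lintegral_mono fun s => ?_
    have e : Dw J (x + s • h) - G x
      = (G (x + s • h) - G x) + (Dw J (x + s • h) - G (x + s • h)) := by abel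
    simp only
    rw [e]
    exact enorm_add_le (G (x + s • h) - G x) (Dw J (x + s • h) - G (x + s • h))
  have hconv : Tendsto (fun J => ‖w J (x + h) - w J x - G x h‖ₑ) atTop
      (𝓝 ‖U (x + h) - U x - G x h‖ₑ) :=
    (continuous_enorm.tendsto _).comp ((hUh.sub hxU).sub tendsto_const_nhds)
  have h1 : ‖h‖ₑ ≤ 1 := by
    rw [← ofReal_norm, ← ENNReal.ofReal_one]
    exact ENNReal.ofReal_le_ofReal ((mem_ball_zero_iff.1 hhr).le.trans hr.2.le)
  refine ENNReal.le_of_forall_pos_le_add fun ε hε _ => ?_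
  have hε' : (0 : ℝ≥0∞) < ε := by exact_mod_cast hε
  have hfr : ∃ᶠ J in atTop, ∫⁻ s in Set.Ioc (0 : ℝ) 1, ‖Dw J (x + s • h) - G (x + s • h)‖ₑ < ε :=
    frequently_lt_of_liminf_lt (by isBoundedDefault) (by rw [h0]; exact hε')
  refine isClosed_Iic.mem_of_frequently_of_tendsto (hfr.mono fun J hJ => ?_) hconv
  refine (hstep J).trans ?_
  rw [mul_add]
  refine add_le_add le_rfl ?_
  calc _ ≤ 1 * (ε : ℝ≥0∞) := by
        exact mul_le_mul' h1 hJ.le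
    _ = _ := one_mul _

end Sobolev

section Kernels

variable {n : ℕ} {E F : Type*} [NormedAddCommGroup E] [NormedSpace ℝ E]
  [NormedAddCommGroup F] [NormedSpace ℝ F]

theorem hasFDerivAt_integral_kernel [CompleteSpace F] {T : Euc n → E →L[ℝ] F}
    {T' : Euc n → Euc n →L[ℝ] E →L[ℝ] F} (hT : ∀ z, HasFDerivAt T (T' z) z) (hT' : Continuous T')
    {C : ℝ} (hC : ∀ z, ‖T z‖ ≤ C) (hC' : ∀ z, ‖T' z‖ ≤ C) {μ : Measure (Euc n)}
    {g : Euc n → E} (hg : Integrable g μ) :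
    (∀ x, HasFDerivAt (fun x => ∫ y, T (x - y) (g y) ∂μ) (∫ y, (T' (x - y)).flip (g y) ∂μ) x) ∧
    Continuous (fun x => ∫ y, (T' (x - y)).flip (g y) ∂μ) ∧
    ∀ x h, (∫ y, (T' (x - y)).flip (g y) ∂μ) h = ∫ y, T' (x - y) h (g y) ∂μ := by
  have hTc : Continuous T := continuous_iff_continuousAt.2 fun z => (hT z).continuousAt
  have hfl : Continuous fun z => (T' z).flip :=
    (ContinuousLinearMap.flipₗᵢ ℝ (Euc n) E F).continuous.comp hT'
  have hb : ∀ z, ‖(T' z).flip‖ ≤ C := fun z => by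
    rw [ContinuousLinearMap.opNorm_flip]
    exact hC' z
  have hi : ∀ x, Integrable (fun y => (T' (x - y)).flip (g y)) μ := fun x =>
    integrable_clm_apply (T := fun y => (T' (x - y)).flip) (hfl.comp (by fun_prop))
      (fun y => hb _) hg
  refine ⟨fun x => ?_, ?_, fun x h => ContinuousLinearMap.integral_apply (hi x) h⟩
  · refine hasFDerivAt_integral_of_dominated_of_fderiv_le (bound := fun y => C * ‖g y‖)
      (F' := fun x y => (T' (x - y)).flip (g y)) univ_mem ?_ ?_ (hi x).1 ?_
      (hg.norm.const_mul C) ?_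
    · exact Eventually.of_forall fun x => aestronglyMeasurable_clm_apply
        (hTc.comp (by fun_prop : Continuous fun y => x - y)).aestronglyMeasurable hg.1
    · exact integrable_clm_apply (T := fun y => T (x - y)) (hTc.comp (by fun_prop))
        (fun y => hC _) hg
    · exact ae_of_all _ fun y x _ => ((T' (x - y)).flip.le_opNorm _).trans
        (mul_le_mul_of_nonneg_right (hb _) (norm_nonneg _))
    · refine ae_of_all _ fun y x _ => ?_
      have h1 : HasFDerivAt (fun x => T (x - y)) (T' (x - y)) x :=
        (hT (x - y)).comp x ((hasFDerivAt_id x).sub_const y)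
      have h2 := h1.clm_apply (hasFDerivAt_const (g y) x)
      rwa [ContinuousLinearMap.comp_zero, zero_add] at h2
  · refine continuous_of_dominated (bound := fun y => C * ‖g y‖) (fun x => (hi x).1)
      (fun x => ae_of_all _ fun y => ((T' (x - y)).flip.le_opNorm _).trans
        (mul_le_mul_of_nonneg_right (hb _) (norm_nonneg _))) (hg.norm.const_mul C)
      (ae_of_all _ fun y => ?_)
    exact (hfl.comp (by fun_prop : Continuous fun x => x - y)).clm_apply continuous_const

theorem norm_clm_le_sum (L : Euc n →L[ℝ] E) : ‖L‖ ≤ ∑ i, ‖L (stdVec n i)‖ := by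
  refine L.opNorm_le_bound (Finset.sum_nonneg fun i _ => norm_nonneg _) fun x => ?_
  have hx : x = ∑ i, x i • stdVec n i := by
    have := (EuclideanSpace.basisFun (Fin n) ℝ).sum_repr x
    simpa [stdVec] using this.symm
  conv_lhs => rw [hx]
  rw [map_sum, Finset.sum_mul]
  refine (norm_sum_le _ _).trans (Finset.sum_le_sum fun i _ => ?_)
  rw [map_smul, norm_smul, mul_comm]
  exact mul_le_mul_of_nonneg_left (PiLp.norm_apply_le x i) (norm_nonneg _)

theorem enorm_clm_le_sum (L : Euc n →L[ℝ] E) : ‖L‖ₑ ≤ ∑ i, ‖L (stdVec n i)‖ₑ := by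
  rw [← ofReal_norm]
  refine (ENNReal.ofReal_le_ofReal (norm_clm_le_sum L)).trans (le_of_eq ?_)
  rw [ENNReal.ofReal_sum_of_nonneg fun i _ => norm_nonneg _]
  exact Finset.sum_congr rfl fun i _ => ofReal_norm _

theorem lintegral_ball_enorm_le_eLpNorm {f : Euc n → E} (hf : AEStronglyMeasurable f) (R : ℝ) :
    ∫⁻ x in ball (0 : Euc n) R, ‖f x‖ₑ
      ≤ eLpNorm f 2 volume * volume (ball (0 : Euc n) R) ^ (1 / 2 : ℝ) := by
  rw [← eLpNorm_one_eq_lintegral_enorm]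
  refine (eLpNorm_le_eLpNorm_mul_rpow_measure_univ (p := 1) (q := 2) (by norm_num)
    hf.restrict).trans ?_
  rw [Measure.restrict_apply_univ, show 1 / (1 : ℝ≥0∞).toReal - 1 / (2 : ℝ≥0∞).toReal = 1 / 2 by
    norm_num]
  exact mul_le_mul_left (eLpNorm_mono_measure _ Measure.restrict_le_self) _

theorem exists_subseq_tendsto_eLpNorm [CompleteSpace E] {ι : Type*} [Fintype ι]
    {f : ι → ℕ → Euc n → E} (hm : ∀ i J, AEStronglyMeasurable (f i J))
    (hl : ∀ i J, LocallyIntegrable (f i J) volume)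
    (hc : ∀ i (ε : ℝ≥0∞), ε ≠ 0 → ∃ J₀, ∀ J ≥ J₀, ∀ J' ≥ J₀,
      eLpNorm (fun x => f i J x - f i J' x) 2 volume ≤ ε) :
    ∃ (s : ℕ → ℕ) (G : ι → Euc n → E), Tendsto s atTop atTop ∧
      ∀ i, StronglyMeasurable (G i) ∧ LocallyIntegrable (G i) volume ∧
      Tendsto (fun k => eLpNorm (fun x => f i (s k) x - G i x) 2 volume) atTop (𝓝 0) := by
  choose N hN using fun i (k : ℕ) => hc i ((1 / 2 : ℝ≥0∞) ^ k) (by simp)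
  set s : ℕ → ℕ := fun k => k + ∑ l ∈ Finset.range (k + 1), ∑ i, N i l with hs
  have hsN : ∀ k l i, k ≤ l → N i k ≤ s l := fun k l i hkl => by
    have h1 : N i k ≤ ∑ i, N i k :=
      Finset.single_le_sum (f := fun i => N i k) (fun _ _ => Nat.zero_le _) (Finset.mem_univ i)
    have h2 : ∑ i, N i k ≤ ∑ l ∈ Finset.range (l + 1), ∑ i, N i l :=
      Finset.single_le_sum (f := fun l => ∑ i, N i l) (fun _ _ => Nat.zero_le _)
        (Finset.mem_range.2 (by lia))
    rw [hs]
    simp only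
    lia
  have hlim : ∀ i, ∃ g : Euc n → E, MemLp g 2 volume ∧ Tendsto (fun k => eLpNorm
      ((fun x => f i (s k) x - f i (s 0) x) - g) 2 volume) atTop (𝓝 0) := fun i => by
    refine Lp.cauchy_complete_eLpNorm (by norm_num) (B := fun k => 2 * (1 / 2 : ℝ≥0∞) ^ k)
      (fun k => ⟨(hm i _).sub (hm i _), ?_⟩) ?_ fun K k l hk hl => ?_
    · exact (hN i 0 _ (hsN 0 k i (Nat.zero_le _)) _ (hsN 0 0 i le_rfl)).trans_lt (by simp)
    · rw [ENNReal.tsum_mul_left, ENNReal.tsum_geometric]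
      simp only [one_div, ENNReal.one_sub_inv_two, inv_inv]
      finiteness
    · have e : ((fun x => f i (s k) x - f i (s 0) x) - fun x => f i (s l) x - f i (s 0) x)
          = fun x => f i (s k) x - f i (s l) x := by
        funext x
        simp
      rw [e]
      refine (hN i K _ (hsN K k i hk) _ (hsN K l i hl)).trans_lt ?_
      conv_lhs => rw [← one_mul ((1 / 2 : ℝ≥0∞) ^ K)]
      exact ENNReal.mul_lt_mul_left (by simp) (by simp) (by norm_num)
  choose g hg hgt using hlim
  refine ⟨s, fun i => ((hg i).1.add (hm i (s 0))).mk _, ?_, fun i => ⟨?_, ?_, ?_⟩⟩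
  · exact tendsto_atTop_mono (fun k => by rw [hs]; simp) tendsto_id
  · exact ((hg i).1.add (hm i (s 0))).stronglyMeasurable_mk
  · refine LocallyIntegrable.congr ?_ ((hg i).1.add (hm i (s 0))).ae_eq_mk
    exact ((hg i).locallyIntegrable (by norm_num)).add (hl i _)
  · refine (hgt i).congr fun k => eLpNorm_congr_ae ?_
    filter_upwards [((hg i).1.add (hm i (s 0))).ae_eq_mk] with x hx
    rw [← hx]
    simp only [Pi.sub_apply, Pi.add_apply]
    abel

theorem ae_l1Diff_of_eLpNorm [FiniteDimensional ℝ E] {U : Euc n → E} {w : ℕ → Euc n → E}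
    {Dw : ℕ → Euc n → Euc n →L[ℝ] E} (hw : ∀ J x, HasFDerivAt (w J) (Dw J x) x)
    (hc : ∀ J, Continuous (Dw J)) {G : Fin n → Euc n → E}
    (hG : ∀ i, StronglyMeasurable (G i) ∧ LocallyIntegrable (G i) volume ∧
      Tendsto (fun k => eLpNorm (fun x => Dw k x (stdVec n i) - G i x) 2 volume) atTop (𝓝 0))
    (hU : ∀ᵐ x, Tendsto (fun J => w J x) atTop (𝓝 (U x))) : ∀ᵐ x, L1Diff U x := by
  have hDc : ∀ i J, Continuous fun x => Dw J x (stdVec n i) := fun i J =>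
    (hc J).clm_apply continuous_const
  set G' : Euc n → Euc n →L[ℝ] E := fun x =>
    ∑ i, ((EuclideanSpace.proj i : Euc n →L[ℝ] ℝ).smulRight (G i x)) with hG'
  have hsr : ∀ i, Continuous fun v : E => (EuclideanSpace.proj i : Euc n →L[ℝ] ℝ).smulRight v :=
    fun i => (ContinuousLinearMap.smulRightL ℝ (Euc n) E (EuclideanSpace.proj i)).continuous
  have hG'a : ∀ x i, G' x (stdVec n i) = G i x := fun x i => by
    rw [hG']
    simp only [_root_.sum_apply, ContinuousLinearMap.smulRight_apply]
    rw [Finset.sum_eq_single i]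
    · simp [stdVec]
    · intro j _ hj
      simp [stdVec, hj]
    · simp
  have hGn : ∀ x, ‖G' x‖ ≤ ∑ i, ‖G i x‖ := fun x => by
    refine (norm_clm_le_sum _).trans (le_of_eq (Finset.sum_congr rfl fun i _ => ?_))
    rw [hG'a]
  have hGm : StronglyMeasurable G' :=
    Finset.stronglyMeasurable_fun_sum _ fun i _ => (hsr i).comp_stronglyMeasurable (hG i).1
  refine ae_l1Diff_of_approx hw hc hGm ?_ ?_ hU
  · have h1 : LocallyIntegrable (fun x => ∑ i, ‖G i x‖) volume :=
      locallyIntegrable_finsetSum _ fun i _ =>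
        (hG i).2.1.mono (hG i).1.norm.aestronglyMeasurable (ae_of_all _ fun x => by simp)
    refine h1.mono hGm.aestronglyMeasurable (ae_of_all _ fun x => (hGn x).trans (le_abs_self _))
  · intro R
    have h1 : ∀ k, ∫⁻ x in ball (0 : Euc n) R, ‖Dw k x - G' x‖ₑ
        ≤ ∑ i, eLpNorm (fun x => Dw k x (stdVec n i) - G i x) 2 volume
          * volume (ball (0 : Euc n) R) ^ (1 / 2 : ℝ) := fun k => by
      have hmi : ∀ i, AEStronglyMeasurable fun x => Dw k x (stdVec n i) - G i x :=
        fun i => (hDc i k).aestronglyMeasurable.sub (hG i).1.aestronglyMeasurable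
      refine le_trans (lintegral_mono (g := fun x => ∑ i, ‖Dw k x (stdVec n i) - G i x‖ₑ)
        fun x => ?_) ?_
      · refine (enorm_clm_le_sum _).trans (le_of_eq (Finset.sum_congr rfl fun i _ => ?_))
        rw [_root_.sub_apply, hG'a]
      · rw [lintegral_finsetSum' _ fun i _ => (hmi i).enorm.restrict]
        exact Finset.sum_le_sum fun i _ => lintegral_ball_enorm_le_eLpNorm (hmi i) R
    have h2 : Tendsto (fun k => ∑ i, eLpNorm (fun x => Dw k x (stdVec n i) - G i x) 2 volume
          * volume (ball (0 : Euc n) R) ^ (1 / 2 : ℝ)) atTop (𝓝 (∑ _i : Fin n, 0)) := by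
      refine tendsto_finsetSum _ fun i _ => ?_
      simpa using ENNReal.Tendsto.mul_const (hG i).2.2 (Or.inr (ENNReal.rpow_ne_top_of_nonneg
        (by norm_num) (measure_ball_lt_top (x := (0 : Euc n)) (r := R)).ne))
    rw [Finset.sum_const_zero] at h2
    exact tendsto_of_tendsto_of_tendsto_of_le_of_le tendsto_const_nhds h2 (fun _ => zero_le) h1

end Kernels

section Potential

variable {n : ℕ} {V W : Type*} [NormedAddCommGroup V] [InnerProductSpace ℝ V]
  [FiniteDimensional ℝ V] [NormedAddCommGroup W] [InnerProductSpace ℝ W] [FiniteDimensional ℝ W]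
  {A : CoeffOp n 1 V W}

theorem norm_sum_le_sum_of_le {ι E : Type*} [NormedAddCommGroup E] (s : Finset ι) (f : ι → E)
    {c : ι → ℝ} (h : ∀ i ∈ s, ‖f i‖ ≤ c i) : ‖∑ i ∈ s, f i‖ ≤ ∑ i ∈ s, c i :=
  (norm_sum_le _ _).trans (Finset.sum_le_sum h)

theorem exists_norm_KJ_le (hA : IsElliptic n 1 A) (J : ℕ) : ∃ C : ℝ, (∀ z, ‖KJ hA J z‖ ≤ C) ∧
    ∀ z, ‖∑ j ∈ Finset.Ico (-J : ℤ) J, dj hA j z‖ ≤ C := by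
  choose C hC using exists_norm_kj_le hA
  refine ⟨∑ j ∈ Finset.Ico (-J : ℤ) J, C j, fun z => ?_, fun z => ?_⟩
  · exact (norm_sum_le _ _).trans (Finset.sum_le_sum fun j _ => (hC j z).1)
  · exact norm_sum_le_sum_of_le _ (fun j => dj hA j z) fun j _ => (hC j z).2

theorem ae_l1Diff_pot_volume (hn : 1 < n) (hA : IsElliptic n 1 A) {g : Euc n → W}
    (hg : Integrable g) (hg2 : MemLp g 2 volume) : ∀ᵐ x, L1Diff (pot hA volume g) x := by
  set T' : ℕ → Euc n → Euc n →L[ℝ] W →L[ℝ] V := fun J z => ∑ j ∈ Finset.Ico (-J : ℤ) J, dj hA j z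
  have hT'c : ∀ J, Continuous (T' J) := fun J => continuous_finsetSum _ fun j _ => continuous_dj hA j
  choose C hC hC' using exists_norm_KJ_le hA
  have key := fun J => hasFDerivAt_integral_kernel (T := KJ hA J) (T' := T' J)
    (hasFDerivAt_KJ hn hA J) (hT'c J) (hC J) (hC' J) hg
  set Dw : ℕ → Euc n → Euc n →L[ℝ] V := fun J x => ∫ y, (T' J (x - y)).flip (g y) with hDw
  have hDc : ∀ i J, Continuous fun x => Dw J x (stdVec n i) := fun i J =>
    (key J).2.1.clm_apply continuous_const
  have hF : ∀ J x i, Dw J x (stdVec n i) = ∫ y, gradTrunc hA i J (x - y) (g y) := fun J x i => by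
    rw [hDw]
    simp only
    rw [(key J).2.2]
    refine integral_congr_ae (ae_of_all _ fun y => ?_)
    simp only
    rw [gradTrunc_eq]
    simp only [T', _root_.sum_apply]
  obtain ⟨s, G, hs, hG⟩ := exists_subseq_tendsto_eLpNorm (ι := Fin n)
    (f := fun i J x => Dw J x (stdVec n i)) (fun i J => (hDc i J).aestronglyMeasurable)
    (fun i J => (hDc i J).locallyIntegrable) (fun i ε hε => by
      simp only [hF]
      exact gradTrunc_cauchy hn.le hA i hg2 hε)
  exact ae_l1Diff_of_eLpNorm (w := fun k x => ∫ y, KJ hA (s k) (x - y) (g y))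
    (Dw := fun k => Dw (s k)) (fun k => (key (s k)).1) (fun k => (key (s k)).2.1) hG <| by
    filter_upwards [ae_riesz_ne_top hn volume hg.1.enorm hg.2.ne] with x hx
    exact (tendsto_integral_KJ hn hA volume hg.1 hx).comp hs

end Potential

section Smear

variable {n : ℕ}

noncomputable def smear (σ : Measure (Euc n)) (F : Set (Euc n)) : Measure (Euc n) :=
  (σ.prod (unif n)).map fun p => p.1 + (infDist p.1 F / 4) • p.2

theorem measurable_smear_fun (F : Set (Euc n)) :
    Continuous fun p : Euc n × Euc n => p.1 + (infDist p.1 F / 4) • p.2 :=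
  continuous_fst.add ((((continuous_infDist_pt F).comp continuous_fst).div_const 4).smul
    continuous_snd)

instance (σ : Measure (Euc n)) [IsFiniteMeasure σ] (F : Set (Euc n)) :
    IsFiniteMeasure (smear σ F) := by
  unfold smear
  infer_instance

theorem smear_apply (σ : Measure (Euc n)) [SFinite σ] (F : Set (Euc n)) {s : Set (Euc n)}
    (hs : MeasurableSet s) :
    smear σ F s = ∫⁻ y, unif n {ζ | y + (infDist y F / 4) • ζ ∈ s} ∂σ := by
  unfold smear
  rw [Measure.map_apply (measurable_smear_fun F).measurable hs,
    Measure.prod_apply ((measurable_smear_fun F).measurable hs)]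
  rfl

theorem unif_preimage_closedBall_le (y z : Euc n) {δ r : ℝ} (hδ : 0 < δ) (hr : 0 ≤ r) :
    unif n {ζ | y + δ • ζ ∈ closedBall z r} ≤ ENNReal.ofReal ((r / δ) ^ n) := by
  have h1 : {ζ : Euc n | y + δ • ζ ∈ closedBall z r} ⊆ closedBall (δ⁻¹ • (z - y)) (r / δ) := by
    intro ζ hζ
    rw [Set.mem_ofPred_eq, mem_closedBall, dist_eq_norm] at hζ
    rw [mem_closedBall, dist_eq_norm, le_div_iff₀' hδ, ← abs_of_pos hδ, ← Real.norm_eq_abs,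
      ← norm_smul, smul_sub, smul_smul, Real.norm_eq_abs, abs_of_pos hδ, mul_inv_cancel₀ hδ.ne',
      one_smul]
    rwa [show δ • ζ - (z - y) = y + δ • ζ - z by abel]
  refine (measure_mono h1).trans ?_
  unfold unif
  rw [Measure.smul_apply, smul_eq_mul]
  refine (mul_le_mul_right (Measure.restrict_apply_le _ _) _).trans ?_
  rw [Measure.addHaar_closedBall _ _ (by positivity), finrank_euclideanSpace_fin, mul_comm,
    mul_assoc, ENNReal.mul_inv_cancel (measure_ball_pos _ _ one_pos).ne' measure_ball_lt_top.ne,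
    mul_one]

theorem smear_closedBall_le (σ : Measure (Euc n)) [SFinite σ] {F : Set (Euc n)}
    (hF : IsClosed F) (hne : F.Nonempty) {c : ℝ} (hc : 0 ≤ c)
    (hσ : ∀ x ∈ F, ∀ r : ℝ, 0 < r → σ (ball x r) ≤ ENNReal.ofReal (c * r ^ n)) (z : Euc n) :
    ∃ δ > 0, ∀ r : ℝ, 0 < r → r ≤ δ →
      smear σ F (closedBall z r) ≤ ENNReal.ofReal (24 ^ n * c * r ^ n) := by
  have hae : ∀ᵐ ζ ∂unif n, ‖ζ‖ ≤ 1 := ae_unif_norm_le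
  have hzero : ∀ (y : Euc n) (r : ℝ), r + infDist y F / 4 < dist y z →
      unif n {ζ | y + (infDist y F / 4) • ζ ∈ closedBall z r} = 0 := by
    intro y r hyr
    rw [← nonpos_iff_eq_zero, ← show unif n {ζ | ¬ ‖ζ‖ ≤ 1} = 0 from hae]
    refine measure_mono fun ζ hζ hζ1 => ?_
    rw [Set.mem_ofPred_eq, mem_closedBall, dist_eq_norm] at hζ
    have h1 : ‖(infDist y F / 4) • ζ‖ ≤ infDist y F / 4 := by
      rw [norm_smul, Real.norm_eq_abs, abs_of_nonneg (by have := infDist_nonneg (x := y) (s := F); positivity)]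
      exact mul_le_of_le_one_right (by have := infDist_nonneg (x := y) (s := F); positivity) hζ1
    have h2 : ‖y - z‖ ≤ ‖y + (infDist y F / 4) • ζ - z‖ + ‖(infDist y F / 4) • ζ‖ := by
      rw [show y - z = (y + (infDist y F / 4) • ζ - z) - (infDist y F / 4) • ζ by abel]
      exact norm_sub_le _ _
    rw [dist_eq_norm] at hyr
    linarith
  have hdist : ∀ y : Euc n, infDist y F ≤ infDist z F + dist y z := fun y =>
    infDist_le_infDist_add_dist
  by_cases hz : z ∈ F
  · refine ⟨1, one_pos, fun r hr _ => ?_⟩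
    rw [smear_apply σ F isClosed_closedBall.measurableSet]
    have h1 : ∀ y, unif n {ζ | y + (infDist y F / 4) • ζ ∈ closedBall z r}
        ≤ (ball z (2 * r)).indicator 1 y := by
      intro y
      by_cases hy : y ∈ ball z (2 * r)
      · rw [Set.indicator_of_mem hy]
        exact prob_le_one
      · rw [Set.indicator_of_notMem hy, hzero y r]
        rw [mem_ball, not_lt] at hy
        have := hdist y
        rw [infDist_zero_of_mem hz] at this
        linarith
    refine (lintegral_mono h1).trans ?_
    rw [lintegral_indicator_one isOpen_ball.measurableSet]
    refine (hσ z hz _ (by positivity)).trans (ENNReal.ofReal_le_ofReal ?_)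
    rw [mul_pow, show 24 ^ n * c * r ^ n = c * (24 ^ n * r ^ n) by ring]
    gcongr
    norm_num
  · have hd : 0 < infDist z F := (hF.notMem_iff_infDist_pos hne).1 hz
    set d := infDist z F
    refine ⟨d / 8, by positivity, fun r hr hrd => ?_⟩
    obtain ⟨p, hp, hpd⟩ := (infDist_lt_iff hne).1 (show infDist z F < 2 * d by linarith)
    rw [smear_apply σ F isClosed_closedBall.measurableSet]
    have h1 : ∀ y, unif n {ζ | y + (infDist y F / 4) • ζ ∈ closedBall z r}
        ≤ (ball p (3 * d)).indicator (fun _ => ENNReal.ofReal ((8 * r / d) ^ n)) y := by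
      intro y
      by_cases hy : r + infDist y F / 4 < dist y z
      · rw [hzero y r hy]
        exact zero_le
      · rw [not_lt] at hy
        have h2 := hdist y
        have h3 : dist y z ≤ d / 2 := by linarith
        have h4 : d / 2 ≤ infDist y F := by
          have := infDist_le_infDist_add_dist (s := F) (x := z) (y := y)
          rw [dist_comm] at this
          linarith
        have h5 : y ∈ ball p (3 * d) := by
          rw [mem_ball]
          linarith [dist_triangle y z p]
        rw [Set.indicator_of_mem h5]
        refine (unif_preimage_closedBall_le y z (by linarith) hr.le).trans
          (ENNReal.ofReal_le_ofReal (pow_le_pow_left₀ (div_nonneg hr.le (by linarith)) ?_ n))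
        rw [div_le_div_iff₀ (by linarith) hd]
        nlinarith
    refine (lintegral_mono h1).trans ?_
    rw [lintegral_indicator_const isOpen_ball.measurableSet]
    refine (mul_le_mul_right (hσ p hp (3 * d) (by positivity)) _).trans ?_
    rw [← ENNReal.ofReal_mul (by positivity)]
    refine le_of_eq (congrArg _ ?_)
    rw [show (24 : ℝ) = 8 * 3 by norm_num, mul_pow, mul_pow, div_pow, mul_pow]
    field_simp

theorem smear_le (σ : Measure (Euc n)) [IsFiniteMeasure σ] {F : Set (Euc n)}
    (hF : IsClosed F) (hne : F.Nonempty) {c : ℝ} (hc : 0 ≤ c)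
    (hσ : ∀ x ∈ F, ∀ r : ℝ, 0 < r → σ (ball x r) ≤ ENNReal.ofReal (c * r ^ n)) :
    ∃ C : NNReal, ∀ s, smear σ F s ≤ C * volume s := by
  set b := volume (ball (0 : Euc n) 1) with hb
  have hb0 : b ≠ 0 := (measure_ball_pos _ _ one_pos).ne'
  have hbt : b ≠ ⊤ := measure_ball_lt_top.ne
  refine ⟨((ENNReal.ofReal (24 ^ n * c)) / b).toNNReal, fun s => ?_⟩
  rw [ENNReal.coe_toNNReal (ENNReal.div_ne_top ENNReal.ofReal_ne_top hb0)]
  set C := (ENNReal.ofReal (24 ^ n * c)) / b with hC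
  have hCt : C ≠ ⊤ := ENNReal.div_ne_top ENNReal.ofReal_ne_top hb0
  have : IsLocallyFiniteMeasure (C.toNNReal • (volume : Measure (Euc n))) := inferInstance
  have key := VitaliFamily.measure_le_of_frequently_le (Besicovitch.vitaliFamily (smear σ F))
    (C.toNNReal • (volume : Measure (Euc n))) (ρ := smear σ F)
    Measure.AbsolutelyContinuous.rfl s fun z _ => ?_
  · rw [Measure.smul_apply, ENNReal.smul_def, ENNReal.coe_toNNReal hCt] at key
    exact key
  · refine (Besicovitch.tendsto_filterAt (smear σ F) z).frequently ?_
    obtain ⟨δ, hδ, h⟩ := smear_closedBall_le σ hF hne hc hσ z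
    refine Eventually.frequently ?_
    filter_upwards [Ioc_mem_nhdsGT hδ] with r hr
    refine (h r hr.1 hr.2).trans ?_
    rw [Measure.smul_apply, ENNReal.smul_def, ENNReal.coe_toNNReal hCt, smul_eq_mul,
      Measure.addHaar_closedBall _ _ hr.1.le, finrank_euclideanSpace_fin, ← hb, hC,
      mul_comm (ENNReal.ofReal (r ^ n)), ← mul_assoc, ENNReal.div_mul_cancel hb0 hbt,
      ← ENNReal.ofReal_mul (by positivity)]

theorem ae_exists_measure_ball_le (σ : Measure (Euc n)) [IsFiniteMeasure σ] :
    ∀ᵐ x, ∃ c : ℕ, ∀ r : ℝ, 0 < r → σ (ball x r) ≤ ENNReal.ofReal (c * r ^ n) := by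
  filter_upwards [Besicovitch.ae_tendsto_rnDeriv σ volume, Measure.rnDeriv_lt_top σ volume]
    with x hx hxt
  set b := volume (ball (0 : Euc n) 1) with hb
  have hb0 : b ≠ 0 := (measure_ball_pos _ _ one_pos).ne'
  have hbt : b ≠ ⊤ := measure_ball_lt_top.ne
  obtain ⟨M, hM1, hM2⟩ := ENNReal.lt_iff_exists_nnreal_btwn.1 hxt
  have h1 := hx.eventually_lt_const hM1
  obtain ⟨δ, hδ, h2⟩ := (mem_nhdsGT_iff_exists_Ioc_subset).1 h1
  rw [Set.mem_Ioi] at hδ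
  obtain ⟨c, hcc⟩ := exists_nat_ge (M * b.toReal + (σ Set.univ).toReal / δ ^ n)
  refine ⟨c, fun r hr => ?_⟩
  by_cases hrd : r ≤ δ
  · have h3 : σ (closedBall x r) / volume (closedBall x r) < M := h2 ⟨hr, hrd⟩
    have h4 : σ (closedBall x r) ≤ M * volume (closedBall x r) :=
      (ENNReal.div_le_iff_le_mul (Or.inl (measure_closedBall_pos _ _ hr).ne')
        (Or.inl measure_closedBall_lt_top.ne)).1 h3.le
    refine (measure_mono ball_subset_closedBall).trans (h4.trans ?_)
    rw [Measure.addHaar_closedBall _ _ hr.le, finrank_euclideanSpace_fin, ← hb,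
      ← ENNReal.ofReal_toReal hbt, ← ENNReal.ofReal_coe_nnreal, ← ENNReal.ofReal_mul (by positivity),
      ← ENNReal.ofReal_mul (by positivity)]
    refine ENNReal.ofReal_le_ofReal ?_
    have : 0 ≤ (σ Set.univ).toReal / δ ^ n := by positivity
    calc (M : ℝ) * (r ^ n * b.toReal) = (M * b.toReal) * r ^ n := by ring
      _ ≤ c * r ^ n := by gcongr; linarith
  · rw [not_le] at hrd
    refine (measure_mono (Set.subset_univ _)).trans ?_
    rw [← ENNReal.ofReal_toReal (measure_ne_top σ Set.univ)]
    refine ENNReal.ofReal_le_ofReal ?_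
    have h3 : (σ Set.univ).toReal / δ ^ n ≤ c := by
      have : (0 : ℝ) ≤ M * b.toReal := by positivity
      linarith
    rw [div_le_iff₀ (by positivity)] at h3
    refine h3.trans ?_
    gcongr

end Smear

section SmearPot

variable {n : ℕ} {V W : Type*} [NormedAddCommGroup V] [InnerProductSpace ℝ V]
  [FiniteDimensional ℝ V] [NormedAddCommGroup W] [InnerProductSpace ℝ W] [FiniteDimensional ℝ W]
  {A : CoeffOp n 1 V W}

theorem memLp_two_of_bounded {g : Euc n → W} (hg : Integrable g) {C : ℝ}
    (hC : ∀ᵐ x, ‖g x‖ ≤ C) : MemLp g 2 volume := by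
  refine (memLp_two_iff_integrable_sq_norm hg.1).2 ?_
  simp only [pow_two]
  exact hg.norm.mul_bdd hg.1.norm (hC.mono fun x hx => by simpa using hx)

theorem ae_l1Diff_pot_of_le_volume (hn : 1 < n) (hA : IsElliptic n 1 A) (σ : Measure (Euc n))
    [IsFiniteMeasure σ] {C : NNReal} (hσ : ∀ s, σ s ≤ C * volume s) (w : W) :
    ∀ᵐ x, L1Diff (pot hA σ fun _ => w) x := by
  have hac : σ ≪ volume := Measure.AbsolutelyContinuous.mk fun s _ hs => by
    have := hσ s
    rwa [hs, mul_zero, nonpos_iff_eq_zero] at this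
  set g : Euc n → W := fun y => (σ.rnDeriv volume y).toReal • w with hg
  have hgi : Integrable g := (integrable_rnDeriv_smul_iff hac).2 (integrable_const w)
  have hb : ∀ᵐ y, σ.rnDeriv volume y ≤ C := by
    refine ae_le_of_forall_setLIntegral_le_of_sigmaFinite (Measure.measurable_rnDeriv _ _)
      fun s hs _ => ?_
    rw [setLIntegral_const]
    exact (Measure.setLIntegral_rnDeriv_le s).trans (hσ s)
  have hgb : ∀ᵐ y, ‖g y‖ ≤ C * ‖w‖ := by
    filter_upwards [hb] with y hy
    rw [hg, norm_smul, Real.norm_eq_abs, abs_of_nonneg ENNReal.toReal_nonneg]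
    gcongr
    exact ENNReal.toReal_mono ENNReal.coe_ne_top hy
  have e : pot hA σ (fun _ => w) = pot hA volume g := by
    funext x
    unfold pot
    rw [← integral_rnDeriv_smul hac]
    simp only [hg, map_smul]
  rw [e]
  exact ae_l1Diff_pot_volume hn hA hgi (memLp_two_of_bounded hgi hgb)

theorem ae_integrable_KK (hn : 1 < n) (hA : IsElliptic n 1 A) (σ : Measure (Euc n))
    [IsFiniteMeasure σ] {f : Euc n → W} (hf : Integrable f σ) :
    ∀ᵐ x, Integrable (fun y => KK hA (x - y) (f y)) σ := by
  obtain ⟨C, hC, h⟩ := exists_enorm_pot_le hn hA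
  filter_upwards [ae_riesz_ne_top hn σ hf.1.enorm hf.2.ne] with x hx
  refine ⟨aestronglyMeasurable_clm_apply ((stronglyMeasurable_KK hn hA).comp_measurable
    (measurable_const.sub measurable_id)).aestronglyMeasurable hf.1, ?_⟩
  exact ((h σ f x).1).trans_lt (ENNReal.mul_lt_top hC.lt_top hx.lt_top)

theorem pot_eq_smear_add_oscPart (hn : 1 < n) (hA : IsElliptic n 1 A) (σ : Measure (Euc n))
    [IsFiniteMeasure σ] (F : Set (Euc n)) (w : W) :
    ∀ᵐ x, pot hA (smear σ F) (fun _ => w) x + oscPart (fun z => KK hA z w) σ F x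
      = pot hA σ (fun _ => w) x := by
  filter_upwards [ae_integrable_KK hn hA σ (integrable_const w),
    ae_integrable_KK hn hA (smear σ F) (integrable_const w)] with x h1 h2
  have hm := (measurable_smear_fun F).measurable
  have h3 : Integrable (fun p : Euc n × Euc n => KK hA (x - (p.1 + (infDist p.1 F / 4) • p.2)) w)
      (σ.prod (unif n)) := (integrable_map_measure h2.1 hm.aemeasurable).1 h2
  have h4 : pot hA (smear σ F) (fun _ => w) x
      = ∫ y, ∫ ζ, KK hA (x - y - (infDist y F / 4) • ζ) w ∂unif n ∂σ := by
    unfold pot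
    unfold smear at h2 ⊢
    rw [integral_map hm.aemeasurable h2.1, integral_prod _ h3]
    simp only [sub_sub]
  have h5 : Integrable (fun y => ∫ ζ, KK hA (x - y - (infDist y F / 4) • ζ) w ∂unif n) σ := by
    have := h3.integral_prod_left
    simpa only [sub_sub] using this
  rw [h4]
  unfold oscPart pot avgDiff
  rw [integral_sub h1 h5, add_sub_cancel]

theorem ae_l1Diff_pot_const (hn : 1 < n) (hA : IsElliptic n 1 A) (σ : Measure (Euc n))
    [IsFiniteMeasure σ] {R : ℝ} (hR : ∀ᵐ y ∂σ, ‖y‖ ≤ R) (w : W) :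
    ∀ᵐ x, L1Diff (pot hA σ fun _ => w) x := by
  set S : ℕ → Set (Euc n) := fun c =>
    {x | ∀ r : ℝ, 0 < r → σ (ball x r) ≤ ENNReal.ofReal (c * r ^ n)}
  have hS : ∀ c : ℕ, ∀ᵐ x, x ∈ closure (S c) → L1Diff (pot hA σ fun _ => w) x := by
    intro c
    by_cases hne : (closure (S c)).Nonempty
    swap
    · exact ae_of_all _ fun x hx => (hne ⟨x, hx⟩).elim
    have hcl : ∀ x ∈ closure (S c), ∀ r : ℝ, 0 < r →
        σ (ball x r) ≤ ENNReal.ofReal (2 ^ n * c * r ^ n) := by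
      intro x hx r hr
      obtain ⟨x', hx', hd⟩ := Metric.mem_closure_iff.1 hx r hr
      refine (measure_mono (ball_subset_ball' (y := x') (ε₂ := 2 * r) (by linarith))).trans ?_
      refine (hx' (2 * r) (by positivity)).trans (le_of_eq (congrArg _ ?_))
      rw [mul_pow]
      ring
    obtain ⟨C, hC⟩ := smear_le σ isClosed_closure hne (c := 2 ^ n * c) (by positivity) hcl
    obtain ⟨p, hp⟩ := hne
    obtain ⟨C', DK, hK⟩ := exists_isKer_KK_apply hn hA w
    have hd : ∀ᵐ y ∂σ, infDist y (closure (S c)) ≤ R + ‖p‖ := by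
      filter_upwards [hR] with y hy
      refine (infDist_le_dist_of_mem hp).trans ?_
      rw [dist_eq_norm]
      exact (norm_sub_le _ _).trans (by gcongr)
    have hm1 : AEStronglyMeasurable (pot hA (smear σ (closure (S c))) fun _ => w) volume :=
      aestronglyMeasurable_pot hn hA (integrable_const w)
    filter_upwards [hK.ae_l1Diff_oscPart hn σ isClosed_closure.measurableSet hd,
      ae_l1Diff_pot_of_le_volume hn hA _ hC w] with x h1 h2 hx
    exact (h2.add (h1 hx) hm1).congr (s := Set.univ) univ_mem <| by
      filter_upwards [pot_eq_smear_add_oscPart hn hA σ (closure (S c)) w] with y hy _ using hy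
  filter_upwards [ae_exists_measure_ball_le σ, ae_all_iff.2 hS] with x ⟨c, hc⟩ h
  exact h c (subset_closure hc)

end SmearPot

section Cutoff

variable {n : ℕ} {V W : Type*} [NormedAddCommGroup V] [InnerProductSpace ℝ V]
  [FiniteDimensional ℝ V] [NormedAddCommGroup W] [InnerProductSpace ℝ W] [FiniteDimensional ℝ W]
  {A : CoeffOp n 1 V W}

noncomputable def gradTerm (A : CoeffOp n 1 V W) (φ : Euc n → ℝ) (u : Euc n → V) (x : Euc n) : W :=
  ∑ i, fderiv ℝ φ x (stdVec n i) • coef A i (u x)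

theorem IsTestFun.smul_test {φ : Euc n → ℝ} {ψ : Euc n → W} (hφ : IsTestFun n φ)
    (hψ : IsTestFun n ψ) : IsTestFun n fun x => φ x • ψ x :=
  ⟨hφ.1.smul hψ.1, hφ.2.smul_right⟩

theorem locallyIntegrable_coef (A : CoeffOp n 1 V W) {u : Euc n → V}
    (hu : LocallyIntegrable u volume) (i : Fin n) :
    LocallyIntegrable (fun x => coef A i (u x)) volume := fun x => by
  obtain ⟨s, hs, h⟩ := hu x
  exact ⟨s, hs, (coefL A i).integrable_comp h⟩

theorem integrable_smul_of_test {φ : Euc n → ℝ} (hφ : Continuous φ) (hc : HasCompactSupport φ)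
    {μ : Measure (Euc n)} {u : Euc n → V} (hu : LocallyIntegrable u μ) :
    Integrable (fun x => φ x • u x) μ :=
  integrable_bilin_of_hasCompactSupport (ContinuousLinearMap.lsmul ℝ ℝ : ℝ →L[ℝ] V →L[ℝ] V).flip
    hu hφ hc

theorem integrable_gradTerm (A : CoeffOp n 1 V W) {φ : Euc n → ℝ} (hφ : IsTestFun n φ)
    {u : Euc n → V} (hu : LocallyIntegrable u volume) : Integrable (gradTerm A φ u) := by
  unfold gradTerm
  exact integrable_finsetSum _ fun i _ => integrable_smul_of_test
    (hφ.fderiv_apply_eq _).1.continuous (hφ.fderiv_apply_eq _).2 (locallyIntegrable_coef A hu i)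

theorem sum_integral_cutoff {u : Euc n → V} (hu : LocallyIntegrable u volume) {φ : Euc n → ℝ}
    (hφ : IsTestFun n φ) {ψ : Euc n → W} (hψ : IsTestFun n ψ) :
    -(∑ i, ∫ x, ⟪coef A i (φ x • u x), fderiv ℝ ψ x (stdVec n i)⟫)
      = -(∑ i, ∫ x, ⟪coef A i (u x), fderiv ℝ (fun x => φ x • ψ x) x (stdVec n i)⟫)
        + ∫ x, ⟪gradTerm A φ u x, ψ x⟫ := by
  have hul := fun i => locallyIntegrable_coef A hu i
  have h1 : ∀ i, Integrable fun x =>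
      ⟪coef A i (u x), φ x • fderiv ℝ ψ x (stdVec n i)⟫ := fun i =>
    locallyIntegrable_inner_test (hul i)
      (hφ.1.continuous.smul (hψ.fderiv_apply_eq (stdVec n i)).1.continuous) hφ.2.smul_right
  have h2 : ∀ i, Integrable fun x =>
      ⟪coef A i (u x), fderiv ℝ φ x (stdVec n i) • ψ x⟫ := fun i =>
    locallyIntegrable_inner_test (hul i)
      ((hφ.fderiv_apply_eq (stdVec n i)).1.continuous.smul hψ.1.continuous) hψ.2.smul_left
  have h3 : ∀ i x, ⟪coef A i (u x), fderiv ℝ (fun x => φ x • ψ x) x (stdVec n i)⟫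
      = ⟪coef A i (u x), φ x • fderiv ℝ ψ x (stdVec n i)⟫
        + ⟪coef A i (u x), fderiv ℝ φ x (stdVec n i) • ψ x⟫ := fun i x => by
    rw [fderiv_fun_smul (hφ.1.differentiable (by simp) x) (hψ.1.differentiable (by simp) x),
      _root_.add_apply, _root_.smul_apply, ContinuousLinearMap.smulRight_apply, inner_add_right]
  have h4 : ∫ x, ⟪gradTerm A φ u x, ψ x⟫
      = ∑ i, ∫ x, ⟪coef A i (u x), fderiv ℝ φ x (stdVec n i) • ψ x⟫ := by
    rw [← integral_finsetSum _ fun i _ => h2 i]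
    refine integral_congr_ae (ae_of_all _ fun x => ?_)
    simp only [gradTerm, sum_inner, real_inner_smul_left, real_inner_smul_right]
  rw [h4]
  simp only [h3]
  rw [Finset.sum_congr rfl fun i _ => integral_add (h1 i) (h2 i), Finset.sum_add_distrib,
    neg_add, neg_add_cancel_right]
  simp only [map_smul, real_inner_smul_left, real_inner_smul_right]

theorem gradTerm_eq_zero {φ : Euc n → ℝ} {u : Euc n → V} {x : Euc n} (hx : x ∉ tsupport φ) :
    gradTerm A φ u x = 0 := by
  have h : fderiv ℝ φ x = 0 := image_eq_zero_of_notMem_tsupport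
    fun h => hx (tsupport_fderiv_subset ℝ h)
  simp [gradTerm, h]

/-- A sum of two vector measures, written with a density with respect to one finite measure. -/
theorem exists_density_add {σ₁ σ₂ : Measure (Euc n)} [SFinite σ₁] [SFinite σ₂]
    {f₁ f₂ : Euc n → W} (h₁ : Integrable f₁ σ₁) (h₂ : Integrable f₂ σ₂) {R : ℝ}
    (hR₁ : ∀ x, R < ‖x‖ → f₁ x = 0) (hR₂ : ∀ x, R < ‖x‖ → f₂ x = 0)
    (hs₁ : σ₁ (closedBall 0 R) ≠ ⊤) (hs₂ : σ₂ (closedBall 0 R) ≠ ⊤) :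
    ∃ (τ : Measure (Euc n)) (f : Euc n → W), IsFiniteMeasure τ ∧ (∀ᵐ x ∂τ, ‖x‖ ≤ R) ∧
      Integrable f τ ∧ (∀ x, R < ‖x‖ → f x = 0) ∧ ∀ ψ : Euc n → W, Continuous ψ →
        HasCompactSupport ψ →
        ∫ x, ⟪f x, ψ x⟫ ∂τ = ∫ x, ⟪f₁ x, ψ x⟫ ∂σ₁ + ∫ x, ⟪f₂ x, ψ x⟫ ∂σ₂ := by
  set B := closedBall (0 : Euc n) R
  have hB : MeasurableSet B := isClosed_closedBall.measurableSet
  set s₁ := σ₁.restrict B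
  set s₂ := σ₂.restrict B
  have f₁s : IsFiniteMeasure s₁ := ⟨by rw [Measure.restrict_apply_univ]; exact hs₁.lt_top⟩
  have f₂s : IsFiniteMeasure s₂ := ⟨by rw [Measure.restrict_apply_univ]; exact hs₂.lt_top⟩
  have hr : ∀ (σ : Measure (Euc n)) (f : Euc n → W), (∀ x, R < ‖x‖ → f x = 0) →
      ∀ ψ : Euc n → W, ∫ x, ⟪f x, ψ x⟫ ∂σ.restrict B = ∫ x, ⟪f x, ψ x⟫ ∂σ := fun σ f hf ψ =>
    setIntegral_eq_integral_of_forall_compl_eq_zero fun x hx => by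
      rw [hf x (by simpa [B] using hx), inner_zero_left]
  set τ := s₁ + s₂
  have ac₁ : s₁ ≪ τ := Measure.le_add_right le_rfl |>.absolutelyContinuous
  have ac₂ : s₂ ≪ τ := Measure.le_add_left le_rfl |>.absolutelyContinuous
  have i₁ := (integrable_rnDeriv_smul_iff ac₁).2 (h₁.restrict (s := B))
  have i₂ := (integrable_rnDeriv_smul_iff ac₂).2 (h₂.restrict (s := B))
  refine ⟨τ, fun x => (s₁.rnDeriv τ x).toReal • f₁ x + (s₂.rnDeriv τ x).toReal • f₂ x,
    inferInstance, ?_, i₁.add i₂, fun x hx => ?_, fun ψ hψ hc => ?_⟩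
  · have : ∀ᵐ x ∂τ, x ∈ B := by
      rw [ae_add_measure_iff]
      exact ⟨ae_restrict_mem hB, ae_restrict_mem hB⟩
    filter_upwards [this] with x hx
    simpa [B] using hx
  · simp only [hR₁ x hx, hR₂ x hx, smul_zero, add_zero]
  · rw [← hr σ₁ f₁ hR₁, ← hr σ₂ f₂ hR₂, ← integral_rnDeriv_smul ac₁, ← integral_rnDeriv_smul ac₂,
      ← integral_add]
    · refine integral_congr_ae (ae_of_all _ fun x => ?_)
      simp only [inner_add_left, real_inner_smul_left, smul_eq_mul]
    · simp only [smul_eq_mul, ← real_inner_smul_left]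
      exact locallyIntegrable_inner_test i₁.locallyIntegrable hψ hc
    · simp only [smul_eq_mul, ← real_inner_smul_left]
      exact locallyIntegrable_inner_test i₂.locallyIntegrable hψ hc

end Cutoff

section Localize

variable {n : ℕ} {V W : Type*} [NormedAddCommGroup V] [InnerProductSpace ℝ V]
  [FiniteDimensional ℝ V] [NormedAddCommGroup W] [InnerProductSpace ℝ W] [FiniteDimensional ℝ W]
  {A : CoeffOp n 1 V W}

theorem ae_l1Diff_pot_ofReal_smul (hn : 1 < n) (hA : IsElliptic n 1 A) {τ : Measure (Euc n)}
    [IsFiniteMeasure τ] {R : ℝ} (hR : ∀ᵐ y ∂τ, ‖y‖ ≤ R) {c : Euc n → ℝ} (hc : Integrable c τ)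
    (w : W) : ∀ᵐ x, L1Diff (pot hA τ fun y => (ENNReal.ofReal (c y)).toReal • w) x := by
  have hf := isFiniteMeasure_withDensity_ofReal hc.2
  have e : pot hA τ (fun y => (ENNReal.ofReal (c y)).toReal • w)
      = pot hA (τ.withDensity fun x => ENNReal.ofReal (c x)) fun _ => w := by
    funext x
    unfold pot
    rw [integral_withDensity_eq_integral_toReal_smul₀ hc.1.aemeasurable.ennreal_ofReal
      (ae_of_all _ fun _ => ENNReal.ofReal_lt_top)]
    simp only [map_smul]
  rw [e]
  exact ae_l1Diff_pot_const hn hA _ ((withDensity_absolutelyContinuous _ _).ae_le hR) w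

theorem L1Diff.sum {E ι : Type*} [NormedAddCommGroup E] [NormedSpace ℝ E] {u : ι → Euc n → E}
    {x : Euc n} (s : Finset ι) (h : ∀ i ∈ s, L1Diff (u i) x)
    (hm : ∀ i ∈ s, AEStronglyMeasurable (u i) volume) : L1Diff (∑ i ∈ s, u i) x := by
  classical
  induction s using Finset.induction_on with
  | empty => simpa using L1Diff.zero (E := E) x
  | insert i s hi ih =>
    rw [Finset.sum_insert hi]
    exact (h i (by simp)).add (ih (fun j hj => h j (by simp [hj])) fun j hj => hm j (by simp [hj]))
      (hm i (by simp))

theorem ae_l1Diff_pot (hn : 1 < n) (hA : IsElliptic n 1 A) {τ : Measure (Euc n)}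
    [IsFiniteMeasure τ] {R : ℝ} (hR : ∀ᵐ y ∂τ, ‖y‖ ≤ R) {f : Euc n → W} (hf : Integrable f τ) :
    ∀ᵐ x, L1Diff (pot hA τ f) x := by
  set b := stdOrthonormalBasis ℝ W
  set c : Fin (Module.finrank ℝ W) → Euc n → ℝ := fun a y => ⟪b a, f y⟫
  have hc : ∀ a, Integrable (c a) τ := fun a => hf.const_inner (b a)
  set p : Fin (Module.finrank ℝ W) → Euc n → W :=
    fun a y => (ENNReal.ofReal (c a y)).toReal • b a
  set m : Fin (Module.finrank ℝ W) → Euc n → W :=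
    fun a y => (ENNReal.ofReal (-c a y)).toReal • b a
  have hint : ∀ c : Euc n → ℝ, Integrable c τ → ∀ w : W,
      Integrable (fun y => (ENNReal.ofReal (c y)).toReal • w) τ := fun c hc w => by
    refine (Integrable.mono hc (hc.1.aemeasurable.ennreal_ofReal.ennreal_toReal.aestronglyMeasurable)
      (ae_of_all _ fun y => ?_)).smul_const w
    rw [Real.norm_eq_abs, abs_of_nonneg ENNReal.toReal_nonneg, ENNReal.toReal_ofReal',
      Real.norm_eq_abs]
    exact max_le (le_abs_self _) (abs_nonneg _)
  have hp : ∀ a, Integrable (p a) τ := fun a => hint _ (hc a) _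
  have hm : ∀ a, Integrable (m a) τ := fun a => hint _ (hc a).neg _
  have hsum : ∀ y, f y = ∑ a, (p a y - m a y) := fun y => by
    rw [← b.sum_repr' (f y)]
    refine Finset.sum_congr rfl fun a _ => ?_
    simp only [p, m, c]
    rw [← sub_smul, ENNReal.toReal_ofReal', ENNReal.toReal_ofReal']
    congr 1
    rcases le_total 0 (⟪b a, f y⟫) with h | h
    · rw [max_eq_left h, max_eq_right (by linarith), sub_zero]
    · rw [max_eq_right h, max_eq_left (by linarith), zero_sub, neg_neg]
  have hpot : ∀ᵐ x, (∑ a, (pot hA τ (p a) + -pot hA τ (m a))) x = pot hA τ f x := by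
    filter_upwards [ae_all_iff.2 fun a => ae_integrable_KK hn hA τ (hp a),
      ae_all_iff.2 fun a => ae_integrable_KK hn hA τ (hm a)] with x h1 h2
    have e : ∀ y, KK hA (x - y) (f y)
        = ∑ a, (KK hA (x - y) (p a y) - KK hA (x - y) (m a y)) := fun y => by
      conv_lhs => rw [hsum y]
      rw [map_sum]
      exact Finset.sum_congr rfl fun a _ => map_sub _ _ _
    unfold pot
    simp only [e]
    have h3 : ∀ a, Integrable (fun y => KK hA (x - y) (p a y) - KK hA (x - y) (m a y)) τ :=
      fun a => (h1 a).sub (h2 a)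
    rw [integral_finsetSum _ fun a _ => h3 a]
    simp only [Finset.sum_apply, Pi.add_apply, Pi.neg_apply]
    exact Finset.sum_congr rfl fun a _ => by rw [integral_sub (h1 a) (h2 a), sub_eq_add_neg]
  have hP : ∀ᵐ x, ∀ a, L1Diff (pot hA τ (p a)) x :=
    ae_all_iff.2 fun a => ae_l1Diff_pot_ofReal_smul hn hA hR (hc a) (b a)
  have hM : ∀ᵐ x, ∀ a, L1Diff (pot hA τ (m a)) x :=
    ae_all_iff.2 fun a => ae_l1Diff_pot_ofReal_smul hn hA hR (hc a).neg (b a)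
  filter_upwards [hP, hM] with x h1 h2
  exact (L1Diff.sum Finset.univ (fun a _ => (h1 a).add (h2 a).neg
    (aestronglyMeasurable_pot hn hA (hp a))) fun a _ => (aestronglyMeasurable_pot hn hA (hp a)).add
      (aestronglyMeasurable_pot hn hA (hm a)).neg).congr (s := Set.univ) univ_mem
    (hpot.mono fun x hx _ => hx)

theorem exists_testFun_one (R : ℝ) (hR : 0 < R) : ∃ φ : Euc n → ℝ, IsTestFun n φ ∧
    (∀ x, ‖x‖ ≤ R → φ x = 1) ∧ ∀ x, R + 1 < ‖x‖ → x ∉ tsupport φ := by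
  let φ : ContDiffBump (0 : Euc n) := ⟨R, R + 1, hR, by linarith⟩
  refine ⟨φ, ⟨φ.contDiff, φ.hasCompactSupport⟩, fun x hx => φ.one_of_mem_closedBall (by
    simpa using hx), fun x hx h => ?_⟩
  rw [φ.tsupport_eq, mem_closedBall, dist_zero_right] at h
  exact absurd h (not_le.2 hx)

theorem MemBVAloc.ae_l1Diff (hn : 1 < n) (hA : IsElliptic n 1 A) {u : Euc n → V}
    (hu : MemBVAloc n 1 A u) : ∀ᵐ x, L1Diff u x := by
  obtain ⟨hul, σ, f, hσ, hfl, -, hD⟩ := hu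
  rw [hasDistribA_iff] at hD
  have main : ∀ k : ℕ, ∀ᵐ x, ‖x‖ < (k + 1 : ℝ) → L1Diff u x := fun k => by
    obtain ⟨φ, hφ, hφ1, hφs⟩ := exists_testFun_one (n := n) (k + 1 : ℝ) (by positivity)
    have hφ0 : ∀ x, (k + 1 : ℝ) + 1 < ‖x‖ → φ x = 0 := fun x hx =>
      image_eq_zero_of_notMem_tsupport (hφs x hx)
    obtain ⟨τ, F, hτ, hτR, hF, hF0, hFψ⟩ := exists_density_add (σ₁ := σ) (σ₂ := volume)
      (integrable_smul_of_test hφ.1.continuous hφ.2 hfl) (integrable_gradTerm A hφ hul)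
      (R := (k + 1 : ℝ) + 1) (fun x hx => by rw [hφ0 x hx, zero_smul])
      (fun x hx => gradTerm_eq_zero (hφs x hx)) (isCompact_closedBall _ _).measure_lt_top.ne
      (isCompact_closedBall _ _).measure_lt_top.ne
    have hD' : HasDistribA n 1 A (fun x => φ x • u x) τ F := by
      rw [hasDistribA_iff]
      intro ψ hψ
      rw [hFψ ψ hψ.1.continuous hψ.2, sum_integral_cutoff hul hφ hψ, hD _ (hφ.smul_test hψ)]
      simp only [real_inner_smul_left, real_inner_smul_right]
    have hpot := hD'.ae_eq_pot hn hA (R := (k + 1 : ℝ) + 2)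
      (fun x hx => by rw [hφ0 x (by linarith), zero_smul]) (fun x hx => hF0 x (by linarith))
      (integrable_smul_of_test hφ.1.continuous hφ.2 hul) hF
    filter_upwards [ae_l1Diff_pot hn hA hτR hF] with x hx hxk
    refine hx.congr (s := ball 0 (k + 1 : ℝ)) (isOpen_ball.mem_nhds (by simpa using hxk)) ?_
    filter_upwards [hpot] with y hy hyb
    rw [mem_ball, dist_zero_right] at hyb
    rw [← hy, hφ1 y hyb.le, one_smul]
  filter_upwards [ae_all_iff.2 main] with x hx
  obtain ⟨k, hk⟩ := exists_nat_ge ‖x‖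
  exact hx k (by linarith)

end Localize

section Util

theorem lintegral_rpow_le {α : Type*} [MeasurableSpace α] (ν : Measure α) {r : ℝ} (hr : 1 < r)
    {g : α → ℝ≥0∞} (hg : AEMeasurable g ν) :
    (∫⁻ a, g a ∂ν) ^ r ≤ ν Set.univ ^ (r - 1) * ∫⁻ a, g a ^ r ∂ν := by
  have hr0 : 0 < r := by linarith
  have h := ENNReal.lintegral_mul_le_Lp_mul_Lq ν (Real.HolderConjugate.conjExponent hr).symm
    (f := fun _ => 1) (g := g) aemeasurable_const hg
  simp only [Pi.mul_apply, one_mul, ENNReal.one_rpow, lintegral_const] at h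
  refine (ENNReal.rpow_le_rpow h hr0.le).trans (le_of_eq ?_)
  rw [ENNReal.mul_rpow_of_nonneg _ _ hr0.le, ← ENNReal.rpow_mul, ← ENNReal.rpow_mul,
    one_div_mul_cancel hr0.ne', ENNReal.rpow_one]
  congr 2
  rw [Real.conjExponent]
  have : r - 1 ≠ 0 := by linarith
  field_simp

theorem lintegral_mul_rpow_le {α : Type*} [MeasurableSpace α] {μ : Measure α} {r : ℝ} (hr : 1 < r)
    {w g : α → ℝ≥0∞} (hw : Measurable w) (hg : Measurable g) :
    (∫⁻ a, w a * g a ∂μ) ^ r ≤ (∫⁻ a, w a ∂μ) ^ (r - 1) * ∫⁻ a, w a * g a ^ r ∂μ := by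
  have h := lintegral_rpow_le (μ.withDensity w) hr hg.aemeasurable
  rw [withDensity_apply _ MeasurableSet.univ, Measure.restrict_univ,
    lintegral_withDensity_eq_lintegral_mul _ hw hg,
    lintegral_withDensity_eq_lintegral_mul _ hw (hg.pow_const r)] at h
  exact h

theorem tsum_mul_rpow_le {ι : Type*} {r : ℝ} (hr : 1 < r) (w g : ι → ℝ≥0∞) :
    (∑' a, w a * g a) ^ r ≤ (∑' a, w a) ^ (r - 1) * ∑' a, w a * g a ^ r := by
  let _ : MeasurableSpace ι := ⊤
  have h := lintegral_mul_rpow_le (μ := Measure.count) hr (measurable_from_top (f := w))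
    (measurable_from_top (f := g))
  simpa only [lintegral_count' measurable_from_top] using h

theorem pw_intCast (j : ℤ) : pw j = (2 : ℝ≥0∞) ^ j := ENNReal.rpow_intCast _ _

theorem pw_lt_pw {x y : ℝ} (h : x < y) : pw x < pw y :=
  ENNReal.rpow_lt_rpow_of_exponent_lt (by norm_num) (by norm_num) h

theorem exists_pw_le_lt {x : ℝ≥0∞} (h0 : x ≠ 0) (ht : x ≠ ⊤) :
    ∃ i : ℤ, pw i ≤ x ∧ x < pw ((i : ℝ) + 1) := by
  obtain ⟨i, hi⟩ := ENNReal.exists_mem_Ico_zpow h0 ht (y := 2) (by norm_num) (by norm_num)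
  refine ⟨i, by rw [pw_intCast]; exact hi.1, ?_⟩
  have := pw_intCast (i + 1)
  push_cast at this
  rw [this]
  exact hi.2

theorem tsum_pw_of_lt {a : ℝ} (ha : 0 < a) {x : ℝ≥0∞} (hx : x ≠ ⊤) :
    ∑' j : ℤ, (if pw j < x then pw (a * j) else 0) ≤ geo a * x ^ a := by
  by_cases h0 : x = 0
  · simp [h0]
  obtain ⟨i, hi1, hi2⟩ := exists_pw_le_lt h0 hx
  calc _ ≤ ∑' j : ℤ, (if j ≤ i then pw (a * j) else 0) := by
        refine ENNReal.tsum_le_tsum fun j => ?_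
        by_cases hj : pw j < x
        · rw [if_pos hj, if_pos]
          by_contra! hij
          have : ((i : ℝ) + 1) ≤ j := by exact_mod_cast hij
          exact absurd (hj.trans hi2) (not_lt.2 (pw_mono this))
        · rw [if_neg hj]
          exact zero_le
    _ ≤ geo a * pw (a * i) := tsum_pw_le i
    _ = geo a * pw i ^ a := by rw [pw_rpow, mul_comm a]
    _ ≤ _ := by gcongr

theorem tsum_pw_of_ge {a : ℝ} (ha : 0 < a) {x : ℝ≥0∞} (hx : x ≠ 0) :
    ∑' j : ℤ, (if x ≤ pw j then pw (-a * j) else 0) ≤ geo a * pw a * x ^ (-a) := by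
  by_cases ht : x = ⊤
  · have : ∀ j : ℤ, ¬ x ≤ pw j := fun j => by simp [ht, pw_ne_top]
    simp [this]
  obtain ⟨i, hi1, hi2⟩ := exists_pw_le_lt hx ht
  calc _ ≤ ∑' j : ℤ, (if i ≤ j then pw (-a * j) else 0) := by
        refine ENNReal.tsum_le_tsum fun j => ?_
        by_cases hj : x ≤ pw j
        · rw [if_pos hj, if_pos]
          by_contra! hij
          have : (j : ℝ) < i := by exact_mod_cast hij
          exact absurd (hi1.trans hj) (not_le.2 (pw_lt_pw this))
        · rw [if_neg hj]
          exact zero_le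
    _ ≤ geo a * pw (-a * i) := tsum_pw_ge i
    _ = geo a * pw a * pw ((i : ℝ) + 1) ^ (-a) := by
        rw [pw_rpow, mul_assoc, ← pw_add]
        congr 2
        ring
    _ ≤ _ := by
        refine mul_le_mul_right ?_ _
        rw [ENNReal.rpow_neg, ENNReal.rpow_neg]
        exact ENNReal.inv_le_inv.2 (ENNReal.rpow_le_rpow hi2.le ha.le)

noncomputable def pj (j : ℤ) (s t : ℝ) : ℝ≥0∞ :=
  ENNReal.ofReal ((1 + ((2 : ℝ) ^ j * (t - s)) ^ 2)⁻¹)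

theorem measurable_pj (j : ℤ) (s : ℝ) : Measurable (pj j s) := by
  unfold pj
  fun_prop

theorem pj_le_one (j : ℤ) (s t : ℝ) : pj j s t ≤ 1 := by
  rw [pj, ← ENNReal.ofReal_one]
  exact ENNReal.ofReal_le_ofReal (inv_le_one_of_one_le₀ (by nlinarith [sq_nonneg ((2 : ℝ) ^ j * (t - s))]))

theorem lintegral_pj (j : ℤ) (s : ℝ) : ∫⁻ t, pj j s t = ENNReal.ofReal Real.pi * pw (-j) := by
  have h1 : ∫⁻ t, pj j s t = ∫⁻ t, pj j 0 t := by
    rw [← lintegral_sub_right_eq_self (pj j 0) s]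
    simp [pj]
  have h2 : Integrable fun t : ℝ => (1 + ((2 : ℝ) ^ j * t) ^ 2)⁻¹ :=
    integrable_inv_one_add_sq.comp_mul_left' (by positivity)
  rw [h1]
  unfold pj
  simp only [sub_zero]
  rw [← ofReal_integral_eq_lintegral_ofReal h2 (ae_of_all _ fun t => by positivity),
    Measure.integral_comp_mul_left (fun t : ℝ => (1 + t ^ 2)⁻¹), integral_univ_inv_one_add_sq,
    smul_eq_mul, abs_of_nonneg (by positivity), mul_comm, ENNReal.ofReal_mul Real.pi_pos.le]
  congr 1
  rw [← zpow_neg, ofReal_two_zpow]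
  push_cast
  rfl

end Util

section Slab

variable {n : ℕ}

theorem wj_le_pj (hn : 1 ≤ n) {ξ : Euc n} (hξ : ‖ξ‖ = 1) (j : ℤ) (x y : Euc n) :
    wj n j (x - y) ≤ pw (j * n) * pj j ⟪x, ξ⟫ ⟪y, ξ⟫ := by
  rw [wj_sub_comm]
  refine mul_le_mul_right (ENNReal.ofReal_le_ofReal ((wt_le_inner hn hξ _).trans (le_of_eq ?_))) _
  rw [real_inner_smul_left, inner_sub_left]

theorem wj_pos (j : ℤ) (x : Euc n) : wj n j x ≠ 0 :=
  mul_ne_zero (pw_ne_zero _) (by simpa using wt_pos _)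

theorem lintegral_wj_slab_le (hn : 1 ≤ n) : ∃ C : ℝ≥0∞, C ≠ ⊤ ∧ ∀ (j : ℤ) (ξ : Euc n), ‖ξ‖ = 1 →
    ∀ (z : Euc n) (B : Set ℝ), MeasurableSet B →
      ∫⁻ y in {y : Euc n | ⟪y, ξ⟫ ∈ B}, wj n j (y - z) ≤ C * (pw j * volume B) := by
  obtain ⟨C, hC, h⟩ := exists_slab_wj_le hn
  refine ⟨C, hC, fun j ξ hξ z B hB => ?_⟩
  have hm : MeasurableSet {y : Euc n | ⟪y, ξ⟫ ∈ B} :=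
    (by fun_prop : Measurable fun y : Euc n => ⟪y, ξ⟫) hB
  rw [← lintegral_indicator hm]
  calc _ = ∫⁻ y : Euc n, B.indicator 1 ⟪y, ξ⟫ * wj n j (y - z) := lintegral_congr fun y => by
        by_cases hy : ⟪y, ξ⟫ ∈ B <;> simp [Set.indicator, hy]
    _ ≤ _ := h j ξ hξ z _ (measurable_one.indicator hB)
    _ ≤ C * ∫⁻ t, pw j * B.indicator 1 t := by
        refine mul_le_mul_right (lintegral_mono fun t => ?_) C
        rw [mul_left_comm]
        exact mul_le_mul_right (mul_le_of_le_one_right zero_le (pj_le_one j _ t)) _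
    _ = _ := by rw [lintegral_const_mul' _ _ (pw_ne_top _), lintegral_indicator_one hB]

theorem map_inner_absolutelyContinuous (hn : 1 ≤ n) {ξ : Euc n} (hξ : ‖ξ‖ = 1)
    {ρ : Measure (Euc n)} (hρ : ρ ≪ volume) : ρ.map (fun y => ⟪y, ξ⟫) ≪ volume := by
  obtain ⟨C, hC, h⟩ := lintegral_wj_slab_le hn
  have hmi : Measurable fun y : Euc n => ⟪y, ξ⟫ := by fun_prop
  refine Measure.AbsolutelyContinuous.mk fun B hB hB0 => ?_
  rw [Measure.map_apply hmi hB]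
  refine hρ ?_
  have h1 := h 0 ξ hξ 0 B hB
  rw [hB0, mul_zero, mul_zero, nonpos_iff_eq_zero] at h1
  by_contra hne
  have hm : Measurable fun y : Euc n => wj n 0 (y - 0) :=
    measurable_wj.comp (measurable_id.sub_const _)
  rw [lintegral_eq_zero_iff hm] at h1
  refine hne (measure_eq_zero_iff_ae_notMem.2 ?_)
  exact ((ae_restrict_iff' (hmi hB)).1 h1).mono fun y hy hyB => wj_pos 0 _ (hy hyB)

theorem exists_good_bad (hn : 1 ≤ n) {r : ℝ} (hr : 1 < r) : ∃ C : ℝ≥0∞, C ≠ ⊤ ∧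
    ∀ (ρ : Measure (Euc n)) [IsFiniteMeasure ρ], ρ ≪ volume → ρ Set.univ ≠ 0 →
    ∀ ξ : Euc n, ‖ξ‖ = 1 → ∃ (B : ℤ → Set ℝ) (γ : ℤ → ℝ≥0∞), (∀ j, MeasurableSet (B j)) ∧
      ∑' j : ℤ, pw j * volume (B j) ≤ C ∧ ∑' j, γ j ≤ C * ρ Set.univ ^ r ∧
      ∀ j : ℤ, (∀ x, ∫⁻ y in {y : Euc n | ⟪y, ξ⟫ ∉ B j}, wj n j (x - y) ∂ρ
          ≤ C * (pw (j * n) * γ j ^ (1 / r))) ∧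
        ∫⁻ x, (∫⁻ y in {y : Euc n | ⟪y, ξ⟫ ∉ B j}, wj n j (x - y) ∂ρ) ^ r
          ≤ C * (pw (j * (n * (r - 1))) * γ j) := by
  set D := ENNReal.ofReal Real.pi with hD
  set N := ∫⁻ x : Euc n, ENNReal.ofReal (wt n x) with hN
  have hr0 : 0 < r := by linarith
  have hr1 : 0 < r - 1 := by linarith
  have hDt : D ≠ ⊤ := ENNReal.ofReal_ne_top
  have hNt : N ≠ ⊤ := lintegral_wt_ne_top hn
  refine ⟨geo 1 + geo (r - 1) * pw (r - 1) + (D ^ (r - 1)) ^ (1 / r) + D ^ (r - 1) * N, ?_, ?_⟩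
  · have h1 := geo_ne_top one_pos
    have h2 := geo_ne_top hr1
    have h3 := pw_ne_top (r - 1)
    have h4 : D ^ (r - 1) ≠ ⊤ := ENNReal.rpow_ne_top_of_nonneg hr1.le hDt
    have h5 : (D ^ (r - 1)) ^ (1 / r) ≠ ⊤ := ENNReal.rpow_ne_top_of_nonneg (by positivity) h4
    finiteness
  intro ρ _ hρ hρ0 ξ hξ
  set M := ρ Set.univ with hM
  have hMt : M ≠ ⊤ := measure_ne_top _ _
  have hmi : Measurable fun y : Euc n => ⟪y, ξ⟫ := by fun_prop
  set l := ρ.map fun y : Euc n => ⟪y, ξ⟫ with hl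
  have hlv : l ≪ volume := map_inner_absolutelyContinuous hn hξ hρ
  have hlu : l Set.univ = M := by rw [hl, Measure.map_apply hmi MeasurableSet.univ, Set.preimage_univ]
  have : IsFiniteMeasure l := ⟨by rw [hlu]; exact hMt.lt_top⟩
  set mm : ℝ → ℝ≥0∞ := fun t => M⁻¹ * l.rnDeriv volume t with hmm
  have hmmm : Measurable mm := (Measure.measurable_rnDeriv _ _).const_mul _
  have key : ∀ φ : ℝ → ℝ≥0∞, Measurable φ → ∫⁻ t, φ t ∂l = M * ∫⁻ t, φ t * mm t := by
    intro φ hφ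
    rw [← lintegral_rnDeriv_mul hlv hφ.aemeasurable, ← lintegral_const_mul' _ _ hMt]
    refine lintegral_congr fun t => ?_
    simp only [hmm]
    rw [mul_left_comm, ← mul_assoc M, ENNReal.mul_inv_cancel hρ0 hMt, one_mul, mul_comm]
  have keyl : ∀ φ : ℝ → ℝ≥0∞, Measurable φ → ∫⁻ y, φ ⟪y, ξ⟫ ∂ρ = ∫⁻ t, φ t ∂l :=
    fun φ hφ => by rw [hl, lintegral_map hφ hmi]
  have hm1 : ∫⁻ t, mm t = 1 := by
    have h := key (fun _ => 1) measurable_const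
    simp only [lintegral_const, one_mul, hlu] at h
    have h2 : M * ∫⁻ t, mm t = M * 1 := by rw [← h, mul_one]
    exact (ENNReal.mul_right_inj hρ0 hMt).1 h2
  have hmv : ∀ᵐ t, mm t ≠ ⊤ := (ae_lt_top hmmm (by simp [hm1])).mono fun t => ne_of_lt
  have hml : ∀ᵐ t ∂l, mm t ≠ ⊤ := hlv.ae_le hmv
  have hml0 : ∀ᵐ t ∂l, mm t ≠ 0 := by
    have hs : MeasurableSet {t | mm t = 0} := hmmm (measurableSet_singleton 0)
    have h := key _ (measurable_one.indicator hs)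
    have h0 : ∀ t, ({t | mm t = 0}.indicator 1 t : ℝ≥0∞) * mm t = 0 := fun t => by
      by_cases ht : mm t = 0 <;> simp [ht]
    simp only [h0, lintegral_zero, mul_zero, lintegral_indicator_one hs] at h
    exact measure_eq_zero_iff_ae_notMem.1 h
  set B : ℤ → Set ℝ := fun j => {t | pw j < mm t} with hB
  have hBm : ∀ j, MeasurableSet (B j) := fun j => measurableSet_lt measurable_const hmmm
  set g : ℤ → ℝ → ℝ≥0∞ := fun j => (B j)ᶜ.indicator 1 with hg
  have hgm : ∀ j, Measurable (g j) := fun j => measurable_one.indicator (hBm j).compl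
  have hg1 : ∀ j t, g j t ≤ 1 := fun j t => Set.indicator_le_self' (by simp) t
  set Γ : ℤ → ℝ≥0∞ := fun j => ∫⁻ t, g j t * mm t ^ (r - 1) ∂l with hΓ
  have hΓm : ∀ j, Γ j = M * ∫⁻ t, g j t * mm t ^ r := by
    intro j
    simp only [hΓ]
    rw [key (fun t => g j t * mm t ^ (r - 1)) ((hgm j).mul (hmmm.pow_const _))]
    congr 1
    refine lintegral_congr fun t => ?_
    have : mm t ^ r = mm t ^ (r - 1) * mm t := by
      conv_rhs => rw [← ENNReal.rpow_one (mm t), ← ENNReal.rpow_mul, one_mul,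
        ← ENNReal.rpow_add_of_nonneg _ _ hr1.le zero_le_one]
      ring_nf
    rw [this, mul_assoc]
  set γ : ℤ → ℝ≥0∞ := fun j => pw (-(r - 1) * j) * M ^ (r - 1) * Γ j with hγ
  have hMr : M ^ (r - 1) ≠ ⊤ := ENNReal.rpow_ne_top_of_nonneg hr1.le hMt
  have hMM : M ^ (r - 1) * M = M ^ r := by
    conv_lhs => rw [← ENNReal.rpow_one M, ← ENNReal.rpow_mul, one_mul,
      ← ENNReal.rpow_add _ _ hρ0 hMt]
    ring_nf
  have hrew : ∀ j x, ∫⁻ y in {y : Euc n | ⟪y, ξ⟫ ∉ B j}, wj n j (x - y) ∂ρ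
      = ∫⁻ y, g j ⟪y, ξ⟫ * wj n j (x - y) ∂ρ := by
    intro j x
    have hm : MeasurableSet {y : Euc n | ⟪y, ξ⟫ ∉ B j} := (hmi (hBm j)).compl
    rw [← lintegral_indicator hm]
    refine lintegral_congr fun y => ?_
    by_cases hy : ⟪y, ξ⟫ ∈ B j <;> simp [Set.indicator, hy, hg]
  have hwm : ∀ j x, Measurable fun y : Euc n => wj n j (x - y) :=
    fun j x => measurable_wj.comp (measurable_id.const_sub _)
  refine ⟨B, γ, hBm, ?_, ?_, fun j => ⟨fun x => ?_, ?_⟩⟩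
  · refine le_trans ?_ (le_add_right (le_add_right (le_add_right (le_refl (geo 1)))))
    calc ∑' j : ℤ, pw j * volume (B j)
        = ∫⁻ t, ∑' j : ℤ, pw j * (B j).indicator 1 t := by
          rw [lintegral_tsum fun j => ((measurable_one.indicator (hBm j)).const_mul _).aemeasurable]
          refine tsum_congr fun j => ?_
          rw [lintegral_const_mul' _ _ (pw_ne_top _), lintegral_indicator_one (hBm j)]
      _ ≤ ∫⁻ t, geo 1 * mm t := by
          refine lintegral_mono_ae (hmv.mono fun t ht => ?_)
          refine le_trans (ENNReal.tsum_le_tsum fun j => ?_)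
            ((tsum_pw_of_lt one_pos ht).trans_eq (by rw [ENNReal.rpow_one]))
          by_cases h : pw j < mm t <;> simp [hB, h]
      _ = geo 1 := by rw [lintegral_const_mul' _ _ (geo_ne_top one_pos), hm1, mul_one]
  · refine le_trans ?_ (mul_le_mul_left (le_add_right (le_add_right (le_add_left
      (le_refl (geo (r - 1) * pw (r - 1)))))) _)
    calc ∑' j, γ j = M ^ (r - 1) * ∑' j : ℤ, ∫⁻ t, pw (-(r - 1) * j) * (g j t * mm t ^ (r - 1)) ∂l := by
          rw [← ENNReal.tsum_mul_left]
          refine tsum_congr fun j => ?_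
          rw [lintegral_const_mul' _ _ (pw_ne_top _)]
          simp only [hγ, hΓ]
          ring
      _ = M ^ (r - 1) * ∫⁻ t, ∑' j : ℤ, pw (-(r - 1) * j) * (g j t * mm t ^ (r - 1)) ∂l := by
          rw [lintegral_tsum (f := fun (j : ℤ) t => pw (-(r - 1) * j) * (g j t * mm t ^ (r - 1)))
            fun j => (((hgm j).mul (hmmm.pow_const _)).const_mul _).aemeasurable]
      _ ≤ M ^ (r - 1) * ∫⁻ t, geo (r - 1) * pw (r - 1) ∂l := by
          refine mul_le_mul_right (lintegral_mono_ae ?_) _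
          filter_upwards [hml, hml0] with t ht ht0
          have h1 : ∀ j : ℤ, pw (-(r - 1) * j) * (g j t * mm t ^ (r - 1))
              = (if mm t ≤ pw j then pw (-(r - 1) * j) else 0) * mm t ^ (r - 1) := by
            intro j
            by_cases h : mm t ≤ pw j <;> simp [hB, hg, h]
          rw [tsum_congr h1, ENNReal.tsum_mul_right]
          refine (mul_le_mul_left (tsum_pw_of_ge hr1 ht0) _).trans_eq ?_
          rw [mul_assoc, ← ENNReal.rpow_add _ _ ht0 ht, neg_add_cancel, ENNReal.rpow_zero, mul_one]
      _ = _ := by rw [lintegral_const, hlu, mul_comm (geo _ * _), ← mul_assoc, hMM, mul_comm]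
  · refine le_trans ?_ (mul_le_mul_left (le_add_right (le_add_left
      (le_refl ((D ^ (r - 1)) ^ (1 / r))))) _)
    rw [hrew]
    have h1 : ∫⁻ y, g j ⟪y, ξ⟫ * wj n j (x - y) ∂ρ
        ≤ pw (j * n) * (M * ∫⁻ t, pj j ⟪x, ξ⟫ t * (g j t * mm t)) := by
      calc _ ≤ ∫⁻ y, pw (j * n) * (pj j ⟪x, ξ⟫ ⟪y, ξ⟫ * g j ⟪y, ξ⟫) ∂ρ := by
            refine lintegral_mono fun y => ?_
            rw [← mul_assoc, mul_comm]
            exact mul_le_mul_left (wj_le_pj hn hξ j x y) _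
        _ = pw (j * n) * ∫⁻ t, pj j ⟪x, ξ⟫ t * g j t ∂l := by
            rw [lintegral_const_mul' _ _ (pw_ne_top _),
              keyl (fun t => pj j ⟪x, ξ⟫ t * g j t) ((measurable_pj j _).mul (hgm j))]
        _ = _ := by
            rw [key (fun t => pj j ⟪x, ξ⟫ t * g j t) ((measurable_pj j _).mul (hgm j))]
            simp only [mul_assoc]
    have h2 := lintegral_mul_rpow_le (μ := volume) hr (measurable_pj j ⟪x, ξ⟫) ((hgm j).mul hmmm)
    simp only [Pi.mul_apply] at h2
    rw [lintegral_pj] at h2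
    have h3 : ∫⁻ t, pj j ⟪x, ξ⟫ t * (g j t * mm t) ^ r ≤ ∫⁻ t, g j t * mm t ^ r := by
      refine lintegral_mono fun t => ?_
      refine (mul_le_of_le_one_left zero_le (pj_le_one _ _ _)).trans_eq ?_
      by_cases ht : t ∈ (B j)ᶜ <;> simp [hg, ht, hr0]
    have h4 : (M * ∫⁻ t, pj j ⟪x, ξ⟫ t * (g j t * mm t)) ^ r ≤ D ^ (r - 1) * γ j := by
      rw [ENNReal.mul_rpow_of_nonneg _ _ hr0.le, ← hMM]
      refine (mul_le_mul_right (h2.trans (mul_le_mul_right h3 _)) _).trans_eq ?_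
      simp only [hγ]
      rw [hΓm, ENNReal.mul_rpow_of_nonneg _ _ hr1.le, pw_rpow, show -(j : ℝ) * (r - 1) = -(r - 1) * j by ring]
      ring
    refine h1.trans ?_
    rw [mul_left_comm _ (pw _)]
    refine mul_le_mul_right ?_ _
    rw [← ENNReal.mul_rpow_of_nonneg _ _ (by positivity), one_div, ENNReal.le_rpow_inv_iff hr0]
    exact h4
  · refine le_trans ?_ (mul_le_mul_left (le_add_left (le_refl (D ^ (r - 1) * N))) _)
    have h1 : ∀ x : Euc n, (∫⁻ y, g j ⟪y, ξ⟫ * wj n j (x - y) ∂ρ) ^ r ≤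
        (pw (j * n) * (M * (D * pw (-j)))) ^ (r - 1) *
          ∫⁻ y, wj n j (x - y) * (g j ⟪y, ξ⟫ * mm ⟪y, ξ⟫ ^ (r - 1)) ∂ρ := by
      intro x
      have hae : ∀ᵐ y ∂ρ, mm ⟪y, ξ⟫ ≠ ⊤ ∧ mm ⟪y, ξ⟫ ≠ 0 :=
        ae_of_ae_map hmi.aemeasurable (hml.and hml0)
      have h2 : ∫⁻ y, g j ⟪y, ξ⟫ * wj n j (x - y) ∂ρ
          = ∫⁻ y, (g j ⟪y, ξ⟫ * wj n j (x - y) * (mm ⟪y, ξ⟫)⁻¹) * mm ⟪y, ξ⟫ ∂ρ := by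
        refine lintegral_congr_ae (hae.mono fun y hy => ?_)
        dsimp only
        rw [mul_assoc _ _ (mm _), ENNReal.inv_mul_cancel hy.2 hy.1, mul_one]
      rw [h2]
      refine (lintegral_mul_rpow_le hr ((((hgm j).comp hmi).mul (hwm j x)).mul
        (hmmm.comp hmi).inv) (hmmm.comp hmi)).trans (mul_le_mul' ?_ ?_)
      · refine ENNReal.rpow_le_rpow ?_ hr1.le
        calc ∫⁻ y, g j ⟪y, ξ⟫ * wj n j (x - y) * (mm ⟪y, ξ⟫)⁻¹ ∂ρ
            ≤ ∫⁻ y, pw (j * n) * (pj j ⟪x, ξ⟫ ⟪y, ξ⟫ * (mm ⟪y, ξ⟫)⁻¹) ∂ρ := by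
              refine lintegral_mono fun y => ?_
              rw [← mul_assoc]
              exact mul_le_mul_left ((mul_le_of_le_one_left zero_le (hg1 _ _)).trans
                (wj_le_pj hn hξ j x y)) _
          _ = pw (j * n) * ∫⁻ t, pj j ⟪x, ξ⟫ t * (mm t)⁻¹ ∂l := by
              rw [lintegral_const_mul' _ _ (pw_ne_top _),
                keyl (fun t => pj j ⟪x, ξ⟫ t * (mm t)⁻¹) ((measurable_pj j _).mul hmmm.inv)]
          _ ≤ _ := by
              rw [key (fun t => pj j ⟪x, ξ⟫ t * (mm t)⁻¹) ((measurable_pj j _).mul hmmm.inv)]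
              refine mul_le_mul_right (mul_le_mul_right ?_ _) _
              rw [← lintegral_pj]
              refine lintegral_mono fun t => ?_
              rw [mul_assoc]
              exact mul_le_of_le_one_right zero_le (ENNReal.inv_mul_le_one _)
      · refine lintegral_mono_ae (hae.mono fun y hy => le_of_eq ?_)
        have : (mm ⟪y, ξ⟫)⁻¹ * mm ⟪y, ξ⟫ ^ r = mm ⟪y, ξ⟫ ^ (r - 1) := by
          rw [← ENNReal.rpow_neg_one, ← ENNReal.rpow_add _ _ hy.2 hy.1]
          ring_nf
        simp only [Function.comp_apply, Pi.mul_apply, Pi.inv_apply]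
        rw [← this]
        ring
    simp only [hrew]
    refine (lintegral_mono h1).trans ?_
    have hm2 : Measurable fun y : Euc n => g j ⟪y, ξ⟫ * mm ⟪y, ξ⟫ ^ (r - 1) :=
      ((hgm j).comp hmi).mul ((hmmm.comp hmi).pow_const _)
    rw [lintegral_const_mul' _ _ (by
      refine ENNReal.rpow_ne_top_of_nonneg hr1.le ?_
      have := pw_ne_top (j * n)
      have := pw_ne_top (-j)
      finiteness), lintegral_lintegral_swap (f := fun x y =>
        wj n j (x - y) * (g j ⟪y, ξ⟫ * mm ⟪y, ξ⟫ ^ (r - 1)))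
      ((measurable_wj.comp (measurable_fst.sub measurable_snd)).mul
        (hm2.comp measurable_snd)).aemeasurable]
    have h3 : ∀ y : Euc n, ∫⁻ x, wj n j (x - y) * (g j ⟪y, ξ⟫ * mm ⟪y, ξ⟫ ^ (r - 1))
        = N * (g j ⟪y, ξ⟫ * mm ⟪y, ξ⟫ ^ (r - 1)) := fun y => by
      have hm : Measurable fun x : Euc n => wj n j (x - y) :=
        measurable_wj.comp (measurable_id.sub_const _)
      rw [lintegral_mul_const _ hm, lintegral_wj]
    simp only [h3]
    rw [lintegral_const_mul' _ _ hNt]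
    have h4 : ∫⁻ y, g j ⟪y, ξ⟫ * mm ⟪y, ξ⟫ ^ (r - 1) ∂ρ = Γ j :=
      keyl (fun t => g j t * mm t ^ (r - 1)) ((hgm j).mul (hmmm.pow_const _))
    rw [h4]
    simp only [hγ]
    rw [ENNReal.mul_rpow_of_nonneg _ _ hr1.le, ENNReal.mul_rpow_of_nonneg _ _ hr1.le,
      ENNReal.mul_rpow_of_nonneg _ _ hr1.le, pw_rpow, pw_rpow,
      show -(j : ℝ) * (r - 1) = -(r - 1) * j by ring, show (j : ℝ) * n * (r - 1) = j * (n * (r - 1)) by ring]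
    exact le_of_eq (by ring)

end Slab

section Lorentz

theorem exists_pw_mul_le {a : ℝ} (ha : 0 < a) {K T : ℝ≥0∞} (hK : K ≠ ⊤) (hT : T ≠ 0) :
    ∃ N : ℤ, ∀ i : ℤ, i ≤ N → pw (a * i) * K ≤ T := by
  have hK1 : K + 1 ≠ ⊤ := by finiteness
  have h0 : min T 1 / (K + 1) ≠ 0 := ENNReal.div_ne_zero.2 ⟨by simp [hT], hK1⟩
  have ht : min T 1 / (K + 1) ≠ ⊤ := ENNReal.div_ne_top (by simp) (by simp)
  obtain ⟨m, hm, -⟩ := exists_pw_le_lt h0 ht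
  refine ⟨⌊m / a⌋, fun i hi => ?_⟩
  have h1 : a * i ≤ m := by
    have := (Int.cast_le.2 hi).trans (Int.floor_le ((m : ℝ) / a))
    rwa [le_div_iff₀ ha, mul_comm] at this
  have h2 := (pw_mono h1).trans hm
  rw [ENNReal.le_div_iff_mul_le (.inl (by simp)) (.inl hK1)] at h2
  exact (mul_le_mul_right le_self_add _).trans (h2.trans (min_le_left _ _))

theorem tsum_pw_abs_le {a : ℝ} (i : ℤ) :
    ∑' j : ℤ, pw (-a * |(i : ℝ) - j|) ≤ 2 * geo a := by
  calc ∑' j : ℤ, pw (-a * |(i : ℝ) - j|)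
      = ∑' k : ℤ, pw (-a * |(k : ℝ)|) := by
        rw [← (Equiv.subLeft i).tsum_eq]
        simp
    _ ≤ ∑' k : ℤ, ((if k ≤ 0 then pw (a * k) else 0) + (if 0 ≤ k then pw (-a * k) else 0)) := by
        refine ENNReal.tsum_le_tsum fun k => ?_
        rcases le_total 0 k with hk | hk
        · rw [if_pos hk, abs_of_nonneg (by exact_mod_cast hk)]
          exact le_add_self
        · rw [if_pos hk, abs_of_nonpos (by exact_mod_cast hk), neg_mul_neg]
          exact le_self_add
    _ ≤ 2 * geo a := by
        rw [ENNReal.tsum_add, two_mul]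
        have h1 := tsum_pw_le (a := a) 0
        have h2 := tsum_pw_ge (a := a) 0
        simp only [Int.cast_zero, mul_zero, pw_zero, mul_one] at h1 h2
        exact add_le_add h1 h2

theorem setLIntegral_ofReal_rpow_le {q : ℝ} (hq : 1 < q) (l : ℝ≥0∞) :
    ∫⁻ t in Set.Ioi (0 : ℝ), (if ENNReal.ofReal t < l then
      ENNReal.ofReal t ^ q * (ENNReal.ofReal t)⁻¹ else 0) ≤ l ^ q := by
  by_cases hl : l = ⊤
  · simp [hl, ENNReal.top_rpow_of_pos (by linarith : 0 < q)]
  by_cases hl0 : l = 0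
  · simp [hl0]
  calc _ ≤ ∫⁻ t in Set.Ioi (0 : ℝ), (Set.Ioo 0 l.toReal).indicator (fun _ => l ^ (q - 1)) t := by
        refine setLIntegral_mono' measurableSet_Ioi fun t ht => ?_
        split_ifs with h
        · have h0 : ENNReal.ofReal t ≠ 0 := by simpa using ht
          have hmem : t ∈ Set.Ioo 0 l.toReal :=
            ⟨ht, (ENNReal.ofReal_lt_iff_lt_toReal (le_of_lt ht) hl).1 h⟩
          rw [Set.indicator_of_mem hmem,
            ← ENNReal.rpow_neg_one, ← ENNReal.rpow_add _ _ h0 ENNReal.ofReal_ne_top]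
          exact ENNReal.rpow_le_rpow h.le (by linarith)
        · exact zero_le
    _ ≤ ∫⁻ t, (Set.Ioo 0 l.toReal).indicator (fun _ => l ^ (q - 1)) t := setLIntegral_le_lintegral _ _
    _ = l ^ (q - 1) * l := by
        rw [lintegral_indicator_const measurableSet_Ioo, Real.volume_Ioo, sub_zero,
          ENNReal.ofReal_toReal hl]
    _ = l ^ q := by
        conv_lhs => rw [← ENNReal.rpow_one l, ← ENNReal.rpow_mul, one_mul,
          ← ENNReal.rpow_add _ _ hl0 hl]
        ring_nf

theorem exists_lorentzNorm_le {n : ℕ} (hn : 1 < n) {r q : ℝ} (hr : 1 < r) (hq : 1 < q)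
    (hrn : ((n : ℝ) - 1) * r < n) : ∃ C : ℝ≥0∞, C ≠ ⊤ ∧
    ∀ {E : Type*} [NormedAddCommGroup E] [NormedSpace ℝ E] (v : Euc n → E)
      (g : ℤ → Euc n → ℝ≥0∞) (α : ℤ → ℝ≥0∞), (∀ j, Measurable (g j)) →
      (∀ x, ‖v x‖ₑ ≤ ∑' j, g j x) → (∀ j x, g j x ≤ pw (((n : ℝ) - 1) * j) * α j) →
      (∀ j : ℤ, ∫⁻ x, g j x ^ r ≤ pw (-j * (n - ((n : ℝ) - 1) * r)) * α j ^ r) →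
      lorentzNorm ((n : ℝ) / ((n : ℝ) - 1)) q volume v ≤ C * (∑' j, α j ^ q) ^ (1 / q) := by
  have hn1 : (1 : ℝ) < n := by exact_mod_cast hn
  set d : ℝ := (n : ℝ) - 1 with hd
  have hd0 : 0 < d := by linarith
  set e : ℝ := n - d * r with he
  have he0 : 0 < e := by linarith
  have hr0 : 0 < r := by linarith
  have hq0 : 0 < q := by linarith
  set s : ℝ := e / (2 * r) with hs
  have hs0 : 0 < s := by positivity
  have hsr : s * r = e / 2 := by rw [hs]; field_simp
  set θ := min d s with hθ
  have hθ0 : 0 < θ := lt_min hd0 hs0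
  set p : ℝ := n / d with hp
  have hp0 : 0 < p := by positivity
  set G := 2 * geo θ with hG
  have hGt : G ≠ ⊤ := ENNReal.mul_ne_top (by simp) (geo_ne_top hθ0)
  set C1 := geo (e / 2) with hC1
  have hC1t : C1 ≠ ⊤ := geo_ne_top (by positivity)
  set K := C1 ^ (q / p) * (pw (d * q) * G ^ q) with hK
  refine ⟨ENNReal.ofReal p ^ (1 / q) * K ^ (1 / q) + 1, ?_, ?_⟩
  · have h1 : K ≠ ⊤ := by
      have h1 := pw_ne_top (d * q)
      have h2 : C1 ^ (q / p) ≠ ⊤ := ENNReal.rpow_ne_top_of_nonneg (by positivity) hC1t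
      have h3 : G ^ q ≠ ⊤ := ENNReal.rpow_ne_top_of_nonneg hq0.le hGt
      finiteness
    have h2 : K ^ (1 / q) ≠ ⊤ := ENNReal.rpow_ne_top_of_nonneg (by positivity) h1
    have h3 : ENNReal.ofReal p ^ (1 / q) ≠ ⊤ :=
      ENNReal.rpow_ne_top_of_nonneg (by positivity) ENNReal.ofReal_ne_top
    finiteness
  intro E _ _ v g α hgm hv hsup hLr
  set S := ∑' j, α j ^ q with hS
  by_cases hSt : S = ⊤
  · rw [hSt, ENNReal.top_rpow_of_pos (by positivity), ENNReal.mul_top (by simp)]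
    exact le_top
  have hαt : ∀ j, α j ≠ ⊤ := fun j hj => ENNReal.ne_top_of_tsum_ne_top hSt j
    (by rw [hj, ENNReal.top_rpow_of_pos hq0])
  set Λ : ℤ → ℝ≥0∞ := fun i => ∑' j : ℤ, pw (-θ * |(i : ℝ) - j|) * α j with hΛ
  have hΛsum : ∑' i, Λ i ^ q ≤ G ^ q * S := by
    calc ∑' i, Λ i ^ q ≤ ∑' i : ℤ, G ^ (q - 1) * ∑' j : ℤ, pw (-θ * |(i : ℝ) - j|) * α j ^ q := by
          refine ENNReal.tsum_le_tsum fun i => (tsum_mul_rpow_le hq _ _).trans ?_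
          exact mul_le_mul_left (ENNReal.rpow_le_rpow (tsum_pw_abs_le i) (by linarith)) _
      _ = G ^ (q - 1) * ∑' j : ℤ, (∑' i : ℤ, pw (-θ * |(j : ℝ) - i|)) * α j ^ q := by
          rw [ENNReal.tsum_mul_left, ENNReal.tsum_comm]
          congr 1
          refine tsum_congr fun j => ?_
          rw [← ENNReal.tsum_mul_right]
          simp only [abs_sub_comm]
      _ ≤ G ^ (q - 1) * ∑' j : ℤ, G * α j ^ q := by
          refine mul_le_mul_right (ENNReal.tsum_le_tsum fun j => ?_) _
          exact mul_le_mul_left (tsum_pw_abs_le j) _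
      _ = G ^ q * S := by
          rw [ENNReal.tsum_mul_left, ← mul_assoc]
          congr 1
          conv_lhs => rw [← ENNReal.rpow_one G, ← ENNReal.rpow_mul, one_mul,
            ← ENNReal.rpow_add_of_nonneg _ _ (by linarith) zero_le_one]
          ring_nf
  have hGS : (G ^ q * S) ^ (1 / q) ≠ ⊤ := ENNReal.rpow_ne_top_of_nonneg (by positivity)
    (ENNReal.mul_ne_top (ENNReal.rpow_ne_top_of_nonneg hq0.le hGt) hSt)
  have hΛle : ∀ i, Λ i ≤ (G ^ q * S) ^ (1 / q) := fun i => by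
    rw [one_div, ENNReal.le_rpow_inv_iff hq0]
    exact (ENNReal.le_tsum i).trans hΛsum
  have hdist : ∀ i : ℤ, volume {x | pw (d * i) * Λ i < ‖v x‖ₑ} ≤ C1 * pw (-n * i) := by
    intro i
    set τ : ℤ → ℝ≥0∞ := fun j => pw (d * i - s * (j - i)) * α j with hτ
    have hsub : {x | pw (d * i) * Λ i < ‖v x‖ₑ} ⊆ ⋃ j : ℤ, {x | i ≤ j ∧ τ j < g j x} := by
      intro x hx
      by_contra hcon
      simp only [Set.mem_iUnion, Set.mem_ofPred_eq, not_exists, not_and, not_lt] at hcon hx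
      refine absurd ((hv x).trans ?_) (not_le.2 hx)
      simp only [hΛ]
      rw [← ENNReal.tsum_mul_left]
      refine ENNReal.tsum_le_tsum fun j => ?_
      rw [← mul_assoc, ← pw_add]
      rcases le_total i j with hij | hij
      · refine (hcon j hij).trans (mul_le_mul_left (pw_mono ?_) _)
        have h1 : (i : ℝ) ≤ j := by exact_mod_cast hij
        rw [abs_of_nonpos (by linarith)]
        nlinarith [min_le_right d s]
      · refine (hsup j x).trans (mul_le_mul_left (pw_mono ?_) _)
        have h1 : (j : ℝ) ≤ i := by exact_mod_cast hij
        rw [abs_of_nonneg (by linarith)]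
        nlinarith [min_le_left d s]
    have hmeas : ∀ j : ℤ, volume {x | i ≤ j ∧ τ j < g j x}
        ≤ if i ≤ j then pw (-n * i) * (pw (e / 2 * i) * pw (-(e / 2) * j)) else 0 := by
      intro j
      split_ifs with hij
      · by_cases hα : α j = 0
        · have : {x | i ≤ j ∧ τ j < g j x} = ∅ := by
            ext x
            have := hsup j x
            simp only [hα, mul_zero, nonpos_iff_eq_zero] at this
            simp [this]
          simp [this]
        have hτ0 : τ j ^ r ≠ 0 := by
          simp [hτ, hr0.le, hα, pw_ne_zero, hr0.not_gt, ENNReal.rpow_eq_zero_iff]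
        have hτt : τ j ^ r ≠ ⊤ := ENNReal.rpow_ne_top_of_nonneg hr0.le
          (ENNReal.mul_ne_top (pw_ne_top _) (hαt j))
        have hαr0 : α j ^ r ≠ 0 := by simp [ENNReal.rpow_eq_zero_iff, hα, hr0.not_gt]
        have hαrt : α j ^ r ≠ ⊤ := ENNReal.rpow_ne_top_of_nonneg hr0.le (hαt j)
        have h1 : {x | i ≤ j ∧ τ j < g j x} ⊆ {x | τ j ^ r ≤ g j x ^ r} := fun x hx =>
          ENNReal.rpow_le_rpow hx.2.le hr0.le
        have h2 := (mul_meas_ge_le_lintegral ((hgm j).pow_const r) (τ j ^ r)).trans (hLr j)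
        refine (measure_mono h1).trans ?_
        rw [← ENNReal.mul_le_mul_iff_right hτ0 hτt]
        refine h2.trans (le_of_eq ?_)
        simp only [hτ]
        rw [ENNReal.mul_rpow_of_nonneg _ _ hr0.le, pw_rpow, mul_right_comm, ← pw_add, ← pw_add,
          ← pw_add]
        congr 2
        have : (d * i - s * (j - i)) * r = d * r * i - s * r * (j - i) := by ring
        rw [this, hsr, he]
        ring
      · simp [hij]
    calc _ ≤ ∑' j : ℤ, volume {x | i ≤ j ∧ τ j < g j x} :=
          (measure_mono hsub).trans (measure_iUnion_le _)
      _ ≤ ∑' j : ℤ, pw (-n * i) * (pw (e / 2 * i) * (if i ≤ j then pw (-(e / 2) * j) else 0)) := by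
          refine ENNReal.tsum_le_tsum fun j => (hmeas j).trans (le_of_eq ?_)
          split_ifs <;> simp
      _ ≤ pw (-n * i) * (pw (e / 2 * i) * (C1 * pw (-(e / 2) * i))) := by
          rw [ENNReal.tsum_mul_left, ENNReal.tsum_mul_left]
          exact mul_le_mul_right (mul_le_mul_right (tsum_pw_ge i) _) _
      _ = _ := by
          rw [mul_left_comm _ C1, ← pw_add, ← mul_assoc, mul_comm _ C1, mul_assoc, ← pw_add]
          ring_nf
  have hmain : ∀ t ∈ Set.Ioi (0 : ℝ), (ENNReal.ofReal t * (volume {x | t < ‖v x‖}) ^ (1 / p)) ^ q *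
      (ENNReal.ofReal t)⁻¹ ≤ ∑' i : ℤ, C1 ^ (q / p) * (pw (-(d * q) * i) *
        (if ENNReal.ofReal t < pw (d * ((i : ℝ) + 1)) * Λ (i + 1) then
          ENNReal.ofReal t ^ q * (ENNReal.ofReal t)⁻¹ else 0)) := by
    intro t ht
    set T := ENNReal.ofReal t with hT
    have hT0 : T ≠ 0 := by simpa [hT] using ht
    set D := volume {x | t < ‖v x‖} with hD
    have hDle : ∀ i : ℤ, pw (d * i) * Λ i ≤ T → D ≤ C1 * pw (-n * i) := by
      refine fun i hi => (measure_mono fun x hx => ?_).trans (hdist i)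
      refine hi.trans_lt ?_
      rw [hT, ← ofReal_norm]
      exact (ENNReal.ofReal_lt_ofReal_iff (lt_trans ht hx)).2 hx
    by_cases hall : ∀ i : ℤ, pw (d * i) * Λ i ≤ T
    · have hD0 : D = 0 := by
        by_contra hne
        have hDt : D ≠ ⊤ := ((hDle 0 (hall 0)).trans_lt
          (ENNReal.mul_lt_top hC1t.lt_top (pw_ne_top _).lt_top)).ne
        obtain ⟨N, hN⟩ := exists_pw_mul_le (by linarith : (0 : ℝ) < n) hC1t
          (ENNReal.half_pos hne).ne'
        have h1 := hDle (-N) (hall _)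
        have h2 := hN N le_rfl
        rw [mul_comm] at h1
        push_cast at h1
        rw [neg_mul_neg] at h1
        exact absurd (h1.trans h2) (not_le.2 (ENNReal.half_lt_self hne hDt))
      rw [hD0, ENNReal.zero_rpow_of_pos (by positivity), mul_zero, ENNReal.zero_rpow_of_pos hq0,
        zero_mul]
      exact zero_le
    push Not at hall
    obtain ⟨i0, hi0⟩ := hall
    obtain ⟨N, hN⟩ := exists_pw_mul_le hd0 hGS hT0
    have hlow : ∀ i ≤ N, pw (d * i) * Λ i ≤ T := fun i hi =>
      (mul_le_mul_right (hΛle i) _).trans (hN i hi)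
    obtain ⟨i, hi1, hi2⟩ : ∃ i : ℤ, pw (d * i) * Λ i ≤ T ∧
        T < pw (d * ((i : ℝ) + 1)) * Λ (i + 1) := by
      by_contra! hcon
      have hN0 : N ≤ i0 := by
        by_contra! h
        exact absurd (hlow i0 h.le) (not_le.2 hi0)
      refine absurd ?_ (not_le.2 hi0)
      clear hi0
      induction i0, hN0 using Int.leInduction with
      | base => exact hlow N le_rfl
      | succ i _ hi =>
        have := hcon i hi
        push_cast
        exact this
    refine le_trans ?_ (ENNReal.le_tsum i)
    rw [if_pos hi2, ENNReal.mul_rpow_of_nonneg _ _ hq0.le, ← ENNReal.rpow_mul, one_div_mul_eq_div]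
    have h1 : D ^ (q / p) ≤ C1 ^ (q / p) * pw (-(d * q) * i) := by
      refine (ENNReal.rpow_le_rpow (hDle i hi1) (by positivity)).trans_eq ?_
      rw [ENNReal.mul_rpow_of_nonneg _ _ (by positivity), pw_rpow]
      congr 2
      rw [hp]
      field_simp
    calc T ^ q * D ^ (q / p) * T⁻¹ = D ^ (q / p) * (T ^ q * T⁻¹) := by ring
      _ ≤ _ := by
        rw [← mul_assoc (C1 ^ _)]
        exact mul_le_mul_left h1 _
  have hint : ∫⁻ t in Set.Ioi (0 : ℝ), (ENNReal.ofReal t * (volume {x | t < ‖v x‖}) ^ (1 / p)) ^ q *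
      (ENNReal.ofReal t)⁻¹ ≤ K * S := by
    refine (setLIntegral_mono' measurableSet_Ioi hmain).trans ?_
    have hmm : ∀ l : ℝ≥0∞, Measurable fun t : ℝ => if ENNReal.ofReal t < l then
        ENNReal.ofReal t ^ q * (ENNReal.ofReal t)⁻¹ else 0 := fun l =>
      Measurable.ite (measurableSet_lt ENNReal.measurable_ofReal measurable_const)
        ((ENNReal.measurable_ofReal.pow_const q).mul ENNReal.measurable_ofReal.inv) measurable_const
    rw [lintegral_tsum fun i => (((hmm _).const_mul _).const_mul _).aemeasurable]
    calc _ ≤ ∑' i : ℤ, C1 ^ (q / p) * (pw (d * q) * Λ (i + 1) ^ q) := by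
          refine ENNReal.tsum_le_tsum fun i => ?_
          rw [lintegral_const_mul _ ((hmm _).const_mul _), lintegral_const_mul _ (hmm _)]
          refine mul_le_mul_right ((mul_le_mul_right (setLIntegral_ofReal_rpow_le hq _)
            _).trans_eq ?_) _
          rw [ENNReal.mul_rpow_of_nonneg _ _ hq0.le, pw_rpow, ← mul_assoc, ← pw_add]
          congr 2
          ring
      _ = C1 ^ (q / p) * (pw (d * q) * ∑' i, Λ i ^ q) := by
          rw [ENNReal.tsum_mul_left, ENNReal.tsum_mul_left,
            ← (Equiv.addRight (1 : ℤ)).tsum_eq fun i => Λ i ^ q]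
          rfl
      _ ≤ _ := by
          rw [hK, mul_assoc, mul_assoc]
          exact mul_le_mul_right (mul_le_mul_right hΛsum _) _
  refine le_trans ?_ (mul_le_mul_left le_self_add _)
  have h1q : 0 ≤ 1 / q := by positivity
  rw [lorentzNorm, mul_assoc, ← ENNReal.mul_rpow_of_nonneg K S h1q]
  exact mul_le_mul_right (ENNReal.rpow_le_rpow hint h1q) _

end Lorentz

section SmoothMaps

open scoped Convolution

theorem measurableSet_slab {n : ℕ} (ξ : Euc n) {B : Set ℝ} (hB : MeasurableSet B) :
    MeasurableSet {y : Euc n | ⟪y, ξ⟫ ∈ B} :=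
  (by fun_prop : Measurable fun y : Euc n => ⟪y, ξ⟫) hB

/-- Integration by parts over a union of parallel hyperplanes, in a direction tangent to them. -/
theorem setIntegral_slab_by_parts {n : ℕ} {E F : Type*} [NormedAddCommGroup E] [NormedSpace ℝ E]
    [NormedAddCommGroup F] [NormedSpace ℝ F] {T : Euc n → E →L[ℝ] F}
    {T' : Euc n → Euc n →L[ℝ] E →L[ℝ] F} (hT : ∀ z, HasFDerivAt T (T' z) z)
    (hTc : Continuous T') {C : ℝ} (hC : ∀ z, ‖T z‖ ≤ C) (hC' : ∀ z, ‖T' z‖ ≤ C)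
    {G : Euc n → E} {G' : Euc n → Euc n →L[ℝ] E} (hG : ∀ y, HasFDerivAt G (G' y) y)
    (hGi : Integrable G) {ξ τ : Euc n} (hGi' : Integrable fun y => G' y τ) (hτ : ⟪τ, ξ⟫ = 0)
    {B : Set ℝ} (hB : MeasurableSet B) (x : Euc n) :
    ∫ y in {y : Euc n | ⟪y, ξ⟫ ∈ B}, T' (x - y) τ (G y) =
      ∫ y in {y : Euc n | ⟪y, ξ⟫ ∈ B}, T (x - y) (G' y τ) := by
  set S := {y : Euc n | ⟪y, ξ⟫ ∈ B} with hS
  have hSm : MeasurableSet S := measurableSet_slab ξ hB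
  have e1 : ∀ {g : Euc n → E →L[ℝ] F} {h : Euc n → E},
      (fun y => (ContinuousLinearMap.id ℝ (E →L[ℝ] F)) (S.indicator g y) (h y)) =
        S.indicator fun y => g y (h y) := fun {g h} => by
    ext y
    by_cases hy : y ∈ S <;> simp [hy]
  have hTcont : Continuous T := continuous_iff_continuousAt.2 fun z => (hT z).continuousAt
  have c1 : Continuous fun y => T (x - y) := hTcont.comp (by fun_prop)
  have c2 : Continuous fun y => -(T' (x - y) τ) := by fun_prop
  have b2 : ∀ y, ‖-(T' (x - y) τ)‖ ≤ C * ‖τ‖ := fun y => by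
    rw [norm_neg]
    exact ((T' _).le_opNorm _).trans (by gcongr; exact hC' _)
  have h := integral_bilinear_hasLineDerivAt_right_eq_neg_left_of_integrable (μ := volume)
    (f := S.indicator fun y => T (x - y)) (v := τ) (g := G) (g' := fun y => G' y τ)
    (f' := S.indicator fun y => -(T' (x - y) τ)) (B := ContinuousLinearMap.id ℝ (E →L[ℝ] F))
    (by rw [e1]; exact (integrable_clm_apply c2 b2 hGi).indicator hSm)
    (by rw [e1]; exact (integrable_clm_apply c1 (fun y => hC _) hGi').indicator hSm)
    (by rw [e1]; exact (integrable_clm_apply c1 (fun y => hC _) hGi).indicator hSm)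
    (fun y _ => ?_) (fun y _ => (hG y).hasLineDerivAt _)
  · rw [e1, e1, integral_indicator hSm, integral_indicator hSm] at h
    rw [h, ← integral_neg]
    simp
  · have h1 : ∀ t : ℝ, y + t • τ ∈ S ↔ y ∈ S := fun t => by
      simp [hS, inner_add_left, inner_smul_left, hτ]
    unfold HasLineDerivAt
    by_cases hy : y ∈ S
    · simp only [Set.indicator, h1, hy, if_true]
      have h2 := ((hT (x - y)).comp y ((hasFDerivAt_id y).const_sub x)).hasLineDerivAt τ
      simpa [HasLineDerivAt, Function.comp_def] using h2
    · simp only [Set.indicator, h1, hy, if_false]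
      exact hasDerivAt_const _ _

variable {n : ℕ} {V W : Type*}
  [NormedAddCommGroup V] [InnerProductSpace ℝ V] [FiniteDimensional ℝ V]
  [NormedAddCommGroup W] [InnerProductSpace ℝ W] [FiniteDimensional ℝ W]
  {A : CoeffOp n 1 V W}

/-- The convolution with a dilate of the approximate identity. -/
noncomputable def cv {E : Type*} [NormedAddCommGroup E] [NormedSpace ℝ E] (j : ℤ) (g : Euc n → E)
    (x : Euc n) : E := ∫ y, et n j y • g (x - y)

theorem cv_eq {E : Type*} [NormedAddCommGroup E] [NormedSpace ℝ E] (j : ℤ) (g : Euc n → E)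
    (x : Euc n) : cv j g x = ∫ y, et n j (x - y) • g y := by
  rw [cv, ← integral_sub_left_eq_self _ volume x]
  simp

theorem integrable_et (hn : 1 ≤ n) (j : ℤ) : Integrable (et n j) := by
  obtain ⟨C, hC⟩ := exists_integral_norm_et_le n hn
  simpa using (hC j 0).1

theorem integrable_cv (hn : 1 ≤ n) {E : Type*} [NormedAddCommGroup E] [NormedSpace ℝ E] (j : ℤ)
    {g : Euc n → E} (hg : Integrable g) : Integrable (cv j g) :=
  (integrable_et hn j).integrable_convolution (ContinuousLinearMap.lsmul ℝ ℝ) hg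

theorem hasFDerivAt_cv (hn : 1 ≤ n) {E : Type*} [NormedAddCommGroup E] [NormedSpace ℝ E] (j : ℤ)
    {g : Euc n → E} (hg : ContDiff ℝ 1 g) (hc : HasCompactSupport g) (x : Euc n) :
    HasFDerivAt (cv j g) (cv j (fderiv ℝ g) x) x :=
  hc.hasFDerivAt_convolution_right (ContinuousLinearMap.lsmul ℝ ℝ)
    (integrable_et hn j).locallyIntegrable hg x

theorem integrable_et_smul {E : Type*} [NormedAddCommGroup E] [NormedSpace ℝ E] {g : Euc n → E}
    (hg : Integrable g) (j : ℤ) (x : Euc n) : Integrable fun y => et n j (x - y) • g y := by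
  obtain ⟨C, hC, h⟩ := exists_norm_et_le (n := n)
  exact hg.bdd_smul (((2 : ℝ) ^ j) ^ n * C)
    ((continuous_et j).comp (by fun_prop)).aestronglyMeasurable (ae_of_all _ fun y => h j _)

theorem clm_cv {E F : Type*} [NormedAddCommGroup E] [NormedSpace ℝ E] [CompleteSpace E]
    [NormedAddCommGroup F] [NormedSpace ℝ F] [CompleteSpace F] (L : E →L[ℝ] F) (j : ℤ)
    {g : Euc n → E} (hg : Integrable g) (x : Euc n) :
    L (cv j g x) = cv j (fun y => L (g y)) x := by
  rw [cv_eq, cv_eq, ← L.integral_comp_comm]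
  · simp
  · exact integrable_et_smul hg j x

/-- The operator, as a linear function of the gradient. -/
noncomputable def opL (A : CoeffOp n 1 V W) : (Euc n →L[ℝ] V) →L[ℝ] W :=
  ∑ l, coefL A l ∘L ContinuousLinearMap.apply ℝ V (stdVec n l)

theorem opL_apply (A : CoeffOp n 1 V W) (L : Euc n →L[ℝ] V) :
    opL A L = ∑ l, coefL A l (L (stdVec n l)) := by
  simp [opL]

theorem integral_kj_opL (hn : 1 < n) (hA : IsElliptic n 1 A) {v : Euc n → V} (hv : ContDiff ℝ 1 v)
    (hc : HasCompactSupport v) (j : ℤ) (x : Euc n) :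
    ∫ y, kj hA j (x - y) (opL A (fderiv ℝ v y)) = cv (j + 1) v x - cv j v x := by
  obtain ⟨C, hC⟩ := exists_norm_kj_le hA j
  have hvi : Integrable v := hv.continuous.integrable_of_hasCompactSupport hc
  have hvi' : Integrable (fderiv ℝ v) :=
    (hv.continuous_fderiv one_ne_zero).integrable_of_hasCompactSupport (hc.fderiv (𝕜 := ℝ))
  have c1 : Continuous fun y => kj hA j (x - y) := (continuous_kj hA j).comp (by fun_prop)
  have c2 : Continuous fun y => dj hA j (x - y) := (continuous_dj hA j).comp (by fun_prop)
  have i1 : ∀ l : Fin n, Integrable fun y => coefL A l (v y) := fun l =>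
    (coefL A l).integrable_comp hvi
  have i2 : ∀ l : Fin n, Integrable fun y => coefL A l (fderiv ℝ v y (stdVec n l)) := fun l =>
    (coefL A l ∘L ContinuousLinearMap.apply ℝ V (stdVec n l)).integrable_comp hvi'
  have h : ∀ l : Fin n, ∫ y, kj hA j (x - y) (coefL A l (fderiv ℝ v y (stdVec n l))) =
      ∫ y, dj hA j (x - y) (stdVec n l) (coefL A l (v y)) := fun l => by
    have := setIntegral_slab_by_parts (hasFDerivAt_kj hn hA j) (continuous_dj hA j)
      (fun z => (hC z).1) (fun z => (hC z).2)
      (G := fun y => coefL A l (v y)) (G' := fun y => coefL A l ∘L fderiv ℝ v y)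
      (fun y => (coefL A l).hasFDerivAt.comp y (hv.differentiable one_ne_zero y).hasFDerivAt)
      (i1 l) (τ := stdVec n l) (ξ := 0) (i2 l) (by simp) MeasurableSet.univ x
    simpa using this.symm
  have i3 : ∀ l : Fin n, Integrable fun y => dj hA j (x - y) (stdVec n l) (coefL A l (v y)) :=
    fun l => integrable_clm_apply (T := fun y => dj hA j (x - y) (stdVec n l)) (by fun_prop)
      (C := C * ‖stdVec n l‖)
      (fun y => ((dj hA j _).le_opNorm _).trans (by gcongr; exact (hC _).2)) (i1 l)
  simp_rw [opL_apply, map_sum]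
  rw [integral_finsetSum _ fun l _ => integrable_clm_apply c1 (fun y => (hC _).1) (i2 l)]
  simp_rw [h]
  rw [← integral_finsetSum _ fun l _ => i3 l]
  simp_rw [sum_dj_coef, cv_eq]
  rw [← integral_sub (integrable_et_smul hvi _ x) (integrable_et_smul hvi _ x)]
  simp_rw [sub_smul]

theorem tendsto_cv {v : Euc n → V} (hv : Continuous v) (hc : HasCompactSupport v) (x : Euc n) :
    Tendsto (fun J : ℕ => cv J v x) atTop (𝓝 (v x)) := by
  obtain ⟨C, hC⟩ := hv.bounded_above_of_compact_support hc
  simp_rw [cv_eq]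
  exact tendsto_integral_et hv hC x

theorem tendsto_cv_neg (hn : 1 ≤ n) {v : Euc n → V} (hv : Integrable v) (x : Euc n) :
    Tendsto (fun J : ℕ => cv (-(J : ℤ)) v x) atTop (𝓝 0) := by
  obtain ⟨C, hC, h⟩ := exists_norm_et_le (n := n)
  have h1 : Tendsto (fun J : ℕ => ((2 : ℝ) ^ (-(J : ℤ))) ^ n * C * ∫ y, ‖v y‖) atTop (𝓝 0) := by
    simpa using ((tendsto_two_zpow_neg_pow (m := n) (by omega)).mul_const C).mul_const (∫ y, ‖v y‖)
  refine squeeze_zero_norm (fun J => ?_) h1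
  rw [cv_eq, ← integral_const_mul]
  refine norm_integral_le_of_norm_le (hv.norm.const_mul _) (ae_of_all _ fun y => ?_)
  rw [norm_smul]
  gcongr
  exact h _ _

theorem enorm_cv_sub_le (hn : 1 < n) (hA : IsElliptic n 1 A) {v : Euc n → V} (hv : ContDiff ℝ 1 v)
    (hc : HasCompactSupport v) {a b : ℤ} (hab : a ≤ b) (x : Euc n) :
    ‖cv b v x - cv a v x‖ₑ ≤ ∑' i : ℤ, if a ≤ i then
      ‖∫ y, kj hA i (x - y) (opL A (fderiv ℝ v y))‖ₑ else 0 := by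
  have h : cv b v x - cv a v x = ∑ i ∈ Finset.Ico a b, (cv (i + 1) v x - cv i v x) := by
    induction b, hab using Int.leInduction with
    | base => simp
    | succ b hb ih => rw [← Finset.insert_Ico_right_eq_Ico_add_one hb, Finset.sum_insert (by simp), ← ih]; abel
  rw [h]
  refine (enorm_sum_le _ _).trans ((Finset.sum_le_sum fun i hi => ?_).trans
    (ENNReal.sum_le_tsum (Finset.Ico a b)))
  rw [if_pos (Finset.mem_Ico.1 hi).1, integral_kj_opL hn hA hv hc]

theorem enorm_sub_cv_le (hn : 1 < n) (hA : IsElliptic n 1 A) {v : Euc n → V} (hv : ContDiff ℝ 1 v)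
    (hc : HasCompactSupport v) (j : ℤ) (x : Euc n) :
    ‖v x - cv j v x‖ₑ ≤ ∑' i : ℤ, if j ≤ i then
      ‖∫ y, kj hA i (x - y) (opL A (fderiv ℝ v y))‖ₑ else 0 := by
  refine le_of_tendsto ((continuous_enorm.tendsto _).comp
    ((tendsto_cv hv.continuous hc x).sub_const _)) ?_
  filter_upwards [eventually_ge_atTop j.toNat] with J hJ
  exact enorm_cv_sub_le hn hA hv hc (Int.toNat_le.1 hJ) x

theorem enorm_le_tsum_kj (hn : 1 < n) (hA : IsElliptic n 1 A) {v : Euc n → V}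
    (hv : ContDiff ℝ 1 v) (hc : HasCompactSupport v) (x : Euc n) :
    ‖v x‖ₑ ≤ ∑' i : ℤ, ‖∫ y, kj hA i (x - y) (opL A (fderiv ℝ v y))‖ₑ := by
  have h1 := tendsto_const_nhds (x := v x).sub (tendsto_cv_neg hn.le
    (hv.continuous.integrable_of_hasCompactSupport hc) x)
  rw [sub_zero] at h1
  refine le_of_tendsto ((continuous_enorm.tendsto _).comp h1) (.of_forall fun J => ?_)
  refine (enorm_sub_cv_le hn hA hv hc _ x).trans (ENNReal.tsum_le_tsum fun i => ?_)
  split_ifs <;> simp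

end SmoothMaps

section SlabEstimates

variable {n : ℕ} {V W : Type*}
  [NormedAddCommGroup V] [InnerProductSpace ℝ V] [FiniteDimensional ℝ V]
  [NormedAddCommGroup W] [InnerProductSpace ℝ W] [FiniteDimensional ℝ W]
  {A : CoeffOp n 1 V W}

theorem enorm_integral_clm_le {α E F : Type*} [MeasurableSpace α] {μ : Measure α}
    [NormedAddCommGroup E] [NormedSpace ℝ E] [NormedAddCommGroup F] [NormedSpace ℝ F]
    {T : α → E →L[ℝ] F} {g : α → E} {w h : α → ℝ≥0∞} {c d : ℝ≥0∞} (hc : c ≠ ⊤)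
    (hd : d ≠ ⊤) (hT : ∀ y, ‖T y‖ₑ ≤ c * w y) (hg : ∀ y, ‖g y‖ₑ ≤ d * h y) :
    ‖∫ y, T y (g y) ∂μ‖ₑ ≤ c * d * ∫⁻ y, w y * h y ∂μ := by
  rw [← lintegral_const_mul' _ _ (ENNReal.mul_ne_top hc hd)]
  refine (enorm_integral_le_lintegral_enorm _).trans (lintegral_mono fun y => ?_)
  rw [mul_mul_mul_comm]
  exact (enorm_clm_apply_le _ _).trans (mul_le_mul' (hT y) (hg y))

theorem measurable_wj_sub (j : ℤ) (z : Euc n) : Measurable fun y => wj n j (y - z) :=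
  measurable_wj.comp (by fun_prop)

theorem measurable_lintegral_wj {g : Euc n → ℝ≥0∞} (hg : Measurable g) (j : ℤ) :
    Measurable fun y => ∫⁻ z, wj n j (y - z) * g z :=
  Measurable.lintegral_prod_right' (f := fun p : Euc n × Euc n => wj n j (p.1 - p.2) * g p.2)
    ((measurable_wj.comp (by fun_prop)).mul (hg.comp measurable_snd))

theorem exists_slab_convolution_le (hn : 1 ≤ n) {q : ℝ} (hq : 1 < q) : ∃ C : ℝ≥0∞, C ≠ ⊤ ∧
    ∀ (j : ℤ) (ξ : Euc n), ‖ξ‖ = 1 → ∀ B : Set ℝ, MeasurableSet B → ∀ g : Euc n → ℝ≥0∞,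
      Measurable g → ∫⁻ y in {y : Euc n | ⟪y, ξ⟫ ∈ B}, ∫⁻ z, wj n j (y - z) * g z ≤
        C * ((pw j * volume B) ^ (1 / q) * ∫⁻ z, g z) := by
  obtain ⟨C, hC, h⟩ := lintegral_wj_slab_le hn
  set N := ∫⁻ x : Euc n, ENNReal.ofReal (wt n x) with hN
  have hNt : N ≠ ⊤ := lintegral_wt_ne_top hn
  refine ⟨C + N, by finiteness, fun j ξ hξ B hB g hg => ?_⟩
  set t := pw j * volume B with ht
  have hm : Measurable (Function.uncurry fun y z : Euc n => wj n j (y - z) * g z) :=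
    (measurable_wj.comp (by fun_prop)).mul (hg.comp measurable_snd)
  rw [lintegral_lintegral_swap hm.aemeasurable, ← mul_assoc,
    ← lintegral_const_mul _ hg]
  refine lintegral_mono fun z => ?_
  rw [lintegral_mul_const _ (measurable_wj_sub j z)]
  gcongr
  rcases le_total t 1 with h1 | h1
  · refine (h j ξ hξ z B hB).trans (mul_le_mul' le_self_add ?_)
    simpa using ENNReal.rpow_le_rpow_of_exponent_ge h1 ((div_le_one (by linarith)).2 hq.le)
  · refine (setLIntegral_le_lintegral _ _).trans ?_
    rw [lintegral_wj]
    refine (le_mul_of_one_le_right' ?_).trans (mul_le_mul' le_add_self le_rfl)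
    simpa using ENNReal.rpow_le_rpow h1 (by positivity : 0 ≤ 1 / q)

theorem lintegral_wj_mul_le (j : ℤ) {h : Euc n → ℝ≥0∞} (hh : Measurable h) (x : Euc n) :
    ∫⁻ y, wj n j (x - y) * h y ≤ pw (j * n) * ∫⁻ y, h y := by
  rw [← lintegral_const_mul _ hh]
  exact lintegral_mono fun y => mul_le_mul' (wj_le _) le_rfl

theorem lintegral_wj_mul_rpow_le {r : ℝ} (hr : 1 < r) (j : ℤ) {h : Euc n → ℝ≥0∞}
    (hh : Measurable h) : ∫⁻ x, (∫⁻ y, wj n j (x - y) * h y) ^ r ≤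
      (∫⁻ x : Euc n, ENNReal.ofReal (wt n x)) * (pw (j * (n * (r - 1))) * (∫⁻ y, h y) ^ r) := by
  have e : ∀ a : ℝ≥0∞, a ^ r = a ^ (r - 1) * a := fun a => by
    conv_rhs => enter [2]; rw [← ENNReal.rpow_one a]
    rw [← ENNReal.rpow_add_of_nonneg _ _ (by linarith) zero_le_one, sub_add_cancel]
  calc _ ≤ ∫⁻ x, (pw (j * n) * ∫⁻ y, h y) ^ (r - 1) * ∫⁻ y, wj n j (x - y) * h y := by
        refine lintegral_mono fun x => ?_
        rw [e]
        exact mul_le_mul' (ENNReal.rpow_le_rpow (lintegral_wj_mul_le j hh x) (by linarith)) le_rfl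
    _ = (pw (j * n) * ∫⁻ y, h y) ^ (r - 1) *
          ((∫⁻ x : Euc n, ENNReal.ofReal (wt n x)) * ∫⁻ y, h y) := by
        have hm : Measurable (Function.uncurry fun x y : Euc n => wj n j (x - y) * h y) :=
          (measurable_wj.comp (by fun_prop)).mul (hh.comp measurable_snd)
        rw [lintegral_const_mul _ (measurable_lintegral_wj hh j),
          lintegral_lintegral_swap hm.aemeasurable]
        congr 1
        rw [← lintegral_const_mul _ hh]
        refine lintegral_congr fun y => ?_
        rw [lintegral_mul_const _ (measurable_wj_sub j y), lintegral_wj]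
    _ = _ := by
        rw [ENNReal.mul_rpow_of_nonneg _ _ (by linarith), pw_rpow, e (∫⁻ y, h y), ← mul_assoc (j : ℝ)]
        ring

theorem exists_slab_remainder_le (hn : 1 < n) (hA : IsElliptic n 1 A) {q : ℝ} (hq : 1 < q) :
    ∃ C : ℝ≥0∞, C ≠ ⊤ ∧ ∀ v : Euc n → V, ContDiff ℝ 1 v → HasCompactSupport v →
      ∀ (j : ℤ) (ξ : Euc n), ‖ξ‖ = 1 → ∀ B : Set ℝ, MeasurableSet B →
      ∫⁻ y in {y : Euc n | ⟪y, ξ⟫ ∈ B},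
        (‖cv j (fun y => opL A (fderiv ℝ v y)) y‖ₑ + pw j * ‖v y - cv j v y‖ₑ) ≤
        C * ((pw j * volume B) ^ (1 / q) * ∫⁻ z, ‖opL A (fderiv ℝ v z)‖ₑ) := by
  obtain ⟨C, hC, h⟩ := exists_slab_convolution_le hn.le hq
  obtain ⟨C₁, hC₁, h₁⟩ := exists_enorm_et_le (n := n)
  obtain ⟨C₂, hC₂, h₂⟩ := exists_enorm_kj_le hn hA
  have hq' : 0 < 1 - 1 / q := by
    rw [sub_pos, div_lt_one (by linarith)]
    exact hq
  have hgeo := geo_ne_top hq'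
  refine ⟨C₁ * C + C₂ * C * geo (1 - 1 / q), by finiteness, fun v hv hc j ξ hξ B hB => ?_⟩
  set F : Euc n → W := fun y => opL A (fderiv ℝ v y) with hF
  have hFc : Continuous F := (opL A).continuous.comp (hv.continuous_fderiv one_ne_zero)
  have hg : Measurable fun y => ‖F y‖ₑ := hFc.enorm.measurable
  set I : ℤ → Euc n → ℝ≥0∞ := fun i y => ∫⁻ z, wj n i (y - z) * ‖F z‖ₑ with hI
  have hIm : ∀ i, Measurable (I i) := measurable_lintegral_wj hg
  have b1 : ∀ y, ‖cv j F y‖ₑ ≤ C₁ * I j y := fun y => by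
    rw [cv_eq, hI, ← lintegral_const_mul' _ _ hC₁]
    refine (enorm_integral_le_lintegral_enorm _).trans (lintegral_mono fun z => ?_)
    rw [enorm_smul, ← mul_assoc]
    gcongr
    exact h₁ j _
  have b2 : ∀ y, ‖v y - cv j v y‖ₑ ≤ ∑' i : ℤ, if j ≤ i then C₂ * pw (-i) * I i y else 0 :=
    fun y => by
    refine (enorm_sub_cv_le hn hA hv hc j y).trans (ENNReal.tsum_le_tsum fun i => ?_)
    split_ifs
    · refine (enorm_integral_clm_le (ENNReal.mul_ne_top hC₂ (pw_ne_top (-i))) ENNReal.one_ne_top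
        (fun z => ?_) fun z => (one_mul _).ge).trans_eq (by rw [mul_one])
      refine (h₂ i _).1.trans (le_of_eq ?_)
      rw [wj, mul_assoc, ← mul_assoc (pw _), ← pw_add]
      ring_nf
    · rfl
  have h3 : ∀ i : ℤ, pw (-i) * (pw i * volume B) ^ (1 / q) =
      pw (-(1 - 1 / q) * i) * volume B ^ (1 / q) := fun i => by
    rw [ENNReal.mul_rpow_of_nonneg _ _ (by positivity), pw_rpow, ← mul_assoc, ← pw_add]
    ring_nf
  have h4 : pw j * pw (-(1 - 1 / q) * j) * volume B ^ (1 / q) = (pw j * volume B) ^ (1 / q) := by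
    rw [ENNReal.mul_rpow_of_nonneg _ _ (by positivity), pw_rpow, ← pw_add]
    ring_nf
  set M := ∫⁻ z, ‖F z‖ₑ with hM
  have h5 : ∀ i : ℤ, ∫⁻ y in {y : Euc n | ⟪y, ξ⟫ ∈ B},
      (if j ≤ i then C₂ * pw (-i) * I i y else 0) ≤
      (if j ≤ i then pw (-(1 - 1 / q) * i) else 0) * (C₂ * C * (volume B ^ (1 / q) * M)) := fun i => by
    split_ifs
    · rw [lintegral_const_mul _ (hIm i)]
      calc _ ≤ C₂ * pw (-i) * (C * ((pw i * volume B) ^ (1 / q) * M)) := by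
            gcongr
            exact h i ξ hξ B hB _ hg
        _ = C₂ * C * (pw (-i) * (pw i * volume B) ^ (1 / q)) * M := by ring
        _ = _ := by rw [h3]; ring
    · simp
  calc _ ≤ ∫⁻ y in {y : Euc n | ⟪y, ξ⟫ ∈ B}, (C₁ * I j y + pw j * ∑' i : ℤ,
          if j ≤ i then C₂ * pw (-i) * I i y else 0) := by
        refine lintegral_mono fun y => ?_
        gcongr
        · exact b1 y
        · exact b2 y
    _ = C₁ * (∫⁻ y in {y : Euc n | ⟪y, ξ⟫ ∈ B}, I j y) + pw j * ∑' i : ℤ,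
          ∫⁻ y in {y : Euc n | ⟪y, ξ⟫ ∈ B}, if j ≤ i then C₂ * pw (-i) * I i y else 0 := by
        have hm : ∀ i : ℤ, Measurable fun y => if j ≤ i then C₂ * pw (-i) * I i y else 0 := fun i => by
          split_ifs
          · exact (hIm i).const_mul _
          · exact measurable_const
        rw [lintegral_add_left ((hIm j).const_mul _), lintegral_const_mul _ (hIm j),
          lintegral_const_mul' _ _ (pw_ne_top _), lintegral_tsum fun i => (hm i).aemeasurable]
    _ ≤ C₁ * (C * ((pw j * volume B) ^ (1 / q) * M)) + pw j *
          ((geo (1 - 1 / q) * pw (-(1 - 1 / q) * j)) * (C₂ * C * (volume B ^ (1 / q) * M))) := by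
        gcongr
        · exact h j ξ hξ B hB _ hg
        · refine (ENNReal.tsum_le_tsum h5).trans ?_
          rw [ENNReal.tsum_mul_right]
          gcongr
          exact tsum_pw_ge j
    _ = _ := by rw [← h4]; ring

end SlabEstimates

section Annihilator

variable {n : ℕ} {V W : Type*}
  [NormedAddCommGroup V] [InnerProductSpace ℝ V] [FiniteDimensional ℝ V]
  [NormedAddCommGroup W] [InnerProductSpace ℝ W] [FiniteDimensional ℝ W]
  {A : CoeffOp n 1 V W}

/-- A map annihilating the image of `𝒜[ξ]` only sees the derivatives in directions tangent to the
hyperplanes orthogonal to `ξ`. -/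
theorem annihilator_opL {Q : W →L[ℝ] W} {ξ : Euc n} (hQ : ∀ v, Q (symL A ξ v) = 0)
    (L : Euc n →L[ℝ] V) :
    Q (opL A L) = ∑ l, Q (coefL A l (L (stdVec n l - ξ l • ξ))) := by
  have h := hQ (L ξ)
  rw [symL_apply', map_sum] at h
  simp only [map_sub, map_smul, Finset.sum_sub_distrib, opL_apply, map_sum] at h ⊢
  rw [h, sub_zero]

theorem setIntegral_kj_annihilator (hn : 1 < n) (hA : IsElliptic n 1 A) {Q : W →L[ℝ] W}
    {ξ : Euc n} (hξ : ‖ξ‖ = 1) (hQ : ∀ v, Q (symL A ξ v) = 0) {v : Euc n → V}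
    (hv : ContDiff ℝ 1 v) (hc : HasCompactSupport v) (j : ℤ) {B : Set ℝ} (hB : MeasurableSet B)
    (x : Euc n) :
    ∫ y in {y : Euc n | ⟪y, ξ⟫ ∈ B}, kj hA j (x - y) (Q (opL A (fderiv ℝ v y))) =
      (∫ y in {y : Euc n | ⟪y, ξ⟫ ∈ B},
        kj hA j (x - y) (Q (cv j (fun y => opL A (fderiv ℝ v y)) y))) +
      ∑ l, ∫ y in {y : Euc n | ⟪y, ξ⟫ ∈ B},
        dj hA j (x - y) (stdVec n l - ξ l • ξ) (Q (coefL A l (v y - cv j v y))) := by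
  obtain ⟨C, hC⟩ := exists_norm_kj_le hA j
  have hvi : Integrable v := hv.continuous.integrable_of_hasCompactSupport hc
  have hvi' : Integrable (fderiv ℝ v) :=
    (hv.continuous_fderiv one_ne_zero).integrable_of_hasCompactSupport (hc.fderiv (𝕜 := ℝ))
  have hFi : Integrable fun y => opL A (fderiv ℝ v y) := (opL A).integrable_comp hvi'
  have c1 : Continuous fun y => kj hA j (x - y) := (continuous_kj hA j).comp (by fun_prop)
  have hH : ∀ y, HasFDerivAt (fun y => v y - cv j v y) (fderiv ℝ v y - cv j (fderiv ℝ v) y) y :=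
    fun y => (hv.differentiable one_ne_zero y).hasFDerivAt.sub (hasFDerivAt_cv hn.le j hv hc y)
  have hHi' : Integrable fun y => fderiv ℝ v y - cv j (fderiv ℝ v) y :=
    hvi'.sub (integrable_cv hn.le j hvi')
  have i2 : ∀ l : Fin n, Integrable fun y =>
      Q (coefL A l ((fderiv ℝ v y - cv j (fderiv ℝ v) y) (stdVec n l - ξ l • ξ))) := fun l =>
    (Q ∘L coefL A l ∘L ContinuousLinearMap.apply ℝ V (stdVec n l - ξ l • ξ)).integrable_comp hHi'
  have h : ∀ l : Fin n, ∫ y in {y : Euc n | ⟪y, ξ⟫ ∈ B},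
      dj hA j (x - y) (stdVec n l - ξ l • ξ) (Q (coefL A l (v y - cv j v y))) =
      ∫ y in {y : Euc n | ⟪y, ξ⟫ ∈ B}, kj hA j (x - y)
        (Q (coefL A l ((fderiv ℝ v y - cv j (fderiv ℝ v) y) (stdVec n l - ξ l • ξ)))) := fun l =>
    setIntegral_slab_by_parts (hasFDerivAt_kj hn hA j) (continuous_dj hA j)
      (fun z => (hC z).1) (fun z => (hC z).2) (G := fun y => Q (coefL A l (v y - cv j v y)))
      (G' := fun y => (Q ∘L coefL A l) ∘L (fderiv ℝ v y - cv j (fderiv ℝ v) y))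
      (fun y => (Q ∘L coefL A l).hasFDerivAt.comp y (hH y))
      ((Q ∘L coefL A l).integrable_comp (hvi.sub (integrable_cv hn.le j hvi))) (i2 l)
      (by rw [inner_sub_left, real_inner_smul_left, real_inner_self_eq_norm_sq, hξ,
        real_inner_comm, inner_stdVec]; simp) hB x
  simp_rw [h]
  have i3 : ∀ {g : Euc n → W}, Integrable g → IntegrableOn (fun y => kj hA j (x - y) (g y))
      {y : Euc n | ⟪y, ξ⟫ ∈ B} := fun {g} hg =>
    (integrable_clm_apply c1 (fun y => (hC _).1) hg).integrableOn
  rw [← integral_finsetSum _ fun l _ => i3 (i2 l),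
    ← integral_add (i3 (Q.integrable_comp (integrable_cv hn.le j hFi)))
      (integrable_finsetSum _ fun l _ => i3 (i2 l))]
  refine integral_congr_ae (ae_of_all _ fun y => ?_)
  dsimp only
  rw [← map_sum, ← map_add, ← annihilator_opL hQ, map_sub, map_sub, clm_cv (opL A) j hvi',
    add_sub_cancel]

theorem exists_enorm_kj_annihilator_le (hn : 1 < n) (hA : IsElliptic n 1 A) {Q : W →L[ℝ] W}
    {ξ : Euc n} (hξ : ‖ξ‖ = 1) (hQ : ∀ v, Q (symL A ξ v) = 0) : ∃ C : ℝ≥0∞, C ≠ ⊤ ∧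
    ∀ v : Euc n → V, ContDiff ℝ 1 v → HasCompactSupport v → ∀ (j : ℤ) (B : Set ℝ),
      MeasurableSet B → ∀ x, ‖∫ y, kj hA j (x - y) (Q (opL A (fderiv ℝ v y)))‖ₑ ≤
        C * pw (-j) * ((∫⁻ y in {y : Euc n | ⟪y, ξ⟫ ∉ B}, wj n j (x - y) * ‖opL A (fderiv ℝ v y)‖ₑ) +
          ∫⁻ y in {y : Euc n | ⟪y, ξ⟫ ∈ B}, wj n j (x - y) *
            (‖cv j (fun y => opL A (fderiv ℝ v y)) y‖ₑ + pw j * ‖v y - cv j v y‖ₑ)) := by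
  obtain ⟨C, hC, h⟩ := exists_enorm_kj_le hn hA
  set S : ℝ≥0∞ := ∑ l : Fin n, C * ‖stdVec n l - ξ l • ξ‖ₑ * ‖Q ∘L coefL A l‖ₑ with hS
  have hSt : S ≠ ⊤ := ENNReal.sum_ne_top.2 fun l _ => by finiteness
  refine ⟨C * ‖Q‖ₑ + S, by finiteness, fun v hv hc j B hB x => ?_⟩
  have hvi' : Integrable (fderiv ℝ v) :=
    (hv.continuous_fderiv one_ne_zero).integrable_of_hasCompactSupport (hc.fderiv (𝕜 := ℝ))
  obtain ⟨C', hC'⟩ := exists_norm_kj_le hA j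
  have c1 : Continuous fun y => kj hA j (x - y) := (continuous_kj hA j).comp (by fun_prop)
  have hFi : Integrable fun y => kj hA j (x - y) (Q (opL A (fderiv ℝ v y))) :=
    integrable_clm_apply c1 (fun y => (hC' _).1) ((Q ∘L opL A).integrable_comp hvi')
  have hSm := measurableSet_slab ξ hB
  have k1 : ∀ y, ‖kj hA j (x - y)‖ₑ ≤ C * pw (-j) * wj n j (x - y) := fun y => by
    refine (h j _).1.trans (le_of_eq ?_)
    rw [wj, mul_assoc, ← mul_assoc (pw _), ← pw_add]
    ring_nf
  have k2 : ∀ (l : Fin n) (y : Euc n), ‖dj hA j (x - y) (stdVec n l - ξ l • ξ)‖ₑ ≤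
      C * ‖stdVec n l - ξ l • ξ‖ₑ * wj n j (x - y) := fun l y => by
    refine (enorm_clm_apply_le _ _).trans ?_
    rw [mul_right_comm]
    exact mul_le_mul' (h j _).2 le_rfl
  rw [← integral_add_compl hSm hFi, setIntegral_kj_annihilator hn hA hξ hQ hv hc j hB x]
  set T := {y : Euc n | ⟪y, ξ⟫ ∈ B} with hT
  have hpw : C * pw (-j) ≠ ⊤ := ENNReal.mul_ne_top hC (pw_ne_top _)
  have m1 : ∀ l : Fin n, ‖∫ y in T, dj hA j (x - y) (stdVec n l - ξ l • ξ)
      (Q (coefL A l (v y - cv j v y)))‖ₑ ≤ C * ‖stdVec n l - ξ l • ξ‖ₑ * ‖Q ∘L coefL A l‖ₑ *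
        (pw (-j) * ∫⁻ y in T, wj n j (x - y) *
          (‖cv j (fun y => opL A (fderiv ℝ v y)) y‖ₑ + pw j * ‖v y - cv j v y‖ₑ)) := fun l => by
    refine (enorm_integral_clm_le (by finiteness) (by finiteness) (k2 l)
      (fun y => enorm_clm_apply_le (Q ∘L coefL A l) (v y - cv j v y))).trans ?_
    rw [← lintegral_const_mul' _ _ (pw_ne_top _)]
    refine mul_le_mul_right (lintegral_mono fun y => ?_) _
    rw [mul_left_comm, mul_add, ← mul_assoc (pw _) (pw _), ← pw_add, neg_add_cancel, pw_zero, one_mul]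
    exact mul_le_mul_right le_add_self _
  have m2 : ‖∫ y in T, kj hA j (x - y) (Q (cv j (fun y => opL A (fderiv ℝ v y)) y))‖ₑ ≤
      C * ‖Q‖ₑ * (pw (-j) * ∫⁻ y in T, wj n j (x - y) *
          (‖cv j (fun y => opL A (fderiv ℝ v y)) y‖ₑ + pw j * ‖v y - cv j v y‖ₑ)) := by
    refine (enorm_integral_clm_le hpw enorm_ne_top k1 fun y => enorm_clm_apply_le Q _).trans ?_
    rw [mul_right_comm C, mul_assoc (C * _)]
    exact mul_le_mul' le_rfl (mul_le_mul' le_rfl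
      (lintegral_mono fun y => mul_le_mul' le_rfl le_self_add))
  have m3 := enorm_integral_clm_le (μ := volume.restrict Tᶜ) hpw enorm_ne_top k1
    fun y => enorm_clm_apply_le Q (opL A (fderiv ℝ v y))
  set X := ∫⁻ y in T, wj n j (x - y) *
    (‖cv j (fun y => opL A (fderiv ℝ v y)) y‖ₑ + pw j * ‖v y - cv j v y‖ₑ) with hX
  calc _ ≤ C * ‖Q‖ₑ * (pw (-j) * X) + S * (pw (-j) * X) + C * pw (-j) * ‖Q‖ₑ *
          ∫⁻ y in Tᶜ, wj n j (x - y) * ‖opL A (fderiv ℝ v y)‖ₑ := by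
        refine (enorm_add_le _ _).trans (add_le_add ((enorm_add_le _ _).trans (add_le_add m2 ?_)) m3)
        rw [hS, Finset.sum_mul]
        exact (enorm_sum_le _ _).trans (Finset.sum_le_sum fun l _ => m1 l)
    _ ≤ C * ‖Q‖ₑ * (pw (-j) * X) + S * (pw (-j) * X) + (C * ‖Q‖ₑ + S) * pw (-j) *
          ∫⁻ y in Tᶜ, wj n j (x - y) * ‖opL A (fderiv ℝ v y)‖ₑ := by
        rw [mul_right_comm C (pw _)]
        exact add_le_add le_rfl (mul_le_mul' (mul_le_mul' le_self_add le_rfl) le_rfl)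
    _ = _ := by
        rw [show {y : Euc n | ⟪y, ξ⟫ ∉ B} = Tᶜ from rfl]
        ring

end Annihilator

section DyadicFamilies

variable {n : ℕ} {r q : ℝ}

theorem tsum_rpow_le_rpow_tsum {ι : Type*} {s : ℝ} (hs : 1 ≤ s) (γ : ι → ℝ≥0∞) :
    ∑' j, γ j ^ s ≤ (∑' j, γ j) ^ s := by
  have e : ∀ a : ℝ≥0∞, a ^ s = a * a ^ (s - 1) := fun a => by
    conv_rhs => enter [1]; rw [← ENNReal.rpow_one a]
    rw [← ENNReal.rpow_add_of_nonneg _ _ zero_le_one (by linarith), add_sub_cancel]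
  rw [e, ← ENNReal.tsum_mul_right]
  refine ENNReal.tsum_le_tsum fun j => ?_
  rw [e]
  exact mul_le_mul' le_rfl (ENNReal.rpow_le_rpow (ENNReal.le_tsum j) (by linarith))

/-- Families of functions with the size of the dyadic pieces of a potential, the sizes being
`q`-summable with norm at most `m`. -/
def DyadicFamily (n : ℕ) (r q : ℝ) (X : ℤ → Euc n → ℝ≥0∞) (m : ℝ≥0∞) : Prop :=
  ∃ α : ℤ → ℝ≥0∞, ∑' j, α j ^ q ≤ m ^ q ∧ ∀ j : ℤ,
    (∀ x, X j x ≤ pw (((n : ℝ) - 1) * j) * α j) ∧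
    ∫⁻ x, X j x ^ r ≤ pw (-j * (n - ((n : ℝ) - 1) * r)) * α j ^ r

theorem DyadicFamily.mono {X Y : ℤ → Euc n → ℝ≥0∞} {m m' : ℝ≥0∞} (h : DyadicFamily n r q X m)
    (hr : 0 ≤ r) (hq : 0 ≤ q) (hY : ∀ j x, Y j x ≤ X j x) (hm : m ≤ m') :
    DyadicFamily n r q Y m' := by
  obtain ⟨α, h1, h2⟩ := h
  exact ⟨α, h1.trans (ENNReal.rpow_le_rpow hm hq), fun j => ⟨fun x => (hY j x).trans ((h2 j).1 x),
    (lintegral_mono fun x => ENNReal.rpow_le_rpow (hY j x) hr).trans (h2 j).2⟩⟩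

theorem DyadicFamily.const_mul {X : ℤ → Euc n → ℝ≥0∞} {m : ℝ≥0∞} (h : DyadicFamily n r q X m)
    (hr : 0 ≤ r) (hq : 0 ≤ q) {c : ℝ≥0∞} (hc : c ≠ ⊤) :
    DyadicFamily n r q (fun j x => c * X j x) (c * m) := by
  obtain ⟨α, h1, h2⟩ := h
  refine ⟨fun j => c * α j, ?_, fun j => ⟨fun x => ?_, ?_⟩⟩
  · simp_rw [ENNReal.mul_rpow_of_nonneg _ _ hq, ENNReal.tsum_mul_left]
    gcongr
  · rw [mul_left_comm]
    exact mul_le_mul_right ((h2 j).1 x) _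
  · simp_rw [ENNReal.mul_rpow_of_nonneg _ _ hr]
    rw [lintegral_const_mul' _ _ (by finiteness), mul_left_comm]
    exact mul_le_mul_right (h2 j).2 _

theorem ENNReal.add_rpow_le_two_mul {a b : ℝ≥0∞} {s : ℝ} (hs : 1 ≤ s) :
    (a + b) ^ s ≤ 2 ^ s * (a ^ s + b ^ s) :=
  (ENNReal.rpow_add_le_mul_rpow_add_rpow a b hs).trans (mul_le_mul'
    (ENNReal.rpow_le_rpow_of_exponent_le (by norm_num) (by linarith)) le_rfl)

theorem DyadicFamily.add {X Y : ℤ → Euc n → ℝ≥0∞} {m m' : ℝ≥0∞} (h : DyadicFamily n r q X m)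
    (h' : DyadicFamily n r q Y m') (hr : 1 ≤ r) (hq : 1 ≤ q) (hX : ∀ j, Measurable (X j)) :
    DyadicFamily n r q (fun j x => X j x + Y j x) (8 * (m + m')) := by
  have hr0 : 0 ≤ r := by linarith
  have hq0 : 0 ≤ q := by linarith
  have e : ∀ {a b : ℝ≥0∞} {s : ℝ}, 1 ≤ s → 2 ^ s * (a ^ s + b ^ s) ≤ (4 * (a + b)) ^ s :=
    fun {a b s} hs => by
    calc (2 : ℝ≥0∞) ^ s * (a ^ s + b ^ s) ≤ 2 ^ s * (2 ^ s * (a + b) ^ s) := by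
          refine mul_le_mul' le_rfl ?_
          calc a ^ s + b ^ s ≤ 2 * (a + b) ^ s := by
                rw [two_mul]
                exact add_le_add (ENNReal.rpow_le_rpow le_self_add (by linarith))
                  (ENNReal.rpow_le_rpow le_add_self (by linarith))
            _ ≤ _ := mul_le_mul' (by
                simpa using ENNReal.rpow_le_rpow_of_exponent_le (x := 2) (by norm_num) hs) le_rfl
      _ = _ := by
          rw [← mul_assoc, ← ENNReal.mul_rpow_of_nonneg _ _ (by linarith),
            ← ENNReal.mul_rpow_of_nonneg _ _ (by linarith)]
          norm_num
  obtain ⟨α, h1, h2⟩ := h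
  obtain ⟨β, h1', h2'⟩ := h'
  refine ⟨fun j => 4 * (α j + β j), ?_, fun j => ⟨fun x => ?_, ?_⟩⟩
  · calc ∑' j, (4 * (α j + β j)) ^ q ≤ ∑' j, 4 ^ q * (2 ^ q * (α j ^ q + β j ^ q)) := by
          refine ENNReal.tsum_le_tsum fun j => ?_
          rw [ENNReal.mul_rpow_of_nonneg _ _ hq0]
          exact mul_le_mul' le_rfl (ENNReal.add_rpow_le_two_mul hq)
      _ ≤ 4 ^ q * (2 ^ q * (m ^ q + m' ^ q)) := by
          rw [ENNReal.tsum_mul_left, ENNReal.tsum_mul_left, ENNReal.tsum_add]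
          gcongr
      _ ≤ 2 ^ q * (4 * (m + m')) ^ q := by
          rw [mul_left_comm, ENNReal.mul_rpow_of_nonneg _ _ hq0]
          refine mul_le_mul' le_rfl (mul_le_mul' le_rfl ?_)
          exact ENNReal.add_rpow_le_rpow_add _ _ hq
      _ = _ := by
          rw [← ENNReal.mul_rpow_of_nonneg _ _ hq0, ← mul_assoc]
          norm_num
  · calc X j x + Y j x ≤ pw (((n : ℝ) - 1) * j) * (α j + β j) := by
          rw [mul_add]
          exact add_le_add ((h2 j).1 x) ((h2' j).1 x)
      _ ≤ _ := mul_le_mul' le_rfl (le_mul_of_one_le_left' (by norm_num))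
  · calc ∫⁻ x, (X j x + Y j x) ^ r ≤ ∫⁻ x, 2 ^ r * (X j x ^ r + Y j x ^ r) :=
          lintegral_mono fun x => ENNReal.add_rpow_le_two_mul hr
      _ ≤ pw (-j * (n - ((n : ℝ) - 1) * r)) * (2 ^ r * (α j ^ r + β j ^ r)) := by
          rw [lintegral_const_mul' _ _ (by finiteness), lintegral_add_left ((hX j).pow_const r),
            mul_left_comm]
          refine mul_le_mul' le_rfl ?_
          rw [mul_add]
          exact add_le_add (h2 j).2 (h2' j).2
      _ ≤ _ := mul_le_mul' le_rfl (e hr)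

theorem dyadicFamily_of_le (hr : 0 < r) (hq : 0 ≤ q) {X : ℤ → Euc n → ℝ≥0∞} {a : ℤ → ℝ≥0∞}
    {C m : ℝ≥0∞} (hX : ∀ j : ℤ, (∀ x, X j x ≤ C * (pw (j * n) * a j)) ∧
      ∫⁻ x, X j x ^ r ≤ C * (pw (j * (n * (r - 1))) * a j ^ r)) (ha : ∑' j, a j ^ q ≤ m ^ q) :
    DyadicFamily n r q (fun j x => pw (-j) * X j x) ((C + C ^ (1 / r)) * m) := by
  refine ⟨fun j => (C + C ^ (1 / r)) * a j, ?_, fun j => ⟨fun x => ?_, ?_⟩⟩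
  · simp_rw [ENNReal.mul_rpow_of_nonneg _ _ hq, ENNReal.tsum_mul_left]
    gcongr
  · calc pw (-j) * X j x ≤ pw (-j) * (C * (pw (j * n) * a j)) := by gcongr; exact (hX j).1 x
      _ = pw (((n : ℝ) - 1) * j) * (C * a j) := by
          rw [mul_left_comm, ← mul_assoc (pw _), ← pw_add, mul_left_comm]
          ring_nf
      _ ≤ _ := mul_le_mul' le_rfl (mul_le_mul' le_self_add le_rfl)
  · simp_rw [ENNReal.mul_rpow_of_nonneg _ _ hr.le]
    rw [lintegral_const_mul' _ _ (ENNReal.rpow_ne_top_of_nonneg hr.le (pw_ne_top _))]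
    calc _ ≤ pw (-j) ^ r * (C * (pw (j * (n * (r - 1))) * a j ^ r)) := by gcongr; exact (hX j).2
      _ = pw (-j * (n - ((n : ℝ) - 1) * r)) * ((C ^ (1 / r)) ^ r * a j ^ r) := by
          rw [pw_rpow, mul_left_comm, ← mul_assoc (pw _), ← pw_add, mul_left_comm, ← ENNReal.rpow_mul,
            one_div_mul_cancel hr.ne', ENNReal.rpow_one]
          ring_nf
      _ ≤ _ := mul_le_mul' le_rfl (mul_le_mul'
          (ENNReal.rpow_le_rpow le_add_self hr.le) le_rfl)

end DyadicFamilies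

section CancelingEstimate

variable {n : ℕ} {r q : ℝ} {V W : Type*}
  [NormedAddCommGroup V] [InnerProductSpace ℝ V] [FiniteDimensional ℝ V]
  [NormedAddCommGroup W] [InnerProductSpace ℝ W] [FiniteDimensional ℝ W]
  {A : CoeffOp n 1 V W}

theorem measurable_integral_kj (hn : 1 < n) (hA : IsElliptic n 1 A) {f : Euc n → W}
    (hf : Integrable f) (j : ℤ) : Measurable fun x => ‖∫ y, kj hA j (x - y) (f y)‖ₑ := by
  obtain ⟨C, hC⟩ := exists_norm_kj_le hA j
  have h := (hasFDerivAt_integral_kernel (hasFDerivAt_kj hn hA j) (continuous_dj hA j)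
    (fun z => (hC z).1) (fun z => (hC z).2) hf).1
  exact (continuous_iff_continuousAt.2 fun x => (h x).continuousAt).enorm.measurable

/-- The dyadic pieces of the potential of `Q 𝒜v` are controlled by the mass of `𝒜v`. -/
def DyadicBound (hA : IsElliptic n 1 A) (r q : ℝ) (Q : W →L[ℝ] W) : Prop :=
  ∃ C : ℝ≥0∞, C ≠ ⊤ ∧ ∀ v : Euc n → V, ContDiff ℝ 1 v → HasCompactSupport v →
    DyadicFamily n r q (fun j x => ‖∫ y, kj hA j (x - y) (Q (opL A (fderiv ℝ v y)))‖ₑ)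
      (C * ∫⁻ y, ‖opL A (fderiv ℝ v y)‖ₑ)

theorem integrable_clm_fderiv {E : Type*} [NormedAddCommGroup E] [NormedSpace ℝ E]
    {v : Euc n → V} (hv : ContDiff ℝ 1 v) (hc : HasCompactSupport v) (L : (Euc n →L[ℝ] V) →L[ℝ] E) :
    Integrable fun y => L (fderiv ℝ v y) :=
  L.integrable_comp
    ((hv.continuous_fderiv one_ne_zero).integrable_of_hasCompactSupport (hc.fderiv (𝕜 := ℝ)))

theorem DyadicBound.add (hn : 1 < n) (hA : IsElliptic n 1 A) (hr : 1 ≤ r) (hq : 1 ≤ q)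
    {Q Q' : W →L[ℝ] W} (h : DyadicBound hA r q Q) (h' : DyadicBound hA r q Q') :
    DyadicBound hA r q (Q + Q') := by
  obtain ⟨C, hC, h⟩ := h
  obtain ⟨C', hC', h'⟩ := h'
  refine ⟨8 * (C + C'), by finiteness, fun v hv hc => ?_⟩
  have hi := fun Q : W →L[ℝ] W => integrable_clm_fderiv hv hc (Q ∘L opL A)
  refine ((h v hv hc).add (h' v hv hc) hr hq fun j => measurable_integral_kj hn hA (hi Q) j).mono
    (by linarith) (by linarith) (fun j x => ?_) (le_of_eq (by ring))
  refine le_trans (le_of_eq ?_) (enorm_add_le _ _)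
  have i1 := fun Q : W →L[ℝ] W => show Integrable fun y => kj hA j (x - y)
    (Q (opL A (fderiv ℝ v y))) by
    simpa using integrable_kj_apply hA (hi Q) j x
  rw [← integral_add (i1 Q) (i1 Q')]
  simp

theorem DyadicBound.smul (hA : IsElliptic n 1 A) (hr : 0 ≤ r) (hq : 0 ≤ q) {Q : W →L[ℝ] W}
    (h : DyadicBound hA r q Q) (c : ℝ) : DyadicBound hA r q (c • Q) := by
  obtain ⟨C, hC, h⟩ := h
  refine ⟨‖c‖ₑ * C, by finiteness, fun v hv hc => ?_⟩
  refine ((h v hv hc).const_mul hr hq (c := ‖c‖ₑ) (by finiteness)).mono hr hq (fun j x => ?_)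
    (mul_assoc _ _ _).ge
  rw [← enorm_smul, ← integral_smul]
  simp

theorem dyadicBound_of_annihilator (hn : 1 < n) (hA : IsElliptic n 1 A) (hr : 1 < r) (hrq : r ≤ q)
    {Q : W →L[ℝ] W} {ξ : Euc n} (hξ : ‖ξ‖ = 1) (hQ : ∀ v, Q (symL A ξ v) = 0) :
    DyadicBound hA r q Q := by
  have hr0 : 0 < r := by linarith
  have hq : 1 < q := by linarith
  have hq0 : 0 < q := by linarith
  obtain ⟨C₀, hC₀, h₀⟩ := exists_enorm_kj_annihilator_le hn hA hξ hQ
  obtain ⟨C₁, hC₁, h₁⟩ := exists_good_bad hn.le hr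
  obtain ⟨C₂, hC₂, h₂⟩ := exists_slab_remainder_le hn hA hq
  set N := ∫⁻ x : Euc n, ENNReal.ofReal (wt n x) with hN
  have hNt : N ≠ ⊤ := lintegral_wt_ne_top hn.le
  refine ⟨C₀ * (8 * ((C₁ + C₁ ^ (1 / r)) * C₁ ^ (1 / r) +
    (N + 1 + (N + 1) ^ (1 / r)) * (C₂ * C₁ ^ (1 / q)))), by finiteness, fun v hv hc => ?_⟩
  set F : Euc n → W := fun y => opL A (fderiv ℝ v y) with hF
  have hFi : Integrable F := integrable_clm_fderiv hv hc (opL A)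
  have hFm : Measurable fun y => ‖F y‖ₑ :=
    ((opL A).continuous.comp (hv.continuous_fderiv one_ne_zero)).enorm.measurable
  set M := ∫⁻ y, ‖F y‖ₑ with hM
  set ρ := volume.withDensity fun y => ‖F y‖ₑ with hρ
  have hρM : ρ Set.univ = M := by rw [hρ, withDensity_apply _ .univ, Measure.restrict_univ]
  have : IsFiniteMeasure ρ := ⟨by rw [hρM]; exact hFi.2⟩
  by_cases hM0 : M = 0
  · have h0 : F =ᵐ[volume] 0 := by
      rw [hM, lintegral_eq_zero_iff hFm] at hM0
      filter_upwards [hM0] with y hy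
      simpa using hy
    have h1 : ∀ j x, ∫ y, kj hA j (x - y) (Q (opL A (fderiv ℝ v y))) = 0 := fun j x => by
      rw [integral_congr_ae (g := fun _ => (0 : V)) (h0.mono fun y hy => by
        simp [show opL A (fderiv ℝ v y) = 0 from hy])]
      simp
    refine ⟨0, by simp [hq0], fun j => ⟨fun x => ?_, ?_⟩⟩
    · simp [h1 j x]
    · simp [h1, hr0]
  obtain ⟨B, γ, hB, hB1, hγ, hX⟩ := h₁ ρ (withDensity_absolutelyContinuous _ _)
    (hρM ▸ hM0) ξ hξ
  rw [hρM] at hγ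
  have hγ' : ∑' j, (γ j ^ (1 / r)) ^ q ≤ (C₁ ^ (1 / r) * M) ^ q := by
    simp_rw [← ENNReal.rpow_mul]
    have hs : 1 ≤ 1 / r * q := by rwa [one_div_mul_eq_div, one_le_div hr0]
    refine (tsum_rpow_le_rpow_tsum hs γ).trans ((ENNReal.rpow_le_rpow hγ (by positivity)).trans ?_)
    rw [ENNReal.mul_rpow_of_nonneg _ _ (by positivity), ← ENNReal.rpow_mul,
      ENNReal.mul_rpow_of_nonneg _ _ hq0.le, ← ENNReal.rpow_mul, ← mul_assoc r,
      mul_one_div_cancel hr0.ne', one_mul]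
  have hgood := dyadicFamily_of_le hr0 hq0.le (X := fun j x =>
      ∫⁻ y in {y : Euc n | ⟪y, ξ⟫ ∉ B j}, wj n j (x - y) ∂ρ) (a := fun j => γ j ^ (1 / r))
    (fun j => ⟨(hX j).1, by
      rw [← ENNReal.rpow_mul, one_div_mul_cancel hr0.ne', ENNReal.rpow_one]
      exact (hX j).2⟩) hγ'
  set R : ℤ → Euc n → ℝ≥0∞ := fun j y => {y : Euc n | ⟪y, ξ⟫ ∈ B j}.indicator
    (fun y => ‖cv j F y‖ₑ + pw j * ‖v y - cv j v y‖ₑ) y with hR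
  have cF : ∀ j, Continuous (cv j F) := fun j => by
    have e : cv j F = fun x => opL A (cv j (fderiv ℝ v) x) := funext fun x =>
      (clm_cv (opL A) j (integrable_clm_fderiv hv hc (.id ℝ _)) x).symm
    have h3 : (fun x => cv j (fderiv ℝ v) x) = cv j (fderiv ℝ v) := rfl
    rw [e]
    exact (opL A).continuous.comp ((hc.fderiv (𝕜 := ℝ)).continuous_convolution_right
      (ContinuousLinearMap.lsmul ℝ ℝ) (integrable_et hn.le j).locallyIntegrable
      (hv.continuous_fderiv one_ne_zero))
  have cv' : ∀ j, Continuous (cv j v) := fun j => continuous_iff_continuousAt.2 fun x =>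
    (hasFDerivAt_cv hn.le j hv hc x).continuousAt
  have hRm : ∀ j, Measurable (R j) := fun j => by
    refine Measurable.indicator ?_ (measurableSet_slab ξ (hB j))
    exact (cF j).enorm.measurable.add
      ((hv.continuous.sub (cv' j)).enorm.measurable.const_mul _)
  have hRa : ∑' j, (∫⁻ y, R j y) ^ q ≤ (C₂ * C₁ ^ (1 / q) * M) ^ q := by
    calc _ ≤ ∑' j : ℤ, (C₂ * M) ^ q * (pw j * volume (B j)) := by
          refine ENNReal.tsum_le_tsum fun j => ?_
          rw [hR, lintegral_indicator (measurableSet_slab ξ (hB j))]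
          refine (ENNReal.rpow_le_rpow (h₂ v hv hc j ξ hξ (B j) (hB j)) hq0.le).trans (le_of_eq ?_)
          rw [mul_left_comm, ENNReal.mul_rpow_of_nonneg _ _ hq0.le, ← ENNReal.rpow_mul,
            one_div_mul_cancel hq0.ne', ENNReal.rpow_one, mul_comm]
      _ ≤ (C₂ * M) ^ q * C₁ := by
          rw [ENNReal.tsum_mul_left]
          gcongr
      _ = _ := by
          rw [mul_right_comm, ENNReal.mul_rpow_of_nonneg _ (C₁ ^ _) hq0.le, ← ENNReal.rpow_mul,
            one_div_mul_cancel hq0.ne', ENNReal.rpow_one]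
  have hbad := dyadicFamily_of_le hr0 hq0.le (X := fun j x => ∫⁻ y, wj n j (x - y) * R j y)
    (a := fun j => ∫⁻ y, R j y) (C := N + 1)
    (fun j => ⟨fun x => (lintegral_wj_mul_le j (hRm j) x).trans
      (le_mul_of_one_le_left' le_add_self),
      (lintegral_wj_mul_rpow_le hr j (hRm j)).trans (mul_le_mul' le_self_add le_rfl)⟩) hRa
  refine ((hbad.add hgood hr.le hq.le fun j => (measurable_lintegral_wj (hRm j) j).const_mul _).const_mul
    hr0.le hq0.le hC₀).mono hr0.le hq0.le (fun j x => ?_) (le_of_eq (by ring))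
  refine (h₀ v hv hc j (B j) (hB j) x).trans (le_of_eq ?_)
  have hSm := measurableSet_slab ξ (hB j)
  have e1 : ∫⁻ y in {y : Euc n | ⟪y, ξ⟫ ∉ B j}, wj n j (x - y) ∂ρ =
      ∫⁻ y in {y : Euc n | ⟪y, ξ⟫ ∉ B j}, wj n j (x - y) * ‖F y‖ₑ := by
    rw [hρ, setLIntegral_withDensity_eq_setLIntegral_mul _ hFm
      (g := fun y => wj n j (x - y)) (measurable_wj.comp (by fun_prop))
      (show MeasurableSet {y : Euc n | ⟪y, ξ⟫ ∉ B j} from hSm.compl)]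
    simp only [Pi.mul_apply, mul_comm, Function.comp_def]
  have e2 : ∫⁻ y, wj n j (x - y) * R j y = ∫⁻ y in {y : Euc n | ⟪y, ξ⟫ ∈ B j},
      wj n j (x - y) * (‖cv j F y‖ₑ + pw j * ‖v y - cv j v y‖ₑ) := by
    rw [← lintegral_indicator hSm]
    refine lintegral_congr fun y => ?_
    by_cases hy : y ∈ {y : Euc n | ⟪y, ξ⟫ ∈ B j} <;> simp only [hR, Set.indicator, hy, if_true,
      if_false, mul_zero]
  rw [e1, e2, ← mul_add, add_comm, mul_assoc]

end CancelingEstimate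

section CancelingPotential

variable {n : ℕ} {V W : Type*}
  [NormedAddCommGroup V] [InnerProductSpace ℝ V] [FiniteDimensional ℝ V]
  [NormedAddCommGroup W] [InnerProductSpace ℝ W] [FiniteDimensional ℝ W]
  {A : CoeffOp n 1 V W}

theorem dyadicBound_id {r q : ℝ} (hn : 1 < n) (hA : IsElliptic n 1 A) (hC : IsCanceling n 1 A)
    (hr : 1 < r) (hrq : r ≤ q) : DyadicBound hA r q (.id ℝ W) := by
  have h0 : DyadicBound hA r q 0 :=
    dyadicBound_of_annihilator hn hA hr hrq (ξ := stdVec n ⟨0, by omega⟩) (by simp [stdVec])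
      fun v => rfl
  have hadd {Q Q' : W →L[ℝ] W} (h : DyadicBound hA r q Q) (h' : DyadicBound hA r q Q') :=
    DyadicBound.add hn hA hr.le (by linarith) h h'
  let T (e : W) : Submodule ℝ W :=
    { carrier := {w | DyadicBound hA r q ((innerSL ℝ w).smulRight e)}
      zero_mem' := by simpa using h0
      add_mem' := fun {a b} ha hb => by
        have e : (innerSL ℝ (a + b)).smulRight e =
            (innerSL ℝ a).smulRight e + (innerSL ℝ b).smulRight e := by
          ext; simp [inner_add_left, add_smul]
        exact (e ▸ hadd ha hb :)
      smul_mem' := fun c a ha => by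
        have e : (innerSL ℝ (c • a)).smulRight e = c • (innerSL ℝ a).smulRight e := by
          ext; simp [inner_smul_left, mul_smul]
        exact (e ▸ DyadicBound.smul hA (by linarith) (by linarith) ha c :) }
  have hT (e w : W) : w ∈ T e := by
    suffices h : T e = ⊤ by rw [h]; trivial
    rw [← Submodule.orthogonal_eq_bot_iff, Submodule.eq_bot_iff]
    intro x hx
    have : x ∈ ⋂ ξ ∈ sphere (0 : Euc n) 1, (LinearMap.range (symbolMap n 1 A ξ) : Set W) := by
      refine Set.mem_iInter₂.2 fun ξ hξ => ?_
      rw [SetLike.mem_coe, ← Submodule.orthogonal_orthogonal (LinearMap.range _)]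
      refine Submodule.orthogonal_le (fun w hw => ?_) hx
      refine dyadicBound_of_annihilator hn hA hr hrq (mem_sphere_zero_iff_norm.1 hξ) fun v => ?_
      rw [ContinuousLinearMap.smulRight_apply, innerSL_apply_apply, symL_apply, real_inner_comm,
        hw _ ⟨v, rfl⟩, zero_smul]
    rwa [hC] at this
  let b := stdOrthonormalBasis ℝ W
  have e : ContinuousLinearMap.id ℝ W = ∑ i, (innerSL ℝ (b i)).smulRight (b i) := by
    ext x
    simp [b.sum_repr' x]
  rw [e]
  exact Finset.sum_induction _ (DyadicBound hA r q) (fun _ _ => hadd) h0 fun i _ => hT (b i) (b i)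

theorem exists_lorentzNorm_le_of_contDiff {q : ℝ} (hn : 1 < n) (hA : IsElliptic n 1 A)
    (hC : IsCanceling n 1 A) (hq : 1 < q) : ∃ C : ℝ≥0∞, C ≠ ⊤ ∧ ∀ v : Euc n → V,
      ContDiff ℝ 1 v → HasCompactSupport v →
      lorentzNorm ((n : ℝ) / ((n : ℝ) - 1)) q volume v ≤ C * ∫⁻ y, ‖opL A (fderiv ℝ v y)‖ₑ := by
  have hn1 : (0 : ℝ) < n - 1 := sub_pos.2 (by exact_mod_cast hn)
  obtain ⟨r, hr, hrq⟩ := exists_between (lt_min hq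
    ((one_lt_div hn1).2 (sub_one_lt _) : 1 < (n : ℝ) / (n - 1)))
  have hrn : ((n : ℝ) - 1) * r < n := by
    rw [mul_comm, ← lt_div_iff₀ hn1]
    exact hrq.trans_le (min_le_right _ _)
  obtain ⟨C₁, hC₁, h₁⟩ := exists_lorentzNorm_le hn hr hq hrn
  obtain ⟨C₂, hC₂, h₂⟩ := dyadicBound_id hn hA hC hr (hrq.le.trans (min_le_left _ _))
  refine ⟨C₁ * C₂, by finiteness, fun v hv hc => ?_⟩
  obtain ⟨α, hα, hX⟩ := h₂ v hv hc
  refine (h₁ v _ α (fun j => measurable_integral_kj hn hA (integrable_clm_fderiv hv hc (opL A)) j)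
    (enorm_le_tsum_kj hn hA hv hc) (fun j => (hX j).1) fun j => (hX j).2).trans ?_
  rw [mul_assoc]
  refine mul_le_mul' le_rfl ((ENNReal.rpow_le_rpow hα (by positivity)).trans (le_of_eq ?_))
  rw [← ENNReal.rpow_mul, mul_one_div_cancel (by positivity), ENNReal.rpow_one]

theorem lorentzNorm_le_of_tendsto {α E : Type*} [MeasurableSpace α] {μ : Measure α}
    [NormedAddCommGroup E] [NormedSpace ℝ E] {p q : ℝ} (hp : 0 ≤ p) (hq : 0 ≤ q) {v : α → E}
    {w : ℕ → α → E} {M : ℝ≥0∞} (hw : ∀ᵐ x ∂μ, Tendsto (fun k => w k x) atTop (𝓝 (v x)))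
    (hM : ∀ k, lorentzNorm p q μ (w k) ≤ M) : lorentzNorm p q μ v ≤ M := by
  set G : ℝ → ℝ≥0∞ → ℝ≥0∞ := fun t m =>
    (ENNReal.ofReal t * m ^ (1 / p)) ^ q * (ENNReal.ofReal t)⁻¹ with hG
  have hGm : ∀ t, Monotone (G t) := fun t a b h => by simp only [hG]; gcongr
  have hd : ∀ t, μ {x | t < ‖v x‖} ≤ liminf (fun k => μ {x | t < ‖w k x‖}) atTop := fun t => by
    have hm : Monotone fun m : ℕ => ⋂ i : ℕ, {x | t < ‖w (i + m) x‖} := fun a b hab x hx =>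
      Set.mem_iInter.2 fun i => by
        have := Set.mem_iInter.1 hx (i + (b - a))
        rwa [show i + (b - a) + a = i + b by omega] at this
    calc μ {x | t < ‖v x‖} ≤ μ (⋃ m : ℕ, ⋂ i : ℕ, {x | t < ‖w (i + m) x‖}) := by
          refine measure_mono_ae (hw.mono fun x hx hxt => ?_)
          obtain ⟨m, hm⟩ := eventually_atTop.1 (hx.norm.eventually_const_lt hxt)
          exact Set.mem_iUnion.2 ⟨m, Set.mem_iInter.2 fun i => hm _ (by omega)⟩
      _ ≤ _ := by
          rw [hm.measure_iUnion, liminf_eq_iSup_iInf_of_nat']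
          exact iSup_mono fun m => le_iInf fun i => measure_mono (Set.iInter_subset _ i)
  have key : lorentzNorm p q μ v ≤
      liminf (fun k => lorentzNorm p q μ (w k)) atTop := by
    have c : Continuous fun I : ℝ≥0∞ => ENNReal.ofReal p ^ (1 / q) * I ^ (1 / q) :=
      (ENNReal.continuous_const_mul (by finiteness)).comp ENNReal.continuous_rpow_const
    have cm : Monotone fun I : ℝ≥0∞ => ENNReal.ofReal p ^ (1 / q) * I ^ (1 / q) :=
      fun a b h => by dsimp only; gcongr
    refine le_trans ?_ (cm.map_liminf_of_continuousAt _ c.continuousAt).le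
    refine cm (le_trans ?_ (lintegral_liminf_le' fun k => ?_))
    · refine setLIntegral_mono' measurableSet_Ioi fun t ht => ?_
      have cG : Continuous (G t) := by
        have h1 : (ENNReal.ofReal t)⁻¹ ≠ ⊤ := by simpa using ht
        exact (ENNReal.continuous_mul_const h1).comp (ENNReal.continuous_rpow_const.comp
          ((ENNReal.continuous_const_mul (by finiteness)).comp ENNReal.continuous_rpow_const))
      exact (hGm t (hd t)).trans ((hGm t).map_liminf_of_continuousAt _ cG.continuousAt).le
    · have : Measurable fun t : ℝ => μ {x | t < ‖w k x‖} :=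
        Antitone.measurable fun a b h => measure_mono fun x hx => h.trans_lt hx
      exact ((((ENNReal.measurable_ofReal.mul (this.pow_const _)).pow_const _)).mul
        ENNReal.measurable_ofReal.inv).aemeasurable
  refine key.trans ((liminf_le_liminf (.of_forall hM)).trans ?_)
  simp

theorem opL_fderiv_mollify {φ : Euc n → ℝ} (hφ : IsTestFun n φ) {v : Euc n → V} (hv : Integrable v)
    {σ : Measure (Euc n)} {f g : Euc n → W} (hf : Integrable f σ) (hg : Integrable g)
    (hD : ∀ ψ : Euc n → W, IsTestFun n ψ →
      -(∑ i, ∫ x, ⟪coef A i (v x), fderiv ℝ ψ x (stdVec n i)⟫) =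
        ∫ x, ⟪f x, ψ x⟫ ∂σ + ∫ x, ⟪g x, ψ x⟫) (x : Euc n) :
    opL A (fderiv ℝ (fun x => ∫ y, φ (x - y) • v y) x) =
      ∫ y, φ (x - y) • f y ∂σ + ∫ y, φ (x - y) • g y := by
  obtain ⟨C₁, hC₁⟩ := hφ.1.continuous.bounded_above_of_compact_support hφ.2
  have hφ' : Continuous (fderiv ℝ φ) := hφ.1.continuous_fderiv (by simp)
  obtain ⟨C₂, hC₂⟩ := hφ'.bounded_above_of_compact_support (hφ.2.fderiv (𝕜 := ℝ))
  have hd : ∀ z, HasFDerivAt φ (fderiv ℝ φ z) z := fun z =>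
    (hφ.1.differentiable (by simp) z).hasFDerivAt
  have hs (L : Euc n) : Integrable fun y => (fderiv ℝ φ (x - y) L) • v y :=
    hv.bdd_smul (C₂ * ‖L‖) (by fun_prop) (ae_of_all _ fun y =>
      (ContinuousLinearMap.le_opNorm _ _).trans (by gcongr; exact hC₂ _))
  have hsm {E : Type _} [NormedAddCommGroup E] [NormedSpace ℝ E] {ν : Measure (Euc n)}
      {h : Euc n → E} (hh : Integrable h ν) : Integrable (fun y => φ (x - y) • h y) ν :=
    hh.bdd_smul C₁ (hφ.1.continuous.comp (by fun_prop)).aestronglyMeasurable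
      (ae_of_all _ fun y => hC₁ _)
  have hder : ∀ e, fderiv ℝ (fun x => ∫ y, φ (x - y) • v y) x e =
      ∫ y, (fderiv ℝ φ (x - y) e) • v y := fun e => by
    let L : ℝ →L[ℝ] V →L[ℝ] V := ContinuousLinearMap.lsmul ℝ ℝ
    have hL : ‖L‖ ≤ 1 := ContinuousLinearMap.opNorm_lsmul_le
    have h := hasFDerivAt_integral_kernel (T := fun z => L (φ z)) (T' := fun z => L ∘L fderiv ℝ φ z)
      (C := max C₁ C₂) (fun z => L.hasFDerivAt.comp z (hd z)) (continuous_const.clm_comp hφ')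
      (fun z => ?_) (fun z => ?_) hv
    · exact (congrArg (fun D => D e) (h.1 x).fderiv).trans (h.2.2 x e)
    · exact (L.le_of_opNorm_le hL _).trans (by simpa using Or.inl (hC₁ z))
    · refine (L.opNorm_comp_le _).trans ((mul_le_of_le_one_left (norm_nonneg _) hL).trans ?_)
      exact (hC₂ z).trans (le_max_right _ _)
  refine ext_inner_right ℝ fun w => ?_
  have hψ : IsTestFun n fun y => φ (x - y) • w :=
    ⟨(hφ.1.comp (contDiff_const.sub contDiff_id)).smul contDiff_const,
      (hφ.2.comp_homeomorph (Homeomorph.subLeft x)).smul_right⟩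
  have hψ' : ∀ y e, fderiv ℝ (fun y => φ (x - y) • w) y e = -(fderiv ℝ φ (x - y) e) • w :=
    fun y e => by
      have h : HasFDerivAt (fun y => φ (x - y) • w) _ y :=
        ((hd (x - y)).comp y ((hasFDerivAt_id y).const_sub x)).smul_const w
      rw [h.fderiv]
      simp
  have hin {ν : Measure (Euc n)} {h : Euc n → W} (hh : Integrable h ν) :
      ∫ y, ⟪h y, φ (x - y) • w⟫ ∂ν = ⟪∫ y, φ (x - y) • h y ∂ν, w⟫ := by
    rw [real_inner_comm, ← integral_inner (hsm hh)]
    simp only [real_inner_smul_right, real_inner_comm]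
  rw [inner_add_left, ← hin hf, ← hin hg, ← hD _ hψ, opL_apply, sum_inner, ← Finset.sum_neg_distrib]
  refine Finset.sum_congr rfl fun i _ => ?_
  rw [hder, ← (coefL A i).integral_comp_comm (hs _), real_inner_comm,
    ← integral_inner ((coefL A i).integrable_comp (hs _)), ← integral_neg]
  refine integral_congr_ae (ae_of_all _ fun y => ?_)
  simp only [hψ', map_smul, real_inner_smul_right, real_inner_comm, neg_mul,
    neg_neg, coefL, LinearMap.coe_toContinuousLinearMap']

/-- The endpoint estimate for canceling operators. -/
theorem exists_lorentzNorm_le_of_canceling {q : ℝ} (hn : 1 < n) (hA : IsElliptic n 1 A)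
    (hC : IsCanceling n 1 A) (hq : 1 < q) : ∃ C : ℝ≥0∞, C ≠ ⊤ ∧ ∀ (v : Euc n → V)
      (σ : Measure (Euc n)) (f g : Euc n → W), SFinite σ → Integrable v → HasCompactSupport v →
      Integrable f σ → Integrable g → (∀ ψ : Euc n → W, IsTestFun n ψ →
        -(∑ i, ∫ x, ⟪coef A i (v x), fderiv ℝ ψ x (stdVec n i)⟫) =
          ∫ x, ⟪f x, ψ x⟫ ∂σ + ∫ x, ⟪g x, ψ x⟫) →
      lorentzNorm ((n : ℝ) / ((n : ℝ) - 1)) q volume v ≤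
        C * (∫⁻ y, ‖f y‖ₑ ∂σ + ∫⁻ y, ‖g y‖ₑ) := by
  have hn1 : (0 : ℝ) < n - 1 := sub_pos.2 (by exact_mod_cast hn)
  obtain ⟨C, hCt, h⟩ := exists_lorentzNorm_le_of_contDiff hn hA hC hq
  refine ⟨C, hCt, fun v σ f g _ hv hc hf hg hD => ?_⟩
  let χ : ℕ → ContDiffBump (0 : Euc n) := fun k =>
    ⟨1 / ((k : ℝ) + 1), 2 * (1 / ((k : ℝ) + 1)), by positivity, by
      have : 0 < 1 / ((k : ℝ) + 1) := by positivity
      linarith⟩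
  have hlim := ContDiffBump.ae_convolution_tendsto_right_of_locallyIntegrable (φ := χ) (l := atTop)
    (K := 2) (by simpa only [mul_zero] using tendsto_one_div_add_atTop_nhds_zero_nat.const_mul (2 : ℝ))
    (.of_forall fun k => le_rfl) hv.locallyIntegrable (μ := volume)
  refine lorentzNorm_le_of_tendsto (by positivity) (by linarith) hlim fun k => ?_
  set φ := (χ k).normed volume with hφ
  have hφt : IsTestFun n φ := ⟨(χ k).contDiff_normed, (χ k).hasCompactSupport_normed⟩
  have e : convolution φ v (ContinuousLinearMap.lsmul ℝ ℝ) volume =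
      fun x => ∫ y, φ (x - y) • v y := funext fun x => convolution_eq_swap _
  refine (h _ (hφt.2.contDiff_convolution_left _ (hφt.1.of_le (by simp)) hv.locallyIntegrable)
    (hφt.2.convolution _ hc)).trans (mul_le_mul' le_rfl ?_)
  have hφ1 : ∫⁻ x, ‖φ x‖ₑ = 1 := by
    rw [← ofReal_integral_norm_eq_lintegral_enorm (hφt.1.continuous.integrable_of_hasCompactSupport
      hφt.2)]
    simp only [hφ, Real.norm_of_nonneg ((χ k).nonneg_normed _), (χ k).integral_normed,
      ENNReal.ofReal_one]
  have hm : ∀ {ν : Measure (Euc n)} {h : Euc n → W}, SFinite ν → Integrable h ν →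
      AEMeasurable (Function.uncurry fun x y => ‖φ (x - y) • h y‖ₑ) (volume.prod ν) ∧
      ∫⁻ x, ∫⁻ y, ‖φ (x - y) • h y‖ₑ ∂ν = ∫⁻ y, ‖h y‖ₑ ∂ν := fun {ν h} _ hh => by
    have h1 : AEMeasurable (Function.uncurry fun x y => ‖φ (x - y) • h y‖ₑ) (volume.prod ν) :=
      ((hφt.1.continuous.comp (by fun_prop : Continuous fun p : Euc n × Euc n =>
        p.1 - p.2)).aestronglyMeasurable.smul hh.1.comp_snd).enorm
    refine ⟨h1, ?_⟩
    rw [lintegral_lintegral_swap h1]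
    refine lintegral_congr fun y => ?_
    simp_rw [enorm_smul]
    rw [lintegral_mul_const' _ _ (by finiteness),
      lintegral_sub_right_eq_self (fun x => ‖φ x‖ₑ) y, hφ1, one_mul]
  rw [e]
  calc ∫⁻ x, ‖opL A (fderiv ℝ (fun x => ∫ y, φ (x - y) • v y) x)‖ₑ
      ≤ ∫⁻ x, ((∫⁻ y, ‖φ (x - y) • f y‖ₑ ∂σ) + ∫⁻ y, ‖φ (x - y) • g y‖ₑ) :=
        lintegral_mono fun x => by
          rw [opL_fderiv_mollify hφt hv hf hg hD]
          exact (enorm_add_le _ _).trans (add_le_add (enorm_integral_le_lintegral_enorm _)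
            (enorm_integral_le_lintegral_enorm _))
    _ = _ := by
        have h1 : AEMeasurable (fun x => ∫⁻ y, ‖φ (x - y) • f y‖ₑ ∂σ) :=
          (hm ‹_› hf).1.lintegral_prod_right'
        rw [lintegral_add_left' h1, (hm ‹_› hf).2, (hm inferInstance hg).2]

end CancelingPotential

section LorentzDifferentiability

variable {n : ℕ} {V W : Type*}
  [NormedAddCommGroup V] [InnerProductSpace ℝ V] [FiniteDimensional ℝ V]
  [NormedAddCommGroup W] [InnerProductSpace ℝ W] [FiniteDimensional ℝ W]
  {A : CoeffOp n 1 V W}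

theorem exists_lebesgue_decomposition {σ : Measure (Euc n)} [IsLocallyFiniteMeasure σ]
    {f : Euc n → W} (hf : LocallyIntegrable f σ) (hf1 : ∀ᵐ x ∂σ, ‖f x‖ = 1) :
    ∃ (s : Measure (Euc n)) (g : Euc n → W), SFinite s ∧ LocallyIntegrable f s ∧
      LocallyIntegrable g volume ∧
      (∀ ψ : Euc n → W, IsTestFun n ψ →
        ∫ x, ⟪f x, ψ x⟫ ∂σ = ∫ x, ⟪f x, ψ x⟫ ∂s + ∫ x, ⟪g x, ψ x⟫) ∧
      ∀ᵐ x, Tendsto (fun r => (∫⁻ y in closedBall x r, ‖f y‖ₑ ∂s + ∫⁻ y in closedBall x r,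
        ‖g y - g x‖ₑ) / volume (closedBall x r)) (𝓝[>] 0) (𝓝 0) := by
  set s := σ.singularPart volume with hs
  set ρ := σ.rnDeriv volume with hρ
  have hρt : ∀ᵐ x, ρ x < ⊤ := Measure.rnDeriv_lt_top σ volume
  have hfs := hf.mono_measure (Measure.singularPart_le σ volume)
  have hfa := hf.mono_measure (Measure.withDensity_rnDeriv_le σ volume)
  have hg : LocallyIntegrable (fun x => (ρ x).toReal • f x) volume := fun x => by
    refine ⟨closedBall x 1, closedBall_mem_nhds x one_pos, ?_⟩
    have h := hfa.integrableOn_isCompact (isCompact_closedBall x 1)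
    rw [IntegrableOn, restrict_withDensity measurableSet_closedBall] at h
    exact (integrable_withDensity_iff_integrable_smul' (Measure.measurable_rnDeriv _ _)
      (ae_restrict_of_ae hρt)).1 h
  refine ⟨s, _, inferInstance, hfs, hg, fun ψ hψ => ?_, ?_⟩
  · conv_lhs => rw [σ.haveLebesgueDecomposition_add volume]
    rw [integral_add_measure (locallyIntegrable_inner_test hfs hψ.1.continuous hψ.2)
      (locallyIntegrable_inner_test hfa hψ.1.continuous hψ.2),
      integral_withDensity_eq_integral_toReal_smul₀ (Measure.measurable_rnDeriv _ _).aemeasurable hρt]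
    simp only [smul_eq_mul, real_inner_smul_left, hρ, hs]
  · filter_upwards [Besicovitch.ae_tendsto_rnDeriv s volume, σ.rnDeriv_singularPart volume,
      (Besicovitch.vitaliFamily volume).ae_tendsto_lintegral_enorm_sub_div hg] with x h1 h2 h3
    rw [h2] at h1
    have h4 := h1.add (h3.comp (Besicovitch.tendsto_filterAt volume x))
    simp only [Pi.zero_apply, add_zero] at h4
    refine h4.congr fun r => ?_
    have e : ∫⁻ y in closedBall x r, ‖f y‖ₑ ∂s = s (closedBall x r) := by
      rw [← setLIntegral_one]
      refine lintegral_congr_ae (ae_restrict_of_ae ?_)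
      filter_upwards [ae_mono (Measure.singularPart_le σ volume) hf1] with y hy
      rw [← ofReal_norm, hy, ENNReal.ofReal_one]
    rw [e, ENNReal.add_div]
    rfl

theorem isPolyDeg_affine (a : V) (L : Euc n →L[ℝ] V) (x : Euc n) :
    IsPolyDeg n 1 fun y => a + L (y - x) := by
  have h : fderiv ℝ (fun y => a + L (y - x)) = fun _ => L := funext fun y =>
    ((L.hasFDerivAt.comp y ((hasFDerivAt_id y).sub_const x)).const_add a).fderiv
  refine ⟨contDiff_const.add (L.contDiff.comp (contDiff_id.sub contDiff_const)), fun y => ?_⟩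
  ext m
  rw [iteratedFDeriv_two_apply, h]
  simp

/-- Subtracting an affine map changes `𝒜u` by a constant. -/
theorem sum_integral_sub_affine {u : Euc n → V} (hu : LocallyIntegrable u volume) (a : V)
    (L : Euc n →L[ℝ] V) (x₀ : Euc n) {ψ : Euc n → W} (hψ : IsTestFun n ψ) :
    -(∑ i, ∫ x, ⟪coef A i (u x - (a + L (x - x₀))), fderiv ℝ ψ x (stdVec n i)⟫) =
      -(∑ i, ∫ x, ⟪coef A i (u x), fderiv ℝ ψ x (stdVec n i)⟫) - ∫ x, ⟪opL A L, ψ x⟫ := by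
  have hP : Continuous fun x => a + L (x - x₀) := by fun_prop
  have hψ' := fun i => (hψ.fderiv_apply_eq (stdVec n i))
  have i1 := fun i => locallyIntegrable_inner_test (locallyIntegrable_coef A hu i)
    (hψ' i).1.continuous (hψ' i).2
  have i2 := fun i => locallyIntegrable_inner_test (μ := volume)
    (u := fun x => coefL A i (a + L (x - x₀))) ((coefL A i).continuous.comp hP).locallyIntegrable (hψ' i).1.continuous (hψ' i).2
  have i3 := fun i => locallyIntegrable_inner_test (μ := volume)
    (continuous_const (y := coefL A i (L (stdVec n i)))).locallyIntegrable hψ.1.continuous hψ.2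
  have h : ∀ i, ∫ x, ⟪coefL A i (a + L (x - x₀)), fderiv ℝ ψ x (stdVec n i)⟫ =
      -∫ x, ⟪coefL A i (L (stdVec n i)), ψ x⟫ := fun i =>
    integral_bilinear_hasLineDerivAt_right_eq_neg_left_of_integrable (μ := volume)
      (f := fun x => coefL A i (a + L (x - x₀))) (f' := fun _ => coefL A i (L (stdVec n i)))
      (g := ψ) (g' := fun x => fderiv ℝ ψ x (stdVec n i)) (v := stdVec n i)
      (B := innerSL ℝ) (i3 i) (i2 i)
      (locallyIntegrable_inner_test ((coefL A i).continuous.comp hP).locallyIntegrable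
        hψ.1.continuous hψ.2)
      (fun x _ => (((coefL A i).hasFDerivAt.comp x ((L.hasFDerivAt.comp x
        ((hasFDerivAt_id x).sub_const x₀)).const_add a)).hasLineDerivAt _))
      (fun x _ => ((hψ.1.differentiable (by simp)) x).hasFDerivAt.hasLineDerivAt _)
  have e : ∀ i, ∫ x, ⟪coef A i (u x - (a + L (x - x₀))), fderiv ℝ ψ x (stdVec n i)⟫ =
      (∫ x, ⟪coef A i (u x), fderiv ℝ ψ x (stdVec n i)⟫) +
        ∫ x, ⟪coefL A i (L (stdVec n i)), ψ x⟫ := fun i => by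
    rw [← sub_neg_eq_add, ← h, ← integral_sub (i1 i) (i2 i)]
    simp only [map_sub, inner_sub_left]
    rfl
  simp only [e, Finset.sum_add_distrib, opL_apply, sum_inner]
  rw [integral_finsetSum _ fun i _ => i3 i, neg_add, sub_eq_add_neg]

theorem zero_of_cutoff {u : Euc n → V} (hu : LocallyIntegrable u volume) {s : Measure (Euc n)}
    {f g : Euc n → W} (hf : LocallyIntegrable f s) (hg : LocallyIntegrable g volume)
    (hD : ∀ ψ : Euc n → W, IsTestFun n ψ →
      -(∑ i, ∫ x, ⟪coef A i (u x), fderiv ℝ ψ x (stdVec n i)⟫) =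
        ∫ x, ⟪f x, ψ x⟫ ∂s + ∫ x, ⟪g x, ψ x⟫) {φ : Euc n → ℝ} (hφ : IsTestFun n φ) :
    ∫ x, φ x • f x ∂s + ((∫ x, φ x • g x) + ∫ x, gradTerm A φ u x) = 0 := by
  refine ext_inner_right ℝ fun w => ?_
  have hw : IsTestFun n fun x => φ x • w := ⟨hφ.1.smul contDiff_const, hφ.2.smul_right⟩
  have h := hD _ hw
  have i1 := fun i => locallyIntegrable_inner_test (locallyIntegrable_coef A hu i)
    (hw.fderiv_apply_eq (stdVec n i)).1.continuous (hw.fderiv_apply_eq (stdVec n i)).2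
  have e {μ : Measure (Euc n)} {h : Euc n → W} (hh : LocallyIntegrable h μ) :
      ∫ x, ⟪h x, φ x • w⟫ ∂μ = ⟪∫ x, φ x • h x ∂μ, w⟫ := by
    rw [real_inner_comm, ← integral_inner (integrable_smul_of_test hφ.1.continuous hφ.2 hh)]
    simp only [real_inner_smul_right, real_inner_comm]
  have h2 : ∑ i, ∫ x, ⟪coef A i (u x), fderiv ℝ (fun x => φ x • w) x (stdVec n i)⟫ =
      ⟪∫ x, gradTerm A φ u x, w⟫ := by
    rw [real_inner_comm, ← integral_inner (integrable_gradTerm A hφ hu), ←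
      integral_finsetSum _ fun i _ => i1 i]
    refine integral_congr_ae (ae_of_all _ fun x => ?_)
    simp only [gradTerm, inner_sum, real_inner_smul_right]
    refine Finset.sum_congr rfl fun i _ => ?_
    rw [fderiv_smul_const (hφ.1.differentiable (by simp) x), ContinuousLinearMap.smulRight_apply,
      real_inner_smul_right, real_inner_comm]
  rw [e hf, e hg, h2] at h
  rw [inner_add_left, inner_add_left, inner_zero_left]
  linarith

theorem exists_cutoff (n : ℕ) : ∃ K : ℝ, ∀ (x : Euc n) (r : ℝ), 0 < r → ∃ φ : Euc n → ℝ,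
    IsTestFun n φ ∧ (∀ y, 0 ≤ φ y ∧ φ y ≤ 1) ∧ (∀ y ∈ ball x r, φ y = 1) ∧
      (∀ y, y ∉ ball x (3 * r) → y ∉ tsupport φ) ∧ ∀ y, ‖fderiv ℝ φ y‖ ≤ K / r := by
  let b : ContDiffBump (0 : Euc n) := ⟨1, 2, one_pos, one_lt_two⟩
  have hb : ContDiff ℝ (⊤ : ℕ∞) b := b.contDiff
  obtain ⟨K, hK⟩ := (hb.continuous_fderiv (by simp)).bounded_above_of_compact_support
    (b.hasCompactSupport.fderiv (𝕜 := ℝ))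
  refine ⟨K, fun x r hr => ?_⟩
  have hn : ∀ y, ‖r⁻¹ • (y - x)‖ = dist y x / r := fun y => by
    rw [norm_smul, norm_inv, Real.norm_of_nonneg hr.le, dist_eq_norm, inv_mul_eq_div]
  have hs : tsupport (fun y => b (r⁻¹ • (y - x))) ⊆ closedBall x (2 * r) :=
    closure_minimal (fun y hy => by
      have h : r⁻¹ • (y - x) ∈ ball (0 : Euc n) 2 := by
        rw [← show b.rOut = 2 from rfl, ← b.support_eq]
        exact hy
      rw [mem_ball_zero_iff, hn, div_lt_iff₀ hr] at h
      exact h.le) isClosed_closedBall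
  refine ⟨fun y => b (r⁻¹ • (y - x)), ⟨hb.comp (by fun_prop),
    (isCompact_closedBall x (2 * r)).of_isClosed_subset (isClosed_tsupport _) hs⟩,
    fun y => ⟨b.nonneg, b.le_one⟩, fun y hy => b.one_of_mem_closedBall ?_, fun y hy h => ?_,
    fun y => ?_⟩
  · rw [mem_closedBall_zero_iff, hn, div_le_iff₀ hr, one_mul]
    exact (mem_ball.1 hy).le
  · have := hs h
    rw [mem_closedBall] at this
    rw [mem_ball, not_lt] at hy
    linarith
  · have h : HasFDerivAt (fun y => b (r⁻¹ • (y - x))) _ y :=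
      ((hb.differentiable (by simp) _).hasFDerivAt).comp y
        (((hasFDerivAt_id y).sub_const x).const_smul r⁻¹)
    rw [h.fderiv]
    refine (ContinuousLinearMap.opNorm_comp_le _ _).trans ?_
    rw [norm_smul, norm_inv, Real.norm_of_nonneg hr.le, div_eq_mul_inv]
    exact mul_le_mul (hK _) (mul_le_of_le_one_right (by positivity) ContinuousLinearMap.norm_id_le)
      (by positivity) ((norm_nonneg _).trans (hK y))

theorem lintegral_enorm_smul_le {φ : Euc n → ℝ} {x : Euc n} {R : ℝ}
    (h1 : ∀ y, 0 ≤ φ y ∧ φ y ≤ 1) (h0 : ∀ y, y ∉ ball x R → y ∉ tsupport φ)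
    (μ : Measure (Euc n)) (h : Euc n → W) :
    ∫⁻ y, ‖φ y • h y‖ₑ ∂μ ≤ ∫⁻ y in closedBall x R, ‖h y‖ₑ ∂μ := by
  rw [← lintegral_indicator measurableSet_closedBall]
  refine lintegral_mono fun y => ?_
  by_cases hy : y ∈ ball x R
  · rw [Set.indicator_of_mem (ball_subset_closedBall hy), enorm_smul]
    refine mul_le_of_le_one_left' ?_
    rw [← ofReal_norm, Real.norm_of_nonneg (h1 y).1]
    exact ENNReal.ofReal_le_one.2 (h1 y).2
  · simp [image_eq_zero_of_notMem_tsupport (h0 y hy)]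

theorem lintegral_gradTerm_le {φ : Euc n → ℝ} {x : Euc n} {R K : ℝ}
    (hK : ∀ y, ‖fderiv ℝ φ y‖ ≤ K) (h0 : ∀ y, y ∉ ball x R → y ∉ tsupport φ) (u : Euc n → V) :
    ∫⁻ y, ‖gradTerm A φ u y‖ₑ ≤
      ENNReal.ofReal (K * ∑ i, ‖coefL A i‖) * ∫⁻ y in ball x R, ‖u y‖ₑ := by
  rw [← lintegral_const_mul' _ _ ENNReal.ofReal_ne_top, ← lintegral_indicator measurableSet_ball]
  refine lintegral_mono fun y => ?_
  by_cases hy : y ∈ ball x R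
  · have hK0 := (norm_nonneg _).trans (hK y)
    rw [Set.indicator_of_mem hy, ← ofReal_norm, ← ofReal_norm,
      ← ENNReal.ofReal_mul (by positivity)]
    refine ENNReal.ofReal_le_ofReal ((norm_sum_le _ _).trans ?_)
    rw [Finset.mul_sum, Finset.sum_mul]
    refine Finset.sum_le_sum fun i _ => ?_
    rw [norm_smul, mul_assoc]
    refine mul_le_mul (((fderiv ℝ φ y).le_opNorm _).trans ?_) ((coefL A i).le_opNorm _)
      (norm_nonneg _) hK0
    simpa [stdVec] using hK y
  · simp [gradTerm_eq_zero (h0 y hy)]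

theorem lorentzNorm_restrict_le {p q : ℝ} (hp : 0 < p) (hq : 0 < q) {s : Set (Euc n)}
    (hs : MeasurableSet s) {u v : Euc n → V} (h : ∀ y ∈ s, v y = u y) :
    lorentzNorm p q (volume.restrict s) u ≤ lorentzNorm p q volume v := by
  unfold lorentzNorm
  refine mul_le_mul' le_rfl (ENNReal.rpow_le_rpow (lintegral_mono fun t => mul_le_mul'
    (ENNReal.rpow_le_rpow (mul_le_mul' le_rfl (ENNReal.rpow_le_rpow ?_ (by positivity)))
      hq.le) le_rfl) (by positivity))
  rw [Measure.restrict_apply' hs]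
  exact measure_mono fun y hy => by simpa [h y hy.2] using hy.1

/-- For an elliptic and canceling operator, every `u ∈ BV^𝒜_loc` is a.e. Lorentz differentiable. -/
theorem MemBVAloc.ae_memTLorentz (hn : 1 < n) (hA : IsElliptic n 1 A) (hC : IsCanceling n 1 A)
    {q : ℝ} (hq : 1 < q) {u : Euc n → V} (hu : MemBVAloc n 1 A u) :
    ∀ᵐ x, MemTLorentz n 1 ((n : ℝ) / ((n : ℝ) - 1)) q u x := by
  have hn1 : (1 : ℝ) < n := by exact_mod_cast hn
  have hp : 0 < (n : ℝ) / ((n : ℝ) - 1) := div_pos (by linarith) (by linarith)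
  have hD1 := hu.ae_l1Diff hn hA
  obtain ⟨hul, σ, f, hσ, hf, hf1, hD⟩ := hu
  rw [hasDistribA_iff] at hD
  obtain ⟨s, g, hs, hfs, hg, hdec, hleb⟩ := exists_lebesgue_decomposition hf hf1
  obtain ⟨C, hCt, hC⟩ := exists_lorentzNorm_le_of_canceling hn hA hC hq
  obtain ⟨K, hK⟩ := exists_cutoff n
  filter_upwards [hD1, hleb] with x ⟨a, L, hL⟩ hx
  have hP : Continuous fun y => a + L (y - x) := by fun_prop
  have hu' : LocallyIntegrable (fun y => u y - (a + L (y - x))) volume :=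
    hul.sub hP.locallyIntegrable
  set u' : Euc n → V := fun y => u y - (a + L (y - x)) with hu'_def
  have hD' : ∀ ψ : Euc n → W, IsTestFun n ψ →
      -(∑ i, ∫ y, ⟪coef A i (u' y), fderiv ℝ ψ y (stdVec n i)⟫) =
        ∫ y, ⟪f y, ψ y⟫ ∂s + ∫ y, ⟪g y - opL A L, ψ y⟫ := fun ψ hψ => by
    rw [sum_integral_sub_affine hul a L x hψ, hD ψ hψ, hdec ψ hψ, add_sub_assoc, ← integral_sub
      (locallyIntegrable_inner_test hg hψ.1.continuous hψ.2)
      (locallyIntegrable_inner_test continuous_const.locallyIntegrable hψ.1.continuous hψ.2)]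
    simp only [inner_sub_left]
  set T : ℝ → ℝ≥0∞ := fun r => (∫⁻ y in closedBall x (3 * r), ‖f y‖ₑ ∂s +
    ∫⁻ y in closedBall x (3 * r), ‖g y - g x‖ₑ) +
    ENNReal.ofReal (K / r * ∑ i, ‖coefL A i‖) * ∫⁻ y in ball x (3 * r), ‖u' y‖ₑ with hT
  have hT0 : Tendsto (fun r => T r / ENNReal.ofReal (r ^ n)) (𝓝[>] 0) (𝓝 0) := by
    have hm : Tendsto (fun r : ℝ => 3 * r) (𝓝[>] 0) (𝓝[>] 0) :=
      tendsto_nhdsWithin_iff.2 ⟨((continuous_const_mul (3 : ℝ)).tendsto' 0 0 (mul_zero _)).mono_left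
        nhdsWithin_le_nhds, by filter_upwards [self_mem_nhdsWithin] with r hr; simpa using hr⟩
    have h := (ENNReal.Tendsto.const_mul (hx.comp hm) (.inr (ENNReal.ofReal_ne_top
      (r := 3 ^ n * (volume (ball (0 : Euc n) 1)).toReal)))).add
      (ENNReal.Tendsto.const_mul (hL.comp hm) (.inr (ENNReal.ofReal_ne_top
        (r := K * (∑ i, ‖coefL A i‖) * 3 ^ (n + 1)))))
    rw [mul_zero, mul_zero, add_zero] at h
    refine h.congr' ?_
    filter_upwards [self_mem_nhdsWithin] with r (hr : 0 < r)
    have hκ : 0 < (volume (ball (0 : Euc n) 1)).toReal :=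
      ENNReal.toReal_pos (measure_ball_pos _ _ one_pos).ne' measure_ball_lt_top.ne
    have e : ∫⁻ y in ball x (3 * r), ‖u' y‖ₑ = ∫⁻ h in ball 0 (3 * r), ‖u (x + h) - a - L h‖ₑ := by
      rw [← (measurePreserving_add_left volume x).setLIntegral_comp_preimage_emb
        (measurableEmbedding_addLeft x), preimage_add_ball, sub_self]
      simp only [hu'_def, add_sub_cancel_left, sub_sub]
    have hv : volume (closedBall x (3 * r)) =
        ENNReal.ofReal (3 ^ n * (volume (ball (0 : Euc n) 1)).toReal) * ENNReal.ofReal (r ^ n) := by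
      rw [Measure.addHaar_closedBall _ _ (by positivity), ← Measure.addHaar_ball_of_pos _ _ (by positivity), volume_ball_eq x (by positivity),
        ← ENNReal.ofReal_mul (by positivity), mul_pow, mul_right_comm]
    simp only [hT, e, Function.comp_apply, ENNReal.add_div (a := _ + _), hv]
    congr 1
    · rw [← mul_div_assoc, ENNReal.mul_div_mul_left _ _ (by simpa using by positivity)
        ENNReal.ofReal_ne_top]
    · rw [ENNReal.mul_div_right_comm, ← ENNReal.ofReal_div_of_pos (by positivity),
        ← mul_div_assoc, ENNReal.mul_div_right_comm, ← ENNReal.ofReal_div_of_pos (by positivity)]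
      congr 2
      field_simp
      ring
  have hgi : ∀ c : W, LocallyIntegrable (fun y => g y - c) volume := fun c =>
    hg.sub continuous_const.locallyIntegrable
  have hb : g x = opL A L := by
    have hle : ∀ᶠ r in 𝓝[>] (0 : ℝ), ‖g x - opL A L‖ₑ * volume (ball (0 : Euc n) 1) ≤
        T r / ENNReal.ofReal (r ^ n) := by
      filter_upwards [self_mem_nhdsWithin] with r (hr : 0 < r)
      obtain ⟨φ, hφ, h1, h2, h3, h4⟩ := hK x r hr
      have hφi : Integrable φ := hφ.1.continuous.integrable_of_hasCompactSupport hφ.2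
      have i1 := integrable_smul_of_test hφ.1.continuous hφ.2 (hgi (g x))
      have h := zero_of_cutoff hu' hfs (hgi (opL A L)) hD' hφ
      have e : ∫ y, φ y • (g y - opL A L) =
          (∫ y, φ y • (g y - g x)) + (∫ y, φ y) • (g x - opL A L) := by
        rw [← integral_smul_const, ← integral_add i1 (hφi.smul_const _)]
        simp only [← smul_add, sub_add_sub_cancel]
      rw [e] at h
      have h5 : (∫ y, φ y) • (g x - opL A L) = -((∫ y, φ y • f y ∂s) +
          (∫ y, φ y • (g y - g x)) + ∫ y, gradTerm A φ u' y) := by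
        rw [eq_neg_iff_add_eq_zero, ← h]
        abel
      rw [ENNReal.le_div_iff_mul_le (.inl (by simpa using by positivity))
        (.inl ENNReal.ofReal_ne_top)]
      calc ‖g x - opL A L‖ₑ * volume (ball (0 : Euc n) 1) * ENNReal.ofReal (r ^ n)
          = volume (ball x r) * ‖g x - opL A L‖ₑ := by
            rw [volume_ball_eq x hr, ENNReal.ofReal_mul (by positivity),
              ENNReal.ofReal_toReal measure_ball_lt_top.ne]
            ring
        _ ≤ ‖(∫ y, φ y) • (g x - opL A L)‖ₑ := by
            rw [enorm_smul, Real.enorm_of_nonneg (integral_nonneg fun y => (h1 y).1),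
              ofReal_integral_eq_lintegral_ofReal hφi (ae_of_all _ fun y => (h1 y).1),
              ← setLIntegral_one, ← lintegral_indicator measurableSet_ball]
            refine mul_le_mul_left (lintegral_mono (Set.indicator_le' (fun y hy => ?_)
              fun _ _ => zero_le)) _
            rw [h2 y hy, ENNReal.ofReal_one]
        _ ≤ T r := by
            rw [h5, enorm_neg]
            exact (enorm_add_le _ _).trans (add_le_add ((enorm_add_le _ _).trans (add_le_add
              ((enorm_integral_le_lintegral_enorm _).trans (lintegral_enorm_smul_le h1 h3 _ _))
              ((enorm_integral_le_lintegral_enorm _).trans (lintegral_enorm_smul_le h1 h3 _ _))))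
              ((enorm_integral_le_lintegral_enorm _).trans (lintegral_gradTerm_le h4 h3 _)))
    have h := ge_of_tendsto hT0 hle
    rw [nonpos_iff_eq_zero, mul_eq_zero, enorm_eq_zero, sub_eq_zero] at h
    exact h.resolve_right (measure_ball_pos _ _ one_pos).ne'
  refine ⟨_, isPolyDeg_affine a L x, ?_⟩
  have he : ((1 : ℕ) : ℝ) + n / ((n : ℝ) / ((n : ℝ) - 1)) = n := by
    rw [div_div_cancel₀ (by positivity)]
    simp
  rw [SmallO, he]
  simp only [Real.rpow_natCast]
  have h0 := ENNReal.Tendsto.const_mul hT0 (.inr hCt)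
  rw [mul_zero] at h0
  refine tendsto_of_tendsto_of_tendsto_of_le_of_le' tendsto_const_nhds h0
    (Eventually.of_forall fun _ => zero_le) ?_
  filter_upwards [self_mem_nhdsWithin] with r hr
  obtain ⟨φ, hφ, h1, h2, h3, h4⟩ := hK x r hr
  rw [← mul_div_assoc]
  refine ENNReal.div_le_div_right ((lorentzNorm_restrict_le hp (by linarith) measurableSet_ball
    (v := fun y => φ y • u' y) fun y hy => by rw [h2 y hy, one_smul]).trans ?_) _
  have i1 := integrable_smul_of_test hφ.1.continuous hφ.2 (hgi (opL A L))
  have i2 := integrable_gradTerm A hφ hu'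
  refine (hC _ s (fun y => φ y • f y) (fun y => φ y • (g y - opL A L) + gradTerm A φ u' y) hs
    (integrable_smul_of_test hφ.1.continuous hφ.2 hu') hφ.2.smul_right
    (integrable_smul_of_test hφ.1.continuous hφ.2 hfs) (i1.add i2) fun ψ hψ => ?_).trans ?_
  · rw [sum_integral_cutoff hu' hφ hψ, hD' _ (hφ.smul_test hψ), add_assoc, ← integral_add
      (locallyIntegrable_inner_test (hgi _) (hφ.smul_test hψ).1.continuous (hφ.smul_test hψ).2)
      (locallyIntegrable_inner_test i2.locallyIntegrable hψ.1.continuous hψ.2)]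
    simp only [inner_add_left, real_inner_smul_left, real_inner_smul_right]
  · refine mul_le_mul_right ?_ C
    simp only [hT, add_assoc]
    refine add_le_add (lintegral_enorm_smul_le h1 h3 s f) ?_
    rw [hb]
    refine (lintegral_mono fun y => enorm_add_le _ _).trans ?_
    rw [lintegral_add_left' i1.1.enorm]
    exact add_le_add (lintegral_enorm_smul_le h1 h3 _ _) (lintegral_gradTerm_le h4 h3 _)

end LorentzDifferentiability

/-- Theorem 1.1: for a first-order operator `𝒜` and `1 < q < ∞`,
`𝒜` is elliptic and canceling if and only if every `u ∈ BV^𝒜_loc(ℝ^n)` is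
`L^{n/(n-1),q}`-differentiable at `ℒ^n`-a.e. `x ∈ ℝ^n`. -/
theorem statement0 (n : ℕ) (hn : 1 < n) {V W : Type*}
    [NormedAddCommGroup V] [InnerProductSpace ℝ V] [FiniteDimensional ℝ V]
    [NormedAddCommGroup W] [InnerProductSpace ℝ W] [FiniteDimensional ℝ W]
    (A : CoeffOp n 1 V W) (hA : IsSymmetricOp n 1 A) (q : ℝ) (hq : 1 < q) :
    (IsElliptic n 1 A ∧ IsCanceling n 1 A) ↔
      ∀ u : Euc n → V, MemBVAloc n 1 A u →
        ∀ᵐ x ∂(volume : Measure (Euc n)),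
          MemTLorentz n 1 ((n : ℝ) / ((n : ℝ) - 1)) q u x := by
  constructor
  · exact fun ⟨hE, hC⟩ u hu => hu.ae_memTLorentz hn hE hC hq
  · intro h
    have key : ¬∃ u, MemBVAloc n 1 A u ∧ ∀ x, ¬MemTLorentz n 1 ((n : ℝ) / ((n : ℝ) - 1)) q u x :=
      fun ⟨u, hu, hx⟩ => by
        have h0 := h u hu
        simp only [hx, eventually_false_iff_eq_bot, ae_eq_bot] at h0
        exact NeZero.ne _ h0
    have hE : IsElliptic n 1 A := by_contra fun hE =>
      key (exists_not_differentiable_of_not_elliptic hn A (by linarith) hE)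
    exact ⟨hE, by_contra fun hC =>
      key (exists_not_differentiable_of_not_canceling hn hE hC (by linarith))⟩
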